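/- For q, T ≥ 2, the fourth power moment of Dirichlet L-functions averaged over primitive characters mod q and over t ∈ [0,T] satisfies: Σ*_{χ (mod q)} ∫_0^T |L(1/2 + it, χ)|^4 dt = (1 + O((ω(q)/log q)·√(q/φ(q)))) · (φ*(q)·T)/(2π²) · Π_{p | q} (1 − p^{-1})³/(1 + p^{-1}) · (log qT)^4 + O(q·T·(log qT)^{7/2}), where the implied constants are absolute. -/

import Mathlib

theorem sum_inv_sq_le_of_separated : ∃ K : ℝ, 0 < K ∧ ∀ {ι : Type} [DecidableEq ι] (S : Finset ι)
    (lam : ι → ℝ) (δ : ℝ), 0 < δ → (∀ i ∈ S, ∀ j ∈ S, i ≠ j → δ ≤ |lam i - lam j|) → ∀ i ∈ S,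
    ∑ j ∈ S, (if i = j then 0 else 1 / (lam i - lam j) ^ 2) ≤ K / δ ^ 2 := by
  have hsum : Summable (fun m : ℤ => 1 / (m : ℝ) ^ 2) := Real.summable_one_div_int_pow.2 (by norm_num)
  refine ⟨4 * (∑' m : ℤ, 1 / (m : ℝ) ^ 2) + 1, ?_, ?_⟩
  · have : 0 ≤ ∑' m : ℤ, 1 / (m : ℝ) ^ 2 := tsum_nonneg fun m => by positivity
    linarith
  intro ι _ S lam δ hδ hsep i hi
  set m : ι → ℤ := fun j => ⌊(lam j - lam i) / δ⌋ with hm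
  have hinj : Set.InjOn m (S : Set ι) := by
    intro a ha b hb hab
    by_contra hne
    have h1 := hsep a ha b hb hne
    have h2 := Int.abs_sub_lt_one_of_floor_eq_floor hab
    rw [← sub_div, abs_div, abs_of_pos hδ, div_lt_one hδ] at h2
    have : lam a - lam i - (lam b - lam i) = lam a - lam b := by ring
    rw [this] at h2
    linarith
  have hterm : ∀ j ∈ S, (if i = j then 0 else 1 / (lam i - lam j) ^ 2) ≤
      4 / δ ^ 2 * (1 / (m j : ℝ) ^ 2) := by
    intro j hj
    split_ifs with h
    · positivity
    have h1 := hsep i hi j hj h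
    have hf1 := Int.floor_le ((lam j - lam i) / δ)
    have hf2 := Int.lt_floor_add_one ((lam j - lam i) / δ)
    rw [le_div_iff₀ hδ] at hf1
    rw [div_lt_iff₀ hδ] at hf2
    have hkey : 0 < (m j : ℝ) ^ 2 ∧ (m j : ℝ) ^ 2 * δ ^ 2 ≤ 4 * (lam i - lam j) ^ 2 := by
      change (m j : ℝ) * δ ≤ _ at hf1
      change _ < ((m j : ℝ) + 1) * δ at hf2
      rcases le_abs.1 h1 with h1 | h1
      · have h0 : (m j : ℝ) < 0 := by
          by_contra hc
          push Not at hc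
          have := mul_nonneg hc hδ.le
          linarith
        have h0' : (m j : ℝ) ≤ -1 := by
          have : m j < 0 := by exact_mod_cast h0
          exact_mod_cast (by omega : m j ≤ -1)
        refine ⟨by nlinarith, ?_⟩
        have : -(m j : ℝ) * δ ≤ 2 * (lam i - lam j) := by linarith
        have h3 : 0 ≤ -(m j : ℝ) * δ := mul_nonneg (by linarith) hδ.le
        nlinarith [pow_le_pow_left₀ h3 this 2]
      · have h0 : (0 : ℝ) < m j := by
          have : 0 < m j := by
            apply Int.floor_pos.2
            rw [le_div_iff₀ hδ]; linarith
          exact_mod_cast this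
        refine ⟨by positivity, ?_⟩
        have h3 : 0 ≤ (m j : ℝ) * δ := by positivity
        nlinarith [pow_le_pow_left₀ h3 hf1 2]
    have h2 : 0 < (lam i - lam j) ^ 2 := by
      have : 0 < |lam i - lam j| := hδ.trans_le h1
      have := abs_pos.1 this
      positivity
    rw [div_mul_div_comm, div_le_div_iff₀ h2 (by have := hkey.1; positivity)]
    linarith [hkey.2]
  calc _ ≤ ∑ j ∈ S, 4 / δ ^ 2 * (1 / (m j : ℝ) ^ 2) := Finset.sum_le_sum hterm
    _ = 4 / δ ^ 2 * ∑ k ∈ S.image m, 1 / (k : ℝ) ^ 2 := by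
        rw [← Finset.mul_sum, Finset.sum_image hinj]
    _ ≤ 4 / δ ^ 2 * ∑' m : ℤ, 1 / (m : ℝ) ^ 2 := by
        gcongr
        exact hsum.sum_le_tsum _ fun m _ => by positivity
    _ ≤ _ := by
        rw [div_mul_eq_mul_div]
        gcongr
        linarith

open Complex in
theorem mean_value_separated : ∃ K : ℝ, 0 < K ∧ ∀ {ι : Type} (S : Finset ι)
    (lam : ι → ℝ) (c : ι → ℂ) (δ x y : ℝ), 0 < δ → x ≤ y →
    (∀ i ∈ S, ∀ j ∈ S, i ≠ j → δ ≤ |lam i - lam j|) →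
    |(∫ t in x..y, ‖∑ i ∈ S, c i * cexp (-(t * lam i) * I)‖ ^ 2) - (y - x) * ∑ i ∈ S, ‖c i‖ ^ 2| ≤
      K / δ * ∑ i ∈ S, ‖c i‖ ^ 2 := by
  classical
  obtain ⟨K₀, hK₀, hK⟩ := sum_inv_sq_le_of_separated
  refine ⟨1 + 4 * K₀, by linarith, ?_⟩
  intro ι S lam c δ x y hδ hxy hsep
  set f : ℝ → ℝ := fun t => ‖∑ i ∈ S, c i * cexp (-(t * lam i) * I)‖ ^ 2 with hf
  set N := ∑ i ∈ S, ‖c i‖ ^ 2 with hN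
  have hfc : Continuous f := by fun_prop
  have hf0 : ∀ t, 0 ≤ f t := fun t => by positivity
  set Δ := 1 / δ with hΔ
  have hΔ0 : 0 < Δ := by positivity
  have hfexp : ∀ t, (f t : ℂ) = ∑ i ∈ S, ∑ j ∈ S,
      c i * starRingEnd ℂ (c j) * cexp ((lam j - lam i) * I * t) := by
    intro t
    simp only [hf]
    push_cast
    rw [← Complex.mul_conj', map_sum, Finset.sum_mul_sum]
    refine Finset.sum_congr rfl fun i _ => Finset.sum_congr rfl fun j _ => ?_
    rw [map_mul, ← Complex.exp_conj]
    have : cexp ((lam j - lam i) * I * t) = cexp (-(t * lam i) * I) * cexp ((starRingEnd ℂ) (-(t * lam j) * I)) := by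
      rw [← Complex.exp_add]; congr 1
      simp; ring
    rw [this]; ring
  have havg : ∀ p r : ℝ, |(∫ u in (0:ℝ)..Δ, ∫ t in p..r, f (t + u)) - Δ * (r - p) * N| ≤
      4 * K₀ / δ ^ 2 * N := by
    intro p r
    have hcx : (((∫ u in (0:ℝ)..Δ, ∫ t in p..r, f (t + u)) : ℝ) : ℂ) =
        ∑ i ∈ S, ∑ j ∈ S, c i * starRingEnd ℂ (c j) *
          ∫ u in (0:ℝ)..Δ, ∫ t in p..r, cexp ((lam j - lam i) * I * ((t + u : ℝ) : ℂ)) := by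
      rw [← intervalIntegral.integral_ofReal]
      have h1 : ∀ u : ℝ, (((∫ t in p..r, f (t + u)) : ℝ) : ℂ) = ∑ i ∈ S, ∑ j ∈ S,
          c i * starRingEnd ℂ (c j) * ∫ t in p..r, cexp ((lam j - lam i) * I * ((t + u : ℝ) : ℂ)) := by
        intro u
        rw [← intervalIntegral.integral_ofReal]
        simp_rw [hfexp]
        rw [intervalIntegral.integral_finsetSum fun i _ =>
          Continuous.intervalIntegrable (by fun_prop) _ _]
        refine Finset.sum_congr rfl fun i _ => ?_
        rw [intervalIntegral.integral_finsetSum fun i _ =>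
          Continuous.intervalIntegrable (by fun_prop) _ _]
        refine Finset.sum_congr rfl fun j _ => ?_
        rw [intervalIntegral.integral_const_mul]
      simp_rw [h1]
      have hcont : ∀ i j, Continuous fun u : ℝ => ∫ t in p..r, cexp ((lam j - lam i) * I * ((t + u : ℝ) : ℂ)) := by
        intro i j
        apply intervalIntegral.continuous_parametric_intervalIntegral_of_continuous'
        fun_prop
      rw [intervalIntegral.integral_finsetSum fun i _ =>
          Continuous.intervalIntegrable (by
            have := hcont i
            fun_prop) _ _]
      refine Finset.sum_congr rfl fun i _ => ?_
      rw [intervalIntegral.integral_finsetSum fun j _ =>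
          Continuous.intervalIntegrable (by
            have := hcont i j
            fun_prop) _ _]
      refine Finset.sum_congr rfl fun j _ => ?_
      rw [intervalIntegral.integral_const_mul]
    have hoff : ∀ i ∈ S, ∀ j ∈ S, i ≠ j →
        ‖∫ u in (0:ℝ)..Δ, ∫ t in p..r, cexp ((lam j - lam i) * I * ((t + u : ℝ) : ℂ))‖ ≤
          4 * (1 / (lam i - lam j) ^ 2) := by
      intro i hi j hj hij
      have hne : lam i - lam j ≠ 0 := by
        have := hδ.trans_le (hsep i hi j hj hij)
        exact abs_pos.1 this
      set ν : ℂ := (lam j - lam i) * I with hν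
      have hνn : ‖ν‖ = |lam i - lam j| := by
        rw [hν, norm_mul, Complex.norm_I, mul_one, ← Complex.ofReal_sub, Complex.norm_real,
          Real.norm_eq_abs, abs_sub_comm]
      have hν0 : ν ≠ 0 := by
        rw [← norm_pos_iff, hνn]; exact abs_pos.2 hne
      have hsplit : ∀ u t : ℝ, cexp (ν * ((t + u : ℝ) : ℂ)) = cexp (ν * u) * cexp (ν * t) := by
        intro u t
        rw [← Complex.exp_add]; congr 1; push_cast; ring
      simp_rw [hsplit, intervalIntegral.integral_const_mul, intervalIntegral.integral_mul_const]
      rw [integral_exp_mul_complex hν0, integral_exp_mul_complex hν0, norm_mul, norm_div, norm_div, hνn]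
      have hun : ∀ z : ℝ, ‖cexp (ν * z)‖ = 1 := by
        intro z
        rw [Complex.norm_exp]
        simp [hν]
      have h2 : ∀ z w : ℝ, ‖cexp (ν * z) - cexp (ν * w)‖ ≤ 2 := by
        intro z w
        refine (norm_sub_le _ _).trans ?_
        rw [hun, hun]; norm_num
      have h3 : 0 < |lam i - lam j| := abs_pos.2 hne
      calc _ ≤ 2 / |lam i - lam j| * (2 / |lam i - lam j|) := by gcongr <;> apply h2
        _ = 4 * (1 / (lam i - lam j) ^ 2) := by
          rw [← sq_abs (lam i - lam j)]; field_simp; norm_num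
    have hdiag : ∀ i, (∫ u in (0:ℝ)..Δ, ∫ t in p..r, cexp ((lam i - lam i) * I * ((t + u : ℝ) : ℂ))) =
        Δ * (r - p) := by
      intro i; simp; ring
    have hdec : (((∫ u in (0:ℝ)..Δ, ∫ t in p..r, f (t + u)) - Δ * (r - p) * N : ℝ) : ℂ) =
        ∑ i ∈ S, ∑ j ∈ S, if i = j then 0 else c i * starRingEnd ℂ (c j) *
          ∫ u in (0:ℝ)..Δ, ∫ t in p..r, cexp ((lam j - lam i) * I * ((t + u : ℝ) : ℂ)) := by
      rw [Complex.ofReal_sub, hcx, hN]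
      push_cast
      rw [Finset.mul_sum, ← Finset.sum_sub_distrib]
      refine Finset.sum_congr rfl fun i hi => ?_
      rw [← Finset.add_sum_erase _ _ hi, ← Finset.add_sum_erase S (fun j => if i = j then _ else _) hi]
      have h5 := hdiag i
      push_cast at h5
      rw [h5]
      simp only [if_true, Complex.mul_conj']
      rw [add_comm, add_sub_assoc]
      have : c i * (starRingEnd ℂ) (c i) = (‖c i‖ : ℂ) ^ 2 := Complex.mul_conj' _
      rw [zero_add, show (‖c i‖ : ℂ) ^ 2 * ((Δ : ℂ) * ((r : ℂ) - p)) - Δ * (r - p) * (‖c i‖ : ℂ) ^ 2 = 0 by ring, add_zero]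
      refine Finset.sum_congr rfl fun j hj => ?_
      rw [if_neg (Finset.ne_of_mem_erase hj).symm]
    have hnorm : |(∫ u in (0:ℝ)..Δ, ∫ t in p..r, f (t + u)) - Δ * (r - p) * N| ≤
        ∑ i ∈ S, ∑ j ∈ S, ((‖c i‖ ^ 2 + ‖c j‖ ^ 2) / 2) *
          (4 * (if i = j then 0 else 1 / (lam i - lam j) ^ 2)) := by
      rw [← Real.norm_eq_abs, ← Complex.norm_real, hdec]
      refine (norm_sum_le _ _).trans (Finset.sum_le_sum fun i hi => ?_)
      refine (norm_sum_le _ _).trans (Finset.sum_le_sum fun j hj => ?_)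
      split_ifs with hij
      · simp
      · rw [norm_mul, norm_mul, RCLike.norm_conj]
        have := hoff i hi j hj hij
        have h6 : ‖c i‖ * ‖c j‖ ≤ (‖c i‖ ^ 2 + ‖c j‖ ^ 2) / 2 := by
          nlinarith [sq_nonneg (‖c i‖ - ‖c j‖)]
        gcongr
    refine hnorm.trans ?_
    have hw : ∀ i j, (if i = j then (0:ℝ) else 1 / (lam i - lam j) ^ 2) =
        if j = i then 0 else 1 / (lam j - lam i) ^ 2 := by
      intro i j
      by_cases h : i = j
      · simp [h]
      · rw [if_neg h, if_neg (Ne.symm h)]; congr 1; ring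
    have hA : ∑ i ∈ S, ∑ j ∈ S, ((‖c i‖ ^ 2 + ‖c j‖ ^ 2) / 2) *
          (4 * (if i = j then 0 else 1 / (lam i - lam j) ^ 2)) =
        ∑ i ∈ S, 4 * ‖c i‖ ^ 2 * ∑ j ∈ S, (if i = j then 0 else 1 / (lam i - lam j) ^ 2) := by
      have e1 : ∀ i j, ((‖c i‖ ^ 2 + ‖c j‖ ^ 2) / 2) *
          (4 * (if i = j then (0:ℝ) else 1 / (lam i - lam j) ^ 2)) =
          2 * ‖c i‖ ^ 2 * (if i = j then (0:ℝ) else 1 / (lam i - lam j) ^ 2) +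
          2 * ‖c j‖ ^ 2 * (if j = i then (0:ℝ) else 1 / (lam j - lam i) ^ 2) := by
        intro i j
        rw [← hw i j]; ring
      simp_rw [e1, Finset.sum_add_distrib]
      rw [Finset.sum_comm (f := fun i j => 2 * ‖c j‖ ^ 2 * (if j = i then (0:ℝ) else 1 / (lam j - lam i) ^ 2)),
        ← Finset.sum_add_distrib]
      refine Finset.sum_congr rfl fun i _ => ?_
      rw [← Finset.mul_sum]; ring
    rw [hA, hN, Finset.mul_sum]
    refine Finset.sum_le_sum fun i hi => ?_
    have := hK S lam δ hδ hsep i hi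
    calc _ ≤ 4 * ‖c i‖ ^ 2 * (K₀ / δ ^ 2) := by gcongr
      _ = _ := by ring
  have hN0 : 0 ≤ N := Finset.sum_nonneg fun i _ => by positivity
  have hii : ∀ a b, IntervalIntegrable f MeasureTheory.volume a b := fun a b => hfc.intervalIntegrable _ _
  have hcpar : ∀ p r : ℝ, Continuous fun u : ℝ => ∫ t in p..r, f (t + u) := by
    intro p r
    apply intervalIntegral.continuous_parametric_intervalIntegral_of_continuous'
    fun_prop
  have hup : Δ * (∫ t in x..y, f t) ≤ ∫ u in (0:ℝ)..Δ, ∫ t in (x - Δ)..y, f (t + u) := by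
    have : Δ * (∫ t in x..y, f t) = ∫ u in (0:ℝ)..Δ, (∫ t in x..y, f t) := by simp
    rw [this]
    apply intervalIntegral.integral_mono_on hΔ0.le (by simp) ((hcpar _ _).intervalIntegrable _ _)
    intro u hu
    rw [intervalIntegral.integral_comp_add_right f]
    apply intervalIntegral.integral_mono_interval (by linarith [hu.2]) hxy (by linarith [hu.1])
      (Filter.Eventually.of_forall hf0) (hii _ _)
  have hlow : (∫ u in (0:ℝ)..Δ, ∫ t in x..(y - Δ), f (t + u)) ≤ Δ * (∫ t in x..y, f t) := by
    have : Δ * (∫ t in x..y, f t) = ∫ u in (0:ℝ)..Δ, (∫ t in x..y, f t) := by simp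
    rw [this]
    apply intervalIntegral.integral_mono_on hΔ0.le ((hcpar _ _).intervalIntegrable _ _) (by simp)
    intro u hu
    rw [intervalIntegral.integral_comp_add_right f]
    rcases le_total (x + u) (y - Δ + u) with h | h
    · apply intervalIntegral.integral_mono_interval (by linarith [hu.1]) h (by linarith [hu.2])
        (Filter.Eventually.of_forall hf0) (hii _ _)
    · rw [intervalIntegral.integral_symm]
      have h1 : 0 ≤ ∫ t in (y - Δ + u)..(x + u), f t :=
        intervalIntegral.integral_nonneg h fun t _ => hf0 t
      have h2 : 0 ≤ ∫ t in x..y, f t := intervalIntegral.integral_nonneg hxy fun t _ => hf0 t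
      linarith
  have h1 := (abs_le.1 (havg (x - Δ) y)).2
  have h2 := (abs_le.1 (havg x (y - Δ))).1
  have hKd : 4 * K₀ / δ ^ 2 * N = Δ * (4 * K₀ * Δ * N) := by rw [hΔ]; ring
  rw [hKd] at h1 h2
  have hgoal : (1 + 4 * K₀) / δ * N = Δ * N + 4 * K₀ * Δ * N := by rw [hΔ]; ring
  rw [hgoal, abs_le]
  constructor
  · refine le_of_mul_le_mul_left ?_ hΔ0
    nlinarith
  · refine le_of_mul_le_mul_left ?_ hΔ0
    nlinarith

open Complex in
/-- The Dirichlet polynomial `∑ c(a,b) χ(a) χ̄(b) (a/b)^{-it}` over a finite set of pairs. -/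
noncomputable def pairPoly {k : ℕ} (S : Finset (ℕ × ℕ)) (c : ℕ × ℕ → ℂ) (χ : DirichletCharacter ℂ k)
    (t : ℝ) : ℂ :=
  ∑ i ∈ S, c i * (χ i.1 * starRingEnd ℂ (χ i.2)) *
    cexp (-(t * (Real.log i.1 - Real.log i.2 : ℝ)) * I)

theorem continuous_pairPoly {k : ℕ} (S : Finset (ℕ × ℕ)) (c : ℕ × ℕ → ℂ)
    (χ : DirichletCharacter ℂ k) : Continuous (pairPoly S c χ) := by
  unfold pairPoly
  fun_prop

theorem DirichletCharacter.mul_conj_apply_coprime {k : ℕ} [NeZero k] (χ : DirichletCharacter ℂ k) {a b : ℕ}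
    (ha : a.Coprime k) (hb : b.Coprime k) :
    χ a * starRingEnd ℂ (χ b) =
      χ ((ZMod.unitOfCoprime a ha * (ZMod.unitOfCoprime b hb)⁻¹ : (ZMod k)ˣ) : ZMod k) := by
  have h1 : starRingEnd ℂ (χ b) = (χ b)⁻¹ := by
    have hu : ‖χ b‖ = 1 := by
      simpa using χ.unit_norm_eq_one (ZMod.unitOfCoprime b hb)
    rw [Complex.inv_def, Complex.normSq_eq_norm_sq, hu]; simp
  rw [h1, Units.val_mul, map_mul, ZMod.coe_unitOfCoprime]
  congr 1
  rw [← ZMod.coe_unitOfCoprime b hb]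
  have h2 : χ (ZMod.unitOfCoprime b hb : ZMod k) * χ ((ZMod.unitOfCoprime b hb)⁻¹ : (ZMod k)ˣ) = 1 := by
    rw [← map_mul, Units.mul_inv, map_one]
  exact inv_eq_of_mul_eq_one_right h2

theorem DirichletCharacter.sum_norm_sq_eq {k : ℕ} [NeZero k] {ι : Type} (S : Finset ι) (C : ι → ℂ)
    (u : ι → (ZMod k)ˣ) :
    ∑ χ : DirichletCharacter ℂ k, ‖∑ i ∈ S, C i * χ (u i)‖ ^ 2 =
      k.totient * ∑ v : (ZMod k)ˣ, ‖∑ i ∈ S.filter (fun i => u i = v), C i‖ ^ 2 := by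
  classical
  have hl : ∀ χ : DirichletCharacter ℂ k, ((‖∑ i ∈ S, C i * χ (u i)‖ ^ 2 : ℝ) : ℂ) =
      ∑ i ∈ S, ∑ j ∈ S, C i * starRingEnd ℂ (C j) * (χ ((u j : ZMod k)⁻¹) * χ (u i)) := by
    intro χ
    push_cast
    rw [← Complex.mul_conj', map_sum, Finset.sum_mul_sum]
    refine Finset.sum_congr rfl fun i _ => Finset.sum_congr rfl fun j _ => ?_
    have : starRingEnd ℂ (χ (u j)) = χ ((u j : ZMod k)⁻¹) := by
      have hu : ‖χ (u j)‖ = 1 := χ.unit_norm_eq_one (u j)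
      have h1 : starRingEnd ℂ (χ (u j)) = (χ (u j))⁻¹ := by
        rw [Complex.inv_def, Complex.normSq_eq_norm_sq, hu]; simp
      rw [h1]
      apply inv_eq_of_mul_eq_one_right
      rw [← map_mul, ZMod.mul_inv_of_unit _ (u j).isUnit, map_one]
    rw [map_mul, this]; ring
  have hr : ∀ v : (ZMod k)ˣ, ((‖∑ i ∈ S.filter (fun i => u i = v), C i‖ ^ 2 : ℝ) : ℂ) =
      ∑ i ∈ S, ∑ j ∈ S, if u i = v ∧ u j = v then C i * starRingEnd ℂ (C j) else 0 := by
    intro v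
    push_cast
    rw [← Complex.mul_conj', map_sum, Finset.sum_mul_sum, Finset.sum_filter]
    refine Finset.sum_congr rfl fun i _ => ?_
    by_cases h : u i = v
    · simp only [h, if_true, true_and]
      rw [Finset.sum_filter]
    · simp [h]
  rw [← Complex.ofReal_inj]
  rw [Complex.ofReal_sum]
  simp_rw [hl]
  rw [Complex.ofReal_mul, Complex.ofReal_sum]
  simp_rw [hr]
  rw [Finset.sum_comm, Finset.sum_comm (s := Finset.univ), Finset.mul_sum]
  refine Finset.sum_congr rfl fun i _ => ?_
  rw [Finset.sum_comm, Finset.sum_comm (s := Finset.univ), Finset.mul_sum]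
  refine Finset.sum_congr rfl fun j _ => ?_
  rw [← Finset.mul_sum, DirichletCharacter.sum_char_inv_mul_char_eq ℂ (u j).isUnit]
  have : ∀ v, (u i = v ∧ u j = v) ↔ (u i = v ∧ u j = u i) := by
    intro v; constructor
    · rintro ⟨rfl, h⟩; exact ⟨rfl, h⟩
    · rintro ⟨rfl, h⟩; exact ⟨rfl, h⟩
  simp_rw [this, ite_and]
  rw [Finset.sum_ite_eq Finset.univ (u i)]
  simp only [Finset.mem_univ, if_true, Units.val_inj]
  split_ifs
  · push_cast; ring
  · simp

open Complex in
theorem mean_value_all_characters : ∃ K : ℝ, 0 < K ∧ ∀ (k : ℕ) [NeZero k] (S : Finset (ℕ × ℕ))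
    (c : ℕ × ℕ → ℂ) (δ x y : ℝ), 0 < δ → x ≤ y →
    (∀ i ∈ S, i.1.Coprime k ∧ i.2.Coprime k) →
    (∀ i ∈ S, ∀ j ∈ S, i ≠ j → i.1 * j.2 ≡ j.1 * i.2 [MOD k] →
      δ ≤ |(Real.log i.1 - Real.log i.2) - (Real.log j.1 - Real.log j.2)|) →
    |∑ χ : DirichletCharacter ℂ k, (∫ t in x..y, ‖pairPoly S c χ t‖ ^ 2) -
        k.totient * (y - x) * ∑ i ∈ S, ‖c i‖ ^ 2| ≤
      k.totient * (K / δ) * ∑ i ∈ S, ‖c i‖ ^ 2 := by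
  classical
  obtain ⟨K, hK0, hK⟩ := mean_value_separated
  refine ⟨K, hK0, ?_⟩
  intro k _ S c δ x y hδ hxy hcop hsep
  set u : ℕ × ℕ → (ZMod k)ˣ := fun i => if h : i.1.Coprime k ∧ i.2.Coprime k then
    ZMod.unitOfCoprime i.1 h.1 * (ZMod.unitOfCoprime i.2 h.2)⁻¹ else 1 with hu
  set lam : ℕ × ℕ → ℝ := fun i => Real.log i.1 - Real.log i.2 with hlam
  have hpoly : ∀ (χ : DirichletCharacter ℂ k) t, pairPoly S c χ t =
      ∑ i ∈ S, (c i * cexp (-(t * lam i) * I)) * χ (u i) := by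
    intro χ t
    unfold pairPoly
    refine Finset.sum_congr rfl fun i hi => ?_
    have h := hcop i hi
    rw [DirichletCharacter.mul_conj_apply_coprime χ h.1 h.2]
    simp only [hu, dif_pos h, hlam]
    ring
  have hsum : ∀ t, ∑ χ : DirichletCharacter ℂ k, ‖pairPoly S c χ t‖ ^ 2 =
      k.totient * ∑ v : (ZMod k)ˣ, ‖∑ i ∈ S.filter (fun i => u i = v), c i * cexp (-(t * lam i) * I)‖ ^ 2 := by
    intro t
    simp_rw [hpoly]
    exact DirichletCharacter.sum_norm_sq_eq S _ u
  rw [← intervalIntegral.integral_finsetSum fun χ _ => Continuous.intervalIntegrable (by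
    have := continuous_pairPoly S c χ
    fun_prop) _ _]
  simp_rw [hsum]
  rw [intervalIntegral.integral_const_mul,
    intervalIntegral.integral_finsetSum fun v _ => Continuous.intervalIntegrable (by fun_prop) _ _]
  have hN : ∑ i ∈ S, ‖c i‖ ^ 2 = ∑ v : (ZMod k)ˣ, ∑ i ∈ S.filter (fun i => u i = v), ‖c i‖ ^ 2 :=
    (Finset.sum_fiberwise S u _).symm
  rw [hN, mul_assoc, mul_assoc, ← mul_sub, abs_mul, abs_of_nonneg (by positivity : (0:ℝ) ≤ k.totient)]
  gcongr
  rw [Finset.mul_sum, Finset.mul_sum, ← Finset.sum_sub_distrib]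
  refine (Finset.abs_sum_le_sum_abs _ _).trans (Finset.sum_le_sum fun v _ => ?_)
  refine hK _ lam c δ x y hδ hxy ?_
  intro i hi j hj hij
  rw [Finset.mem_filter] at hi hj
  refine hsep i hi.1 j hj.1 hij ?_
  have he : u i = u j := hi.2.trans hj.2.symm
  have h1 := hcop i hi.1
  have h2 := hcop j hj.1
  simp only [hu, dif_pos h1, dif_pos h2] at he
  rw [mul_inv_eq_iff_eq_mul, mul_assoc, mul_comm _ (ZMod.unitOfCoprime i.2 _), ← mul_assoc, eq_mul_inv_iff_mul_eq] at he
  rw [← ZMod.natCast_eq_natCast_iff]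
  have := congrArg (Units.val) he
  simpa using this

theorem Nat.sum_moebius_div_of_dvd {f q : ℕ} (hq : q ≠ 0) (hf : f ∣ q) :
    ∑ k ∈ q.divisors, (if f ∣ k then ArithmeticFunction.moebius (q / k) else 0) = if f = q then 1 else 0 := by
  obtain ⟨m, rfl⟩ := hf
  have hf0 : f ≠ 0 := by rintro rfl; simp at hq
  have hm0 : m ≠ 0 := by rintro rfl; simp at hq
  rw [← Finset.sum_filter]
  have : ∑ k ∈ (f * m).divisors.filter (f ∣ ·), ArithmeticFunction.moebius (f * m / k) =
      ∑ d ∈ m.divisors, ArithmeticFunction.moebius (m / d) := by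
    symm
    refine Finset.sum_bij (fun d _ => f * d) ?_ ?_ ?_ ?_
    · intro d hd
      simp only [Finset.mem_filter, Nat.mem_divisors] at hd ⊢
      exact ⟨⟨mul_dvd_mul_left f hd.1, hq⟩, dvd_mul_right _ _⟩
    · intro a _ b _ h
      exact Nat.eq_of_mul_eq_mul_left (Nat.pos_of_ne_zero hf0) h
    · intro b hb
      simp only [Finset.mem_filter, Nat.mem_divisors] at hb
      obtain ⟨⟨h1, _⟩, ⟨e, rfl⟩⟩ := hb
      exact ⟨e, by simpa [hm0] using Nat.dvd_of_mul_dvd_mul_left (Nat.pos_of_ne_zero hf0) h1, rfl⟩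
    · intro d _
      rw [Nat.mul_div_mul_left _ _ (Nat.pos_of_ne_zero hf0)]
  rw [this, Nat.sum_div_divisors m (fun d => ArithmeticFunction.moebius d), 
    ← ArithmeticFunction.coe_mul_zeta_apply, ArithmeticFunction.moebius_mul_coe_zeta,
    ArithmeticFunction.one_apply]
  congr 1
  simp only [eq_iff_iff]
  constructor
  · rintro rfl; simp
  · intro h
    have : f * m = f * 1 := by rw [mul_one]; exact h.symm
    exact Nat.eq_of_mul_eq_mul_left (Nat.pos_of_ne_zero hf0) this

open scoped Classical in
theorem DirichletCharacter.sum_primitive_eq {q : ℕ} [NeZero q] (F : DirichletCharacter ℂ q → ℝ) :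
    ∑ χ : DirichletCharacter ℂ q, (if χ.IsPrimitive then F χ else 0) =
      ∑ k ∈ q.divisors.attach, (ArithmeticFunction.moebius (q / k.1) : ℝ) *
        haveI : NeZero k.1 := ⟨(Nat.pos_of_mem_divisors k.2).ne'⟩
        ∑ χ : DirichletCharacter ℂ k.1, F (DirichletCharacter.changeLevel (Nat.dvd_of_mem_divisors k.2) χ) := by
  have hq : q ≠ 0 := NeZero.ne q
  have h1 : ∀ k : q.divisors, 
      (haveI : NeZero k.1 := ⟨(Nat.pos_of_mem_divisors k.2).ne'⟩
        ∑ χ : DirichletCharacter ℂ k.1, F (DirichletCharacter.changeLevel (Nat.dvd_of_mem_divisors k.2) χ)) =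
      ∑ χ : DirichletCharacter ℂ q, if χ.conductor ∣ k.1 then F χ else 0 := by
    intro k
    have : NeZero k.1 := ⟨(Nat.pos_of_mem_divisors k.2).ne'⟩
    have hk := Nat.dvd_of_mem_divisors k.2
    rw [← Finset.sum_filter]
    refine Finset.sum_bij (fun χ _ => DirichletCharacter.changeLevel hk χ) ?_ ?_ ?_ ?_
    · intro χ _
      simp only [Finset.mem_filter, Finset.mem_univ, true_and]
      rw [← DirichletCharacter.mem_conductorSet_iff_conductor_dvd _ hk]
      exact ⟨hk, χ, rfl⟩
    · intro a _ b _ h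
      exact DirichletCharacter.changeLevel_injective hk h
    · intro χ hχ
      simp only [Finset.mem_filter, Finset.mem_univ, true_and] at hχ
      rw [← DirichletCharacter.mem_conductorSet_iff_conductor_dvd _ hk] at hχ
      obtain ⟨_, ψ, hψ⟩ := hχ
      exact ⟨ψ, Finset.mem_univ _, hψ.symm⟩
    · intro χ _; rfl
  simp_rw [h1]
  rw [Finset.sum_attach q.divisors (fun k => (ArithmeticFunction.moebius (q / k) : ℝ) *
    ∑ χ : DirichletCharacter ℂ q, if χ.conductor ∣ k then F χ else 0)]
  simp_rw [Finset.mul_sum]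
  rw [Finset.sum_comm]
  refine Finset.sum_congr rfl fun χ _ => ?_
  have h2 := Nat.sum_moebius_div_of_dvd hq χ.conductor_dvd_level
  have h3 : ∑ k ∈ q.divisors, (ArithmeticFunction.moebius (q / k) : ℝ) * (if χ.conductor ∣ k then F χ else 0) =
      ((∑ k ∈ q.divisors, (if χ.conductor ∣ k then ArithmeticFunction.moebius (q / k) else 0) : ℤ) : ℝ) * F χ := by
    push_cast
    rw [Finset.sum_mul]
    refine Finset.sum_congr rfl fun k _ => ?_
    split_ifs <;> simp
  rw [h3, h2, DirichletCharacter.isPrimitive_def]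
  split_ifs <;> simp

theorem pairPoly_changeLevel {q k : ℕ} [NeZero q] (hk : k ∣ q) (S : Finset (ℕ × ℕ)) (c : ℕ × ℕ → ℂ)
    (χ : DirichletCharacter ℂ k) (hS : ∀ i ∈ S, i.1.Coprime q ∧ i.2.Coprime q) (t : ℝ) :
    pairPoly S c (DirichletCharacter.changeLevel hk χ) t = pairPoly S c χ t := by
  unfold pairPoly
  have key : ∀ a : ℕ, a.Coprime q → DirichletCharacter.changeLevel hk χ (a : ZMod q) = χ (a : ZMod k) := by
    intro a ha
    have := DirichletCharacter.changeLevel_eq_cast_of_dvd χ hk (ZMod.unitOfCoprime a ha)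
    simpa [ZMod.cast_natCast hk] using this
  refine Finset.sum_congr rfl fun i hi => ?_
  rw [key _ (hS i hi).1, key _ (hS i hi).2]

open scoped Classical in
theorem mean_value_primitive : ∃ K : ℝ, 0 < K ∧ ∀ (q : ℕ) [NeZero q] (S : Finset (ℕ × ℕ))
    (c : ℕ × ℕ → ℂ) (δ : ℕ → ℝ) (x y : ℝ), (∀ k, 0 < δ k) → x ≤ y →
    (∀ i ∈ S, i.1.Coprime q ∧ i.2.Coprime q) →
    (∀ k ∈ q.divisors, ∀ i ∈ S, ∀ j ∈ S, i ≠ j → i.1 * j.2 ≡ j.1 * i.2 [MOD k] →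
      δ k ≤ |(Real.log i.1 - Real.log i.2) - (Real.log j.1 - Real.log j.2)|) →
    |∑ χ : DirichletCharacter ℂ q, (if χ.IsPrimitive then ∫ t in x..y, ‖pairPoly S c χ t‖ ^ 2 else 0) -
        ((Finset.univ.filter fun χ : DirichletCharacter ℂ q => χ.IsPrimitive).card : ℝ) * (y - x) *
          ∑ i ∈ S, ‖c i‖ ^ 2| ≤
      (∑ k ∈ q.divisors, |(ArithmeticFunction.moebius (q / k) : ℝ)| * (k.totient * (K / δ k))) *
        ∑ i ∈ S, ‖c i‖ ^ 2 := by
  obtain ⟨K, hK0, hK⟩ := mean_value_all_characters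
  refine ⟨K, hK0, ?_⟩
  intro q _ S c δ x y hδ hxy hcop hsep
  have hcard : ((Finset.univ.filter fun χ : DirichletCharacter ℂ q => χ.IsPrimitive).card : ℝ) =
      ∑ k ∈ q.divisors.attach, (ArithmeticFunction.moebius (q / k.1) : ℝ) * (k.1.totient : ℝ) := by
    have := DirichletCharacter.sum_primitive_eq (q := q) (fun _ => 1)
    rw [← Finset.sum_filter, Finset.sum_const, nsmul_eq_mul, mul_one] at this
    rw [this]
    refine Finset.sum_congr rfl fun k _ => ?_
    have : NeZero k.1 := ⟨(Nat.pos_of_mem_divisors k.2).ne'⟩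
    congr 1
    rw [Finset.sum_const, nsmul_eq_mul, mul_one, Finset.card_univ, ← Nat.card_eq_fintype_card,
      DirichletCharacter.card_eq_totient_of_hasEnoughRootsOfUnity]
  rw [DirichletCharacter.sum_primitive_eq, hcard, mul_assoc, Finset.sum_mul, ← Finset.sum_sub_distrib,
    Finset.sum_mul, ← Finset.sum_attach q.divisors]
  refine (Finset.abs_sum_le_sum_abs _ _).trans (Finset.sum_le_sum fun k _ => ?_)
  have : NeZero k.1 := ⟨(Nat.pos_of_mem_divisors k.2).ne'⟩
  have hk := Nat.dvd_of_mem_divisors k.2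
  rw [mul_assoc, ← mul_sub, abs_mul, mul_assoc]
  gcongr
  simp_rw [pairPoly_changeLevel hk S c _ hcop]
  have := hK k.1 S c (δ k.1) x y (hδ _) hxy (fun i hi => ⟨(hcop i hi).1.coprime_dvd_right hk,
    (hcop i hi).2.coprime_dvd_right hk⟩) (hsep k.1 k.2)
  rw [mul_assoc (k.1.totient : ℝ)] at this
  exact this

theorem log_ratio_spacing {i j : ℕ × ℕ} {k : ℕ} {X : ℝ} (hk : 0 < k) (hi : i.1.Coprime i.2)
    (hj : j.1.Coprime j.2) (hi1 : 0 < i.1) (hi2 : 0 < i.2) (hj1 : 0 < j.1) (hj2 : 0 < j.2)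
    (hiX : (i.1 * i.2 : ℝ) ≤ X) (hjX : (j.1 * j.2 : ℝ) ≤ X) (hij : i ≠ j)
    (hmod : i.1 * j.2 ≡ j.1 * i.2 [MOD k]) :
    min (k / (2 * X)) 1 ≤ |(Real.log i.1 - Real.log i.2) - (Real.log j.1 - Real.log j.2)| ∧
    2 * Real.log (k / X) ≤ |(Real.log i.1 - Real.log i.2) - (Real.log j.1 - Real.log j.2)| := by
  have key : ∀ m n : ℕ, 0 < m → 0 < n → (m * n : ℝ) ≤ X ^ 2 → n < m → m ≡ n [MOD k] →
      min (k / (2 * X)) 1 ≤ |Real.log m - Real.log n| ∧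
      2 * Real.log (k / X) ≤ |Real.log m - Real.log n| := by
    intro m n hm hn hX hnm hmod
    have hX0 : 0 < X := by
      have : (0:ℝ) < i.1 * i.2 := by positivity
      linarith
    have hmk : n + k ≤ m := by
      have := (Nat.modEq_iff_dvd' hnm.le).1 hmod.symm
      have := Nat.le_of_dvd (by omega) this
      omega
    have hm' : (0:ℝ) < m := by exact_mod_cast hm
    have hn' : (0:ℝ) < n := by exact_mod_cast hn
    have hnm' : (n:ℝ) < m := by exact_mod_cast hnm
    have hk' : (0:ℝ) < k := by exact_mod_cast hk
    have hmk' : (n + k : ℝ) ≤ m := by exact_mod_cast hmk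
    rw [← Real.log_div hm'.ne' hn'.ne', abs_of_nonneg (Real.log_nonneg (by rw [one_le_div hn']; exact hnm'.le))]
    constructor
    · rcases le_or_gt (4 * n : ℝ) m with h | h
      · apply (min_le_right _ _).trans
        rw [Real.le_log_iff_exp_le (by positivity), le_div_iff₀ hn']
        have := Real.exp_one_lt_d9
        nlinarith
      · apply (min_le_left _ _).trans
        have h1 := Real.one_sub_inv_le_log_of_pos (show 0 < (m / n : ℝ) by positivity)
        have h2 : (m : ℝ) ≤ 2 * X := by
          have : (m:ℝ) ^ 2 ≤ (2 * X) ^ 2 := by nlinarith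
          exact le_of_sq_le_sq this (by positivity)
        have h3 : (k : ℝ) / (2 * X) ≤ k / m := by gcongr
        have h4 : (k : ℝ) / m ≤ 1 - (m / n : ℝ)⁻¹ := by
          rw [inv_div, div_le_iff₀ hm', sub_mul, div_mul_cancel₀ _ hm'.ne']
          linarith
        linarith
    · rw [← Real.log_rpow (by positivity)]
      apply Real.log_le_log (by positivity)
      rw [show ((2:ℝ)) = ((2:ℕ):ℝ) by norm_num, Real.rpow_natCast, div_pow, div_le_div_iff₀ (by positivity) hn']
      have : (k:ℝ)^2 ≤ m ^ 2 := by
        apply pow_le_pow_left₀ hk'.le; linarith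
      calc (k:ℝ)^2 * n ≤ (m:ℝ)^2 * n := by gcongr
        _ = (m:ℝ) * (m * n) := by ring
        _ ≤ (m:ℝ) * X ^ 2 := by gcongr
  have hprod : ((i.1 * j.2 : ℝ)) * (j.1 * i.2) ≤ X ^ 2 := by
    have : (0:ℝ) < j.1 * j.2 := by positivity
    have h0 : (0:ℝ) < i.1 * i.2 := by positivity
    calc ((i.1 * j.2 : ℝ)) * (j.1 * i.2) = (i.1 * i.2) * (j.1 * j.2) := by ring
      _ ≤ X * X := by gcongr; linarith
      _ = X ^ 2 := by ring
  have hre : (Real.log i.1 - Real.log i.2) - (Real.log j.1 - Real.log j.2) =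
      Real.log ((i.1 * j.2 : ℕ)) - Real.log ((j.1 * i.2 : ℕ)) := by
    push_cast
    rw [Real.log_mul, Real.log_mul]
    · ring
    all_goals positivity
  have hne : i.1 * j.2 ≠ j.1 * i.2 := by
    intro h
    apply hij
    have h1 : i.1 ∣ j.1 := hi.dvd_of_dvd_mul_right (h ▸ dvd_mul_right _ _)
    have h2 : j.1 ∣ i.1 := hj.dvd_of_dvd_mul_right (h.symm ▸ dvd_mul_right _ _)
    have h3 := Nat.dvd_antisymm h1 h2
    rw [h3] at h
    have h4 := Nat.eq_of_mul_eq_mul_left hj1 h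
    exact Prod.ext h3 h4.symm
  rw [hre]
  rcases lt_or_gt_of_ne hne with h | h
  · rw [abs_sub_comm]
    exact key _ _ (by positivity) (by positivity) (by push_cast; linarith) h hmod.symm
  · exact key _ _ (by positivity) (by positivity) (by push_cast; linarith) h hmod

theorem Nat.sum_abs_moebius_div {q : ℕ} (hq : q ≠ 0) :
    ∑ k ∈ q.divisors, |(ArithmeticFunction.moebius (q / k) : ℝ)| = 2 ^ q.primeFactors.card := by
  rw [Nat.sum_div_divisors q (fun d => |(ArithmeticFunction.moebius d : ℝ)|)]
  have : ∀ d : ℕ, |(ArithmeticFunction.moebius d : ℝ)| = if Squarefree d then 1 else 0 := by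
    intro d
    rw [← Int.cast_abs, ArithmeticFunction.abs_moebius]
    split_ifs <;> simp
  simp_rw [this]
  rw [← Finset.sum_filter, Nat.sum_divisors_filter_squarefree hq]
  simp only [Finset.sum_const, Finset.card_powerset, nsmul_eq_mul, mul_one]
  have h : (UniqueFactorizationMonoid.normalizedFactors q).toFinset = q.primeFactors := by
    rw [Nat.factors_eq]; rfl
  rw [h]; push_cast; rfl

theorem Nat.card_primeFactors_mul_log_two_le {q : ℕ} (hq : q ≠ 0) :
    q.primeFactors.card * Real.log 2 ≤ Real.log q := by
  have h1 : 2 ^ q.primeFactors.card ≤ q := by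
    calc 2 ^ q.primeFactors.card ≤ ∏ p ∈ q.primeFactors, p :=
          Finset.pow_card_le_prod _ _ _ fun p hp => (Nat.prime_of_mem_primeFactors hp).two_le
      _ ≤ q := Nat.le_of_dvd (Nat.pos_of_ne_zero hq) (Nat.prod_primeFactors_dvd q)
  rw [← Real.log_pow]
  apply Real.log_le_log (by positivity)
  exact_mod_cast h1

/-- The logarithmic length by which the main Dirichlet polynomial is shortened. -/
noncomputable def shortening (q : ℕ) (U : ℝ) : ℝ :=
  q.primeFactors.card * Real.log 4 + √(Real.log (q * U))

/-- The length of the shortened Dirichlet polynomial. -/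
noncomputable def shortLength (q : ℕ) (U : ℝ) : ℝ := q * U * Real.exp (-shortening q U)

/-- Lower bound for the gaps between frequencies that are congruent modulo `k`. -/
noncomputable def shortGap (q : ℕ) (U : ℝ) (k : ℕ) : ℝ :=
  if shortLength q U * Real.exp (shortening q U / 2) ≤ k then shortening q U
  else if k = 0 then 1 else min (k / (2 * shortLength q U)) 1

theorem log_two_le_log_mul {q : ℕ} (hq : 2 ≤ q) {U : ℝ} (hU : 1 ≤ U) : Real.log 2 ≤ Real.log (q * U) := by
  have : (2:ℝ) ≤ q := by exact_mod_cast hq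
  apply Real.log_le_log (by norm_num)
  nlinarith

theorem shortening_pos {q : ℕ} (hq : 2 ≤ q) {U : ℝ} (hU : 1 ≤ U) : 0 < shortening q U := by
  have h := log_two_le_log_mul hq hU
  have h2 := Real.log_pos one_lt_two
  have h4 : 0 < Real.log 4 := Real.log_pos (by norm_num)
  have : 0 < √(Real.log (q * U)) := Real.sqrt_pos.2 (by linarith)
  unfold shortening
  positivity

theorem shortLength_pos {q : ℕ} (hq : 2 ≤ q) {U : ℝ} (hU : 1 ≤ U) : 0 < shortLength q U := by
  have : (0:ℝ) < q := by positivity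
  unfold shortLength; positivity

theorem shortGap_pos {q : ℕ} (hq : 2 ≤ q) {U : ℝ} (hU : 1 ≤ U) (k : ℕ) : 0 < shortGap q U k := by
  have h1 := shortening_pos hq hU
  have h2 := shortLength_pos hq hU
  unfold shortGap
  split_ifs with h h'
  · exact h1
  · norm_num
  · have : (0:ℝ) < k := by positivity
    positivity

theorem shortGap_le {q : ℕ} (hq : 2 ≤ q) {U : ℝ} (hU : 1 ≤ U) {k : ℕ} (hk : 0 < k) {i j : ℕ × ℕ}
    (hi : i.1.Coprime i.2)
    (hj : j.1.Coprime j.2) (hi1 : 0 < i.1) (hi2 : 0 < i.2) (hj1 : 0 < j.1) (hj2 : 0 < j.2)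
    (hiX : (i.1 * i.2 : ℝ) ≤ shortLength q U) (hjX : (j.1 * j.2 : ℝ) ≤ shortLength q U) (hij : i ≠ j)
    (hmod : i.1 * j.2 ≡ j.1 * i.2 [MOD k]) :
    shortGap q U k ≤ |(Real.log i.1 - Real.log i.2) - (Real.log j.1 - Real.log j.2)| := by
  obtain ⟨h1, h2⟩ := log_ratio_spacing hk hi hj hi1 hi2 hj1 hj2 hiX hjX hij hmod
  have hZ := shortLength_pos hq hU
  unfold shortGap
  rw [if_neg hk.ne']
  split_ifs with h
  · refine le_trans ?_ h2
    have : shortening q U / 2 ≤ Real.log (k / shortLength q U) := by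
      rw [Real.le_log_iff_exp_le (by positivity), le_div_iff₀ hZ]
      linarith
    linarith
  · exact h1

theorem sum_moebius_div_shortGap_le {q : ℕ} (hq : 2 ≤ q) {U : ℝ} (hU : 1 ≤ U) :
    ∑ k ∈ q.divisors, |(ArithmeticFunction.moebius (q / k) : ℝ)| * (k.totient / shortGap q U k) ≤
      60 * (q * U) / shortening q U := by
  set J := shortening q U with hJ
  set Z := shortLength q U with hZ
  have hJ0 : 0 < J := shortening_pos hq hU
  have hZ0 : 0 < Z := shortLength_pos hq hU
  have hq0 : q ≠ 0 := by omega
  have hE : 1 ≤ Real.exp (J / 2) := Real.one_le_exp (by positivity)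
  have hterm : ∀ k ∈ q.divisors, |(ArithmeticFunction.moebius (q / k) : ℝ)| * (k.totient / shortGap q U k) ≤
      k.totient / J + |(ArithmeticFunction.moebius (q / k) : ℝ)| * (3 * Z * Real.exp (J / 2)) := by
    intro k hk
    have hk0 : 0 < k := Nat.pos_of_mem_divisors hk
    have hk' : (0:ℝ) < k := by exact_mod_cast hk0
    have hmu : |(ArithmeticFunction.moebius (q / k) : ℝ)| ≤ 1 := by
      rw [← Int.cast_abs]; exact_mod_cast ArithmeticFunction.abs_moebius_le_one
    unfold shortGap
    rw [if_neg hk0.ne']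
    split_ifs with h
    · have : |(ArithmeticFunction.moebius (q / k) : ℝ)| * (k.totient / J) ≤ 1 * (k.totient / J) := by gcongr
      have h2 : 0 ≤ |(ArithmeticFunction.moebius (q / k) : ℝ)| * (3 * Z * Real.exp (J / 2)) := by positivity
      linarith
    · push Not at h
      have h1 : (k.totient : ℝ) / min (k / (2 * Z)) 1 ≤ 3 * Z * Real.exp (J / 2) := by
        have hmin : 0 < min ((k:ℝ) / (2 * Z)) 1 := by positivity
        have htot : (k.totient : ℝ) ≤ k := by exact_mod_cast Nat.totient_le k
        rw [div_le_iff₀ hmin]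
        rcases min_cases ((k:ℝ) / (2 * Z)) 1 with ⟨h3, _⟩ | ⟨h3, _⟩
        · rw [h3]
          calc (k.totient:ℝ) ≤ k := htot
            _ ≤ 3 / 2 * 1 * k := by linarith
            _ ≤ 3 / 2 * Real.exp (J / 2) * k := by gcongr
            _ = _ := by field_simp
        · rw [h3]
          have : 0 ≤ Z * Real.exp (J / 2) := by positivity
          change (k:ℝ) < Z * Real.exp (J / 2) at h
          linarith
      have h2 : 0 ≤ (k.totient : ℝ) / J := by positivity
      have h3 := mul_le_mul_of_nonneg_left h1 (abs_nonneg (ArithmeticFunction.moebius (q / k) : ℝ))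
      linarith
  refine (Finset.sum_le_sum hterm).trans ?_
  rw [Finset.sum_add_distrib, ← Finset.sum_mul, Nat.sum_abs_moebius_div hq0, ← Finset.sum_div]
  have htot : ∑ k ∈ q.divisors, (k.totient : ℝ) = q := by exact_mod_cast Nat.sum_totient q
  rw [htot]
  set s := √(Real.log (q * U)) with hs
  have hl2 := Real.log_pos one_lt_two
  have hL := log_two_le_log_mul hq hU
  have hs2 : s ^ 2 = Real.log (q * U) := Real.sq_sqrt (by linarith)
  have hs0 : 0 ≤ s := Real.sqrt_nonneg _
  have hlog4 : Real.log 4 = 2 * Real.log 2 := by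
    rw [show (4:ℝ) = 2 ^ 2 by norm_num, Real.log_pow]; norm_num
  have hJle : J ≤ 2 * s ^ 2 + s := by
    have h1 := Nat.card_primeFactors_mul_log_two_le hq0
    have h2 : Real.log q ≤ Real.log (q * U) := by
      apply Real.log_le_log (by positivity)
      have : (0:ℝ) < q := by positivity
      nlinarith
    rw [hs2, hJ, shortening, hlog4]
    linarith
  have hexp : J ≤ 18 * Real.exp (s / 2) := by
    have h1 := Real.quadratic_le_exp_of_nonneg (show 0 ≤ s / 2 by positivity)
    nlinarith
  have hZexp : (2:ℝ) ^ q.primeFactors.card * (3 * Z * Real.exp (J / 2)) = 3 * (q * U) * Real.exp (-(s / 2)) := by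
    have h2 : (2:ℝ) ^ q.primeFactors.card = Real.exp (q.primeFactors.card * Real.log 2) := by
      rw [Real.exp_nat_mul, Real.exp_log (by norm_num)]
    have e : (2:ℝ) ^ q.primeFactors.card * (3 * Z * Real.exp (J / 2)) =
        3 * (q * U) * (Real.exp (q.primeFactors.card * Real.log 2) * Real.exp (-J) * Real.exp (J / 2)) := by
      rw [hZ, shortLength, h2]; ring
    rw [e, ← Real.exp_add, ← Real.exp_add]
    congr 2
    rw [hJ, shortening, hlog4]; ring
  rw [hZexp, le_div_iff₀ hJ0, add_mul, div_mul_cancel₀ _ hJ0.ne']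
  have hq' : (0:ℝ) < q := by positivity
  have h5 : 3 * (q * U) * Real.exp (-(s / 2)) * J ≤ 3 * (q * U) * Real.exp (-(s / 2)) * (18 * Real.exp (s / 2)) := by
    gcongr
  have h6 : Real.exp (-(s / 2)) * Real.exp (s / 2) = 1 := by rw [← Real.exp_add]; simp
  have h7 : 3 * (q * U) * Real.exp (-(s / 2)) * (18 * Real.exp (s / 2)) = 54 * (q * U) * (Real.exp (-(s / 2)) * Real.exp (s / 2)) := by ring
  rw [h7, h6] at h5
  nlinarith

theorem one_add_div_sq_le_rpow_mul_rpow {x z θ u : ℝ} (hx : 0 < x) (hz : 0 < z) (h0 : 0 ≤ θ) (h1 : θ ≤ 1) :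
    1 + u ^ 2 / (θ * x + (1 - θ) * z) ^ 2 ≤ (1 + u ^ 2 / x ^ 2) ^ θ * (1 + u ^ 2 / z ^ 2) ^ (1 - θ) := by
  have h1' : 0 ≤ 1 - θ := by linarith
  set A := u ^ 2 / x ^ 2 with hA
  set B := u ^ 2 / z ^ 2 with hB
  have hA0 : 0 ≤ A := by positivity
  have hB0 : 0 ≤ B := by positivity
  have hy := Real.geom_mean_le_arith_mean2_weighted h0 h1' hx.le hz.le (by ring)
  have hm : 0 < x ^ θ * z ^ (1 - θ) := by positivity
  have step1 : u ^ 2 / (θ * x + (1 - θ) * z) ^ 2 ≤ A ^ θ * B ^ (1 - θ) := by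
    calc u ^ 2 / (θ * x + (1 - θ) * z) ^ 2 ≤ u ^ 2 / (x ^ θ * z ^ (1 - θ)) ^ 2 := by gcongr
      _ = A ^ θ * B ^ (1 - θ) := by
        have hA' : A = |u / x| ^ 2 := by rw [sq_abs, div_pow]
        have hB' : B = |u / z| ^ 2 := by rw [sq_abs, div_pow]
        rw [hA', hB']
        have e1 : (|u / x| ^ 2) ^ θ = (|u / x| ^ θ) ^ 2 := by
          rw [← Real.rpow_natCast, ← Real.rpow_natCast, ← Real.rpow_mul (abs_nonneg _),
            ← Real.rpow_mul (abs_nonneg _), mul_comm]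
        have e2 : (|u / z| ^ 2) ^ (1 - θ) = (|u / z| ^ (1 - θ)) ^ 2 := by
          rw [← Real.rpow_natCast, ← Real.rpow_natCast, ← Real.rpow_mul (abs_nonneg _),
            ← Real.rpow_mul (abs_nonneg _), mul_comm]
        rw [e1, e2, ← mul_pow, abs_div, abs_div, abs_of_pos hx, abs_of_pos hz,
          Real.div_rpow (abs_nonneg _) hx.le, Real.div_rpow (abs_nonneg _) hz.le, div_mul_div_comm,
          ← Real.rpow_add_of_nonneg (abs_nonneg _) h0 h1', add_sub_cancel, Real.rpow_one, div_pow, sq_abs, ← div_pow]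
  clear_value A B
  have step2 : 1 + A ^ θ * B ^ (1 - θ) ≤ (1 + A) ^ θ * (1 + B) ^ (1 - θ) := by
    have g1 := Real.geom_mean_le_arith_mean2_weighted h0 h1' (show 0 ≤ 1 / (1 + A) by positivity)
      (show 0 ≤ 1 / (1 + B) by positivity) (by ring)
    have g2 := Real.geom_mean_le_arith_mean2_weighted h0 h1' (show 0 ≤ A / (1 + A) by positivity)
      (show 0 ≤ B / (1 + B) by positivity) (by ring)
    rw [Real.div_rpow (by positivity) (by positivity), Real.div_rpow (by positivity) (by positivity),
      div_mul_div_comm] at g1 g2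
    rw [Real.one_rpow, Real.one_rpow, mul_one] at g1
    have hpos : 0 < (1 + A) ^ θ * (1 + B) ^ (1 - θ) := by positivity
    have hs : θ * (1 / (1 + A)) + (1 - θ) * (1 / (1 + B)) + (θ * (A / (1 + A)) + (1 - θ) * (B / (1 + B))) = 1 := by
      field_simp; ring
    have := add_le_add g1 g2
    rw [hs, ← add_div, div_le_one hpos] at this
    exact this
  linarith

open Complex in
theorem norm_ratio_rpow_le {x z θ u : ℝ} (hx : 0 < x) (hz : 0 < z) (h0 : 0 ≤ θ) (h1 : θ ≤ 1) :
    (‖(x : ℂ)‖ / ‖(x : ℂ) + u * I‖) ^ θ * (‖(z : ℂ)‖ / ‖(z : ℂ) + u * I‖) ^ (1 - θ) ≤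
      ‖((θ * x + (1 - θ) * z : ℝ) : ℂ)‖ / ‖((θ * x + (1 - θ) * z : ℝ) : ℂ) + u * I‖ := by
  have hy : 0 < θ * x + (1 - θ) * z := by
    have h1' : 0 ≤ 1 - θ := by linarith
    rcases h0.eq_or_lt with rfl | h
    · simpa using hz
    · positivity
  have hform : ∀ w : ℝ, 0 < w → ‖(w : ℂ)‖ / ‖(w : ℂ) + u * I‖ = (1 + u ^ 2 / w ^ 2) ^ (-(1/2) : ℝ) := by
    intro w hw
    have : ‖(w : ℂ) + u * I‖ = √(w ^ 2 + u ^ 2) := by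
      rw [Complex.norm_add_mul_I]
    rw [this, Complex.norm_real, Real.norm_eq_abs, abs_of_pos hw, Real.rpow_neg (by positivity),
      ← Real.sqrt_eq_rpow]
    have e : 1 + u ^ 2 / w ^ 2 = (w ^ 2 + u ^ 2) / w ^ 2 := by field_simp
    rw [e, Real.sqrt_div' _ (by positivity), Real.sqrt_sq hw.le, inv_div]
  rw [hform _ hx, hform _ hz, hform _ hy, ← Real.rpow_mul (by positivity), ← Real.rpow_mul (by positivity),
    mul_comm _ θ, mul_comm _ (1 - θ), Real.rpow_mul (by positivity), Real.rpow_mul (by positivity),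
    ← Real.mul_rpow (by positivity) (by positivity)]
  apply Real.rpow_le_rpow_of_nonpos (by positivity) _ (by norm_num)
  exact one_add_div_sq_le_rpow_mul_rpow hx hz h0 h1

open Complex Filter in
/-- Log-concavity of `x ↦ |Γ(x+iu)| / Γ(x)`. -/
theorem norm_Gamma_ratio_logConcave {x z θ u : ℝ} (hx : 0 < x) (hz : 0 < z) (h0 : 0 ≤ θ) (h1 : θ ≤ 1) :
    (‖Complex.Gamma (x + u * I)‖ / ‖Complex.Gamma x‖) ^ θ *
      (‖Complex.Gamma (z + u * I)‖ / ‖Complex.Gamma z‖) ^ (1 - θ) ≤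
      ‖Complex.Gamma ((θ * x + (1 - θ) * z : ℝ) + u * I)‖ / ‖Complex.Gamma ((θ * x + (1 - θ) * z : ℝ))‖ := by
  have h1' : 0 ≤ 1 - θ := by linarith
  have hy : 0 < θ * x + (1 - θ) * z := by
    rcases h0.eq_or_lt with rfl | h
    · simpa using hz
    · positivity
  have hlim : ∀ w : ℝ, 0 < w → Tendsto (fun n : ℕ => ‖Complex.GammaSeq (w + u * I) n‖ / ‖Complex.GammaSeq w n‖)
      atTop (nhds (‖Complex.Gamma (w + u * I)‖ / ‖Complex.Gamma w‖)) := by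
    intro w hw
    apply Tendsto.div (Complex.GammaSeq_tendsto_Gamma _).norm (Complex.GammaSeq_tendsto_Gamma _).norm
    rw [norm_ne_zero_iff]
    exact Complex.Gamma_ne_zero_of_re_pos (by simpa using hw)
  have hprod : ∀ w : ℝ, 0 < w → ∀ n : ℕ, n ≠ 0 → ‖Complex.GammaSeq (w + u * I) n‖ / ‖Complex.GammaSeq w n‖ =
      ∏ j ∈ Finset.range (n + 1), ‖((w + j : ℝ) : ℂ)‖ / ‖((w + j : ℝ) : ℂ) + u * I‖ := by
    intro w hw n hn
    have hn' : (0:ℝ) < n := by exact_mod_cast Nat.pos_of_ne_zero hn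
    unfold Complex.GammaSeq
    rw [norm_div, norm_div, norm_mul, norm_mul, norm_prod, norm_prod]
    have e1 : ‖(n : ℂ) ^ ((w : ℂ) + u * I)‖ = ‖(n : ℂ) ^ (w : ℂ)‖ := by
      rw [← Complex.ofReal_natCast, Complex.norm_cpow_eq_rpow_re_of_pos hn', Complex.norm_cpow_eq_rpow_re_of_pos hn']
      simp
    have hne : ‖(n : ℂ) ^ (w : ℂ)‖ ≠ 0 := by
      rw [← Complex.ofReal_natCast, Complex.norm_cpow_eq_rpow_re_of_pos hn']; positivity
    have hne2 : ‖(n.factorial : ℂ)‖ ≠ 0 := by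
      rw [norm_ne_zero_iff]; exact_mod_cast n.factorial_ne_zero
    have hp1 : ∏ j ∈ Finset.range (n + 1), ‖(w : ℂ) + j‖ ≠ 0 := by
      rw [Finset.prod_ne_zero_iff]
      intro j _
      rw [norm_ne_zero_iff]
      have : (0:ℝ) < w + j := by positivity
      exact_mod_cast this.ne'
    have hp2 : ∏ j ∈ Finset.range (n + 1), ‖(w : ℂ) + u * I + j‖ ≠ 0 := by
      rw [Finset.prod_ne_zero_iff]
      intro j _
      rw [norm_ne_zero_iff]
      intro h
      have := congrArg Complex.re h
      simp at this
      have : (0:ℝ) < w + j := by positivity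
      linarith
    rw [Finset.prod_div_distrib, e1]
    have e2 : ∏ j ∈ Finset.range (n + 1), ‖((w + j : ℝ) : ℂ)‖ = ∏ j ∈ Finset.range (n + 1), ‖(w : ℂ) + j‖ := by
      push_cast; rfl
    have e3 : ∏ j ∈ Finset.range (n + 1), ‖((w + j : ℝ) : ℂ) + u * I‖ = ∏ j ∈ Finset.range (n + 1), ‖(w : ℂ) + u * I + j‖ := by
      refine Finset.prod_congr rfl fun j _ => ?_
      congr 1; push_cast; ring
    rw [e2, e3]
    field_simp
  have hL := ((hlim x hx).rpow_const (p := θ) (Or.inr h0)).mul ((hlim z hz).rpow_const (p := 1 - θ) (Or.inr h1'))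
  refine le_of_tendsto_of_tendsto hL (hlim _ hy) ?_
  filter_upwards [eventually_ne_atTop 0] with n hn
  rw [hprod x hx n hn, hprod z hz n hn, hprod _ hy n hn, ← Real.finsetProd_rpow _ _ (fun j _ => by positivity),
    ← Real.finsetProd_rpow _ _ (fun j _ => by positivity), ← Finset.prod_mul_distrib]
  apply Finset.prod_le_prod
  · intro j _; positivity
  · intro j _
    have := norm_ratio_rpow_le (u := u) (show 0 < x + j by positivity) (show 0 < z + j by positivity) h0 h1
    have e : θ * (x + j) + (1 - θ) * (z + j) = θ * x + (1 - θ) * z + j := by ring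
    rw [e] at this
    exact this

open Complex in
theorem norm_Gamma_half_bounds (u : ℝ) :
    Real.exp (-(Real.pi * |u| / 2)) ≤ ‖Complex.Gamma ((1 / 2 : ℝ) + u * I)‖ ∧
    ‖Complex.Gamma ((1 / 2 : ℝ) + u * I)‖ ≤ 3 * Real.exp (-(Real.pi * |u| / 2)) := by
  have h := Complex.Gamma_mul_Gamma_one_sub ((1 / 2 : ℝ) + u * I)
  have hc : 1 - (((1 / 2 : ℝ) : ℂ) + u * I) = starRingEnd ℂ (((1 / 2 : ℝ) : ℂ) + u * I) := by
    rw [map_add, Complex.conj_ofReal, map_mul, Complex.conj_I, Complex.conj_ofReal]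
    push_cast; ring
  have hs : Complex.sin (Real.pi * (((1 / 2 : ℝ) : ℂ) + u * I)) = (Real.cosh (Real.pi * u) : ℂ) := by
    have : Real.pi * (((1 / 2 : ℝ) : ℂ) + u * I) = (Real.pi * u : ℂ) * I + Real.pi / 2 := by push_cast; ring
    rw [this, Complex.sin_add_pi_div_two, Complex.cos_mul_I]; push_cast; rfl
  rw [hc, Complex.Gamma_conj, Complex.mul_conj', hs] at h
  have h2 : ‖Complex.Gamma ((1 / 2 : ℝ) + u * I)‖ ^ 2 = Real.pi / Real.cosh (Real.pi * u) := by
    exact_mod_cast h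
  set E := Real.exp (-(Real.pi * |u| / 2)) with hE
  have hE2 : E ^ 2 = (Real.exp (Real.pi * |u|))⁻¹ := by
    rw [hE, ← Real.exp_nat_mul, ← Real.exp_neg]; congr 1; push_cast; ring
  have habs : Real.cosh (Real.pi * u) = Real.cosh (Real.pi * |u|) := by
    rw [← Real.cosh_abs, abs_mul, abs_of_pos Real.pi_pos]
  have hcu : Real.cosh (Real.pi * |u|) ≤ Real.exp (Real.pi * |u|) := by
    rw [Real.cosh_eq]
    have : Real.exp (-(Real.pi * |u|)) ≤ Real.exp (Real.pi * |u|) := by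
      apply Real.exp_le_exp.2
      have : 0 ≤ Real.pi * |u| := by positivity
      linarith
    linarith
  have hcl : Real.exp (Real.pi * |u|) / 2 ≤ Real.cosh (Real.pi * |u|) := by
    rw [Real.cosh_eq]
    have := Real.exp_pos (-(Real.pi * |u|))
    linarith
  have hp3 := Real.pi_gt_three
  have hp4 := Real.pi_lt_four
  have hcp := Real.cosh_pos (Real.pi * |u|)
  have hep := Real.exp_pos (Real.pi * |u|)
  have hE0 : 0 < E := Real.exp_pos _
  constructor
  · apply le_of_sq_le_sq _ (norm_nonneg _)
    rw [h2, hE2, habs, inv_eq_one_div, div_le_div_iff₀ hep hcp]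
    nlinarith
  · apply le_of_sq_le_sq _ (by positivity)
    rw [h2, mul_pow, hE2, habs, ← div_eq_mul_inv, div_le_div_iff₀ hcp hep]
    nlinarith

open Complex in
theorem norm_Gamma_add_one_bounds {x u a b : ℝ} (hx : 1 / 2 ≤ x) (ha : a ≤ ‖Complex.Gamma (x + u * I)‖)
    (ha0 : 0 ≤ a) (hb : ‖Complex.Gamma (x + u * I)‖ ≤ b) :
    (1 + |u|) / 4 * a ≤ ‖Complex.Gamma ((x + 1 : ℝ) + u * I)‖ ∧
    ‖Complex.Gamma ((x + 1 : ℝ) + u * I)‖ ≤ (x + 1) * (1 + |u|) * b := by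
  have hne : (x : ℂ) + u * I ≠ 0 := by
    intro h
    have := congrArg Complex.re h
    simp at this
    linarith
  have e : (((x + 1 : ℝ) : ℂ) + u * I) = (x + u * I) + 1 := by push_cast; ring
  rw [e, Complex.Gamma_add_one _ hne, norm_mul]
  have h1 : |x| ≤ ‖(x : ℂ) + u * I‖ := by
    simpa using Complex.abs_re_le_norm ((x : ℂ) + u * I)
  have h2 : |u| ≤ ‖(x : ℂ) + u * I‖ := by
    simpa using Complex.abs_im_le_norm ((x : ℂ) + u * I)
  have h3 : ‖(x : ℂ) + u * I‖ ≤ |x| + |u| := by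
    simpa using Complex.norm_le_abs_re_add_abs_im ((x : ℂ) + u * I)
  rw [abs_of_nonneg (by linarith)] at h1 h3
  have := abs_nonneg u
  constructor
  · gcongr; linarith
  · gcongr
    nlinarith

open Complex in
theorem norm_Gamma_upper {x : ℝ} (hx0 : 0 < x) (hx1 : x < 3 / 2) : ∃ C : ℝ, 0 < C ∧ ∀ u : ℝ,
    ‖Complex.Gamma (x + u * I)‖ ≤ C * (1 + |u|) ^ (x - 1 / 2) * Real.exp (-(Real.pi * |u| / 2)) := by
  set θ : ℝ := 1 / (5 / 2 - x) with hθ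
  have hd : 0 < 5 / 2 - x := by linarith
  have h0 : 0 < θ := by positivity
  have hθ' : θ * (5 / 2 - x) = 1 := by rw [hθ, one_div_mul_cancel hd.ne']
  have h1 : θ ≤ 1 := by rw [hθ, div_le_one hd]; linarith
  have hy : θ * x + (1 - θ) * (5 / 2) = 3 / 2 := by linear_combination -hθ'
  have hG : ∀ w : ℝ, 0 < w → 0 < ‖Complex.Gamma w‖ := fun w hw =>
    norm_pos_iff.2 (Complex.Gamma_ne_zero_of_re_pos (by simpa using hw))
  set g := ‖Complex.Gamma x‖
  set g3 := ‖Complex.Gamma ((3 / 2 : ℝ))‖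
  set g5 := ‖Complex.Gamma ((5 / 2 : ℝ))‖
  have hg : 0 < g := hG x hx0
  have hg3 : 0 < g3 := hG _ (by norm_num)
  have hg5 : 0 < g5 := hG _ (by norm_num)
  refine ⟨g * ((9 / 2 / g3) / (1 / 16 / g5) ^ (1 - θ)) ^ (1 / θ), by positivity, ?_⟩
  intro u
  set W := 1 + |u| with hW
  have hW0 : 0 < W := by positivity
  set E := Real.exp (-(Real.pi * |u| / 2)) with hE
  have hE0 : 0 < E := Real.exp_pos _
  obtain ⟨a1, a2⟩ := norm_Gamma_half_bounds u
  obtain ⟨b1, b2⟩ := norm_Gamma_add_one_bounds le_rfl a1 hE0.le a2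
  have e3 : (1 / 2 + 1 : ℝ) = 3 / 2 := by norm_num
  rw [e3] at b1 b2
  obtain ⟨c1, c2⟩ := norm_Gamma_add_one_bounds (by norm_num) b1 (by positivity) b2
  have e5 : (3 / 2 + 1 : ℝ) = 5 / 2 := by norm_num
  rw [e5] at c1 c2
  have hc := norm_Gamma_ratio_logConcave (u := u) hx0 (show (0:ℝ) < 5 / 2 by norm_num) h0.le h1
  rw [hy] at hc
  have h1' : 0 ≤ 1 - θ := by linarith
  have k1 : ‖Complex.Gamma ((3 / 2 : ℝ) + u * I)‖ / g3 ≤ 9 / 2 / g3 * (W * E) := by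
    rw [div_mul_eq_mul_div]; gcongr; linarith
  have k2 : 1 / 16 / g5 * (W ^ 2 * E) ≤ ‖Complex.Gamma ((5 / 2 : ℝ) + u * I)‖ / g5 := by
    rw [div_mul_eq_mul_div]; gcongr; nlinarith
  have k3 : (‖Complex.Gamma (x + u * I)‖ / g) ^ θ * (1 / 16 / g5 * (W ^ 2 * E)) ^ (1 - θ) ≤ 9 / 2 / g3 * (W * E) := by
    refine le_trans ?_ (hc.trans k1)
    gcongr
  rw [Real.mul_rpow (by positivity) (by positivity)] at k3
  have k4 : (‖Complex.Gamma (x + u * I)‖ / g) ^ θ ≤ (9 / 2 / g3) / (1 / 16 / g5) ^ (1 - θ) * ((W * E) / (W ^ 2 * E) ^ (1 - θ)) := by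
    rw [div_mul_div_comm, le_div_iff₀ (by positivity)]
    exact k3
  have k5 : ‖Complex.Gamma (x + u * I)‖ / g ≤ ((9 / 2 / g3) / (1 / 16 / g5) ^ (1 - θ) * ((W * E) / (W ^ 2 * E) ^ (1 - θ))) ^ (1 / θ) := by
    have := Real.rpow_le_rpow (by positivity) k4 (show 0 ≤ 1 / θ by positivity)
    rwa [← Real.rpow_mul (by positivity), mul_one_div_cancel h0.ne', Real.rpow_one] at this
  have k6 : ((W * E) / (W ^ 2 * E) ^ (1 - θ)) ^ (1 / θ) = W ^ (x - 1 / 2) * E := by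
    have : (W * E) / (W ^ 2 * E) ^ (1 - θ) = W ^ (2 * θ - 1) * E ^ θ := by
      rw [Real.mul_rpow (by positivity) hE0.le, ← Real.rpow_natCast, ← Real.rpow_mul hW0.le, mul_div_mul_comm]
      nth_rewrite 1 [← Real.rpow_one W]
      nth_rewrite 1 [← Real.rpow_one E]
      rw [← Real.rpow_sub hW0, ← Real.rpow_sub hE0]
      congr 2
      · push_cast; ring
      · ring
    rw [this, Real.mul_rpow (by positivity) (by positivity), ← Real.rpow_mul hW0.le, ← Real.rpow_mul hE0.le,
      mul_one_div_cancel h0.ne', Real.rpow_one]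
    congr 2
    have : 1 / θ = 5 / 2 - x := by rw [hθ, one_div_one_div]
    rw [this]
    linear_combination 2 * hθ'
  rw [Real.mul_rpow (by positivity) (by positivity), k6, div_le_iff₀ hg] at k5
  linarith

open Complex in
theorem norm_Gamma_lower {x : ℝ} (hx0 : 1 / 2 ≤ x) (hx1 : x ≤ 3 / 2) : ∃ c : ℝ, 0 < c ∧ ∀ u : ℝ,
    c * (1 + |u|) ^ (x - 1 / 2) * Real.exp (-(Real.pi * |u| / 2)) ≤ ‖Complex.Gamma (x + u * I)‖ := by
  set θ : ℝ := 3 / 2 - x with hθ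
  have h0 : 0 ≤ θ := by linarith
  have h1 : θ ≤ 1 := by linarith
  have hy : θ * (1 / 2) + (1 - θ) * (3 / 2) = x := by rw [hθ]; ring
  have hG : ∀ w : ℝ, 0 < w → 0 < ‖Complex.Gamma w‖ := fun w hw =>
    norm_pos_iff.2 (Complex.Gamma_ne_zero_of_re_pos (by simpa using hw))
  set g := ‖Complex.Gamma x‖
  set g3 := ‖Complex.Gamma ((3 / 2 : ℝ))‖
  set g1 := ‖Complex.Gamma ((1 / 2 : ℝ))‖
  have hg : 0 < g := hG x (by linarith)
  have hg3 : 0 < g3 := hG _ (by norm_num)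
  have hg1 : 0 < g1 := hG _ (by norm_num)
  refine ⟨g * ((1 / g1) ^ θ * (1 / 4 / g3) ^ (1 - θ)), by positivity, ?_⟩
  intro u
  set W := 1 + |u| with hW
  have hW0 : 0 < W := by positivity
  set E := Real.exp (-(Real.pi * |u| / 2)) with hE
  have hE0 : 0 < E := Real.exp_pos _
  obtain ⟨a1, a2⟩ := norm_Gamma_half_bounds u
  obtain ⟨b1, b2⟩ := norm_Gamma_add_one_bounds le_rfl a1 hE0.le a2
  have e3 : (1 / 2 + 1 : ℝ) = 3 / 2 := by norm_num
  rw [e3] at b1 b2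
  have hc := norm_Gamma_ratio_logConcave (u := u) (show (0:ℝ) < 1 / 2 by norm_num) (show (0:ℝ) < 3 / 2 by norm_num) h0 h1
  rw [hy] at hc
  have h1' : 0 ≤ 1 - θ := by linarith
  have k1 : 1 / g1 * E ≤ ‖Complex.Gamma ((1 / 2 : ℝ) + u * I)‖ / g1 := by
    rw [div_mul_eq_mul_div]; gcongr; linarith
  have k2 : 1 / 4 / g3 * (W * E) ≤ ‖Complex.Gamma ((3 / 2 : ℝ) + u * I)‖ / g3 := by
    rw [div_mul_eq_mul_div]; gcongr; linarith
  have k3 : (1 / g1 * E) ^ θ * (1 / 4 / g3 * (W * E)) ^ (1 - θ) ≤ ‖Complex.Gamma (x + u * I)‖ / g := by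
    refine le_trans ?_ hc
    gcongr
  rw [Real.mul_rpow (by positivity) (by positivity), Real.mul_rpow (by positivity) (by positivity),
    Real.mul_rpow hW0.le hE0.le, le_div_iff₀ hg] at k3
  have hEE : E ^ θ * E ^ (1 - θ) = E := by
    rw [← Real.rpow_add hE0, add_sub_cancel, Real.rpow_one]
  calc _ = (1 / g1) ^ θ * (1 / 4 / g3) ^ (1 - θ) * g * (W ^ (x - 1 / 2) * E) := by ring
    _ = (1 / g1) ^ θ * (1 / 4 / g3) ^ (1 - θ) * g * (W ^ (1 - θ) * (E ^ θ * E ^ (1 - θ))) := by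
        rw [hEE]; congr 3; rw [hθ]; ring
    _ ≤ _ := by linarith

open Complex in
theorem norm_Gamma_lower_quarter : ∃ c : ℝ, 0 < c ∧ ∀ u : ℝ,
    c * (1 + |u|) ^ (-(1 / 4) : ℝ) * Real.exp (-(Real.pi * |u| / 2)) ≤ ‖Complex.Gamma ((1 / 4 : ℝ) + u * I)‖ := by
  obtain ⟨c, hc0, hc⟩ := norm_Gamma_lower (x := 5 / 4) (by norm_num) (by norm_num)
  refine ⟨c, hc0, fun u => ?_⟩
  have h := hc u
  have hne : ((1 / 4 : ℝ) : ℂ) + u * I ≠ 0 := by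
    intro h
    have := congrArg Complex.re h
    norm_num at this
  have e : (((5 / 4 : ℝ) : ℂ) + u * I) = (((1 / 4 : ℝ) : ℂ) + u * I) + 1 := by push_cast; ring
  rw [e, Complex.Gamma_add_one _ hne, norm_mul] at h
  have hW0 : 0 < 1 + |u| := by positivity
  have h3 : ‖((1 / 4 : ℝ) : ℂ) + u * I‖ ≤ 1 + |u| := by
    have := Complex.norm_le_abs_re_add_abs_im (((1 / 4 : ℝ) : ℂ) + u * I)
    simp only [add_re, ofReal_re, mul_re, I_re, mul_zero, ofReal_im, I_im, mul_one, sub_self, add_zero, add_im, mul_im, zero_add] at this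
    rw [abs_of_nonneg (by norm_num : (0:ℝ) ≤ 1 / 4)] at this
    linarith
  have h4 : c * (1 + |u|) ^ (5 / 4 - 1 / 2 : ℝ) * Real.exp (-(Real.pi * |u| / 2)) ≤
      (1 + |u|) * ‖Complex.Gamma ((1 / 4 : ℝ) + u * I)‖ := h.trans (by gcongr)
  have e2 : (1 + |u|) ^ (5 / 4 - 1 / 2 : ℝ) = (1 + |u|) * (1 + |u|) ^ (-(1 / 4) : ℝ) := by
    nth_rewrite 2 [← Real.rpow_one (1 + |u|)]
    rw [← Real.rpow_add hW0]; norm_num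
  rw [e2] at h4
  refine le_of_mul_le_mul_left ?_ hW0
  linarith

theorem one_add_abs_rpow_le {v τ η e : ℝ} (h1 : |v| ≤ |τ| + |η|) (h2 : |τ| ≤ |v| + |η|) :
    (1 + |v|) ^ e ≤ (1 + |τ|) ^ e * (1 + |η|) ^ |e| := by
  have hv := abs_nonneg v
  have hτ := abs_nonneg τ
  have hη := abs_nonneg η
  rcases le_total 0 e with he | he
  · rw [abs_of_nonneg he, ← Real.mul_rpow (by positivity) (by positivity)]
    apply Real.rpow_le_rpow (by positivity) _ he
    nlinarith
  · rw [abs_of_nonpos he, Real.rpow_neg (by positivity), ← div_eq_mul_inv, ← Real.div_rpow (by positivity) (by positivity)]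
    apply Real.rpow_le_rpow_of_nonpos (by positivity) _ he
    rw [div_le_iff₀ (by positivity)]
    nlinarith

open Complex in
theorem Gamma_product_ratio {x₀ σ c C : ℝ} (hc : 0 < c) (hC : 0 < C) (he : |x₀ + σ / 2 - 1 / 2| ≤ 1)
    (hσ : -1 ≤ σ)
    (hl : ∀ u : ℝ, c * (1 + |u|) ^ (x₀ - 1 / 2) * Real.exp (-(Real.pi * |u| / 2)) ≤ ‖Complex.Gamma (x₀ + u * I)‖)
    (hu : ∀ u : ℝ, ‖Complex.Gamma ((x₀ + σ / 2 : ℝ) + u * I)‖ ≤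
      C * (1 + |u|) ^ (x₀ + σ / 2 - 1 / 2) * Real.exp (-(Real.pi * |u| / 2))) (t y : ℝ) :
    ‖Complex.Gamma ((x₀ + σ / 2 : ℝ) + ((y + t) / 2 : ℝ) * I)‖ *
      ‖Complex.Gamma ((x₀ + σ / 2 : ℝ) + ((y - t) / 2 : ℝ) * I)‖ ≤
    2 * (C ^ 2 / c ^ 2) * ‖Complex.Gamma (x₀ + (t / 2 : ℝ) * I)‖ ^ 2 * (1 + |t|) ^ σ * (1 + |y|) ^ 2 := by
  set e := x₀ + σ / 2 - 1 / 2 with he'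
  set τ := t / 2 with hτ
  set η := y / 2 with hη
  have hv1 : (y + t) / 2 = η + τ := by rw [hτ, hη]; ring
  have hv2 : (y - t) / 2 = η - τ := by rw [hτ, hη]; ring
  rw [hv1, hv2]
  have A1 : (1 + |η + τ|) ^ e ≤ (1 + |τ|) ^ e * (1 + |η|) ^ |e| := by
    apply one_add_abs_rpow_le
    · rw [add_comm]; exact abs_add_le _ _
    · have := abs_sub (η + τ) η; simpa using this
  have A2 : (1 + |η - τ|) ^ e ≤ (1 + |τ|) ^ e * (1 + |η|) ^ |e| := by
    apply one_add_abs_rpow_le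
    · rw [add_comm]; exact abs_sub _ _
    · have := abs_sub η (η - τ); simp only [sub_sub_cancel] at this; linarith
  have hW : 0 < 1 + |τ| := by positivity
  have hexp : Real.exp (-(Real.pi * |η + τ| / 2)) * Real.exp (-(Real.pi * |η - τ| / 2)) ≤
      Real.exp (-(Real.pi * |τ| / 2)) ^ 2 := by
    rw [← Real.exp_add, ← Real.exp_nat_mul]
    apply Real.exp_le_exp.2
    have : 2 * |τ| ≤ |η + τ| + |η - τ| := by
      have := abs_sub (η + τ) (η - τ)
      rw [show η + τ - (η - τ) = 2 * τ by ring, abs_mul, abs_two] at this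
      exact this
    have hp := Real.pi_pos
    push_cast
    nlinarith
  have B := mul_le_mul (hu (η + τ)) (hu (η - τ)) (norm_nonneg _) (by positivity)
  have hlow := pow_le_pow_left₀ (by positivity) (hl τ) 2
  set E := Real.exp (-(Real.pi * |τ| / 2)) with hE
  have hη1 : ((1 + |η|) ^ |e|) ^ 2 ≤ (1 + |y|) ^ 2 := by
    apply pow_le_pow_left₀ (by positivity)
    calc (1 + |η|) ^ |e| ≤ (1 + |η|) ^ (1:ℝ) := Real.rpow_le_rpow_of_exponent_le (by linarith [abs_nonneg η]) he
      _ = 1 + |η| := Real.rpow_one _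
      _ ≤ 1 + |y| := by rw [hη, abs_div, abs_two]; linarith [abs_nonneg y]
  have hτσ : (1 + |τ|) ^ σ ≤ 2 * (1 + |t|) ^ σ := by
    have ht : |τ| = |t| / 2 := by rw [hτ, abs_div, abs_two]
    have ht0 := abs_nonneg t
    rcases le_total 0 σ with h | h
    · have : (1 + |τ|) ^ σ ≤ (1 + |t|) ^ σ := Real.rpow_le_rpow (by positivity) (by linarith) h
      have h2 : 0 < (1 + |t|) ^ σ := by positivity
      linarith
    · have h1 : (1 + |τ|) ^ σ ≤ ((1 + |t|) / 2) ^ σ :=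
        Real.rpow_le_rpow_of_nonpos (by positivity) (by linarith) h
      have h2 : ((1 + |t|) / 2) ^ σ = (1 / 2 : ℝ) ^ σ * (1 + |t|) ^ σ := by
        rw [← Real.mul_rpow (by norm_num) (by positivity)]; congr 1; ring
      have h3 : (1 / 2 : ℝ) ^ σ ≤ 2 := by
        calc (1 / 2 : ℝ) ^ σ ≤ (1 / 2 : ℝ) ^ (-1 : ℝ) :=
              Real.rpow_le_rpow_of_exponent_ge (by norm_num) (by norm_num) hσ
          _ = 2 := by rw [Real.rpow_neg_one]; norm_num
      rw [h2] at h1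
      exact h1.trans (by gcongr)
  have hpow : ((1 + |τ|) ^ e) ^ 2 = ((1 + |τ|) ^ (x₀ - 1 / 2)) ^ 2 * (1 + |τ|) ^ σ := by
    rw [← Real.rpow_natCast, ← Real.rpow_natCast, ← Real.rpow_mul hW.le, ← Real.rpow_mul hW.le, ← Real.rpow_add hW]
    congr 1
    rw [he']; push_cast; ring
  calc _ ≤ _ := B
    _ = C ^ 2 * ((1 + |η + τ|) ^ e * (1 + |η - τ|) ^ e) *
        (Real.exp (-(Real.pi * |η + τ| / 2)) * Real.exp (-(Real.pi * |η - τ| / 2))) := by ring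
    _ ≤ C ^ 2 * (((1 + |τ|) ^ e * (1 + |η|) ^ |e|) * ((1 + |τ|) ^ e * (1 + |η|) ^ |e|)) * E ^ 2 := by
        gcongr
    _ = C ^ 2 / c ^ 2 * (c * (1 + |τ|) ^ (x₀ - 1 / 2) * E) ^ 2 * (1 + |τ|) ^ σ * ((1 + |η|) ^ |e|) ^ 2 := by
        have : C ^ 2 * (((1 + |τ|) ^ e * (1 + |η|) ^ |e|) * ((1 + |τ|) ^ e * (1 + |η|) ^ |e|)) * E ^ 2 =
          C ^ 2 * ((1 + |τ|) ^ e) ^ 2 * ((1 + |η|) ^ |e|) ^ 2 * E ^ 2 := by ring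
        rw [this, hpow]; field_simp
    _ ≤ C ^ 2 / c ^ 2 * ‖Complex.Gamma (x₀ + τ * I)‖ ^ 2 * (2 * (1 + |t|) ^ σ) * (1 + |y|) ^ 2 := by
        gcongr
    _ = _ := by ring

open Complex in
theorem norm_Gammaℝ (x u : ℝ) : ‖Complex.Gammaℝ (x + u * I)‖ =
    Real.pi ^ (-x / 2) * ‖Complex.Gamma ((x / 2 : ℝ) + (u / 2 : ℝ) * I)‖ := by
  rw [Complex.Gammaℝ_def, norm_mul, Complex.norm_cpow_eq_rpow_re_of_pos Real.pi_pos]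
  congr 2
  · simp
  · congr 1; push_cast; ring

open Complex in
theorem gammaFactor_ratio_bound : ∃ C : ℝ, 0 < C ∧ ∀ (q : ℕ) [NeZero q] (χ : DirichletCharacter ℂ q)
    (σ : ℝ), (σ = -1 / 4 ∨ σ = 1) → ∀ t y : ℝ,
    ‖χ.gammaFactor (1 / 2 + t * I + (σ + y * I))‖ * ‖χ.gammaFactor (1 / 2 - t * I + (σ + y * I))‖ ≤
      C * ‖χ.gammaFactor (1 / 2 + t * I)‖ ^ 2 * (1 + |t|) ^ σ * (1 + |y|) ^ 2 := by
  have base : ∀ x₀ σ : ℝ, (x₀ = 1 / 4 ∨ x₀ = 3 / 4) → (σ = -1 / 4 ∨ σ = 1) → ∃ C : ℝ, 0 < C ∧ ∀ t y : ℝ,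
      ‖Complex.Gammaℝ ((2 * x₀ + σ : ℝ) + (y + t : ℝ) * I)‖ * ‖Complex.Gammaℝ ((2 * x₀ + σ : ℝ) + (y - t : ℝ) * I)‖ ≤
      C * ‖Complex.Gammaℝ ((2 * x₀ : ℝ) + t * I)‖ ^ 2 * (1 + |t|) ^ σ * (1 + |y|) ^ 2 := by
    intro x₀ σ hx hσ
    obtain ⟨c, hc, hl⟩ : ∃ c : ℝ, 0 < c ∧ ∀ u : ℝ,
        c * (1 + |u|) ^ (x₀ - 1 / 2) * Real.exp (-(Real.pi * |u| / 2)) ≤ ‖Complex.Gamma (x₀ + u * I)‖ := by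
      rcases hx with rfl | rfl
      · obtain ⟨c, hc, h⟩ := norm_Gamma_lower_quarter
        refine ⟨c, hc, fun u => ?_⟩
        rw [show (1 / 4 - 1 / 2 : ℝ) = -(1 / 4) by norm_num]
        exact h u
      · exact norm_Gamma_lower (by norm_num) (by norm_num)
    obtain ⟨C, hC, hu⟩ := norm_Gamma_upper (x := x₀ + σ / 2) (by rcases hx with rfl | rfl <;> rcases hσ with rfl | rfl <;> norm_num)
      (by rcases hx with rfl | rfl <;> rcases hσ with rfl | rfl <;> norm_num)
    have he : |x₀ + σ / 2 - 1 / 2| ≤ 1 := by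
      rw [abs_le]
      rcases hx with rfl | rfl <;> rcases hσ with rfl | rfl <;> norm_num
    have hσ1 : -1 ≤ σ := by rcases hσ with rfl | rfl <;> norm_num
    have main := Gamma_product_ratio hc hC he hσ1 hl hu
    refine ⟨(Real.pi ^ (-(2 * x₀ + σ) / 2)) ^ 2 / (Real.pi ^ (-(2 * x₀) / 2)) ^ 2 * (2 * (C ^ 2 / c ^ 2)), ?_, ?_⟩
    · have := Real.pi_pos
      positivity
    intro t y
    have hp := Real.pi_pos
    rw [norm_Gammaℝ, norm_Gammaℝ, norm_Gammaℝ]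
    have := main t y
    rw [show (2 * x₀ + σ) / 2 = x₀ + σ / 2 by ring, show 2 * x₀ / 2 = x₀ by ring]
    calc _ = (Real.pi ^ (-(2 * x₀ + σ) / 2)) ^ 2 * (‖Complex.Gamma ((x₀ + σ / 2 : ℝ) + ((y + t) / 2 : ℝ) * I)‖ *
      ‖Complex.Gamma ((x₀ + σ / 2 : ℝ) + ((y - t) / 2 : ℝ) * I)‖) := by ring
      _ ≤ (Real.pi ^ (-(2 * x₀ + σ) / 2)) ^ 2 * (2 * (C ^ 2 / c ^ 2) * ‖Complex.Gamma (x₀ + (t / 2 : ℝ) * I)‖ ^ 2 * (1 + |t|) ^ σ * (1 + |y|) ^ 2) := by gcongr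
      _ = _ := by
        have : (Real.pi ^ (-(2 * x₀) / 2)) ≠ 0 := by positivity
        field_simp
  obtain ⟨C1, h1, H1⟩ := base (1 / 4) (-1 / 4) (Or.inl rfl) (Or.inl rfl)
  obtain ⟨C2, h2, H2⟩ := base (1 / 4) 1 (Or.inl rfl) (Or.inr rfl)
  obtain ⟨C3, h3, H3⟩ := base (3 / 4) (-1 / 4) (Or.inr rfl) (Or.inl rfl)
  obtain ⟨C4, h4, H4⟩ := base (3 / 4) 1 (Or.inr rfl) (Or.inr rfl)
  refine ⟨C1 + C2 + C3 + C4, by positivity, ?_⟩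
  intro q _ χ σ hσ t y
  have fin : ∀ (x₀ C : ℝ) , C ≤ C1 + C2 + C3 + C4 → 
      ‖Complex.Gammaℝ ((2 * x₀ + σ : ℝ) + (y + t : ℝ) * I)‖ * ‖Complex.Gammaℝ ((2 * x₀ + σ : ℝ) + (y - t : ℝ) * I)‖ ≤
      C * ‖Complex.Gammaℝ ((2 * x₀ : ℝ) + t * I)‖ ^ 2 * (1 + |t|) ^ σ * (1 + |y|) ^ 2 →
      ‖Complex.Gammaℝ ((2 * x₀ + σ : ℝ) + (y + t : ℝ) * I)‖ * ‖Complex.Gammaℝ ((2 * x₀ + σ : ℝ) + (y - t : ℝ) * I)‖ ≤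
      (C1 + C2 + C3 + C4) * ‖Complex.Gammaℝ ((2 * x₀ : ℝ) + t * I)‖ ^ 2 * (1 + |t|) ^ σ * (1 + |y|) ^ 2 := by
    intro x₀ C hC h
    exact h.trans (by gcongr)
  rcases χ.even_or_odd with hχ | hχ
  · rw [hχ.gammaFactor_def, hχ.gammaFactor_def, hχ.gammaFactor_def]
    have e1 : (1 / 2 + t * I + (σ + y * I) : ℂ) = (2 * (1 / 4) + σ : ℝ) + (y + t : ℝ) * I := by push_cast; ring
    have e2 : (1 / 2 - t * I + (σ + y * I) : ℂ) = (2 * (1 / 4) + σ : ℝ) + (y - t : ℝ) * I := by push_cast; ring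
    have e3 : (1 / 2 + t * I : ℂ) = (2 * (1 / 4) : ℝ) + t * I := by push_cast; ring
    rw [e1, e2, e3]
    rcases hσ with rfl | rfl
    · exact fin _ C1 (by linarith) (H1 t y)
    · exact fin _ C2 (by linarith) (H2 t y)
  · rw [hχ.gammaFactor_def, hχ.gammaFactor_def, hχ.gammaFactor_def]
    have e1 : (1 / 2 + t * I + (σ + y * I) + 1 : ℂ) = (2 * (3 / 4) + σ : ℝ) + (y + t : ℝ) * I := by push_cast; ring
    have e2 : (1 / 2 - t * I + (σ + y * I) + 1 : ℂ) = (2 * (3 / 4) + σ : ℝ) + (y - t : ℝ) * I := by push_cast; ring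
    have e3 : (1 / 2 + t * I + 1 : ℂ) = (2 * (3 / 4) : ℝ) + t * I := by push_cast; ring
    rw [e1, e2, e3]
    rcases hσ with rfl | rfl
    · exact fin _ C3 (by linarith) (H3 t y)
    · exact fin _ C4 (by linarith) (H4 t y)

open Complex MeasureTheory Set in
theorem exists_norm_mellin_le {f : ℝ → ℂ} {a b : ℝ} (ha : MellinConvergent f a) (hb : MellinConvergent f b) :
    ∃ C : ℝ, ∀ s : ℂ, a ≤ s.re → s.re ≤ b → ‖mellin f s‖ ≤ C := by
  have h1 := ha.norm
  have h2 := hb.norm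
  refine ⟨∫ t in Ioi (0 : ℝ), (‖(t : ℂ) ^ ((a : ℂ) - 1) • f t‖ + ‖(t : ℂ) ^ ((b : ℂ) - 1) • f t‖), ?_⟩
  intro s hs1 hs2
  refine norm_integral_le_of_norm_le (h1.add h2) ?_
  filter_upwards [ae_restrict_mem measurableSet_Ioi] with t ht
  have ht' : 0 < t := ht
  simp only [norm_smul, norm_cpow_eq_rpow_re_of_pos ht', sub_re, ofReal_re, one_re]
  rw [← add_mul]
  refine mul_le_mul_of_nonneg_right ?_ (norm_nonneg _)
  have p1 := Real.rpow_pos_of_pos ht' (a - 1)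
  have p2 := Real.rpow_pos_of_pos ht' (b - 1)
  rcases le_total 1 t with h | h
  · have := Real.rpow_le_rpow_of_exponent_le h (show s.re - 1 ≤ b - 1 by linarith)
    linarith
  · have := Real.rpow_le_rpow_of_exponent_ge ht' h (show a - 1 ≤ s.re - 1 by linarith)
    linarith

open HurwitzZeta in
theorem exists_norm_completedHurwitzZetaEven₀_le (x : UnitAddCircle) (a b : ℝ) :
    ∃ C : ℝ, ∀ s : ℂ, a ≤ s.re → s.re ≤ b → ‖completedHurwitzZetaEven₀ x s‖ ≤ C := by
  obtain ⟨C, hC⟩ := exists_norm_mellin_le (f := (hurwitzEvenFEPair x).f_modif)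
    ((hurwitzEvenFEPair x).isStrongFEPair_toStrongFEPair.hasMellin (a / 2 : ℝ)).1
    ((hurwitzEvenFEPair x).isStrongFEPair_toStrongFEPair.hasMellin (b / 2 : ℝ)).1
  refine ⟨C / 2, fun s h1 h2 => ?_⟩
  have := hC (s / 2) (by simp; linarith) (by simp; linarith)
  rw [completedHurwitzZetaEven₀, WeakFEPair.Λ₀, norm_div, Complex.norm_ofNat]
  linarith

open HurwitzZeta in
theorem exists_norm_completedHurwitzZetaOdd_le (x : UnitAddCircle) (a b : ℝ) :
    ∃ C : ℝ, ∀ s : ℂ, a ≤ s.re → s.re ≤ b → ‖completedHurwitzZetaOdd x s‖ ≤ C := by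
  obtain ⟨C, hC⟩ := exists_norm_mellin_le (f := (hurwitzOddFEPair x).f)
    ((isStrong_hurwitzOddFEPair x).hasMellin ((a + 1) / 2 : ℝ)).1
    ((isStrong_hurwitzOddFEPair x).hasMellin ((b + 1) / 2 : ℝ)).1
  refine ⟨C / 2, fun s h1 h2 => ?_⟩
  have := hC ((s + 1) / 2) (by simp; linarith) (by simp; linarith)
  rw [completedHurwitzZetaOdd, (isStrong_hurwitzOddFEPair x).Λ_eq, norm_div, Complex.norm_ofNat]
  linarith

theorem ZMod.exists_norm_completedLFunction₀_le {N : ℕ} [NeZero N] (Φ : ZMod N → ℂ) (a b : ℝ) :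
    ∃ C : ℝ, ∀ s : ℂ, a ≤ s.re → s.re ≤ b → ‖ZMod.completedLFunction₀ Φ s‖ ≤ C := by
  choose E hE using fun j : ZMod N => exists_norm_completedHurwitzZetaEven₀_le (toAddCircle j) a b
  choose O hO using fun j : ZMod N => exists_norm_completedHurwitzZetaOdd_le (toAddCircle j) a b
  have hN : (1 : ℝ) ≤ N := by exact_mod_cast NeZero.one_le
  refine ⟨(N : ℝ) ^ (-a) * ∑ j, ‖Φ j‖ * E j + (N : ℝ) ^ (-a) * ∑ j, ‖Φ j‖ * O j, fun s h1 h2 => ?_⟩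
  have hp : ‖(N : ℂ) ^ (-s)‖ ≤ (N : ℝ) ^ (-a) := by
    rw [Complex.norm_natCast_cpow_of_pos (NeZero.pos N), Complex.neg_re]
    exact Real.rpow_le_rpow_of_exponent_le hN (by linarith)
  rw [ZMod.completedLFunction₀]
  refine (norm_add_le _ _).trans (add_le_add ?_ ?_)
  all_goals
    rw [norm_mul]
    refine mul_le_mul hp ((norm_sum_le _ _).trans (Finset.sum_le_sum fun j _ => ?_))
      (norm_nonneg _) (by positivity)
    rw [norm_mul]
    refine mul_le_mul_of_nonneg_left ?_ (norm_nonneg _)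
  · exact hE j s h1 h2
  · exact hO j s h1 h2

namespace DirichletCharacter

variable {q : ℕ} [NeZero q]

theorem exists_norm_completedLFunction_le {χ : DirichletCharacter ℂ q} (hχ : χ ≠ 1) (a b : ℝ) :
    ∃ C : ℝ, ∀ s : ℂ, a ≤ s.re → s.re ≤ b → ‖χ.completedLFunction s‖ ≤ C := by
  obtain ⟨C, hC⟩ := ZMod.exists_norm_completedLFunction₀_le (χ : ZMod q → ℂ) a b
  refine ⟨C, fun s h1 h2 => ?_⟩
  rw [completedLFunction, ZMod.completedLFunction_eq, χ.map_zero' (hχ ∘ level_one' _),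
    χ.sum_eq_zero_of_ne_one hχ]
  simpa using hC s h1 h2

open ComplexConjugate

theorem inv_apply_eq_conj (χ : DirichletCharacter ℂ q) (a : ZMod q) : χ⁻¹ a = conj (χ a) := by
  rw [MulChar.inv_apply_eq_inv']
  by_cases ha : IsUnit a
  · obtain ⟨u, rfl⟩ := ha
    rw [Complex.inv_def, Complex.normSq_eq_norm_sq, χ.unit_norm_eq_one u]; simp
  · rw [χ.map_nonunit ha]; simp

theorem LFunction_inv_conj {χ : DirichletCharacter ℂ q} (hχ : χ ≠ 1) (s : ℂ) :
    χ⁻¹.LFunction (conj s) = conj (χ.LFunction s) := by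
  have hχ' : χ⁻¹ ≠ 1 := by simpa using hχ
  have h1 : Differentiable ℂ (fun s => conj (χ.LFunction (conj s))) := by
    intro z
    have := (differentiable_LFunction hχ (conj z)).conj_conj
    simpa [Function.comp_def] using this
  have h2 : (fun s => conj (χ.LFunction (conj s))) = χ⁻¹.LFunction := by
    refine AnalyticOnNhd.eq_of_eventuallyEq (𝕜 := ℂ) (z₀ := 2) (fun z _ => h1.analyticAt z)
      (fun z _ => (differentiable_LFunction hχ').analyticAt z) ?_
    have : {z : ℂ | 1 < z.re} ∈ nhds (2 : ℂ) :=
      (isOpen_lt continuous_const Complex.continuous_re).mem_nhds (by simp)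
    filter_upwards [this] with z hz
    have hz' : 1 < z.re := hz
    rw [LFunction_eq_LSeries _ (by simpa using hz'), LFunction_eq_LSeries _ hz', LSeries, LSeries,
      Complex.conj_tsum]
    refine tsum_congr fun n => ?_
    rcases eq_or_ne n 0 with rfl | hn
    · simp
    · rw [LSeries.term_of_ne_zero hn, LSeries.term_of_ne_zero hn, map_div₀, inv_apply_eq_conj]
      congr 1
      rw [Complex.cpow_conj _ _ (by rw [Complex.natCast_arg]; exact Real.pi_pos.ne),
        Complex.conj_conj, Complex.conj_natCast]
  have := congrFun h2 (conj s)
  simpa using this.symm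

theorem gammaFactor_inv (χ : DirichletCharacter ℂ q) (s : ℂ) : χ⁻¹.gammaFactor s = χ.gammaFactor s := by
  rcases χ.even_or_odd with h | h
  · have : χ⁻¹.Even := by
      rw [DirichletCharacter.Even, inv_apply_eq_conj, h]; simp
    rw [this.gammaFactor_def, h.gammaFactor_def]
  · have : χ⁻¹.Odd := by
      rw [DirichletCharacter.Odd, inv_apply_eq_conj, h]; simp
    rw [this.gammaFactor_def, h.gammaFactor_def]

theorem IsPrimitive.inv {n : ℕ} {χ : DirichletCharacter ℂ n} (h : χ.IsPrimitive) : χ⁻¹.IsPrimitive := by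
  rw [IsPrimitive, conductor_inv]; exact h

theorem IsPrimitive.ne_one {χ : DirichletCharacter ℂ q} (h : χ.IsPrimitive) (hq : 2 ≤ q) : χ ≠ 1 := by
  rintro rfl
  rw [IsPrimitive, conductor_one] at h
  omega

theorem IsPrimitive.rootNumber_mul_inv {χ : DirichletCharacter ℂ q} (h : χ.IsPrimitive) (hq : 2 ≤ q) :
    χ.rootNumber * χ⁻¹.rootNumber = 1 := by
  have hχ := h.ne_one hq
  have hq0 : (q : ℂ) ≠ 0 := NeZero.ne _
  have h1 := h.completedLFunction_one_sub (-1)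
  have h2 := h.inv.completedLFunction_one_sub 2
  rw [inv_inv] at h2
  norm_num at h1 h2
  rw [h2] at h1
  have h0 : χ.completedLFunction 2 ≠ 0 := by
    intro h0
    apply LFunction_ne_zero_of_one_le_re χ (s := 2) (Or.inl hχ) (by simp)
    rw [LFunction_eq_completed_div_gammaFactor χ 2 (Or.inl two_ne_zero), h0, zero_div]
  have h3 : (q : ℂ) ^ (-(3 / 2) : ℂ) * (q : ℂ) ^ (3 / 2 : ℂ) = 1 := by
    rw [← Complex.cpow_add _ _ hq0]; simp
  apply mul_right_cancel₀ h0
  linear_combination -h1 - χ.rootNumber * χ⁻¹.rootNumber * χ.completedLFunction 2 * h3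

end DirichletCharacter

open Complex in
theorem integral_inv_add_mul_I {b : ℝ} (hb : b ≠ 0) (T : ℝ) :
    ∫ y in (-T)..T, ((b : ℂ) + y * I)⁻¹ = (2 * Real.arctan (T / b) : ℝ) := by
  have hne : ∀ y : ℝ, (b : ℂ) + y * I ≠ 0 := fun y h => hb (by simpa using congrArg Complex.re h)
  have hd : ∀ y : ℝ, HasDerivAt (fun y : ℝ => ((Real.arctan (y / b) : ℝ) : ℂ) -
      I * ((Real.log (b ^ 2 + y ^ 2) / 2 : ℝ) : ℂ)) (((b : ℂ) + y * I)⁻¹) y := by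
    intro y
    have hp : 0 < b ^ 2 + y ^ 2 := by positivity
    have h1 : HasDerivAt (fun y : ℝ => Real.arctan (y / b)) (b / (b ^ 2 + y ^ 2)) y := by
      have := ((hasDerivAt_id y).div_const b).arctan
      refine this.congr_deriv ?_
      change 1 / (1 + (y / b) ^ 2) * (1 / b) = _
      field_simp
    have h2 : HasDerivAt (fun y : ℝ => Real.log (b ^ 2 + y ^ 2) / 2) (y / (b ^ 2 + y ^ 2)) y := by
      have := ((((hasDerivAt_pow 2 y).const_add (b ^ 2)).log hp.ne').div_const 2)
      refine this.congr_deriv ?_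
      norm_num
      ring
    have h3 := h1.ofReal_comp.sub (h2.ofReal_comp.const_mul I)
    refine h3.congr_deriv ?_
    have hpc : (b : ℂ) ^ 2 + (y : ℂ) ^ 2 ≠ 0 := by exact_mod_cast hp.ne'
    push_cast
    rw [← one_div, eq_div_iff (hne y)]
    field_simp
    linear_combination (-y ^ 2 : ℂ) * I_sq
  rw [intervalIntegral.integral_eq_sub_of_hasDerivAt (fun y _ => hd y)]
  · rw [neg_div, Real.arctan_neg, neg_sq]; push_cast; ring
  · exact Continuous.intervalIntegrable (Continuous.inv₀ (by fun_prop) hne) _ _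

open Complex MeasureTheory Filter Topology Set in
theorem integral_div_sub_integral_div_eq {F : ℂ → ℂ} {a b C : ℝ} (ha : 0 < a) (hb : 0 < b)
    (hF : DifferentiableOn ℂ F {s | -a ≤ s.re ∧ s.re ≤ b})
    (hC : ∀ s : ℂ, -a ≤ s.re → s.re ≤ b → ‖F s‖ ≤ C / (1 + s.im ^ 2)) :
    (∀ σ : ℝ, -a ≤ σ → σ ≤ b → σ ≠ 0 → Integrable (fun y : ℝ => F (σ + y * I) / (σ + y * I))) ∧
    (∫ y : ℝ, F (b + y * I) / (b + y * I)) - (∫ y : ℝ, F ((-a : ℝ) + y * I) / ((-a : ℝ) + y * I)) =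
      2 * Real.pi * F 0 := by
  set S : Set ℂ := {s | -a ≤ s.re ∧ s.re ≤ b} with hS
  have hC0 : 0 ≤ C := by
    have := (norm_nonneg _).trans (hC 0 (by simp; linarith) (by simpa using hb.le))
    simpa using this
  have hline : ∀ σ : ℝ, -a ≤ σ → σ ≤ b → Continuous fun y : ℝ => F (σ + y * I) := by
    intro σ h1 h2
    refine hF.continuousOn.comp_continuous (by fun_prop) fun y => ?_
    simp [hS, h1, h2]
  have hne : ∀ σ : ℝ, σ ≠ 0 → ∀ y : ℝ, (σ : ℂ) + y * I ≠ 0 :=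
    fun σ hσ y h => hσ (by simpa using congrArg Complex.re h)
  have hinteg : ∀ σ : ℝ, -a ≤ σ → σ ≤ b → σ ≠ 0 →
      Integrable (fun y : ℝ => F (σ + y * I) / (σ + y * I)) := by
    intro σ h1 h2 h3
    refine Integrable.mono' ((integrable_inv_one_add_sq).const_mul (C / |σ|)) ?_ ?_
    · exact ((hline σ h1 h2).div (by fun_prop) (hne σ h3)).aestronglyMeasurable
    · refine Eventually.of_forall fun y => ?_
      have h4 := hC (σ + y * I) (by simpa using h1) (by simpa using h2)
      have h5 : |σ| ≤ ‖(σ : ℂ) + y * I‖ := by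
        simpa using Complex.abs_re_le_norm ((σ : ℂ) + y * I)
      simp only [add_im, ofReal_im, mul_im, ofReal_re, I_im, mul_one, I_re, mul_zero, add_zero, zero_add] at h4
      rw [norm_div]
      calc _ ≤ (C / (1 + y ^ 2)) / |σ| := by
            have := abs_pos.mpr h3
            gcongr
        _ = _ := by rw [div_div, mul_comm, ← div_div, div_eq_mul_inv (C / |σ|)]
  refine ⟨hinteg, ?_⟩
  have hS0 : S ∈ 𝓝 (0 : ℂ) := by
    have h1 : {s : ℂ | -a < s.re} ∈ 𝓝 (0 : ℂ) :=
      (isOpen_lt continuous_const Complex.continuous_re).mem_nhds (by simpa using ha)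
    have h2 : {s : ℂ | s.re < b} ∈ 𝓝 (0 : ℂ) :=
      (isOpen_lt Complex.continuous_re continuous_const).mem_nhds (by simpa using hb)
    filter_upwards [h1, h2] with s h3 h4 using ⟨le_of_lt h3, le_of_lt h4⟩
  have hH : DifferentiableOn ℂ (dslope F 0) S := (Complex.differentiableOn_dslope hS0).mpr hF
  have hHeq : ∀ s : ℂ, s ≠ 0 → dslope F 0 s = F s / s - F 0 * s⁻¹ := by
    intro s hs
    rw [dslope_of_ne _ hs, slope_def_field, sub_zero]; ring
  have hrect : ∀ T : ℝ, (∫ y in (-T)..T, F (b + y * I) / (b + y * I)) -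
      (∫ y in (-T)..T, F ((-a : ℝ) + y * I) / ((-a : ℝ) + y * I)) =
      F 0 * (2 * Real.arctan (T / b) : ℝ) - F 0 * (2 * Real.arctan (T / (-a)) : ℝ) -
      I * ((∫ x in (-a)..b, dslope F 0 (x + T * I)) - ∫ x in (-a)..b, dslope F 0 (x + (-T : ℝ) * I)) := by
    intro T
    have h1 := Complex.integral_boundary_rect_eq_zero_of_differentiableOn (dslope F 0)
      ((-a : ℝ) + (-T : ℝ) * I) (b + T * I) (hH.mono (by
        intro s hs
        rw [mem_reProdIm] at hs
        have := hs.1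
        simp only [add_re, ofReal_re, mul_re, I_re, mul_zero, ofReal_im, I_im, mul_one, sub_self, add_zero] at this
        rw [uIcc_of_le (by linarith)] at this
        exact this))
    simp only [add_re, ofReal_re, mul_re, I_re, mul_zero, ofReal_im, I_im, mul_one, sub_self, add_zero,
      add_im, mul_im, zero_add, smul_eq_mul] at h1
    have h2 : ∀ σ : ℝ, -a ≤ σ → σ ≤ b → σ ≠ 0 → ∫ y in (-T)..T, dslope F 0 (σ + y * I) =
        (∫ y in (-T)..T, F (σ + y * I) / (σ + y * I)) - F 0 * (2 * Real.arctan (T / σ) : ℝ) := by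
      intro σ h1 h2 h3
      rw [← integral_inv_add_mul_I h3, ← intervalIntegral.integral_const_mul,
        ← intervalIntegral.integral_sub (hinteg σ h1 h2 h3).intervalIntegrable]
      · exact intervalIntegral.integral_congr fun y _ => hHeq _ (hne σ h3 y)
      · exact Continuous.intervalIntegrable (continuous_const.mul (Continuous.inv₀ (by fun_prop) (hne σ h3))) _ _
    rw [h2 b (by linarith) le_rfl hb.ne', h2 (-a) le_rfl (by linarith) (by linarith)] at h1
    linear_combination (-I) * h1 + ((∫ y in (-T)..T, F (b + y * I) / (b + y * I)) -
      (∫ y in (-T)..T, F ((-a : ℝ) + y * I) / ((-a : ℝ) + y * I)) -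
      F 0 * (2 * Real.arctan (T / b) : ℝ) + F 0 * (2 * Real.arctan (T / (-a)) : ℝ)) * (I_sq)
  have hlim : ∀ σ : ℝ, -a ≤ σ → σ ≤ b → σ ≠ 0 →
      Tendsto (fun T : ℝ => ∫ y in (-T)..T, F (σ + y * I) / (σ + y * I)) atTop
        (𝓝 (∫ y : ℝ, F (σ + y * I) / (σ + y * I))) := fun σ h1 h2 h3 =>
    intervalIntegral_tendsto_integral (hinteg σ h1 h2 h3) tendsto_neg_atTop_atBot tendsto_id
  have hD : ∀ T : ℝ, 1 ≤ |T| → ‖∫ x in (-a)..b, dslope F 0 (x + T * I)‖ ≤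
      ((C + ‖F 0‖) / |T|) * |b - -a| := by
    intro T hT
    refine intervalIntegral.norm_integral_le_of_norm_le_const fun x hx => ?_
    rw [uIoc_of_le (by linarith)] at hx
    have hT0 : 0 < |T| := by linarith
    have him : |T| ≤ ‖(x : ℂ) + T * I‖ := by
      simpa using Complex.abs_im_le_norm ((x : ℂ) + T * I)
    have hnz : (x : ℂ) + T * I ≠ 0 := norm_pos_iff.mp (by linarith)
    rw [dslope_of_ne _ hnz, slope_def_field, sub_zero, norm_div]
    have h4 := hC (x + T * I) (by simpa using hx.1.le) (by simpa using hx.2)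
    have h5 : C / (1 + ((x : ℂ) + T * I).im ^ 2) ≤ C := div_le_self hC0 (by nlinarith [sq_nonneg ((x : ℂ) + T * I).im])
    have := norm_sub_le (F (x + T * I)) (F 0)
    gcongr
    linarith
  have hsm : ∀ ε : ℝ, ε = 1 ∨ ε = -1 →
      Tendsto (fun T : ℝ => ∫ x in (-a)..b, dslope F 0 (x + (ε * T : ℝ) * I)) atTop (𝓝 0) := by
    intro ε hε
    have hεa : |ε| = 1 := by rcases hε with rfl | rfl <;> simp
    refine squeeze_zero_norm' (a := fun T : ℝ => ((C + ‖F 0‖) * T⁻¹) * |b - -a|) ?_ ?_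
    · filter_upwards [eventually_ge_atTop 1] with T hT
      have h6 : |ε * T| = T := by rw [abs_mul, hεa, one_mul, abs_of_nonneg (by linarith)]
      have := hD (ε * T) (by rw [h6]; exact hT)
      rwa [h6, div_eq_mul_inv] at this
    · have := (tendsto_inv_atTop_zero.const_mul (C + ‖F 0‖)).mul_const (|b - -a|)
      simpa using this
  have h1 := (hlim b (by linarith) le_rfl hb.ne').sub (hlim (-a) le_rfl (by linarith) (by linarith))
  have harc1 : Tendsto (fun T : ℝ => (2 * Real.arctan (T / b) : ℝ)) atTop (𝓝 (2 * (Real.pi / 2))) :=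
    ((Real.tendsto_arctan_atTop.mono_right nhdsWithin_le_nhds).comp
      (tendsto_id.atTop_div_const hb)).const_mul 2
  have harc2 : Tendsto (fun T : ℝ => (2 * Real.arctan (T / (-a)) : ℝ)) atTop (𝓝 (2 * (-(Real.pi / 2)))) := by
    have := (((Real.tendsto_arctan_atTop.mono_right nhdsWithin_le_nhds).comp
      (tendsto_id.atTop_div_const ha)).neg).const_mul 2
    refine this.congr fun T => ?_
    simp [div_neg, Real.arctan_neg]
  have h2 := ((((continuous_ofReal.tendsto _).comp harc1).const_mul (F 0)).sub
    (((continuous_ofReal.tendsto _).comp harc2).const_mul (F 0))).sub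
    (((hsm 1 (Or.inl rfl)).sub (hsm (-1) (Or.inr rfl))).const_mul I)
  have h3 := tendsto_nhds_unique (h1.congr fun T => hrect T) (h2.congr fun T => by
    simp only [Function.comp_apply, one_mul, neg_one_mul])
  rw [h3]
  push_cast
  ring

/-- Pairs of positive integers with product at most `X`. -/
noncomputable def pairsLE (X : ℝ) : Finset (ℕ × ℕ) :=
  (Finset.Icc 1 ⌊X⌋₊ ×ˢ Finset.Icc 1 ⌊X⌋₊).filter fun i => ((i.1 * i.2 : ℕ) : ℝ) ≤ X

theorem mem_pairsLE {X : ℝ} {i : ℕ × ℕ} :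
    i ∈ pairsLE X ↔ 0 < i.1 ∧ 0 < i.2 ∧ ((i.1 * i.2 : ℕ) : ℝ) ≤ X := by
  simp only [pairsLE, Finset.mem_filter, Finset.mem_product, Finset.mem_Icc]
  constructor
  · rintro ⟨⟨⟨h1, _⟩, ⟨h2, _⟩⟩, h3⟩
    exact ⟨h1, h2, h3⟩
  · rintro ⟨h1, h2, h3⟩
    have h4 : i.1 ≤ i.1 * i.2 := Nat.le_mul_of_pos_right _ h2
    have h5 : i.2 ≤ i.1 * i.2 := Nat.le_mul_of_pos_left _ h1
    exact ⟨⟨⟨h1, h4.trans (Nat.le_floor h3)⟩, h2, h5.trans (Nat.le_floor h3)⟩, h3⟩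

/-- The Dirichlet polynomial `∑ χ(a) χ̄(b) (a/b)^{-it} (ab)^{-1/2-s}` over a finite set of pairs. -/
noncomputable def pairSum {k : ℕ} (S : Finset (ℕ × ℕ)) (χ : DirichletCharacter ℂ k) (t : ℝ) (s : ℂ) : ℂ :=
  pairPoly S (fun i => ((i.1 * i.2 : ℕ) : ℂ) ^ (-(1 / 2 + s))) χ t

section

variable {k : ℕ} {S : Finset (ℕ × ℕ)}

theorem norm_pairSum_le [NeZero k] (hS : ∀ i ∈ S, 0 < i.1 ∧ 0 < i.2) (χ : DirichletCharacter ℂ k) (t : ℝ) {s : ℂ}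
    (hs : -(1 / 2) ≤ s.re) : ‖pairSum S χ t s‖ ≤ S.card := by
  rw [pairSum, pairPoly]
  refine (norm_sum_le _ _).trans ?_
  rw [Finset.card_eq_sum_ones, Nat.cast_sum]
  refine Finset.sum_le_sum fun i hi => ?_
  obtain ⟨h1, h2⟩ := hS i hi
  have hp : 0 < i.1 * i.2 := Nat.mul_pos h1 h2
  have e1 : ‖((i.1 * i.2 : ℕ) : ℂ) ^ (-(1 / 2 + s))‖ ≤ 1 := by
    rw [Complex.norm_natCast_cpow_of_pos hp]
    apply Real.rpow_le_one_of_one_le_of_nonpos (by exact_mod_cast hp)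
    simp only [Complex.neg_re, Complex.add_re]
    norm_num
    linarith
  have e2 : ‖Complex.exp (-(t * (Real.log i.1 - Real.log i.2 : ℝ)) * Complex.I)‖ = 1 := by
    rw [← Complex.ofReal_mul, ← Complex.ofReal_neg, Complex.norm_exp_ofReal_mul_I]
  rw [norm_mul, norm_mul, norm_mul, e2, RCLike.norm_conj, mul_one]
  simp only [Nat.cast_one]
  exact mul_le_one₀ e1 (by positivity) (mul_le_one₀ (χ.norm_le_one _) (norm_nonneg _) (χ.norm_le_one _))

theorem differentiable_pairSum (hS : ∀ i ∈ S, 0 < i.1 ∧ 0 < i.2) (χ : DirichletCharacter ℂ k) (t : ℝ) :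
    Differentiable ℂ (pairSum S χ t) := by
  unfold pairSum pairPoly
  refine Differentiable.fun_sum fun i hi => ?_
  obtain ⟨h1, h2⟩ := hS i hi
  refine Differentiable.mul_const (Differentiable.mul_const ?_ _) _
  refine Differentiable.const_cpow (by fun_prop) (Or.inl ?_)
  exact_mod_cast (Nat.mul_pos h1 h2).ne'

theorem pairSum_sdiff {S' : Finset (ℕ × ℕ)} (h : S ⊆ S') (χ : DirichletCharacter ℂ k) (t : ℝ) (s : ℂ) :
    pairSum S' χ t s = pairSum (S' \ S) χ t s + pairSum S χ t s := by
  rw [pairSum, pairSum, pairSum, pairPoly, pairPoly, pairPoly, Finset.sum_sdiff h]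

end

theorem pairsLE_pos {X : ℝ} : ∀ i ∈ pairsLE X, 0 < i.1 ∧ 0 < i.2 := fun _ hi =>
  ⟨(mem_pairsLE.mp hi).1, (mem_pairsLE.mp hi).2.1⟩

theorem pairsLE_mono {X Y : ℝ} (h : X ≤ Y) : pairsLE X ⊆ pairsLE Y := fun i hi => by
  rw [mem_pairsLE] at hi ⊢
  exact ⟨hi.1, hi.2.1, hi.2.2.trans h⟩

open Complex in
theorem exists_norm_LFunction_mul_sub_pairSum_le {ε : ℝ} (hε : 0 < ε) : ∃ X₀ : ℝ, ∀ X : ℝ, X₀ ≤ X →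
    ∀ (q : ℕ) [NeZero q] (χ : DirichletCharacter ℂ q) (t y : ℝ),
    ‖χ.LFunction (1 / 2 + t * I + (1 + y * I)) * χ⁻¹.LFunction (1 / 2 - t * I + (1 + y * I)) -
      pairSum (pairsLE X) χ t (1 + y * I)‖ ≤ ε := by
  have hg0 : Summable fun n : ℕ => (n : ℝ) ^ (-(3 / 2) : ℝ) := by
    rw [Real.summable_nat_rpow]; norm_num
  have hg : Summable fun i : ℕ × ℕ => (i.1 : ℝ) ^ (-(3 / 2) : ℝ) * (i.2 : ℝ) ^ (-(3 / 2) : ℝ) :=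
    hg0.mul_of_nonneg hg0 (fun _ => by positivity) (fun _ => by positivity)
  set g : ℕ × ℕ → ℝ := fun i => (i.1 : ℝ) ^ (-(3 / 2) : ℝ) * (i.2 : ℝ) ^ (-(3 / 2) : ℝ) with hgdef
  have hgn : ∀ i, 0 ≤ g i := fun i => by simp only [hgdef]; positivity
  obtain ⟨S₀, hS₀⟩ := (Metric.tendsto_atTop.mp hg.hasSum) ε hε
  refine ⟨∑ i ∈ S₀, ((i.1 * i.2 : ℕ) : ℝ), fun X hX q _ χ t y => ?_⟩
  have hsub : ∑ i ∈ S₀, g i ≤ ∑ i ∈ pairsLE X, g i := by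
    rw [← Finset.sum_filter_ne_zero]
    refine Finset.sum_le_sum_of_subset_of_nonneg ?_ fun i _ _ => hgn i
    intro i hi
    rw [Finset.mem_filter] at hi
    have h1 : i.1 ≠ 0 := by
      intro h; apply hi.2; simp only [hgdef, h, Nat.cast_zero]; rw [Real.zero_rpow (by norm_num), zero_mul]
    have h2 : i.2 ≠ 0 := by
      intro h; apply hi.2; simp only [hgdef, h, Nat.cast_zero]; rw [Real.zero_rpow (by norm_num), mul_zero]
    refine mem_pairsLE.mpr ⟨Nat.pos_of_ne_zero h1, Nat.pos_of_ne_zero h2, le_trans ?_ hX⟩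
    exact Finset.single_le_sum (f := fun i : ℕ × ℕ => ((i.1 * i.2 : ℕ) : ℝ)) (fun _ _ => by positivity) hi.1
  set s₁ : ℂ := 1 / 2 + t * I + (1 + y * I) with hs₁
  set s₂ : ℂ := 1 / 2 - t * I + (1 + y * I) with hs₂
  have hr1 : s₁.re = 3 / 2 := by simp [hs₁]; norm_num
  have hr2 : s₂.re = 3 / 2 := by simp [hs₂]; norm_num
  have hterm : ∀ (ψ : DirichletCharacter ℂ q) (s : ℂ), s.re = 3 / 2 → ∀ n : ℕ,
      ‖LSeries.term (fun n => ψ n) s n‖ ≤ (n : ℝ) ^ (-(3 / 2) : ℝ) := by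
    intro ψ s hs n
    rcases Nat.eq_zero_or_pos n with rfl | hn
    · simp
    · rw [LSeries.term_of_ne_zero hn.ne', norm_div, Complex.norm_natCast_cpow_of_pos hn, hs,
        Real.rpow_neg (by positivity), ← one_div]
      have := ψ.norm_le_one n
      gcongr
  set f : ℕ × ℕ → ℂ := fun i => LSeries.term (fun n => χ n) s₁ i.1 * LSeries.term (fun n => χ⁻¹ n) s₂ i.2 with hf
  have hfg : ∀ i, ‖f i‖ ≤ g i := fun i => by
    simp only [hf, hgdef, norm_mul]
    exact mul_le_mul (hterm _ _ hr1 _) (hterm _ _ hr2 _) (norm_nonneg _) (by positivity)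
  have hfs : Summable f := Summable.of_norm_bounded hg hfg
  have hL : χ.LFunction s₁ * χ⁻¹.LFunction s₂ = ∑' i, f i := by
    rw [DirichletCharacter.LFunction_eq_LSeries _ (by rw [hr1]; norm_num),
      DirichletCharacter.LFunction_eq_LSeries _ (by rw [hr2]; norm_num), LSeries, LSeries]
    refine tsum_mul_tsum_of_summable_norm ?_ ?_
    · exact Summable.of_nonneg_of_le (fun _ => norm_nonneg _) (hterm _ _ hr1) hg0
    · exact Summable.of_nonneg_of_le (fun _ => norm_nonneg _) (hterm _ _ hr2) hg0
  have hP : pairSum (pairsLE X) χ t (1 + y * I) = ∑ i ∈ pairsLE X, f i := by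
    rw [pairSum, pairPoly]
    refine Finset.sum_congr rfl fun i hi => ?_
    obtain ⟨h1, h2⟩ := pairsLE_pos i hi
    simp only [hf]
    have n1 : (i.1 : ℂ) ≠ 0 := by exact_mod_cast h1.ne'
    have n2 : (i.2 : ℂ) ≠ 0 := by exact_mod_cast h2.ne'
    rw [LSeries.term_of_ne_zero h1.ne', LSeries.term_of_ne_zero h2.ne', DirichletCharacter.inv_apply_eq_conj,
      div_mul_div_comm, div_eq_mul_inv _ ((i.1 : ℂ) ^ s₁ * (i.2 : ℂ) ^ s₂)]
    have e : (((i.1 * i.2 : ℕ) : ℂ) ^ (-(1 / 2 + (1 + y * I)))) *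
        cexp (-(t * (Real.log i.1 - Real.log i.2 : ℝ)) * I) = ((i.1 : ℂ) ^ s₁ * (i.2 : ℂ) ^ s₂)⁻¹ := by
      rw [Nat.cast_mul, Complex.natCast_mul_natCast_cpow, Complex.cpow_def_of_ne_zero n1, Complex.cpow_def_of_ne_zero n2,
        Complex.cpow_def_of_ne_zero n1, Complex.cpow_def_of_ne_zero n2, ← Complex.exp_add, ← Complex.exp_add,
        ← Complex.exp_add, ← Complex.exp_neg, ← Complex.natCast_log, ← Complex.natCast_log, hs₁, hs₂]
      congr 1
      push_cast
      ring
    rw [← e]; ring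
  rw [hL, hP, ← hfs.sum_add_tsum_compl (s := pairsLE X), add_sub_cancel_left]
  have hgc := hg.sum_add_tsum_compl (s := pairsLE X)
  have h1 : ‖∑' x : ((pairsLE X : Set (ℕ × ℕ))ᶜ : Set (ℕ × ℕ)), f x‖ ≤
      ∑' x : ((pairsLE X : Set (ℕ × ℕ))ᶜ : Set (ℕ × ℕ)), g x :=
    tsum_of_norm_bounded (hg.subtype _).hasSum fun x => hfg x
  have h2 := hS₀ S₀ le_rfl
  rw [Real.dist_eq, abs_lt] at h2
  change ∑ x ∈ pairsLE X, g x + _ = ∑' x, g x at hgc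
  linarith [h2.1]

open Complex MeasureTheory Set in
theorem exists_norm_Gamma_le {a b : ℝ} (ha : 0 < a) (hb : 0 < b) :
    ∃ C : ℝ, ∀ s : ℂ, a ≤ s.re → s.re ≤ b → ‖Gamma s‖ ≤ C := by
  have hconv : ∀ c : ℝ, 0 < c → MellinConvergent (fun x => ((Real.exp (-x) : ℝ) : ℂ)) (c : ℂ) := by
    intro c hc
    have h := Complex.GammaIntegral_convergent (s := (c : ℂ)) (by simpa using hc)
    refine h.congr_fun (fun x _ => ?_) measurableSet_Ioi
    simp only [smul_eq_mul]; ring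
  obtain ⟨C, hC⟩ := exists_norm_mellin_le (hconv a ha) (hconv b hb)
  refine ⟨C, fun s h1 h2 => ?_⟩
  rw [Complex.Gamma_eq_integral (ha.trans_le h1), Complex.GammaIntegral_eq_mellin]
  exact hC s h1 h2

open Complex in
theorem exists_norm_Gammaℝ_le {a b : ℝ} (ha : 0 < a) (hb : 0 < b) :
    ∃ C : ℝ, ∀ s : ℂ, a ≤ s.re → s.re ≤ b → ‖Gammaℝ s‖ ≤ C := by
  obtain ⟨C, hC⟩ := exists_norm_Gamma_le (half_pos ha) (half_pos hb)
  refine ⟨C, fun s h1 h2 => ?_⟩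
  have h3 : ‖Gamma (s / 2)‖ ≤ C := hC _ (by simp; linarith) (by simp; linarith)
  rw [Gammaℝ_def, norm_mul, Complex.norm_cpow_eq_rpow_re_of_pos Real.pi_pos]
  have h4 : Real.pi ^ (-s / 2).re ≤ 1 := by
    apply Real.rpow_le_one_of_one_le_of_nonpos (by linarith [Real.pi_gt_three])
    simp; linarith
  calc _ ≤ 1 * ‖Gamma (s / 2)‖ := by gcongr
    _ ≤ C := by rwa [one_mul]

namespace DirichletCharacter

open Complex ComplexConjugate

variable {q : ℕ}

theorem exists_norm_gammaFactor_le (χ : DirichletCharacter ℂ q) {a b : ℝ} (ha : 0 < a) (hb : 0 < b) :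
    ∃ C : ℝ, ∀ s : ℂ, a ≤ s.re → s.re ≤ b → ‖χ.gammaFactor s‖ ≤ C := by
  rcases χ.even_or_odd with h | h
  · simp only [h.gammaFactor_def]
    exact exists_norm_Gammaℝ_le ha hb
  · simp only [h.gammaFactor_def]
    obtain ⟨C, hC⟩ := exists_norm_Gammaℝ_le (a := a + 1) (b := b + 1) (by linarith) (by linarith)
    exact ⟨C, fun s h1 h2 => hC _ (by simpa using h1) (by simpa using h2)⟩

theorem gammaFactor_conj (χ : DirichletCharacter ℂ q) (s : ℂ) :
    χ.gammaFactor (conj s) = conj (χ.gammaFactor s) := by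
  have key : ∀ s : ℂ, Gammaℝ (conj s) = conj (Gammaℝ s) := by
    intro s
    have h := Complex.cpow_conj (Real.pi : ℂ) (-s / 2)
      (by rw [Complex.arg_ofReal_of_nonneg Real.pi_pos.le]; exact Real.pi_pos.ne)
    rw [conj_ofReal] at h
    rw [Gammaℝ_def, Gammaℝ_def, map_mul, ← Gamma_conj, ← h]
    simp [Complex.conj_ofNat]
  rcases χ.even_or_odd with h | h
  · rw [h.gammaFactor_def, h.gammaFactor_def, key]
  · rw [h.gammaFactor_def, h.gammaFactor_def, ← key, map_add, map_one]

theorem gammaFactor_ne_zero (χ : DirichletCharacter ℂ q) {s : ℂ} (hs : 0 < s.re) : χ.gammaFactor s ≠ 0 := by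
  rcases χ.even_or_odd with h | h
  · rw [h.gammaFactor_def]; exact Gammaℝ_ne_zero_of_re_pos hs
  · rw [h.gammaFactor_def]; exact Gammaℝ_ne_zero_of_re_pos (by simp; linarith)

theorem differentiableAt_gammaFactor (χ : DirichletCharacter ℂ q) {s : ℂ} (hs : 0 < s.re) :
    DifferentiableAt ℂ χ.gammaFactor s := by
  have key : ∀ s : ℂ, 0 < s.re → DifferentiableAt ℂ Gammaℝ s := by
    intro s hs
    have h := (differentiable_Gammaℝ_inv s).inv (inv_ne_zero (Gammaℝ_ne_zero_of_re_pos hs))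
    refine h.congr_of_eventuallyEq (Filter.Eventually.of_forall fun z => ?_)
    simp
  rcases χ.even_or_odd with h | h
  · have e : χ.gammaFactor = Gammaℝ := funext fun s => h.gammaFactor_def s
    rw [e]; exact key s hs
  · have e : χ.gammaFactor = fun s => Gammaℝ (s + 1) := funext fun s => h.gammaFactor_def s
    rw [e]
    exact DifferentiableAt.comp (g := Gammaℝ) s (key (s + 1) (by simp; linarith)) (by fun_prop)

end DirichletCharacter

/-- The decaying weight in the approximate functional equation. -/
noncomputable def gaussWeight (y : ℝ) : ℝ := (1 + |y|) ^ 2 * Real.exp (-y ^ 2)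

theorem gaussWeight_nonneg (y : ℝ) : 0 ≤ gaussWeight y := by unfold gaussWeight; positivity

theorem continuous_gaussWeight : Continuous gaussWeight := by unfold gaussWeight; fun_prop

theorem integrable_gaussWeight : MeasureTheory.Integrable gaussWeight := by
  have h := (integrable_exp_neg_mul_sq (b := 1 / 2) (by norm_num)).const_mul 4
  refine h.mono' continuous_gaussWeight.aestronglyMeasurable (Filter.Eventually.of_forall fun y => ?_)
  rw [Real.norm_of_nonneg (gaussWeight_nonneg y), gaussWeight]
  have h1 := Real.add_one_le_exp (1 / 2 * y ^ 2)
  have h2 : (1 + |y|) ^ 2 ≤ 4 * Real.exp (1 / 2 * y ^ 2) := by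
    nlinarith [sq_nonneg (1 - |y|), sq_abs y]
  have h3 : Real.exp (-y ^ 2) = Real.exp (-(1 / 2) * y ^ 2) * Real.exp (-(1 / 2) * y ^ 2) := by
    rw [← Real.exp_add]; ring_nf
  have h4 : Real.exp (1 / 2 * y ^ 2) * Real.exp (-(1 / 2) * y ^ 2) = 1 := by
    rw [← Real.exp_add]; simp
  have h5 := Real.exp_pos (-(1 / 2) * y ^ 2)
  calc _ ≤ 4 * Real.exp (1 / 2 * y ^ 2) * (Real.exp (-(1 / 2) * y ^ 2) * Real.exp (-(1 / 2) * y ^ 2)) := by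
        rw [h3]; gcongr
    _ = 4 * (Real.exp (1 / 2 * y ^ 2) * Real.exp (-(1 / 2) * y ^ 2)) * Real.exp (-(1 / 2) * y ^ 2) := by ring
    _ = _ := by rw [h4, mul_one]

theorem integrable_gaussWeight_mul {f : ℝ → ℝ} (hf : Continuous f) {C : ℝ} (hC : ∀ y, |f y| ≤ C) :
    MeasureTheory.Integrable fun y => gaussWeight y * f y := by
  refine (integrable_gaussWeight.mul_const C).mono' (continuous_gaussWeight.mul hf).aestronglyMeasurable
    (Filter.Eventually.of_forall fun y => ?_)
  rw [norm_mul, Real.norm_of_nonneg (gaussWeight_nonneg y), Real.norm_eq_abs]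
  exact mul_le_mul_of_nonneg_left (hC y) (gaussWeight_nonneg y)

theorem norm_exp_sq_le {s : ℂ} (h1 : -1 ≤ s.re) (h2 : s.re ≤ 1) :
    ‖Complex.exp (s ^ 2)‖ ≤ 3 * Real.exp (-s.im ^ 2) := by
  rw [Complex.norm_exp]
  have e : (s ^ 2).re = s.re ^ 2 + -s.im ^ 2 := by rw [sq, Complex.mul_re]; ring
  rw [e, Real.exp_add]
  have : Real.exp (s.re ^ 2) ≤ 3 := by
    calc Real.exp (s.re ^ 2) ≤ Real.exp 1 := Real.exp_le_exp.mpr (by nlinarith)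
      _ ≤ 3 := Real.exp_one_lt_three.le
  gcongr

theorem exp_neg_sq_le (y : ℝ) : Real.exp (-y ^ 2) ≤ 1 / (1 + y ^ 2) := by
  rw [Real.exp_neg, ← one_div]
  have := Real.add_one_le_exp (y ^ 2)
  exact one_div_le_one_div_of_le (by positivity) (by linarith)

theorem norm_natCast_cpow_le {q : ℕ} (hq : 1 ≤ q) {s : ℂ} (h : s.re ≤ 1) : ‖(q : ℂ) ^ s‖ ≤ q := by
  rw [Complex.norm_natCast_cpow_of_pos hq]
  calc (q : ℝ) ^ s.re ≤ (q : ℝ) ^ (1 : ℝ) := Real.rpow_le_rpow_of_exponent_le (by exact_mod_cast hq) h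
    _ = q := Real.rpow_one _

namespace DirichletCharacter

open Complex ComplexConjugate MeasureTheory

variable {q : ℕ} [NeZero q]

theorem integral_completedLFunction_mul {χ : DirichletCharacter ℂ q} (h : χ.IsPrimitive) (hq : 2 ≤ q) (t : ℝ) :
    Integrable (fun y : ℝ => (q : ℂ) ^ ((1 : ℝ) + y * I) * χ.completedLFunction (1 / 2 + t * I + ((1 : ℝ) + y * I)) *
      χ⁻¹.completedLFunction (1 / 2 - t * I + ((1 : ℝ) + y * I)) * cexp (((1 : ℝ) + y * I) ^ 2) / ((1 : ℝ) + y * I)) ∧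
    ∫ y : ℝ, (q : ℂ) ^ ((1 : ℝ) + y * I) * χ.completedLFunction (1 / 2 + t * I + ((1 : ℝ) + y * I)) *
      χ⁻¹.completedLFunction (1 / 2 - t * I + ((1 : ℝ) + y * I)) * cexp (((1 : ℝ) + y * I) ^ 2) / ((1 : ℝ) + y * I) =
    Real.pi * (χ.completedLFunction (1 / 2 + t * I) * χ⁻¹.completedLFunction (1 / 2 - t * I)) := by
  have hχ := h.ne_one hq
  have hχ' := h.inv.ne_one hq
  have hq0 : (q : ℂ) ≠ 0 := NeZero.ne _
  set F : ℂ → ℂ := fun s => (q : ℂ) ^ s * χ.completedLFunction (1 / 2 + t * I + s) *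
      χ⁻¹.completedLFunction (1 / 2 - t * I + s) * cexp (s ^ 2) with hF
  obtain ⟨C₁, hC₁⟩ := exists_norm_completedLFunction_le hχ (-1) 2
  obtain ⟨C₂, hC₂⟩ := exists_norm_completedLFunction_le hχ' (-1) 2
  have hd : Differentiable ℂ F := by
    have d1 := differentiable_completedLFunction hχ
    have d2 := differentiable_completedLFunction hχ'
    have d3 : Differentiable ℂ fun s : ℂ => (q : ℂ) ^ s := by
      refine Differentiable.const_cpow differentiable_id (Or.inl hq0)
    simp only [hF]
    exact ((d3.mul (d1.comp (by fun_prop))).mul (d2.comp (by fun_prop))).mul (by fun_prop)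
  have hbound : ∀ s : ℂ, -1 ≤ s.re → s.re ≤ 1 → ‖F s‖ ≤ (q * C₁ * C₂ * 3) / (1 + s.im ^ 2) := by
    intro s h1 h2
    have b1 := hC₁ (1 / 2 + t * I + s) (by simp; linarith) (by simp; linarith)
    have b2 := hC₂ (1 / 2 - t * I + s) (by simp; linarith) (by simp; linarith)
    have b3 := norm_natCast_cpow_le (show 1 ≤ q by omega) h2
    have b4 := (norm_exp_sq_le h1 h2).trans (mul_le_mul_of_nonneg_left (exp_neg_sq_le s.im) (by norm_num))
    have c1 : 0 ≤ C₁ := (norm_nonneg _).trans b1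
    have c2 : 0 ≤ C₂ := (norm_nonneg _).trans b2
    simp only [hF, norm_mul]
    calc _ ≤ q * C₁ * C₂ * (3 * (1 / (1 + s.im ^ 2))) := by gcongr
      _ = _ := by ring
  have hev : ∀ s, F (-s) = F s := by
    intro s
    simp only [hF]
    have e1 : (1 / 2 + t * I + -s : ℂ) = 1 - (1 / 2 - t * I + s) := by ring
    have e2 : (1 / 2 - t * I + -s : ℂ) = 1 - (1 / 2 + t * I + s) := by ring
    rw [e1, e2, h.completedLFunction_one_sub, h.inv.completedLFunction_one_sub, inv_inv, neg_sq]
    have e3 : (q : ℂ) ^ (-s) * (q : ℂ) ^ (1 / 2 - t * I + s - 1 / 2) * (q : ℂ) ^ (1 / 2 + t * I + s - 1 / 2) =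
        (q : ℂ) ^ s := by
      rw [← Complex.cpow_add _ _ hq0, ← Complex.cpow_add _ _ hq0]; congr 1; ring
    rw [← e3]
    have e4 := h.rootNumber_mul_inv hq
    linear_combination ((q : ℂ) ^ (-s) * (q : ℂ) ^ (1 / 2 - t * I + s - 1 / 2) * (q : ℂ) ^ (1 / 2 + t * I + s - 1 / 2)) *
      χ.completedLFunction (1 / 2 + t * I + s) * χ⁻¹.completedLFunction (1 / 2 - t * I + s) * cexp (s ^ 2) * e4
  obtain ⟨k1, k2⟩ := integral_div_sub_integral_div_eq one_pos one_pos hd.differentiableOn hbound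
  refine ⟨k1 1 (by norm_num) le_rfl one_ne_zero, ?_⟩
  have k3 : ∫ y : ℝ, F (((-1 : ℝ) : ℂ) + y * I) / (((-1 : ℝ) : ℂ) + y * I) = -∫ y : ℝ, F ((1 : ℝ) + y * I) / ((1 : ℝ) + y * I) := by
    rw [← integral_neg, ← integral_neg_eq_self (fun y : ℝ => F (((-1 : ℝ) : ℂ) + y * I) / (((-1 : ℝ) : ℂ) + y * I))]
    congr 1
    funext y
    have e : (((-1 : ℝ) : ℂ) + (-y : ℝ) * I) = -((1 : ℝ) + y * I) := by push_cast; ring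
    rw [e, hev, div_neg]
  rw [k3] at k2
  have k4 : F 0 = χ.completedLFunction (1 / 2 + t * I) * χ⁻¹.completedLFunction (1 / 2 - t * I) := by
    simp [hF]
  rw [← k4]
  linear_combination k2 / 2

theorem integral_gammaFactor_mul_pairSum (χ : DirichletCharacter ℂ q) (t : ℝ) {S : Finset (ℕ × ℕ)}
    (hS : ∀ i ∈ S, 0 < i.1 ∧ 0 < i.2) :
    (∀ σ : ℝ, -(1 / 4) ≤ σ → σ ≤ 1 → σ ≠ 0 → Integrable (fun y : ℝ => (q : ℂ) ^ (σ + y * I) *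
      χ.gammaFactor (1 / 2 + t * I + (σ + y * I)) * χ.gammaFactor (1 / 2 - t * I + (σ + y * I)) *
      pairSum S χ t (σ + y * I) * cexp ((σ + y * I) ^ 2) / (σ + y * I))) ∧
    (∫ y : ℝ, (q : ℂ) ^ ((1 : ℝ) + y * I) *
      χ.gammaFactor (1 / 2 + t * I + ((1 : ℝ) + y * I)) * χ.gammaFactor (1 / 2 - t * I + ((1 : ℝ) + y * I)) *
      pairSum S χ t ((1 : ℝ) + y * I) * cexp (((1 : ℝ) + y * I) ^ 2) / ((1 : ℝ) + y * I)) -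
    (∫ y : ℝ, (q : ℂ) ^ ((-(1 / 4) : ℝ) + y * I) *
      χ.gammaFactor (1 / 2 + t * I + ((-(1 / 4) : ℝ) + y * I)) * χ.gammaFactor (1 / 2 - t * I + ((-(1 / 4) : ℝ) + y * I)) *
      pairSum S χ t ((-(1 / 4) : ℝ) + y * I) * cexp (((-(1 / 4) : ℝ) + y * I) ^ 2) / ((-(1 / 4) : ℝ) + y * I)) =
    2 * Real.pi * (χ.gammaFactor (1 / 2 + t * I) * χ.gammaFactor (1 / 2 - t * I) * pairSum S χ t 0) := by
  have hq0 : (q : ℂ) ≠ 0 := NeZero.ne _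
  set F : ℂ → ℂ := fun s => (q : ℂ) ^ s * χ.gammaFactor (1 / 2 + t * I + s) * χ.gammaFactor (1 / 2 - t * I + s) *
      pairSum S χ t s * cexp (s ^ 2) with hF
  obtain ⟨C, hC⟩ := χ.exists_norm_gammaFactor_le (a := 1 / 4) (b := 2) (by norm_num) (by norm_num)
  have hd : DifferentiableOn ℂ F {s | -(1 / 4) ≤ s.re ∧ s.re ≤ 1} := by
    rintro s ⟨hs, -⟩
    apply DifferentiableAt.differentiableWithinAt
    simp only [hF]
    have d1 : DifferentiableAt ℂ (fun s : ℂ => χ.gammaFactor (1 / 2 + t * I + s)) s := by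
      refine DifferentiableAt.comp (g := χ.gammaFactor) s (χ.differentiableAt_gammaFactor ?_) (by fun_prop)
      simp; linarith
    have d2 : DifferentiableAt ℂ (fun s : ℂ => χ.gammaFactor (1 / 2 - t * I + s)) s := by
      refine DifferentiableAt.comp (g := χ.gammaFactor) s (χ.differentiableAt_gammaFactor ?_) (by fun_prop)
      simp; linarith
    have d3 : Differentiable ℂ fun s : ℂ => (q : ℂ) ^ s :=
      Differentiable.const_cpow differentiable_id (Or.inl hq0)
    exact (((d3.differentiableAt.mul d1).mul d2).mul (differentiable_pairSum hS χ t).differentiableAt).mul (by fun_prop)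
  have hbound : ∀ s : ℂ, -(1 / 4) ≤ s.re → s.re ≤ 1 → ‖F s‖ ≤ (q * C * C * S.card * 3) / (1 + s.im ^ 2) := by
    intro s h1 h2
    have b1 := hC (1 / 2 + t * I + s) (by simp; linarith) (by simp; linarith)
    have b2 := hC (1 / 2 - t * I + s) (by simp; linarith) (by simp; linarith)
    have b3 := norm_natCast_cpow_le (NeZero.one_le (n := q)) h2
    have b4 := (norm_exp_sq_le (by linarith) h2).trans (mul_le_mul_of_nonneg_left (exp_neg_sq_le s.im) (by norm_num))
    have b5 := norm_pairSum_le hS χ t (s := s) (by linarith)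
    have c1 : 0 ≤ C := (norm_nonneg _).trans b1
    simp only [hF, norm_mul]
    calc _ ≤ q * C * C * S.card * (3 * (1 / (1 + s.im ^ 2))) := by gcongr
      _ = _ := by ring
  obtain ⟨k1, k2⟩ := integral_div_sub_integral_div_eq (by norm_num) one_pos hd hbound
  refine ⟨k1, ?_⟩
  have k4 : F 0 = χ.gammaFactor (1 / 2 + t * I) * χ.gammaFactor (1 / 2 - t * I) * pairSum S χ t 0 := by
    simp [hF]
  rw [← k4]
  exact k2

end DirichletCharacter

namespace DirichletCharacter

open Complex ComplexConjugate MeasureTheory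

theorem norm_gammaFactor_kernel_le : ∃ C : ℝ, 0 < C ∧ ∀ (q : ℕ) [NeZero q] (χ : DirichletCharacter ℂ q)
    (σ : ℝ), (σ = -(1 / 4) ∨ σ = 1) → ∀ (t y : ℝ) (P : ℂ),
    ‖(q : ℂ) ^ (σ + y * I) * χ.gammaFactor (1 / 2 + t * I + (σ + y * I)) *
      χ.gammaFactor (1 / 2 - t * I + (σ + y * I)) * P * cexp ((σ + y * I) ^ 2) / (σ + y * I)‖ ≤
      C * ‖χ.gammaFactor (1 / 2 + t * I)‖ ^ 2 * (q * (1 + |t|)) ^ σ * (gaussWeight y * ‖P‖) := by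
  obtain ⟨C, hC, h⟩ := gammaFactor_ratio_bound
  refine ⟨12 * C, by positivity, fun q _ χ σ hσ t y P => ?_⟩
  have hq : 0 < q := Nat.pos_of_ne_zero (NeZero.ne q)
  have h1 := h q χ σ (by rcases hσ with h | h <;> [left; right] <;> linarith) t y
  have hre : (σ + y * I : ℂ).re = σ := by simp
  have him : (σ + y * I : ℂ).im = y := by simp
  have h2 : ‖cexp ((σ + y * I) ^ 2)‖ ≤ 3 * Real.exp (-y ^ 2) := by
    have := norm_exp_sq_le (s := (σ + y * I : ℂ)) (by rw [hre]; rcases hσ with h | h <;> linarith)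
      (by rw [hre]; rcases hσ with h | h <;> linarith)
    rwa [him] at this
  have h3 : 1 / 4 ≤ ‖(σ + y * I : ℂ)‖ := by
    refine le_trans ?_ (Complex.abs_re_le_norm _)
    rw [hre]
    rcases hσ with h | h <;> rw [h] <;> norm_num
  rw [norm_div, norm_mul, norm_mul, norm_mul, norm_mul, Complex.norm_natCast_cpow_of_pos hq, hre,
    Real.mul_rpow (by positivity) (by positivity), gaussWeight]
  rw [div_le_iff₀ (by linarith)]
  have hqσ : 0 ≤ (q : ℝ) ^ σ := by positivity
  have htσ : 0 ≤ (1 + |t|) ^ σ := by positivity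
  calc (q : ℝ) ^ σ * ‖χ.gammaFactor (1 / 2 + t * I + (σ + y * I))‖ * ‖χ.gammaFactor (1 / 2 - t * I + (σ + y * I))‖ *
        ‖P‖ * ‖cexp ((σ + y * I) ^ 2)‖
      = (q : ℝ) ^ σ * (‖χ.gammaFactor (1 / 2 + t * I + (σ + y * I))‖ * ‖χ.gammaFactor (1 / 2 - t * I + (σ + y * I))‖) *
        ‖P‖ * ‖cexp ((σ + y * I) ^ 2)‖ := by ring
    _ ≤ (q : ℝ) ^ σ * (C * ‖χ.gammaFactor (1 / 2 + t * I)‖ ^ 2 * (1 + |t|) ^ σ * (1 + |y|) ^ 2) *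
        ‖P‖ * (3 * Real.exp (-y ^ 2)) := by gcongr
    _ = 12 * C * ‖χ.gammaFactor (1 / 2 + t * I)‖ ^ 2 * ((q : ℝ) ^ σ * (1 + |t|) ^ σ) *
        ((1 + |y|) ^ 2 * Real.exp (-y ^ 2) * ‖P‖) * (1 / 4) := by ring
    _ ≤ _ := by gcongr

theorem norm_sq_LFunction_sub_two_mul_pairSum_le : ∃ C : ℝ, 0 < C ∧ ∀ ε : ℝ, 0 < ε → ∃ X₀ : ℝ, ∀ X : ℝ, X₀ ≤ X →
    ∀ (q : ℕ) [NeZero q], 2 ≤ q → ∀ χ : DirichletCharacter ℂ q, χ.IsPrimitive → ∀ t N : ℝ, N ≤ X →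
    ‖((‖χ.LFunction (1 / 2 + t * I)‖ ^ 2 : ℝ) : ℂ) - 2 * pairSum (pairsLE N) χ t 0‖ ≤
      C * ((q * (1 + |t|)) * (ε + ∫ y : ℝ, gaussWeight y *
        ‖pairSum (pairsLE X \ pairsLE N) χ t ((1 : ℝ) + y * I)‖) +
      (q * (1 + |t|)) ^ (-(1 / 4) : ℝ) * ∫ y : ℝ, gaussWeight y *
        ‖pairSum (pairsLE N) χ t ((-(1 / 4) : ℝ) + y * I)‖) := by
  obtain ⟨C, hC, hker⟩ := norm_gammaFactor_kernel_le
  refine ⟨C, hC, fun ε hε => ?_⟩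
  set W : ℝ := ∫ y, gaussWeight y with hW
  have hW0 : 0 ≤ W := integral_nonneg gaussWeight_nonneg
  obtain ⟨X₀, hX₀⟩ := exists_norm_LFunction_mul_sub_pairSum_le (ε := ε / (W + 1)) (by positivity)
  refine ⟨X₀, fun X hX q _ hq χ h t N hN => ?_⟩
  set g := χ.gammaFactor (1 / 2 + t * I) with hg
  have hg0 : g ≠ 0 := χ.gammaFactor_ne_zero (by simp)
  have hconj : (1 / 2 - t * I : ℂ) = conj (1 / 2 + t * I : ℂ) := by simp [Complex.conj_ofNat]; ring
  have hg1 : χ.gammaFactor (1 / 2 - t * I) = conj g := by rw [hconj, gammaFactor_conj]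
  have hG : 0 < ‖g‖ ^ 2 := by positivity
  obtain ⟨i1, e1⟩ := integral_completedLFunction_mul h hq t
  obtain ⟨i2, e2⟩ := integral_gammaFactor_mul_pairSum χ t (pairsLE_pos (X := N))
  have i3 := i2 1 (by norm_num) le_rfl one_ne_zero
  have hcompl : ∀ (ψ : DirichletCharacter ℂ q) (s : ℂ), 0 < s.re →
      ψ.completedLFunction s = ψ.LFunction s * ψ.gammaFactor s := by
    intro ψ s hs
    rw [ψ.LFunction_eq_completed_div_gammaFactor s (Or.inr (by omega)), div_mul_cancel₀ _ (ψ.gammaFactor_ne_zero hs)]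
  have hsq : χ.completedLFunction (1 / 2 + t * I) * χ⁻¹.completedLFunction (1 / 2 - t * I) =
      g * conj g * ((‖χ.LFunction (1 / 2 + t * I)‖ ^ 2 : ℝ) : ℂ) := by
    rw [hcompl _ _ (by simp), hcompl _ _ (by simp), gammaFactor_inv, hg1, hconj,
      LFunction_inv_conj (h.ne_one hq), Complex.ofReal_pow, ← Complex.mul_conj']
    ring
  have hP : pairSum (pairsLE X) χ t = fun s => pairSum (pairsLE X \ pairsLE N) χ t s + pairSum (pairsLE N) χ t s :=
    funext fun s => pairSum_sdiff (pairsLE_mono hN) χ t s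
  have hinteg : ∀ (S : Finset (ℕ × ℕ)) (hS : ∀ i ∈ S, 0 < i.1 ∧ 0 < i.2) (σ : ℝ), -(1 / 4) ≤ σ →
      Integrable fun y : ℝ => gaussWeight y * ‖pairSum S χ t (σ + y * I)‖ := by
    intro S hS σ hσ
    refine integrable_gaussWeight_mul (((differentiable_pairSum hS χ t).continuous.comp (by fun_prop)).norm)
      (C := S.card) fun y => ?_
    rw [abs_of_nonneg (norm_nonneg _)]
    exact norm_pairSum_le hS χ t (by simp; linarith)
  have hS : ∀ i ∈ pairsLE X \ pairsLE N, 0 < i.1 ∧ 0 < i.2 := fun i hi => pairsLE_pos i (Finset.mem_sdiff.mp hi).1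
  have j1 := hinteg _ hS 1 (by norm_num)
  have j2 := hinteg _ (pairsLE_pos (X := N)) (-(1 / 4)) le_rfl
  have main1 := norm_integral_le_of_norm_le
    (g := fun y => C * ‖g‖ ^ 2 * (q * (1 + |t|)) ^ (1 : ℝ) * (gaussWeight y * (ε / (W + 1)) + gaussWeight y *
        ‖pairSum (pairsLE X \ pairsLE N) χ t ((1 : ℝ) + y * I)‖))
    (((integrable_gaussWeight.mul_const _).add j1).const_mul _)
    (Filter.Eventually.of_forall fun y => by
      have k := hker q χ 1 (Or.inr rfl) t y (χ.LFunction (1 / 2 + t * I + ((1 : ℝ) + y * I)) *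
        χ⁻¹.LFunction (1 / 2 - t * I + ((1 : ℝ) + y * I)) - pairSum (pairsLE N) χ t ((1 : ℝ) + y * I))
      have k2 := hX₀ X hX q χ t y
      rw [hP, ← Complex.ofReal_one] at k2
      have k3 : ‖χ.LFunction (1 / 2 + t * I + ((1 : ℝ) + y * I)) *
        χ⁻¹.LFunction (1 / 2 - t * I + ((1 : ℝ) + y * I)) - pairSum (pairsLE N) χ t ((1 : ℝ) + y * I)‖ ≤
          ε / (W + 1) + ‖pairSum (pairsLE X \ pairsLE N) χ t ((1 : ℝ) + y * I)‖ := by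
        refine le_trans ?_ (add_le_add_left k2 _)
        refine le_trans (le_of_eq ?_) (norm_add_le _ _)
        congr 1
        push_cast
        ring
      refine (le_of_eq ?_).trans (k.trans (mul_le_mul_of_nonneg_left
        ((mul_le_mul_of_nonneg_left k3 (gaussWeight_nonneg y)).trans (le_of_eq (mul_add _ _ _))) (by positivity)))
      exact rfl)
  have main2 := norm_integral_le_of_norm_le (j2.const_mul (C * ‖g‖ ^ 2 * (q * (1 + |t|)) ^ (-(1 / 4) : ℝ)))
    (Filter.Eventually.of_forall fun y => hker q χ (-(1 / 4)) (Or.inl rfl) t y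
      (pairSum (pairsLE N) χ t ((-(1 / 4) : ℝ) + y * I)))
  rw [integral_const_mul] at main1 main2
  rw [integral_add (integrable_gaussWeight.mul_const _) j1, integral_mul_const, ← hW] at main1
  have hdiff : ∫ y : ℝ, (q : ℂ) ^ ((1 : ℝ) + y * I) * χ.gammaFactor (1 / 2 + t * I + ((1 : ℝ) + y * I)) *
      χ.gammaFactor (1 / 2 - t * I + ((1 : ℝ) + y * I)) * (χ.LFunction (1 / 2 + t * I + ((1 : ℝ) + y * I)) *
        χ⁻¹.LFunction (1 / 2 - t * I + ((1 : ℝ) + y * I)) - pairSum (pairsLE N) χ t ((1 : ℝ) + y * I)) *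
      cexp (((1 : ℝ) + y * I) ^ 2) / ((1 : ℝ) + y * I) =
      Real.pi * (g * conj g * ((‖χ.LFunction (1 / 2 + t * I)‖ ^ 2 : ℝ) : ℂ)) -
      (2 * Real.pi * (g * conj g * pairSum (pairsLE N) χ t 0) +
        ∫ y : ℝ, (q : ℂ) ^ ((-(1 / 4) : ℝ) + y * I) *
      χ.gammaFactor (1 / 2 + t * I + ((-(1 / 4) : ℝ) + y * I)) * χ.gammaFactor (1 / 2 - t * I + ((-(1 / 4) : ℝ) + y * I)) *
      pairSum (pairsLE N) χ t ((-(1 / 4) : ℝ) + y * I) * cexp (((-(1 / 4) : ℝ) + y * I) ^ 2) / ((-(1 / 4) : ℝ) + y * I)) := by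
    rw [← hsq, ← e1, ← hg1, ← e2, sub_add_cancel, ← integral_sub i1 i3]
    congr 1
    funext y
    rw [hcompl _ _ (by simp; norm_num), hcompl χ⁻¹ _ (by simp; norm_num), gammaFactor_inv]
    ring
  rw [hdiff] at main1
  set B := ∫ y : ℝ, (q : ℂ) ^ ((-(1 / 4) : ℝ) + y * I) *
      χ.gammaFactor (1 / 2 + t * I + ((-(1 / 4) : ℝ) + y * I)) * χ.gammaFactor (1 / 2 - t * I + ((-(1 / 4) : ℝ) + y * I)) *
      pairSum (pairsLE N) χ t ((-(1 / 4) : ℝ) + y * I) * cexp (((-(1 / 4) : ℝ) + y * I) ^ 2) / ((-(1 / 4) : ℝ) + y * I)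
  set l : ℂ := ((‖χ.LFunction (1 / 2 + t * I)‖ ^ 2 : ℝ) : ℂ)
  set p := pairSum (pairsLE N) χ t 0
  set R1 := ∫ y : ℝ, gaussWeight y * ‖pairSum (pairsLE X \ pairsLE N) χ t ((1 : ℝ) + y * I)‖
  set R2 := ∫ y : ℝ, gaussWeight y * ‖pairSum (pairsLE N) χ t ((-(1 / 4) : ℝ) + y * I)‖
  have hW1 : W * (ε / (W + 1)) ≤ ε := by
    rw [mul_div_assoc', div_le_iff₀ (by positivity)]; nlinarith
  have f1 : Real.pi * ‖g‖ ^ 2 * ‖l - 2 * p‖ ≤ C * ‖g‖ ^ 2 * (q * (1 + |t|)) ^ (1 : ℝ) * (ε + R1) +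
      C * ‖g‖ ^ 2 * (q * (1 + |t|)) ^ (-(1 / 4) : ℝ) * R2 := by
    have : Real.pi * ‖g‖ ^ 2 * ‖l - 2 * p‖ = ‖(Real.pi * (g * conj g * l) - (2 * Real.pi * (g * conj g * p) + B)) + B‖ := by
      have e : (Real.pi * (g * conj g * l) - (2 * Real.pi * (g * conj g * p) + B)) + B =
        Real.pi * (g * conj g) * (l - 2 * p) := by ring
      rw [e, norm_mul, norm_mul, norm_mul, RCLike.norm_conj, Complex.norm_real, Real.norm_of_nonneg Real.pi_pos.le]
      ring
    rw [this]
    refine (norm_add_le _ _).trans (add_le_add (main1.trans ?_) main2)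
    gcongr
  rw [Real.rpow_one] at f1
  have hpi : (1 : ℝ) ≤ Real.pi := by linarith [Real.pi_gt_three]
  have f2 : ‖g‖ ^ 2 * ‖l - 2 * p‖ ≤ ‖g‖ ^ 2 * (C * ((q * (1 + |t|)) * (ε + R1) + (q * (1 + |t|)) ^ (-(1 / 4) : ℝ) * R2)) := by
    calc ‖g‖ ^ 2 * ‖l - 2 * p‖ = 1 * ‖g‖ ^ 2 * ‖l - 2 * p‖ := by ring
      _ ≤ Real.pi * ‖g‖ ^ 2 * ‖l - 2 * p‖ := by gcongr
      _ ≤ _ := f1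
      _ = _ := by ring
  exact le_of_mul_le_mul_left f2 hG

end DirichletCharacter

open Finset in
/-- The harmonic sum over the integers up to `x` free of prime factors in `P`. -/
noncomputable def siftedHarmonic (P : Finset ℕ) (x : ℝ) : ℝ :=
  ∑ n ∈ (Icc 1 ⌊x⌋₊).filter (fun n => ∀ p ∈ P, ¬ p ∣ n), (1 / n : ℝ)

theorem abs_max_log_sub_le {x p : ℝ} (hx : 0 < x) (hp : 1 ≤ p) :
    |max 0 (Real.log x) - max 0 (Real.log (x / p))| ≤ Real.log p := by
  have h := Real.log_nonneg hp
  have h' := abs_max_sub_max_le_abs (Real.log x) (Real.log (x / p)) 0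
  rw [max_comm 0, max_comm 0]
  rwa [Real.log_div hx.ne' (by linarith), sub_sub_cancel, abs_of_nonneg h,
    ← Real.log_div hx.ne' (by linarith)] at h'

theorem siftedHarmonic_insert {P : Finset ℕ} {p : ℕ} (hP : ∀ r ∈ P, r.Prime) (hp : p.Prime) (hpP : p ∉ P)
    {x : ℝ} (hx : 0 < x) :
    siftedHarmonic (insert p P) x = siftedHarmonic P x - 1 / p * siftedHarmonic P (x / p) := by
  have hp0 : (0 : ℝ) < p := by exact_mod_cast hp.pos
  have key : ∑ n ∈ (Finset.Icc 1 ⌊x⌋₊).filter (fun n => (∀ r ∈ P, ¬ r ∣ n) ∧ p ∣ n), (1 / n : ℝ) =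
      1 / p * siftedHarmonic P (x / p) := by
    rw [siftedHarmonic, Finset.mul_sum]
    symm
    refine Finset.sum_bij (fun n _ => p * n) ?_ ?_ ?_ ?_
    · intro n hn
      simp only [Finset.mem_filter, Finset.mem_Icc] at hn ⊢
      obtain ⟨⟨h1, h2⟩, h3⟩ := hn
      have h4 : (n : ℝ) ≤ x / p := (Nat.le_floor_iff (by positivity)).mp h2
      refine ⟨⟨Nat.mul_pos hp.pos h1, Nat.le_floor ?_⟩, fun r hr hd => ?_, Dvd.intro _ rfl⟩
      · rw [le_div_iff₀ hp0] at h4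
        push_cast; linarith
      · rcases (hP r hr).dvd_mul.mp hd with h | h
        · rw [(Nat.prime_dvd_prime_iff_eq (hP r hr) hp).mp h] at hr
          exact hpP hr
        · exact h3 r hr h
    · intro a _ b _ h
      exact Nat.eq_of_mul_eq_mul_left hp.pos h
    · intro n hn
      simp only [Finset.mem_filter, Finset.mem_Icc] at hn
      obtain ⟨⟨h1, h2⟩, h3, m, rfl⟩ := hn
      have h4 : ((p * m : ℕ) : ℝ) ≤ x := (Nat.le_floor_iff hx.le).mp h2
      refine ⟨m, ?_, rfl⟩
      simp only [Finset.mem_filter, Finset.mem_Icc]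
      refine ⟨⟨Nat.pos_of_mul_pos_left h1, Nat.le_floor ?_⟩, fun r hr hd => h3 r hr (Dvd.dvd.mul_left hd p)⟩
      rw [le_div_iff₀ hp0]
      push_cast at h4; linarith
    · intro n _
      push_cast
      rw [one_div_mul_one_div]
  have h1 : siftedHarmonic (insert p P) x =
      ∑ n ∈ ((Finset.Icc 1 ⌊x⌋₊).filter (fun n => ∀ r ∈ P, ¬ r ∣ n)).filter (fun n => ¬ p ∣ n), (1 / n : ℝ) := by
    rw [siftedHarmonic, Finset.filter_filter]
    congr 1
    refine Finset.filter_congr fun n _ => ?_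
    rw [Finset.forall_mem_insert]; tauto
  have h2 := Finset.sum_filter_add_sum_filter_not ((Finset.Icc 1 ⌊x⌋₊).filter (fun n => ∀ r ∈ P, ¬ r ∣ n))
    (fun n => p ∣ n) (fun n : ℕ => (1 / n : ℝ))
  rw [Finset.filter_filter] at h2
  rw [h1, ← key, siftedHarmonic, ← h2]
  ring

theorem siftedHarmonic_empty {x : ℝ} (hx : 0 < x) : |siftedHarmonic ∅ x - max 0 (Real.log x)| ≤ 1 := by
  have e : siftedHarmonic ∅ x = (harmonic ⌊x⌋₊ : ℝ) := by
    simp [siftedHarmonic, harmonic_eq_sum_Icc]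
  rw [e]
  rcases le_or_gt 1 x with h | h
  · have h1 := log_le_harmonic_floor x hx.le
    have h2 := harmonic_floor_le_one_add_log x h
    rw [max_eq_right (Real.log_nonneg h), abs_le]
    constructor <;> linarith
  · rw [Nat.floor_eq_zero.mpr h, max_eq_left (Real.log_nonpos hx.le h.le)]
    simp

theorem abs_siftedHarmonic_sub_le (P : Finset ℕ) (hP : ∀ r ∈ P, r.Prime) : ∀ {x : ℝ}, 0 < x →
    |siftedHarmonic P x - (∏ p ∈ P, (1 - 1 / (p : ℝ))) * max 0 (Real.log x)| ≤
      (∏ p ∈ P, (1 + 1 / (p : ℝ))) * (1 + ∑ p ∈ P, Real.log p / p) := by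
  induction P using Finset.induction_on with
  | empty => intro x hx; simpa using siftedHarmonic_empty hx
  | insert p P hpP ih =>
    intro x hx
    have hP' : ∀ r ∈ P, r.Prime := fun r hr => hP r (Finset.mem_insert_of_mem hr)
    have hp : p.Prime := hP p (Finset.mem_insert_self _ _)
    have hp1 : (1 : ℝ) < p := by exact_mod_cast hp.one_lt
    have i1 := ih hP' hx
    have i2 := ih hP' (x := x / p) (by positivity)
    have i3 := abs_max_log_sub_le hx hp1.le
    rw [siftedHarmonic_insert hP' hp hpP hx, Finset.prod_insert hpP, Finset.prod_insert hpP, Finset.sum_insert hpP]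
    set R := ∏ p ∈ P, (1 - 1 / (p : ℝ)) with hR
    set E := ∏ p ∈ P, (1 + 1 / (p : ℝ)) with hE
    set S := ∑ p ∈ P, Real.log p / p
    have hR0 : 0 ≤ R := Finset.prod_nonneg fun r hr => by
      have : (1 : ℝ) < r := by exact_mod_cast (hP' r hr).one_lt
      rw [sub_nonneg, div_le_one (by linarith)]; exact this.le
    have hR1 : R ≤ 1 := Finset.prod_le_one (fun r hr => by
      have : (1 : ℝ) < r := by exact_mod_cast (hP' r hr).one_lt
      rw [sub_nonneg, div_le_one (by linarith)]; exact this.le) fun r _ => by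
        have : (0 : ℝ) ≤ 1 / r := by positivity
        linarith
    have hE1 : 1 ≤ E := by
      rw [hE]
      refine Finset.prod_induction _ (fun z : ℝ => 1 ≤ z) (fun a b ha hb => by nlinarith) le_rfl fun r _ => ?_
      have : (0 : ℝ) ≤ 1 / r := by positivity
      linarith
    have hlp : 0 ≤ Real.log p := Real.log_nonneg hp1.le
    set A := siftedHarmonic P x
    set B := siftedHarmonic P (x / p)
    set a := max 0 (Real.log x)
    set b := max 0 (Real.log (x / p))
    have hp0 : (0 : ℝ) ≤ 1 / p := by positivity
    have e : A - 1 / p * B - (1 - 1 / p) * R * a = (A - R * a) - 1 / p * (B - R * b) + 1 / p * (R * (a - b)) := by ring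
    rw [e]
    calc _ ≤ |A - R * a| + 1 / p * |B - R * b| + 1 / p * (R * |a - b|) := by
          refine (abs_add_le _ _).trans (add_le_add ((abs_sub _ _).trans_eq ?_) (le_of_eq ?_))
          · rw [abs_mul, abs_of_nonneg hp0]
          · rw [abs_mul, abs_mul, abs_of_nonneg hp0, abs_of_nonneg hR0]
      _ ≤ E * (1 + S) + 1 / p * (E * (1 + S)) + 1 / p * (1 * Real.log p) := by gcongr
      _ = (1 + 1 / p) * E * (1 + S) + 1 * (Real.log p / p) := by ring
      _ ≤ (1 + 1 / p) * E * (1 + S) + ((1 + 1 / p) * E) * (Real.log p / p) := by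
          gcongr
          nlinarith
      _ = _ := by ring

open MeasureTheory Set in
theorem setIntegral_Icc_indicator_Ici {m : ℕ} {w u : ℝ} (hw : 0 ≤ w) (hwu : w ≤ u) :
    ∫ v in Icc 0 u, (Ici w).indicator (fun v => (m + 1 : ℝ) * (u - v) ^ m) v = (u - w) ^ (m + 1) := by
  rw [setIntegral_indicator measurableSet_Ici]
  have e : Icc 0 u ∩ Ici w = Icc w u := by
    ext v; simp only [mem_inter_iff, mem_Icc, mem_Ici]
    constructor
    · rintro ⟨⟨_, h2⟩, h3⟩; exact ⟨h3, h2⟩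
    · rintro ⟨h1, h2⟩; exact ⟨⟨hw.trans h1, h2⟩, h1⟩
  rw [e, integral_Icc_eq_integral_Ioc, ← intervalIntegral.integral_of_le hwu]
  have h : ∀ v ∈ uIcc w u, HasDerivAt (fun v => -(u - v) ^ (m + 1)) ((m + 1 : ℝ) * (u - v) ^ m) v := by
    intro v _
    refine (((hasDerivAt_id' v).const_sub u).pow (m + 1)).neg.congr_deriv ?_
    push_cast
    simp
  rw [intervalIntegral.integral_eq_sub_of_hasDerivAt h (by apply Continuous.intervalIntegrable; fun_prop)]
  simp

open MeasureTheory Set in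
theorem setIntegral_Icc_mul_sub_pow (m : ℕ) {u : ℝ} (hu : 0 ≤ u) :
    ∫ v in Icc 0 u, (m + 1 : ℝ) * (u - v) ^ m * v = u ^ (m + 2) / (m + 2) := by
  rw [integral_Icc_eq_integral_Ioc, ← intervalIntegral.integral_of_le hu]
  have h : ∀ v ∈ uIcc 0 u, HasDerivAt (fun v => -(u - v) ^ (m + 1) * v - (u - v) ^ (m + 2) / (m + 2))
      ((m + 1 : ℝ) * (u - v) ^ m * v) v := by
    intro v _
    have d1 := (((hasDerivAt_id' v).const_sub u).pow (m + 1)).neg.mul (hasDerivAt_id' v)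
    have d2 := (((hasDerivAt_id' v).const_sub u).pow (m + 2)).div_const (m + 2 : ℝ)
    refine (d1.sub d2).congr_deriv ?_
    have : (m + 2 : ℝ) ≠ 0 := by positivity
    push_cast
    simp
    field_simp
    ring
  rw [intervalIntegral.integral_eq_sub_of_hasDerivAt h (by apply Continuous.intervalIntegrable; fun_prop)]
  simp

section

variable {a : ℕ → ℝ} {ρ E : ℝ}

open MeasureTheory Set in
theorem abs_sum_mul_log_pow_sub_le
    (hH : ∀ x : ℝ, 0 < x → |∑ n ∈ Finset.Icc 1 ⌊x⌋₊, a n - ρ * max 0 (Real.log x)| ≤ E) (m : ℕ) {X : ℝ} (hX : 0 < X) :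
    |∑ n ∈ Finset.Icc 1 ⌊X⌋₊, a n * Real.log (X / n) ^ (m + 1) -
      ρ * (max 0 (Real.log X) ^ (m + 2) / (m + 2))| ≤ E * max 0 (Real.log X) ^ (m + 1) := by
  rcases lt_or_ge X 1 with h | h
  · rw [Nat.floor_eq_zero.mpr h, max_eq_left (Real.log_nonpos hX.le h.le)]
    simp
  set u := Real.log X with hu
  have hu0 : 0 ≤ u := Real.log_nonneg h
  rw [max_eq_right hu0]
  have hinteg : ∀ n, IntegrableOn (fun v => a n * (Ici (Real.log n)).indicator (fun v => (m + 1 : ℝ) * (u - v) ^ m) v)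
      (Icc 0 u) := by
    intro n
    refine Integrable.const_mul (Integrable.indicator ?_ measurableSet_Ici) _
    exact Continuous.integrableOn_Icc (by fun_prop)
  have h1 : ∑ n ∈ Finset.Icc 1 ⌊X⌋₊, a n * Real.log (X / n) ^ (m + 1) =
      ∫ v in Icc 0 u, ∑ n ∈ Finset.Icc 1 ⌊X⌋₊, a n * (Ici (Real.log n)).indicator (fun v => (m + 1 : ℝ) * (u - v) ^ m) v := by
    rw [integral_finsetSum _ fun n _ => hinteg n]
    refine Finset.sum_congr rfl fun n hn => ?_
    rw [Finset.mem_Icc] at hn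
    have hn1 : (1 : ℝ) ≤ n := by exact_mod_cast hn.1
    have hn2 : (n : ℝ) ≤ X := (Nat.le_floor_iff hX.le).mp hn.2
    rw [integral_const_mul, setIntegral_Icc_indicator_Ici (Real.log_nonneg hn1) (Real.log_le_log (by linarith) hn2),
      Real.log_div hX.ne' (by linarith)]
  have h2 : ∀ v ∈ Icc 0 u, ∑ n ∈ Finset.Icc 1 ⌊X⌋₊, a n * (Ici (Real.log n)).indicator (fun v => (m + 1 : ℝ) * (u - v) ^ m) v =
      (m + 1 : ℝ) * (u - v) ^ m * ∑ n ∈ Finset.Icc 1 ⌊Real.exp v⌋₊, a n := by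
    intro v hv
    have hvX : Real.exp v ≤ X := by
      rw [← Real.exp_log hX]; exact Real.exp_le_exp.mpr hv.2
    have hsub : Finset.Icc 1 ⌊Real.exp v⌋₊ = (Finset.Icc 1 ⌊X⌋₊).filter (fun n : ℕ => Real.log n ≤ v) := by
      ext n
      simp only [Finset.mem_Icc, Finset.mem_filter]
      constructor
      · rintro ⟨k1, k2⟩
        have k3 : (n : ℝ) ≤ Real.exp v := (Nat.le_floor_iff (Real.exp_pos v).le).mp k2
        refine ⟨⟨k1, k2.trans (Nat.floor_le_floor hvX)⟩, ?_⟩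
        rw [Real.log_le_iff_le_exp (by exact_mod_cast k1)]; exact k3
      · rintro ⟨⟨k1, k2⟩, k3⟩
        rw [Real.log_le_iff_le_exp (by exact_mod_cast k1)] at k3
        exact ⟨k1, Nat.le_floor k3⟩
    rw [hsub, Finset.sum_filter, Finset.mul_sum]
    refine Finset.sum_congr rfl fun n _ => ?_
    simp only [indicator, mem_Ici]
    split_ifs <;> ring
  have h3 : ρ * (u ^ (m + 2) / (m + 2)) = ∫ v in Icc 0 u, ρ * ((m + 1 : ℝ) * (u - v) ^ m * v) := by
    rw [integral_const_mul, setIntegral_Icc_mul_sub_pow m hu0]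
  have i1 : IntegrableOn (fun v => ρ * ((m + 1 : ℝ) * (u - v) ^ m * v)) (Icc 0 u) :=
    Continuous.integrableOn_Icc (by fun_prop)
  rw [h1, h3, ← integral_sub (integrable_finsetSum _ fun n _ => hinteg n) i1]
  have h4 := setIntegral_Icc_indicator_Ici (m := m) le_rfl hu0
  have h5 : ∫ v in Icc 0 u, E * ((m + 1 : ℝ) * (u - v) ^ m) = E * u ^ (m + 1) := by
    rw [integral_const_mul]
    congr 1
    rw [← sub_zero u, ← h4, sub_zero]
    refine setIntegral_congr_fun measurableSet_Icc fun v hv => ?_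
    simp only [indicator, mem_Ici, hv.1, if_true]
  rw [← h5, ← Real.norm_eq_abs]
  refine norm_integral_le_of_norm_le (Continuous.integrableOn_Icc (by fun_prop)) ?_
  refine (ae_restrict_iff' measurableSet_Icc).mpr (Filter.Eventually.of_forall fun v hv => ?_)
  rw [h2 v hv, Real.norm_eq_abs]
  have hk := hH (Real.exp v) (Real.exp_pos v)
  rw [Real.log_exp, max_eq_right hv.1] at hk
  have hp : 0 ≤ (m + 1 : ℝ) * (u - v) ^ m := mul_nonneg (by positivity) (pow_nonneg (by linarith [hv.2]) _)
  calc _ = |((m + 1 : ℝ) * (u - v) ^ m) * (∑ n ∈ Finset.Icc 1 ⌊Real.exp v⌋₊, a n - ρ * v)| := by congr 1; ring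
    _ = ((m + 1 : ℝ) * (u - v) ^ m) * |∑ n ∈ Finset.Icc 1 ⌊Real.exp v⌋₊, a n - ρ * v| := by
        rw [abs_mul, abs_of_nonneg hp]
    _ ≤ ((m + 1 : ℝ) * (u - v) ^ m) * E := by gcongr
    _ = _ := by ring

theorem sum_pairsLE {M : Type*} [AddCommMonoid M] {X : ℝ} (hX : 0 ≤ X) (f : ℕ → ℕ → M) :
    ∑ i ∈ pairsLE X, f i.1 i.2 = ∑ α ∈ Finset.Icc 1 ⌊X⌋₊, ∑ β ∈ Finset.Icc 1 ⌊X / α⌋₊, f α β := by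
  rw [Finset.sum_sigma']
  refine Finset.sum_bij' (fun i _ => ⟨i.1, i.2⟩) (fun i _ => (i.1, i.2)) ?_ ?_ ?_ ?_ ?_
  · intro i hi
    obtain ⟨h1, h2, h3⟩ := mem_pairsLE.mp hi
    simp only [Finset.mem_sigma, Finset.mem_Icc]
    have h4 : (0 : ℝ) < i.1 := by exact_mod_cast h1
    have h5 : i.1 ≤ i.1 * i.2 := Nat.le_mul_of_pos_right _ h2
    refine ⟨⟨h1, Nat.le_floor (le_trans (by exact_mod_cast h5) h3)⟩, h2, Nat.le_floor ?_⟩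
    rw [le_div_iff₀ h4]
    push_cast at h3
    linarith
  · rintro ⟨α, β⟩ hi
    simp only [Finset.mem_sigma, Finset.mem_Icc] at hi
    obtain ⟨⟨h1, h2⟩, h3, h4⟩ := hi
    have h5 : (0 : ℝ) < α := by exact_mod_cast h1
    have h6 : (β : ℝ) ≤ X / α := (Nat.le_floor_iff (by positivity)).mp h4
    refine mem_pairsLE.mpr ⟨h1, h3, ?_⟩
    rw [le_div_iff₀ h5] at h6
    push_cast
    linarith
  · intro i _; rfl
  · intro i _; rfl
  · intro i _; rfl

theorem sum_pairsLE_mul_le (ha : ∀ n, 0 ≤ a n) {X : ℝ} :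
    ∑ i ∈ pairsLE X, a i.1 * a i.2 ≤ (∑ n ∈ Finset.Icc 1 ⌊X⌋₊, a n) ^ 2 := by
  rw [sq, Finset.sum_mul_sum, ← Finset.sum_product']
  exact Finset.sum_le_sum_of_subset_of_nonneg (Finset.filter_subset _ _) fun i _ _ => mul_nonneg (ha _) (ha _)

theorem abs_sum_pairsLE_sub_le (ha : ∀ n, 0 ≤ a n) (hρ : 0 ≤ ρ) (hE : 0 ≤ E)
    (hH : ∀ x : ℝ, 0 < x → |∑ n ∈ Finset.Icc 1 ⌊x⌋₊, a n - ρ * max 0 (Real.log x)| ≤ E) {X : ℝ} (hX : 0 < X) :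
    |∑ i ∈ pairsLE X, a i.1 * a i.2 * (∑ n ∈ Finset.Icc 1 ⌊√(X / (i.1 * i.2))⌋₊, a n) ^ 2 -
      ρ ^ 4 * max 0 (Real.log X) ^ 4 / 48| ≤ 2 * (E * (ρ * max 0 (Real.log X) + E) ^ 3) := by
  rcases lt_or_ge X 1 with h | h
  · have : pairsLE X = ∅ := by
      rw [pairsLE, Nat.floor_eq_zero.mpr h]; simp
    rw [this, max_eq_left (Real.log_nonpos hX.le h.le)]
    simp; positivity
  set ℓ := Real.log X with hℓ
  have hℓ0 : 0 ≤ ℓ := Real.log_nonneg h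
  rw [max_eq_right hℓ0]
  have hHX := hH X hX
  rw [← hℓ, max_eq_right hℓ0] at hHX
  have hHX' : ∑ n ∈ Finset.Icc 1 ⌊X⌋₊, a n ≤ ρ * ℓ + E := by linarith [(abs_le.mp hHX).2]
  have hHX0 : 0 ≤ ∑ n ∈ Finset.Icc 1 ⌊X⌋₊, a n := Finset.sum_nonneg fun n _ => ha n
  set x : ℕ × ℕ → ℝ := fun i => Real.log (X / (i.1 * i.2)) with hx
  set G : ℕ × ℕ → ℝ := fun i => ∑ n ∈ Finset.Icc 1 ⌊√(X / (i.1 * i.2))⌋₊, a n with hG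
  have s1 : |∑ i ∈ pairsLE X, a i.1 * a i.2 * (G i) ^ 2 - ∑ i ∈ pairsLE X, a i.1 * a i.2 * (ρ ^ 2 / 4 * x i ^ 2)| ≤
      E * (ρ * ℓ + E) ^ 3 := by
    rw [← Finset.sum_sub_distrib]
    refine (Finset.abs_sum_le_sum_abs _ _).trans ?_
    calc _ ≤ ∑ i ∈ pairsLE X, a i.1 * a i.2 * (E * (ρ * ℓ + E)) := by
          refine Finset.sum_le_sum fun i hi => ?_
          obtain ⟨h1, h2, h3⟩ := mem_pairsLE.mp hi
          have q1 : (1 : ℝ) ≤ i.1 * i.2 := by exact_mod_cast Nat.mul_pos h1 h2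
          have q2 : 1 ≤ X / (i.1 * i.2) := by
            rw [le_div_iff₀ (by linarith)]; push_cast at h3; linarith
          have q3 : X / (i.1 * i.2) ≤ X := div_le_self hX.le q1
          have x0 : 0 ≤ x i := Real.log_nonneg q2
          have x1 : x i ≤ ℓ := Real.log_le_log (by linarith) q3
          have hh := hH (√(X / (i.1 * i.2))) (Real.sqrt_pos.mpr (by linarith))
          rw [Real.log_sqrt (by linarith), max_eq_right (by simp only [hx] at x0; linarith)] at hh
          change |G i - ρ * (x i / 2)| ≤ E at hh
          rw [← mul_sub, abs_mul, abs_of_nonneg (mul_nonneg (ha _) (ha _))]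
          refine mul_le_mul_of_nonneg_left ?_ (mul_nonneg (ha _) (ha _))
          have g0 : 0 ≤ G i := Finset.sum_nonneg fun n _ => ha n
          have e : G i ^ 2 - ρ ^ 2 / 4 * x i ^ 2 = (G i - ρ * (x i / 2)) * (G i + ρ * (x i / 2)) := by ring
          have r1 : ρ * x i ≤ ρ * ℓ := by gcongr
          have r2 : 0 ≤ ρ * (x i / 2) := by positivity
          rw [e, abs_mul, abs_of_nonneg (add_nonneg g0 r2)]
          refine mul_le_mul hh ?_ (by positivity) hE
          linarith [(abs_le.mp hh).2]
      _ = (∑ i ∈ pairsLE X, a i.1 * a i.2) * (E * (ρ * ℓ + E)) := by rw [Finset.sum_mul]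
      _ ≤ (ρ * ℓ + E) ^ 2 * (E * (ρ * ℓ + E)) := by
          gcongr
          exact (sum_pairsLE_mul_le ha).trans (by gcongr)
      _ = _ := by ring
  have s2 : |∑ i ∈ pairsLE X, a i.1 * a i.2 * x i ^ 2 - ρ / 3 * ∑ n ∈ Finset.Icc 1 ⌊X⌋₊, a n * Real.log (X / n) ^ 3| ≤
      E * ∑ n ∈ Finset.Icc 1 ⌊X⌋₊, a n * Real.log (X / n) ^ 2 := by
    rw [sum_pairsLE hX.le (fun α β => a α * a β * x (α, β) ^ 2), Finset.mul_sum, ← Finset.sum_sub_distrib, Finset.mul_sum]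
    refine (Finset.abs_sum_le_sum_abs _ _).trans (Finset.sum_le_sum fun α hα => ?_)
    rw [Finset.mem_Icc] at hα
    have α0 : (0 : ℝ) < α := by exact_mod_cast hα.1
    have α1 : (α : ℝ) ≤ X := (Nat.le_floor_iff hX.le).mp hα.2
    have hh := abs_sum_mul_log_pow_sub_le hH 1 (X := X / α) (by positivity)
    rw [max_eq_right (Real.log_nonneg ((one_le_div α0).mpr α1))] at hh
    have e : ∑ β ∈ Finset.Icc 1 ⌊X / α⌋₊, a α * a β * x (α, β) ^ 2 =
        a α * ∑ β ∈ Finset.Icc 1 ⌊X / α⌋₊, a β * Real.log (X / α / β) ^ 2 := by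
      rw [Finset.mul_sum]
      refine Finset.sum_congr rfl fun β _ => ?_
      simp only [hx, div_div]
      ring
    rw [e]
    have e2 : a α * ∑ β ∈ Finset.Icc 1 ⌊X / α⌋₊, a β * Real.log (X / α / β) ^ 2 - ρ / 3 * (a α * Real.log (X / α) ^ 3) =
      a α * (∑ β ∈ Finset.Icc 1 ⌊X / α⌋₊, a β * Real.log (X / α / β) ^ (1 + 1) -
        ρ * (Real.log (X / α) ^ (1 + 2) / ((1 : ℕ) + 2))) := by
      push_cast; ring
    rw [e2, abs_mul, abs_of_nonneg (ha α)]
    calc _ ≤ a α * (E * Real.log (X / α) ^ (1 + 1)) := mul_le_mul_of_nonneg_left hh (ha α)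
      _ = _ := by ring
  have s3 := abs_sum_mul_log_pow_sub_le hH 2 hX
  have s4 := abs_sum_mul_log_pow_sub_le hH 1 hX
  rw [← hℓ, max_eq_right hℓ0] at s3 s4
  norm_num at s3 s4
  set S3 := ∑ n ∈ Finset.Icc 1 ⌊X⌋₊, a n * Real.log (X / n) ^ 3
  set S2 := ∑ n ∈ Finset.Icc 1 ⌊X⌋₊, a n * Real.log (X / n) ^ 2
  set Y := ∑ i ∈ pairsLE X, a i.1 * a i.2 * x i ^ 2
  have s5 : ∑ i ∈ pairsLE X, a i.1 * a i.2 * (ρ ^ 2 / 4 * x i ^ 2) = ρ ^ 2 / 4 * Y := by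
    rw [Finset.mul_sum]; exact Finset.sum_congr rfl fun i _ => by ring
  rw [s5] at s1
  have t1 : |ρ ^ 2 / 4 * Y - ρ ^ 4 * ℓ ^ 4 / 48| ≤ ρ ^ 2 / 4 * (E * S2 + ρ / 3 * (E * ℓ ^ 3)) := by
    have e : ρ ^ 2 / 4 * Y - ρ ^ 4 * ℓ ^ 4 / 48 = ρ ^ 2 / 4 * ((Y - ρ / 3 * S3) + ρ / 3 * (S3 - ρ * (ℓ ^ 4 / 4))) := by ring
    rw [e, abs_mul, abs_of_nonneg (by positivity : 0 ≤ ρ ^ 2 / 4)]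
    gcongr
    refine (abs_add_le _ _).trans (add_le_add s2 ?_)
    rw [abs_mul, abs_of_nonneg (by positivity : 0 ≤ ρ / 3)]
    gcongr
  have t2 : S2 ≤ ρ * (ℓ ^ 3 / 3) + E * ℓ ^ 2 := by linarith [(abs_le.mp s4).2]
  have t3 : ρ ^ 2 / 4 * (E * S2 + ρ / 3 * (E * ℓ ^ 3)) ≤ E * (ρ * ℓ + E) ^ 3 := by
    calc _ ≤ ρ ^ 2 / 4 * (E * (ρ * (ℓ ^ 3 / 3) + E * ℓ ^ 2) + ρ / 3 * (E * ℓ ^ 3)) := by gcongr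
      _ ≤ _ := by
        have p1 : 0 ≤ E * (ρ ^ 3 * ℓ ^ 3) := by positivity
        have p2 : 0 ≤ E * (ρ ^ 2 * ℓ ^ 2 * E) := by positivity
        have p3 : 0 ≤ E * (ρ * ℓ * E ^ 2) := by positivity
        have p4 : 0 ≤ E * E ^ 3 := by positivity
        nlinarith
  calc _ ≤ |∑ i ∈ pairsLE X, a i.1 * a i.2 * (G i) ^ 2 - ρ ^ 2 / 4 * Y| + |ρ ^ 2 / 4 * Y - ρ ^ 4 * ℓ ^ 4 / 48| :=
        abs_sub_le _ _ _
    _ ≤ _ := by linarith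

end

theorem abs_max_pow_four_sub_le {l w : ℝ} (hw : 0 ≤ w) :
    |max 0 (l - 2 * w) ^ 4 - max 0 l ^ 4| ≤ 8 * w * max 0 l ^ 3 := by
  have h0 : 0 ≤ max 0 (l - 2 * w) := le_max_left _ _
  have h1 : max 0 (l - 2 * w) ≤ max 0 l := max_le_max le_rfl (by linarith)
  have h2 : max 0 l ≤ max 0 (l - 2 * w) + 2 * w := by
    apply max_le (by positivity)
    have := le_max_right 0 (l - 2 * w)
    linarith
  set x := max 0 l
  set y := max 0 (l - 2 * w)
  have hx : 0 ≤ x := h0.trans h1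
  have h3 : y ^ 4 ≤ x ^ 4 := pow_le_pow_left₀ h0 h1 4
  rw [abs_sub_comm, abs_of_nonneg (by linarith)]
  have e : x ^ 4 - y ^ 4 = (x - y) * (x ^ 3 + x ^ 2 * y + x * y ^ 2 + y ^ 3) := by ring
  rw [e]
  calc _ ≤ (2 * w) * (x ^ 3 + x ^ 2 * x + x * x ^ 2 + x ^ 3) := by
        gcongr
        · linarith
    _ = _ := by ring

open ArithmeticFunction in
theorem Nat.sum_moebius_divisors (n : ℕ) :
    ∑ d ∈ n.divisors, (moebius d : ℤ) = if n = 1 then 1 else 0 := by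
  have h := congrArg (fun f : ArithmeticFunction ℤ => f n) coe_zeta_mul_moebius
  simp only [coe_zeta_mul_apply, one_apply] at h
  exact h

section

variable {a : ℕ → ℝ}

theorem sum_coprime_pairsLE_eq (hmul : ∀ m n, a (m * n) = a m * a n) (Φ : ℝ → ℝ) (Z : ℝ) :
    ∑ i ∈ (pairsLE Z).filter (fun i => i.1.Coprime i.2), a i.1 * a i.2 * Φ (Z / (i.1 * i.2)) =
      ∑ e ∈ Finset.Icc 1 ⌊Z⌋₊, (ArithmeticFunction.moebius e : ℝ) * a e ^ 2 *
        ∑ i ∈ pairsLE (Z / e ^ 2), a i.1 * a i.2 * Φ (Z / e ^ 2 / (i.1 * i.2)) := by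
  set f : ℕ × ℕ → ℝ := fun i => a i.1 * a i.2 * Φ (Z / (i.1 * i.2)) with hf
  have h1 : ∀ i ∈ pairsLE Z, (if i.1.Coprime i.2 then f i else 0) =
      ∑ e ∈ Finset.Icc 1 ⌊Z⌋₊, if e ∣ i.1 ∧ e ∣ i.2 then (ArithmeticFunction.moebius e : ℝ) * f i else 0 := by
    intro i hi
    obtain ⟨k1, k2, k3⟩ := mem_pairsLE.mp hi
    have hg : Nat.gcd i.1 i.2 ≠ 0 := Nat.gcd_ne_zero_left k1.ne'
    have hm := Nat.sum_moebius_divisors (Nat.gcd i.1 i.2)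
    have hset : (Finset.Icc 1 ⌊Z⌋₊).filter (fun e => e ∣ i.1 ∧ e ∣ i.2) = (Nat.gcd i.1 i.2).divisors := by
      ext e
      simp only [Finset.mem_filter, Finset.mem_Icc, Nat.mem_divisors]
      constructor
      · rintro ⟨_, h3, h4⟩
        exact ⟨Nat.dvd_gcd h3 h4, hg⟩
      · rintro ⟨h3, _⟩
        have h4 := h3.trans (Nat.gcd_dvd_left _ _)
        have h5 : i.1 ≤ i.1 * i.2 := Nat.le_mul_of_pos_right _ k2
        exact ⟨⟨Nat.pos_of_dvd_of_pos h4 k1, (Nat.le_of_dvd k1 h4).trans (h5.trans (Nat.le_floor k3))⟩, h4,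
          h3.trans (Nat.gcd_dvd_right _ _)⟩
    rw [← Finset.sum_filter, hset, ← Finset.sum_mul]
    have hm' : (∑ d ∈ (Nat.gcd i.1 i.2).divisors, (ArithmeticFunction.moebius d : ℝ)) =
        if Nat.gcd i.1 i.2 = 1 then 1 else 0 := by
      rw [← Int.cast_sum, hm]; push_cast; rfl
    rw [hm']
    simp only [Nat.Coprime, ite_mul, one_mul, zero_mul]
  rw [Finset.sum_filter, Finset.sum_congr rfl h1, Finset.sum_comm]
  refine Finset.sum_congr rfl fun e he => ?_
  rw [Finset.mem_Icc] at he
  have e0 : (0 : ℝ) < e := by exact_mod_cast he.1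
  rw [← Finset.sum_filter, Finset.mul_sum]
  symm
  refine Finset.sum_bij (fun i _ => (e * i.1, e * i.2)) ?_ ?_ ?_ ?_
  · intro i hi
    obtain ⟨k1, k2, k3⟩ := mem_pairsLE.mp hi
    rw [le_div_iff₀ (by positivity)] at k3
    simp only [Finset.mem_filter, mem_pairsLE]
    refine ⟨⟨Nat.mul_pos he.1 k1, Nat.mul_pos he.1 k2, ?_⟩, Dvd.intro _ rfl, Dvd.intro _ rfl⟩
    push_cast at k3 ⊢
    linarith
  · intro i _ j _ h
    simp only [Prod.mk.injEq] at h
    exact Prod.ext (Nat.eq_of_mul_eq_mul_left he.1 h.1) (Nat.eq_of_mul_eq_mul_left he.1 h.2)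
  · rintro ⟨i, j⟩ hi
    rw [Finset.mem_filter, mem_pairsLE] at hi
    obtain ⟨⟨k1, k2, k3⟩, ⟨m, hm⟩, ⟨n, hn⟩⟩ := hi
    simp only at k1 k2 k3 hm hn
    subst hm hn
    refine ⟨(m, n), mem_pairsLE.mpr ⟨Nat.pos_of_mul_pos_left k1, Nat.pos_of_mul_pos_left k2, ?_⟩, rfl⟩
    rw [le_div_iff₀ (by positivity)]
    push_cast at k3 ⊢
    linarith
  · intro i _
    simp only [hf, hmul]
    have e1 : Z / e ^ 2 / (i.1 * i.2) = Z / (((e * i.1 : ℕ) : ℝ) * ((e * i.2 : ℕ) : ℝ)) := by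
      rw [div_div]; push_cast; congr 1; ring
    rw [e1]; ring

theorem summable_log_div_sq : Summable fun e : ℕ => Real.log e / (e : ℝ) ^ 2 := by
  have h : Summable fun e : ℕ => 2 * (e : ℝ) ^ (-(3 / 2) : ℝ) := by
    refine Summable.mul_left _ ?_
    rw [Real.summable_nat_rpow]; norm_num
  refine Summable.of_nonneg_of_le (fun e => div_nonneg (Real.log_natCast_nonneg e) (by positivity)) (fun e => ?_) h
  rcases Nat.eq_zero_or_pos e with rfl | he
  · simp
  have e0 : (0 : ℝ) < e := by exact_mod_cast he
  have h1 := Real.log_natCast_le_rpow_div e (ε := 1 / 2) (by norm_num)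
  rw [div_le_iff₀ (by positivity)]
  have h2 : (e : ℝ) ^ (-(3 / 2) : ℝ) * (e : ℝ) ^ 2 = (e : ℝ) ^ (1 / 2 : ℝ) := by
    rw [← Real.rpow_natCast, ← Real.rpow_add e0]; norm_num
  rw [mul_assoc, h2]
  linarith

theorem abs_coprime_pairs_main_le : ∃ K : ℝ, 0 < K ∧ ∀ (a : ℕ → ℝ) (ρ E c : ℝ), (∀ m n, a (m * n) = a m * a n) →
    (∀ n, 0 ≤ a n) → (∀ n, a n ≤ 1 / n) → 0 ≤ ρ → 0 ≤ E →
    (∀ x : ℝ, 0 < x → |∑ n ∈ Finset.Icc 1 ⌊x⌋₊, a n - ρ * max 0 (Real.log x)| ≤ E) →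
    HasSum (fun e : ℕ => (ArithmeticFunction.moebius e : ℝ) * a e ^ 2) c → ∀ Z : ℝ, 0 < Z →
    |∑ i ∈ (pairsLE Z).filter (fun i => i.1.Coprime i.2),
      a i.1 * a i.2 * (∑ n ∈ Finset.Icc 1 ⌊√(Z / (i.1 * i.2))⌋₊, a n) ^ 2 -
      c * ρ ^ 4 / 48 * max 0 (Real.log Z) ^ 4| ≤
    K * (E * (ρ * max 0 (Real.log Z) + E) ^ 3 + ρ ^ 4 * max 0 (Real.log Z) ^ 3) := by
  have hs2 : Summable fun e : ℕ => 1 / (e : ℝ) ^ 2 := by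
    rw [Real.summable_one_div_nat_pow]; norm_num
  set K₁ := ∑' e : ℕ, 1 / (e : ℝ) ^ 2 with hK₁
  set K₂ := ∑' e : ℕ, Real.log e / (e : ℝ) ^ 2 with hK₂
  have hK₁0 : 0 ≤ K₁ := tsum_nonneg fun e => by positivity
  have hK₂0 : 0 ≤ K₂ := tsum_nonneg fun e => div_nonneg (Real.log_natCast_nonneg e) (by positivity)
  refine ⟨2 * K₁ + K₂ + 1, by positivity, fun a ρ E c hmul ha ha1 hρ hE hH hc Z hZ => ?_⟩
  set l := max 0 (Real.log Z) with hl
  have hl0 : 0 ≤ l := le_max_left _ _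
  have hmu : ∀ e : ℕ, |(ArithmeticFunction.moebius e : ℝ)| ≤ 1 := fun e => by
    exact_mod_cast ArithmeticFunction.abs_moebius_le_one
  have ha2 : ∀ e : ℕ, a e ^ 2 ≤ 1 / (e : ℝ) ^ 2 := fun e => by
    rw [← one_div_pow]; exact pow_le_pow_left₀ (ha e) (ha1 e) 2
  have hlog : ∀ e : ℕ, 0 < e → Real.log (Z / (e : ℝ) ^ 2) = Real.log Z - 2 * Real.log e := fun e he => by
    have e0 : (0 : ℝ) < e := by exact_mod_cast he
    rw [Real.log_div hZ.ne' (by positivity), Real.log_pow]; norm_num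
  have hmono : ∀ e : ℕ, 0 < e → max 0 (Real.log (Z / (e : ℝ) ^ 2)) ≤ l := fun e he => by
    rw [hlog e he, hl]
    have := Real.log_natCast_nonneg e
    exact max_le_max le_rfl (by linarith)
  rw [sum_coprime_pairsLE_eq hmul (fun x => (∑ n ∈ Finset.Icc 1 ⌊√x⌋₊, a n) ^ 2) Z]
  set Q : ℝ → ℝ := fun X => ∑ i ∈ pairsLE X, a i.1 * a i.2 * (∑ n ∈ Finset.Icc 1 ⌊√(X / (i.1 * i.2))⌋₊, a n) ^ 2 with hQ
  have s1 : |∑ e ∈ Finset.Icc 1 ⌊Z⌋₊, (ArithmeticFunction.moebius e : ℝ) * a e ^ 2 * Q (Z / e ^ 2) -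
      ∑ e ∈ Finset.Icc 1 ⌊Z⌋₊, (ArithmeticFunction.moebius e : ℝ) * a e ^ 2 *
        (ρ ^ 4 * max 0 (Real.log (Z / (e : ℝ) ^ 2)) ^ 4 / 48)| ≤ 2 * K₁ * (E * (ρ * l + E) ^ 3) := by
    rw [← Finset.sum_sub_distrib]
    refine (Finset.abs_sum_le_sum_abs _ _).trans ?_
    calc _ ≤ ∑ e ∈ Finset.Icc 1 ⌊Z⌋₊, 1 / (e : ℝ) ^ 2 * (2 * (E * (ρ * l + E) ^ 3)) := by
          refine Finset.sum_le_sum fun e he => ?_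
          rw [Finset.mem_Icc] at he
          have e0 : (0 : ℝ) < e := by exact_mod_cast he.1
          rw [← mul_sub, abs_mul, abs_mul, abs_of_nonneg (sq_nonneg (a e))]
          have hh := abs_sum_pairsLE_sub_le ha hρ hE hH (X := Z / (e : ℝ) ^ 2) (by positivity)
          have hm := hmono e he.1
          have hm0 : 0 ≤ max 0 (Real.log (Z / (e : ℝ) ^ 2)) := le_max_left _ _
          have hh2 : |Q (Z / e ^ 2) - ρ ^ 4 * max 0 (Real.log (Z / (e : ℝ) ^ 2)) ^ 4 / 48| ≤ 2 * (E * (ρ * l + E) ^ 3) :=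
            hh.trans (by gcongr)
          calc _ ≤ 1 * (1 / (e : ℝ) ^ 2) * (2 * (E * (ρ * l + E) ^ 3)) :=
                mul_le_mul (mul_le_mul (hmu e) (ha2 e) (sq_nonneg _) zero_le_one) hh2 (abs_nonneg _) (by positivity)
            _ = _ := by ring
      _ = (∑ e ∈ Finset.Icc 1 ⌊Z⌋₊, 1 / (e : ℝ) ^ 2) * (2 * (E * (ρ * l + E) ^ 3)) := by rw [Finset.sum_mul]
      _ ≤ K₁ * (2 * (E * (ρ * l + E) ^ 3)) := by
          gcongr
          exact hs2.sum_le_tsum _ fun e _ => by positivity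
      _ = _ := by ring
  have hz0 : a 0 ^ 2 = 0 := by
    have h1 := ha 0
    have h2 := ha1 0
    simp at h2
    rw [le_antisymm h2 h1]; norm_num
  have s2 : ∑ e ∈ Finset.Icc 1 ⌊Z⌋₊, (ArithmeticFunction.moebius e : ℝ) * a e ^ 2 *
        (ρ ^ 4 * max 0 (Real.log (Z / (e : ℝ) ^ 2)) ^ 4 / 48) =
      ∑' e : ℕ, (ArithmeticFunction.moebius e : ℝ) * a e ^ 2 *
        (ρ ^ 4 * max 0 (Real.log (Z / (e : ℝ) ^ 2)) ^ 4 / 48) := by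
    symm
    refine tsum_eq_sum fun e he => ?_
    rcases Nat.eq_zero_or_pos e with rfl | he0
    · rw [hz0]; ring
    · have e1 : (1 : ℝ) ≤ e := by exact_mod_cast he0
      have h1 : ⌊Z⌋₊ < e := by
        rw [Finset.mem_Icc] at he; by_contra h; exact he ⟨he0, by omega⟩
      have h2 : Z < e := (Nat.floor_lt hZ.le).mp h1
      have h3 : Z / (e : ℝ) ^ 2 ≤ 1 := by
        rw [div_le_one (by positivity)]; nlinarith
      rw [max_eq_left (Real.log_nonpos (by positivity) h3)]
      ring
  have hterm : ∀ e : ℕ, ‖(ArithmeticFunction.moebius e : ℝ) * a e ^ 2 *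
        (ρ ^ 4 * max 0 (Real.log (Z / (e : ℝ) ^ 2)) ^ 4 / 48) -
        (ArithmeticFunction.moebius e : ℝ) * a e ^ 2 * (ρ ^ 4 * l ^ 4 / 48)‖ ≤
        Real.log e / (e : ℝ) ^ 2 * (ρ ^ 4 * l ^ 3 / 6) := by
    intro e
    rcases Nat.eq_zero_or_pos e with rfl | he0
    · rw [hz0]; simp
    · have h1 := abs_max_pow_four_sub_le (l := Real.log Z) (Real.log_natCast_nonneg e)
      rw [← hlog e he0, ← hl] at h1
      have e1 : ∀ x y : ℝ, x * (ρ ^ 4 * y ^ 4 / 48) - x * (ρ ^ 4 * l ^ 4 / 48) = x * (ρ ^ 4 / 48 * (y ^ 4 - l ^ 4)) := by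
        intro x y; ring
      rw [e1, Real.norm_eq_abs, abs_mul, abs_mul, abs_mul, abs_of_nonneg (sq_nonneg (a e)),
        abs_of_nonneg (by positivity : 0 ≤ ρ ^ 4 / 48)]
      calc _ ≤ 1 * (1 / (e : ℝ) ^ 2) * (ρ ^ 4 / 48 * (8 * Real.log e * l ^ 3)) :=
            mul_le_mul (mul_le_mul (hmu e) (ha2 e) (sq_nonneg _) zero_le_one)
              (mul_le_mul_of_nonneg_left h1 (by positivity)) (by positivity) (by positivity)
        _ = _ := by ring
  have hsl := summable_log_div_sq.mul_right (ρ ^ 4 * l ^ 3 / 6)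
  have hsd := Summable.of_norm_bounded hsl hterm
  have hc' := hc.mul_right (ρ ^ 4 * l ^ 4 / 48)
  have s3 : |∑' e : ℕ, (ArithmeticFunction.moebius e : ℝ) * a e ^ 2 *
        (ρ ^ 4 * max 0 (Real.log (Z / (e : ℝ) ^ 2)) ^ 4 / 48) - c * (ρ ^ 4 * l ^ 4 / 48)| ≤
      K₂ * (ρ ^ 4 * l ^ 3 / 6) := by
    have e : ∑' e : ℕ, (ArithmeticFunction.moebius e : ℝ) * a e ^ 2 *
        (ρ ^ 4 * max 0 (Real.log (Z / (e : ℝ) ^ 2)) ^ 4 / 48) - c * (ρ ^ 4 * l ^ 4 / 48) =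
        ∑' e : ℕ, ((ArithmeticFunction.moebius e : ℝ) * a e ^ 2 *
        (ρ ^ 4 * max 0 (Real.log (Z / (e : ℝ) ^ 2)) ^ 4 / 48) -
        (ArithmeticFunction.moebius e : ℝ) * a e ^ 2 * (ρ ^ 4 * l ^ 4 / 48)) := by
      have := (hsd.hasSum.add hc').tsum_eq
      simp only [sub_add_cancel] at this
      rw [this]; ring
    rw [e, hK₂, ← tsum_mul_right, ← Real.norm_eq_abs]
    exact tsum_of_norm_bounded hsl.hasSum hterm
  rw [s2] at s1
  have e2 : c * ρ ^ 4 / 48 * l ^ 4 = c * (ρ ^ 4 * l ^ 4 / 48) := by ring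
  rw [e2]
  refine (abs_sub_le _ _ _).trans ((add_le_add s1 s3).trans ?_)
  have p1 : 0 ≤ E * (ρ * l + E) ^ 3 := by positivity
  have p2 : 0 ≤ ρ ^ 4 * l ^ 3 := by positivity
  nlinarith [mul_nonneg hK₁0 p2, mul_nonneg hK₂0 p2, mul_nonneg hK₂0 p1]

end

/-- The reciprocal of `n` if `n` is coprime to `q`, and zero otherwise. -/
noncomputable def copRecip (q n : ℕ) : ℝ := if n.Coprime q then 1 / (n : ℝ) else 0

theorem copRecip_mul (q m n : ℕ) : copRecip q (m * n) = copRecip q m * copRecip q n := by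
  simp only [copRecip, Nat.coprime_mul_iff_left]
  by_cases h1 : m.Coprime q
  · by_cases h2 : n.Coprime q
    · rw [if_pos ⟨h1, h2⟩, if_pos h1, if_pos h2, Nat.cast_mul, one_div_mul_one_div]
    · rw [if_neg (fun h => h2 h.2), if_neg h2, mul_zero]
  · rw [if_neg (fun h => h1 h.1), if_neg h1, zero_mul]

theorem copRecip_nonneg (q n : ℕ) : 0 ≤ copRecip q n := by
  unfold copRecip; split_ifs <;> positivity

theorem copRecip_le (q n : ℕ) : copRecip q n ≤ 1 / n := by
  unfold copRecip; split_ifs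
  · exact le_rfl
  · positivity

theorem copRecip_of_coprime {q n : ℕ} (h : n.Coprime q) : copRecip q n = 1 / n := if_pos h

theorem sum_copRecip {q : ℕ} (hq : q ≠ 0) (x : ℝ) :
    ∑ n ∈ Finset.Icc 1 ⌊x⌋₊, copRecip q n = siftedHarmonic q.primeFactors x := by
  unfold copRecip
  rw [← Finset.sum_filter, siftedHarmonic]
  refine Finset.sum_congr (Finset.filter_congr fun n hn => ?_) fun _ _ => rfl
  rw [Nat.coprime_comm, Nat.coprime_iff_gcd_eq_one]
  constructor
  · intro h p hp hd
    have := Nat.dvd_gcd (Nat.dvd_of_mem_primeFactors hp) hd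
    rw [h] at this
    exact (Nat.prime_of_mem_primeFactors hp).one_lt.ne' (Nat.dvd_one.mp this)
  · intro h
    by_contra hne
    obtain ⟨p, hp, hd⟩ := Nat.exists_prime_and_dvd hne
    exact h p (Nat.mem_primeFactors.mpr ⟨hp, hd.trans (Nat.gcd_dvd_left _ _), hq⟩) (hd.trans (Nat.gcd_dvd_right _ _))

open ArithmeticFunction in
theorem hasSum_moebius_mul_copRecip_sq {q : ℕ} (hq : q ≠ 0) :
    HasSum (fun e : ℕ => (moebius e : ℝ) * copRecip q e ^ 2)
      (6 / Real.pi ^ 2 * (∏ p ∈ q.primeFactors, (1 - 1 / (p : ℝ) ^ 2))⁻¹) := by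
  have : NeZero q := ⟨hq⟩
  have hs : 1 < (2 : ℂ).re := by norm_num
  have h1 := DirichletCharacter.LSeries.mul_mu_eq_one (1 : DirichletCharacter ℂ q) hs
  have h2 : LSeriesSummable ((fun n : ℕ => (1 : DirichletCharacter ℂ q) n) * fun n : ℕ => ((moebius n : ℤ) : ℂ)) 2 :=
    DirichletCharacter.LSeriesSummable_mul 1 (LSeriesSummable_moebius_iff.mpr hs)
  have h3 := h2.LSeriesHasSum
  have h4 := DirichletCharacter.LFunctionTrivChar_eq_mul_riemannZeta (N := q) (s := 2) (by norm_num)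
  rw [DirichletCharacter.LFunctionTrivChar, DirichletCharacter.LFunction_eq_LSeries _ hs] at h4
  rw [h4, riemannZeta_two] at h1
  have h5 : ∏ p ∈ q.primeFactors, (1 - (p : ℂ) ^ (-2 : ℂ)) =
      ((∏ p ∈ q.primeFactors, (1 - 1 / (p : ℝ) ^ 2) : ℝ) : ℂ) := by
    push_cast
    refine Finset.prod_congr rfl fun p _ => ?_
    rw [Complex.cpow_neg, one_div]
    norm_cast
  rw [h5] at h1
  have hP : (∏ p ∈ q.primeFactors, (1 - 1 / (p : ℝ) ^ 2)) ≠ 0 := by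
    refine Finset.prod_ne_zero_iff.mpr fun p hp => ?_
    have hp1 : (1 : ℝ) < p := by exact_mod_cast (Nat.prime_of_mem_primeFactors hp).one_lt
    have : 1 / (p : ℝ) ^ 2 < 1 := by rw [div_lt_one (by positivity)]; nlinarith
    linarith
  have h6 := eq_inv_of_mul_eq_one_right h1
  rw [← Complex.hasSum_ofReal]
  unfold LSeriesHasSum at h3
  rw [h6] at h3
  convert! h3 using 1
  · funext n
    rcases Nat.eq_zero_or_pos n with rfl | hn
    · simp
    rw [LSeries.term_of_ne_zero hn.ne', Pi.mul_apply]
    by_cases h : n.Coprime q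
    · rw [copRecip_of_coprime h, MulChar.one_apply ((ZMod.isUnit_iff_coprime n q).mpr h), one_mul]
      push_cast
      rw [one_div, inv_pow, div_eq_mul_inv]
      norm_cast
    · rw [MulChar.map_nonunit _ (fun hu => h ((ZMod.isUnit_iff_coprime n q).mp hu)), copRecip, if_neg h]
      simp
  · push_cast
    rw [mul_inv, mul_comm, inv_div]

theorem totient_div_eq_prod (q : ℕ) (hq : q ≠ 0) :
    (q.totient : ℝ) / q = ∏ p ∈ q.primeFactors, (1 - 1 / (p : ℝ)) := by
  have h := Nat.totient_eq_mul_prod_factors q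
  have h' : ((q.totient : ℚ) : ℝ) = ((q * ∏ p ∈ q.primeFactors, (1 - (p : ℚ)⁻¹) : ℚ) : ℝ) := by rw [h]
  push_cast at h'
  rw [h', mul_div_assoc, mul_comm, div_mul_cancel₀ _ (by exact_mod_cast hq)]
  simp only [one_div]

/-- The arithmetic factor in the main term of the fourth moment. -/
noncomputable def momentConst (q : ℕ) : ℝ :=
  1 / (2 * Real.pi ^ 2) * ∏ p ∈ q.primeFactors, (1 - 1 / (p : ℝ)) ^ 3 / (1 + 1 / (p : ℝ))

theorem momentConst_eq (q : ℕ) (hq : q ≠ 0) :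
    4 * ((6 / Real.pi ^ 2 * (∏ p ∈ q.primeFactors, (1 - 1 / (p : ℝ) ^ 2))⁻¹) * ((q.totient : ℝ) / q) ^ 4 / 48) =
      momentConst q := by
  have h : (∏ p ∈ q.primeFactors, (1 - 1 / (p : ℝ) ^ 2))⁻¹ * ((q.totient : ℝ) / q) ^ 4 =
      ∏ p ∈ q.primeFactors, (1 - 1 / (p : ℝ)) ^ 3 / (1 + 1 / (p : ℝ)) := by
    rw [totient_div_eq_prod q hq, ← Finset.prod_pow, ← Finset.prod_inv_distrib, ← Finset.prod_mul_distrib]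
    refine Finset.prod_congr rfl fun p hp => ?_
    have hp1 : (1 : ℝ) < p := by exact_mod_cast (Nat.prime_of_mem_primeFactors hp).one_lt
    have h1 : 1 / (p : ℝ) < 1 := by rw [div_lt_one (by linarith)]; linarith
    have h2 : 0 < 1 / (p : ℝ) := by positivity
    have e : 1 - 1 / (p : ℝ) ^ 2 = (1 - 1 / p) * (1 + 1 / p) := by rw [← one_div_pow]; ring
    have h3 : 1 - 1 / (p : ℝ) ≠ 0 := by linarith
    have h4 : 1 + 1 / (p : ℝ) ≠ 0 := by linarith
    rw [e]
    generalize 1 / (p : ℝ) = z at *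
    field_simp
  rw [momentConst, ← h]
  ring

theorem momentConst_nonneg (q : ℕ) : 0 ≤ momentConst q := by
  refine mul_nonneg (by positivity) (Finset.prod_nonneg fun p hp => ?_)
  have hp1 : (1 : ℝ) < p := by exact_mod_cast (Nat.prime_of_mem_primeFactors hp).one_lt
  have h1 : 1 / (p : ℝ) < 1 := by rw [div_lt_one (by linarith)]; linarith
  have : 0 ≤ 1 - 1 / (p : ℝ) := by linarith
  positivity

theorem prod_one_sub_sq_ge (P : Finset ℕ) (hP : ∀ p ∈ P, 2 ≤ p) : 1 / 2 ≤ ∏ p ∈ P, (1 - 1 / (p : ℝ) ^ 2) := by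
  have key : ∀ n : ℕ, 1 / 2 ≤ ∏ p ∈ Finset.Icc 2 (n + 1), (1 - 1 / (p : ℝ) ^ 2) := by
    intro n
    have h : ∏ p ∈ Finset.Icc 2 (n + 1), (1 - 1 / (p : ℝ) ^ 2) = ((n : ℝ) + 2) / (2 * ((n : ℝ) + 1)) := by
      induction n with
      | zero => simp
      | succ k ih =>
        rw [Finset.prod_Icc_succ_top (by omega), ih]
        have h1 : (k : ℝ) + 1 ≠ 0 := by positivity
        have h2 : (k : ℝ) + 2 ≠ 0 := by positivity
        push_cast
        rw [show (k : ℝ) + 1 + 1 = k + 2 by ring]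
        field_simp
        ring
    rw [h, div_le_div_iff₀ (by norm_num) (by positivity)]
    have : (0 : ℝ) ≤ n := Nat.cast_nonneg n
    nlinarith
  have hmem : P ⊆ Finset.Icc 2 (P.sup id + 1) := fun p hp => by
    have := Finset.le_sup (f := id) hp
    simp only [id, Finset.mem_Icc] at this ⊢
    exact ⟨hP p hp, by omega⟩
  have hb : ∀ p : ℕ, 2 ≤ p → 0 ≤ 1 - 1 / (p : ℝ) ^ 2 ∧ 1 - 1 / (p : ℝ) ^ 2 ≤ 1 := by
    intro p hp
    have hp1 : (2 : ℝ) ≤ p := by exact_mod_cast hp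
    have : 1 / (p : ℝ) ^ 2 ≤ 1 := by rw [div_le_one (by positivity)]; nlinarith
    have h0 : 0 ≤ 1 / (p : ℝ) ^ 2 := by positivity
    constructor <;> linarith
  refine (key (P.sup id)).trans (Finset.prod_le_prod_of_subset_of_le_one hmem ?_ ?_)
  · intro p hp; exact (hb p (Finset.mem_Icc.mp hp).1).1
  · intro p hp _; exact (hb p (Finset.mem_Icc.mp hp).1).2

theorem momentConst_bounds (q : ℕ) (hq : q ≠ 0) :
    1 / (2 * Real.pi ^ 2) * ((q.totient : ℝ) / q) ^ 4 ≤ momentConst q ∧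
      momentConst q ≤ 1 / Real.pi ^ 2 * ((q.totient : ℝ) / q) ^ 4 := by
  rw [← momentConst_eq q hq]
  have h1 := prod_one_sub_sq_ge q.primeFactors (fun p hp => (Nat.prime_of_mem_primeFactors hp).two_le)
  have h2 : ∏ p ∈ q.primeFactors, (1 - 1 / (p : ℝ) ^ 2) ≤ 1 := by
    refine Finset.prod_le_one (fun p hp => ?_) (fun p hp => ?_)
    · have hp1 : (1 : ℝ) < p := by exact_mod_cast (Nat.prime_of_mem_primeFactors hp).one_lt
      have : 1 / (p : ℝ) ^ 2 ≤ 1 := by rw [div_le_one (by positivity)]; nlinarith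
      linarith
    · have : 0 ≤ 1 / (p : ℝ) ^ 2 := by positivity
      linarith
  set Q := ∏ p ∈ q.primeFactors, (1 - 1 / (p : ℝ) ^ 2)
  have h3 : 1 ≤ Q⁻¹ := (one_le_inv₀ (by linarith)).mpr h2
  have h4 : Q⁻¹ ≤ 2 := by rw [inv_le_comm₀ (by linarith) (by norm_num)]; linarith
  have e : 4 * (6 / Real.pi ^ 2 * Q⁻¹ * ((q.totient : ℝ) / q) ^ 4 / 48) =
      1 / (2 * Real.pi ^ 2) * ((q.totient : ℝ) / q) ^ 4 * Q⁻¹ := by ring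
  have e2 : 1 / Real.pi ^ 2 * ((q.totient : ℝ) / q) ^ 4 = 1 / (2 * Real.pi ^ 2) * ((q.totient : ℝ) / q) ^ 4 * 2 := by ring
  rw [e, e2]
  have h5 : 0 ≤ 1 / (2 * Real.pi ^ 2) * ((q.totient : ℝ) / q) ^ 4 := by positivity
  constructor
  · exact le_mul_of_one_le_right h5 h3
  · gcongr

theorem sum_log_primes_dyadic_le (P : Finset ℕ) (hP : ∀ p ∈ P, p.Prime) (n : ℕ) :
    ∑ p ∈ P.filter (fun p => n < p ∧ p ≤ 2 * n), Real.log p ≤ n * Real.log 4 := by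
  set Q := P.filter (fun p => n < p ∧ p ≤ 2 * n)
  have h1 : ∏ p ∈ Q, p ∣ (2 * n).choose n := by
    refine Finset.prod_primes_dvd _ (fun p hp => (hP p (Finset.mem_filter.mp hp).1).prime) fun p hp => ?_
    obtain ⟨h, h2, h3⟩ := Finset.mem_filter.mp hp
    exact (hP p h).dvd_choose h2 (by omega) h3
  have h2 : ∏ p ∈ Q, p ≤ 2 ^ (2 * n) :=
    (Nat.le_of_dvd (Nat.choose_pos (by omega)) h1).trans (Nat.choose_le_two_pow _ _)
  have h3 : ∑ p ∈ Q, Real.log p = Real.log ((∏ p ∈ Q, p : ℕ) : ℝ) := by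
    push_cast
    rw [Real.log_prod]
    intro p hp
    exact_mod_cast (hP p (Finset.mem_filter.mp hp).1).ne_zero
  have h4 : ((∏ p ∈ Q, p : ℕ) : ℝ) ≤ 4 ^ n := by
    have : ((∏ p ∈ Q, p : ℕ) : ℝ) ≤ ((2 ^ (2 * n) : ℕ) : ℝ) := by exact_mod_cast h2
    rw [pow_mul] at this
    push_cast at this
    norm_num at this ⊢
    exact this
  rw [h3, ← Real.log_pow]
  refine Real.log_le_log ?_ h4
  exact_mod_cast Finset.prod_pos fun p hp => (hP p (Finset.mem_filter.mp hp).1).pos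

theorem sum_filter_le_two_pow_succ (P : Finset ℕ) (f : ℕ → ℝ) (k : ℕ) :
    ∑ p ∈ P.filter (fun p => p ≤ 2 ^ (k + 1)), f p =
      ∑ p ∈ P.filter (fun p => p ≤ 2 ^ k), f p +
      ∑ p ∈ P.filter (fun p => 2 ^ k < p ∧ p ≤ 2 * 2 ^ k), f p := by
  rw [← Finset.sum_filter_add_sum_filter_not (P.filter (fun p => p ≤ 2 ^ (k + 1))) (fun p => p ≤ 2 ^ k),
    Finset.filter_filter, Finset.filter_filter]
  congr 1
  · refine Finset.sum_congr (Finset.filter_congr fun p _ => ?_) fun _ _ => rfl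
    rw [pow_succ]; omega
  · refine Finset.sum_congr (Finset.filter_congr fun p _ => ?_) fun _ _ => rfl
    rw [pow_succ]; omega

theorem sum_log_div_primes_le (P : Finset ℕ) (hP : ∀ p ∈ P, p.Prime) (k : ℕ) :
    ∑ p ∈ P.filter (fun p => p ≤ 2 ^ k), Real.log p / p ≤ k * Real.log 4 := by
  induction k with
  | zero =>
    rw [Finset.filter_false_of_mem]
    · simp
    · intro p hp; have := (hP p hp).two_le; simp; omega
  | succ k ih =>
    rw [sum_filter_le_two_pow_succ]
    have h := sum_log_primes_dyadic_le P hP (2 ^ k)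
    have h2 : ∑ p ∈ P.filter (fun p => 2 ^ k < p ∧ p ≤ 2 * 2 ^ k), Real.log p / p ≤
        (∑ p ∈ P.filter (fun p => 2 ^ k < p ∧ p ≤ 2 * 2 ^ k), Real.log p) / 2 ^ k := by
      rw [Finset.sum_div]
      refine Finset.sum_le_sum fun p hp => ?_
      have h3 : (2 : ℝ) ^ k ≤ p := by exact_mod_cast (Finset.mem_filter.mp hp).2.1.le
      exact div_le_div_of_nonneg_left (Real.log_natCast_nonneg p) (by positivity) h3
    have h3 : (∑ p ∈ P.filter (fun p => 2 ^ k < p ∧ p ≤ 2 * 2 ^ k), Real.log p) / 2 ^ k ≤ Real.log 4 := by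
      rw [div_le_iff₀ (by positivity)]
      push_cast at h
      linarith
    push_cast
    linarith

theorem sum_inv_primes_le (P : Finset ℕ) (hP : ∀ p ∈ P, p.Prime) (k : ℕ) :
    ∑ p ∈ P.filter (fun p => p ≤ 2 ^ (k + 1)), 1 / (p : ℝ) ≤ 1 / 2 + 2 * ∑ j ∈ Finset.range k, 1 / ((j : ℝ) + 1) := by
  induction k with
  | zero =>
    have h : P.filter (fun p => p ≤ 2 ^ (0 + 1)) ⊆ {2} := by
      intro p hp
      obtain ⟨h1, h2⟩ := Finset.mem_filter.mp hp
      have := (hP p h1).two_le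
      rw [Finset.mem_singleton]; omega
    refine (Finset.sum_le_sum_of_subset_of_nonneg h (fun i _ _ => by positivity)).trans ?_
    simp
  | succ k ih =>
    rw [sum_filter_le_two_pow_succ, Finset.sum_range_succ]
    have h := sum_log_primes_dyadic_le P hP (2 ^ (k + 1))
    set Q := P.filter (fun p => 2 ^ (k + 1) < p ∧ p ≤ 2 * 2 ^ (k + 1))
    have hl2 : 0 < Real.log 2 := Real.log_pos (by norm_num)
    have hl4 : Real.log 4 = 2 * Real.log 2 := by
      rw [show (4 : ℝ) = 2 ^ 2 by norm_num, Real.log_pow]; norm_num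
    have h2 : ∑ p ∈ Q, 1 / (p : ℝ) ≤ (∑ p ∈ Q, Real.log p) * (1 / (2 ^ (k + 1) * ((k + 1) * Real.log 2))) := by
      rw [Finset.sum_mul]
      refine Finset.sum_le_sum fun p hp => ?_
      have h3 : (2 : ℝ) ^ (k + 1) ≤ p := by exact_mod_cast (Finset.mem_filter.mp hp).2.1.le
      have h4 : (k + 1) * Real.log 2 ≤ Real.log p := by
        have := Real.log_le_log (by positivity) h3
        rw [Real.log_pow] at this
        push_cast at this; exact this
      have hp0 : (0 : ℝ) < p := lt_of_lt_of_le (by positivity) h3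
      rw [mul_one_div, div_le_div_iff₀ hp0 (by positivity), one_mul, mul_comm (2 ^ (k + 1) : ℝ)]
      exact mul_le_mul h4 h3 (by positivity) (Real.log_natCast_nonneg p)
    have h3 : (∑ p ∈ Q, Real.log p) * (1 / (2 ^ (k + 1) * ((k + 1) * Real.log 2))) ≤ 2 * (1 / ((k : ℝ) + 1)) := by
      rw [mul_one_div, mul_one_div, div_le_div_iff₀ (by positivity) (by positivity)]
      push_cast at h
      rw [hl4] at h
      calc _ ≤ (2 ^ (k + 1) * (2 * Real.log 2)) * ((k : ℝ) + 1) := by gcongr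
        _ = _ := by ring
    linarith

theorem exists_dyadic_level (w : ℕ) (hw : 1 ≤ w) :
    ∃ l : ℕ, 2 ^ l ≤ w ∧ w ≤ 2 ^ (l + 1) :=
  ⟨Nat.log 2 w, Nat.pow_log_le_self 2 (by omega), (Nat.lt_pow_succ_log_self (by norm_num) w).le⟩

/-- The relative error factor in the sifted harmonic sum over integers coprime to `q`. -/
noncomputable def sieveError (q : ℕ) : ℝ :=
  (∏ p ∈ q.primeFactors, (1 + 1 / (p : ℝ))) * (1 + ∑ p ∈ q.primeFactors, Real.log p / p)

theorem sum_log_div_le (P : Finset ℕ) (hP : ∀ p ∈ P, p.Prime) (l : ℕ) (hl : P.card ≤ 2 ^ (l + 1)) :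
    ∑ p ∈ P, Real.log p / p ≤ 3 * (l + 2) := by
  rw [← Finset.sum_filter_add_sum_filter_not P (fun p => p ≤ 2 ^ (l + 2))]
  have h1 := sum_log_div_primes_le P hP (l + 2)
  have h2 : ∑ p ∈ P.filter (fun p => ¬ p ≤ 2 ^ (l + 2)), Real.log p / p ≤
      ∑ p ∈ P.filter (fun p => ¬ p ≤ 2 ^ (l + 2)), Real.log (2 ^ (l + 2)) / 2 ^ (l + 2) := by
    refine Finset.sum_le_sum fun p hp => ?_
    have h3 : (2 : ℝ) ^ (l + 2) ≤ p := by
      have := (Finset.mem_filter.mp hp).2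
      push Not at this
      exact_mod_cast this.le
    have h4 : Real.exp 1 ≤ (2 : ℝ) ^ (l + 2) := by
      have h5 : (1 : ℝ) ≤ 2 ^ l := one_le_pow₀ (by norm_num)
      have := Real.exp_one_lt_d9
      rw [pow_add]; linarith
    exact Real.log_div_self_antitoneOn h4 (h4.trans h3) h3
  rw [Finset.sum_const, nsmul_eq_mul] at h2
  have h3 : ((P.filter (fun p => ¬ p ≤ 2 ^ (l + 2))).card : ℝ) ≤ 2 ^ (l + 2) := by
    have := (Finset.card_filter_le P (fun p => ¬ p ≤ 2 ^ (l + 2))).trans hl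
    have h5 : 2 ^ (l + 1) ≤ 2 ^ (l + 2) := Nat.pow_le_pow_right (by norm_num) (by omega)
    exact_mod_cast this.trans h5
  have hl2 : 0 < Real.log 2 := Real.log_pos (by norm_num)
  have hlt := Real.log_two_lt_d9
  have hl4 : Real.log 4 = 2 * Real.log 2 := by
    rw [show (4 : ℝ) = 2 ^ 2 by norm_num, Real.log_pow]; norm_num
  rw [Real.log_pow] at h2
  have h6 : ((P.filter (fun p => ¬ p ≤ 2 ^ (l + 2))).card : ℝ) * (((l + 2 : ℕ) : ℝ) * Real.log 2 / 2 ^ (l + 2)) ≤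
      ((l + 2 : ℕ) : ℝ) * Real.log 2 := by
    rw [mul_div_assoc', div_le_iff₀ (by positivity), mul_comm]
    gcongr
  rw [hl4] at h1
  push_cast at h1 h2 h6
  have : ((l : ℝ) + 2) * (2 * Real.log 2) + (l + 2) * Real.log 2 ≤ 3 * (l + 2) := by
    have : (0 : ℝ) ≤ l := Nat.cast_nonneg l
    nlinarith
  linarith

theorem prod_one_add_inv_le (P : Finset ℕ) (hP : ∀ p ∈ P, p.Prime) (l : ℕ) (hl : P.card ≤ 2 ^ (l + 1)) :
    ∏ p ∈ P, (1 + 1 / (p : ℝ)) ≤ 81 * ((l : ℝ) + 2) ^ 2 := by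
  have h0 : ∑ p ∈ P, 1 / (p : ℝ) ≤ 4 + 2 * Real.log (l + 2) := by
    rw [← Finset.sum_filter_add_sum_filter_not P (fun p => p ≤ 2 ^ (l + 1 + 1))]
    have h1 := sum_inv_primes_le P hP (l + 1)
    have h2 : ∑ p ∈ P.filter (fun p => ¬ p ≤ 2 ^ (l + 1 + 1)), 1 / (p : ℝ) ≤
        ∑ p ∈ P.filter (fun p => ¬ p ≤ 2 ^ (l + 1 + 1)), 1 / 2 ^ (l + 1 + 1) := by
      refine Finset.sum_le_sum fun p hp => ?_
      have h3 : (2 : ℝ) ^ (l + 1 + 1) ≤ p := by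
        have := (Finset.mem_filter.mp hp).2
        push Not at this
        exact_mod_cast this.le
      exact one_div_le_one_div_of_le (by positivity) h3
    rw [Finset.sum_const, nsmul_eq_mul] at h2
    have h3 : ((P.filter (fun p => ¬ p ≤ 2 ^ (l + 1 + 1))).card : ℝ) ≤ 2 ^ (l + 1) := by
      exact_mod_cast (Finset.card_filter_le P (fun p => ¬ p ≤ 2 ^ (l + 1 + 1))).trans hl
    have h4 : ((P.filter (fun p => ¬ p ≤ 2 ^ (l + 1 + 1))).card : ℝ) * (1 / 2 ^ (l + 1 + 1)) ≤ 1 / 2 := by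
      have e : (2 : ℝ) ^ (l + 1 + 1) = 2 ^ (l + 1) * 2 := pow_succ _ _
      rw [mul_one_div, div_le_iff₀ (by positivity), e]
      linarith
    have h5 : ∑ j ∈ Finset.range (l + 1), 1 / ((j : ℝ) + 1) ≤ 1 + Real.log (l + 1) := by
      have := harmonic_le_one_add_log (l + 1)
      rw [harmonic] at this
      push_cast at this
      simpa only [one_div] using this
    have h6 : Real.log ((l : ℝ) + 1) ≤ Real.log (l + 2) := Real.log_le_log (by positivity) (by linarith)
    linarith
  have h1 : ∏ p ∈ P, (1 + 1 / (p : ℝ)) ≤ Real.exp (∑ p ∈ P, 1 / (p : ℝ)) := by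
    rw [Real.exp_sum]
    refine Finset.prod_le_prod (fun p _ => by positivity) fun p _ => ?_
    have := Real.add_one_le_exp (1 / (p : ℝ))
    linarith
  refine h1.trans ((Real.exp_le_exp.mpr h0).trans ?_)
  have h2 : Real.exp (2 * Real.log (l + 2)) = ((l : ℝ) + 2) ^ 2 := by
    rw [mul_comm, Real.exp_mul, Real.exp_log (by positivity)]
    norm_num
  rw [Real.exp_add, h2]
  have h3 : Real.exp 4 ≤ 81 := by
    have : Real.exp 4 = Real.exp 1 ^ 4 := by rw [← Real.exp_nat_mul]; norm_num
    rw [this]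
    calc Real.exp 1 ^ 4 ≤ (3 : ℝ) ^ 4 := pow_le_pow_left₀ (Real.exp_pos 1).le Real.exp_one_lt_three.le 4
      _ = 81 := by norm_num
  gcongr

theorem inv_le_prod_one_add_inv (q : ℕ) (hq : q ≠ 0) :
    (q : ℝ) / q.totient ≤ 2 * ∏ p ∈ q.primeFactors, (1 + 1 / (p : ℝ)) := by
  have h1 := prod_one_sub_sq_ge q.primeFactors (fun p hp => (Nat.prime_of_mem_primeFactors hp).two_le)
  have h2 : ∏ p ∈ q.primeFactors, (1 - 1 / (p : ℝ) ^ 2) =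
      (q.totient : ℝ) / q * ∏ p ∈ q.primeFactors, (1 + 1 / (p : ℝ)) := by
    rw [totient_div_eq_prod q hq, ← Finset.prod_mul_distrib]
    refine Finset.prod_congr rfl fun p _ => ?_
    rw [← one_div_pow]; ring
  rw [h2] at h1
  have hφ : (0 : ℝ) < q.totient := by exact_mod_cast Nat.totient_pos.mpr (Nat.pos_of_ne_zero hq)
  have hq0 : (0 : ℝ) < q := by exact_mod_cast Nat.pos_of_ne_zero hq
  rw [div_le_iff₀ hφ]
  rw [div_mul_eq_mul_div, div_le_div_iff₀ (by norm_num) hq0] at h1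
  linarith

theorem card_mul_le_log (q : ℕ) (hq : q ≠ 0) (l : ℕ) (hl : 2 ^ l ≤ q.primeFactors.card) :
    (q.primeFactors.card : ℝ) * (l + 2) ≤ 8 * Real.log q := by
  have hl2 : 0.69 < Real.log 2 := by have := Real.log_two_gt_d9; linarith
  have h1 := Nat.card_primeFactors_mul_log_two_le hq
  have h2 : (q.primeFactors.card : ℝ) * ((l - 1 : ℝ) * Real.log 2) ≤ 2 * Real.log q := by
    rcases Nat.eq_zero_or_pos l with rfl | hl0
    · have : (0 : ℝ) ≤ q.primeFactors.card := Nat.cast_nonneg _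
      have h3 : 0 ≤ Real.log q := Real.log_natCast_nonneg q
      push_cast
      nlinarith
    obtain ⟨j, rfl⟩ : ∃ j, l = j + 1 := ⟨l - 1, by omega⟩
    have h3 : Real.log ((∏ p ∈ q.primeFactors, p : ℕ) : ℝ) ≤ Real.log q := by
      refine Real.log_le_log ?_ ?_
      · exact_mod_cast Finset.prod_pos fun p hp => (Nat.prime_of_mem_primeFactors hp).pos
      · exact_mod_cast Nat.le_of_dvd (Nat.pos_of_ne_zero hq) (Nat.prod_primeFactors_dvd q)
    push_cast at h3
    rw [Real.log_prod (fun p hp => by exact_mod_cast (Nat.prime_of_mem_primeFactors hp).ne_zero)] at h3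
    have h4 : ∑ p ∈ q.primeFactors.filter (fun p => ¬ p ≤ 2 ^ j), ((j : ℝ) * Real.log 2) ≤
        ∑ p ∈ q.primeFactors, Real.log p := by
      refine le_trans (Finset.sum_le_sum fun p hp => ?_)
        (Finset.sum_le_sum_of_subset_of_nonneg (Finset.filter_subset (fun p => ¬ p ≤ 2 ^ j) _)
          (fun p _ _ => Real.log_natCast_nonneg p))
      rw [← Real.log_pow]
      refine Real.log_le_log (by positivity) ?_
      have := (Finset.mem_filter.mp hp).2
      push Not at this
      exact_mod_cast this.le
    rw [Finset.sum_const, nsmul_eq_mul] at h4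
    have h5 := Finset.card_filter_add_card_filter_not (s := q.primeFactors) (fun p => p ≤ 2 ^ j)
    have h6 : (q.primeFactors.filter (fun p => p ≤ 2 ^ j)).card ≤ 2 ^ j := by
      have : q.primeFactors.filter (fun p => p ≤ 2 ^ j) ⊆ Finset.Icc 1 (2 ^ j) := fun p hp => by
        obtain ⟨h7, h8⟩ := Finset.mem_filter.mp hp
        exact Finset.mem_Icc.mpr ⟨(Nat.prime_of_mem_primeFactors h7).one_le, h8⟩
      simpa using Finset.card_le_card this
    have h7 : q.primeFactors.card ≤ 2 * (q.primeFactors.filter (fun p => ¬ p ≤ 2 ^ j)).card := by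
      rw [pow_succ] at hl; omega
    have h8 : (q.primeFactors.card : ℝ) ≤ 2 * ((q.primeFactors.filter (fun p => ¬ p ≤ 2 ^ j)).card : ℝ) := by
      exact_mod_cast h7
    push_cast
    have h9 : (0 : ℝ) ≤ j * Real.log 2 := by positivity
    have h10 := mul_le_mul_of_nonneg_right h8 h9
    have e : ((j : ℝ) + 1 - 1) = j := by ring
    rw [e]
    linarith
  have h3 : (q.primeFactors.card : ℝ) * (l + 2) * Real.log 2 ≤ 5 * Real.log q := by linarith
  have h4 : (0 : ℝ) ≤ q.primeFactors.card * (l + 2) := by positivity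
  nlinarith

theorem exists_arithmetic_bounds : ∃ C : ℝ, 0 < C ∧ ∀ q : ℕ, 2 ≤ q →
    sieveError q ≤ C * ((q.totient : ℝ) / q) * q.primeFactors.card ∧
    (q.primeFactors.card : ℝ) * Real.sqrt (q / q.totient) ≤ C * Real.log q := by
  refine ⟨2 * 81 ^ 2 * 4 * (120 * 2 ^ 5) * 4, by norm_num, fun q hq => ?_⟩
  have hq0 : q ≠ 0 := by omega
  have hw : 1 ≤ q.primeFactors.card := by
    rw [Nat.one_le_iff_ne_zero, Finset.card_ne_zero]
    exact Nat.nonempty_primeFactors.mpr (by omega)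
  obtain ⟨l, hl1, hl2⟩ := exists_dyadic_level _ hw
  have hP : ∀ p ∈ q.primeFactors, p.Prime := fun p hp => Nat.prime_of_mem_primeFactors hp
  have h1 := sum_log_div_le _ hP l hl2
  have h2 := prod_one_add_inv_le _ hP l hl2
  have h3 := inv_le_prod_one_add_inv q hq0
  have h4 := card_mul_le_log q hq0 l hl1
  have hφ : (0 : ℝ) < q.totient := by exact_mod_cast Nat.totient_pos.mpr (by omega)
  have hqr : (0 : ℝ) < q := by exact_mod_cast (by omega : 0 < q)
  have h5 : (q : ℝ) / q.totient ≤ 2 * (81 * ((l : ℝ) + 2) ^ 2) := by linarith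
  have hl0 : (0 : ℝ) ≤ l := Nat.cast_nonneg l
  constructor
  · have h6 : sieveError q ≤ 81 * ((l : ℝ) + 2) ^ 2 * (1 + 3 * (l + 2)) := by
      unfold sieveError
      refine mul_le_mul h2 (by linarith) ?_ (by positivity)
      exact add_nonneg zero_le_one (Finset.sum_nonneg fun p _ => div_nonneg (Real.log_natCast_nonneg p) (by positivity))
    have h7 : ((l : ℝ) + 2) ^ 5 ≤ 120 * 2 ^ 5 * 2 ^ (l + 2) := by
      have := Real.pow_div_factorial_le_exp ((l + 2 : ℝ) * Real.log 2) (by positivity) 5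
      rw [mul_comm _ (Real.log 2), Real.exp_mul, Real.exp_log (by norm_num)] at this
      have e : (2 : ℝ) ^ ((l : ℝ) + 2) = 2 ^ (l + 2) := by
        rw [← Real.rpow_natCast]; push_cast; rfl
      rw [e, div_le_iff₀ (by positivity), mul_pow] at this
      have hl2' : 1 / 2 < Real.log 2 := by have := Real.log_two_gt_d9; linarith
      have h8 : (1 / 2 : ℝ) ^ 5 ≤ Real.log 2 ^ 5 := pow_le_pow_left₀ (by norm_num) hl2'.le 5
      have h9 : (1 / 2 : ℝ) ^ 5 * ((l : ℝ) + 2) ^ 5 ≤ 2 ^ (l + 2) * (Nat.factorial 5 : ℝ) :=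
        (mul_le_mul_of_nonneg_right h8 (by positivity)).trans this
      have e5 : (Nat.factorial 5 : ℝ) = 120 := by norm_num [Nat.factorial]
      rw [e5] at h9
      linarith
    have h8 : (2 : ℝ) ^ (l + 2) ≤ 4 * q.primeFactors.card := by
      have : ((2 ^ l : ℕ) : ℝ) ≤ q.primeFactors.card := by exact_mod_cast hl1
      push_cast at this
      rw [pow_add]; linarith
    have h9 : sieveError q * (q / q.totient) ≤ 2 * 81 ^ 2 * 4 * (120 * 2 ^ 5) * 4 * q.primeFactors.card := by
      calc sieveError q * (q / q.totient) ≤ (81 * ((l : ℝ) + 2) ^ 2 * (1 + 3 * (l + 2))) * (2 * (81 * ((l : ℝ) + 2) ^ 2)) :=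
            mul_le_mul h6 h5 (by positivity) (by positivity)
        _ ≤ (81 * ((l : ℝ) + 2) ^ 2 * (4 * (l + 2))) * (2 * (81 * ((l : ℝ) + 2) ^ 2)) := by
            gcongr; linarith
        _ = 2 * 81 ^ 2 * 4 * ((l : ℝ) + 2) ^ 5 := by ring
        _ ≤ 2 * 81 ^ 2 * 4 * (120 * 2 ^ 5 * (4 * q.primeFactors.card)) := by
            refine mul_le_mul_of_nonneg_left (h7.trans ?_) (by norm_num)
            exact mul_le_mul_of_nonneg_left h8 (by norm_num)
        _ = _ := by ring
    calc sieveError q = sieveError q * (q / q.totient) * (q.totient / q) := by field_simp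
      _ ≤ (2 * 81 ^ 2 * 4 * (120 * 2 ^ 5) * 4 * q.primeFactors.card) * (q.totient / q) := by gcongr
      _ = _ := by ring
  · have h6 : Real.sqrt (q / q.totient) ≤ 13 * (l + 2) := by
      rw [Real.sqrt_le_left (by positivity)]
      nlinarith
    have hlog : 0 ≤ Real.log q := Real.log_natCast_nonneg q
    calc (q.primeFactors.card : ℝ) * Real.sqrt (q / q.totient) ≤ q.primeFactors.card * (13 * (l + 2)) := by gcongr
      _ = 13 * (q.primeFactors.card * (l + 2)) := by ring
      _ ≤ 13 * (8 * Real.log q) := by gcongr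
      _ ≤ _ := by nlinarith

open scoped Classical in
/-- The number of primitive Dirichlet characters modulo `q`, as a real number. -/
noncomputable def primCount (q : ℕ) : ℝ :=
  ((Finset.univ.filter fun χ : DirichletCharacter ℂ q => χ.IsPrimitive).card : ℝ)

/-- Euler's totient function as a real arithmetic function. -/
noncomputable def totientArith : ArithmeticFunction ℝ := ⟨fun n => (n.totient : ℝ), by simp⟩

theorem totientArith_apply (n : ℕ) : totientArith n = n.totient := rfl

theorem isMultiplicative_totientArith : totientArith.IsMultiplicative := by
  refine ⟨by simp [totientArith_apply], fun {m n} h => ?_⟩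
  simp only [totientArith_apply]
  rw [Nat.totient_mul h, Nat.cast_mul]

/-- The multiplicative function counting primitive characters. -/
noncomputable def primCountArith : ArithmeticFunction ℝ :=
  (ArithmeticFunction.moebius : ArithmeticFunction ℝ) * totientArith

theorem isMultiplicative_primCountArith : primCountArith.IsMultiplicative :=
  ArithmeticFunction.isMultiplicative_moebius.intCast.mul isMultiplicative_totientArith

theorem primCount_eq (q : ℕ) [NeZero q] : primCount q = primCountArith q := by
  classical
  have h := DirichletCharacter.sum_primitive_eq (q := q) (fun _ => 1)
  rw [← Finset.sum_filter, Finset.sum_const, nsmul_eq_mul, mul_one] at h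
  rw [primCount]
  convert! h using 1
  rw [primCountArith, ArithmeticFunction.mul_apply,
    Nat.sum_divisorsAntidiagonal' (fun a b => (ArithmeticFunction.moebius : ArithmeticFunction ℝ) a * totientArith b),
    ← Finset.sum_attach]
  refine Finset.sum_congr rfl fun k _ => ?_
  have : NeZero k.1 := ⟨(Nat.pos_of_mem_divisors k.2).ne'⟩
  rw [Finset.sum_const, nsmul_eq_mul, mul_one, Finset.card_univ, ← Nat.card_eq_fintype_card,
      DirichletCharacter.card_eq_totient_of_hasEnoughRootsOfUnity]
  rfl

theorem primCountArith_prime_pow {p : ℕ} (hp : p.Prime) (k : ℕ) :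
    primCountArith (p ^ (k + 1)) = ((p ^ (k + 1)).totient : ℝ) - (p ^ k).totient := by
  rw [primCountArith, ArithmeticFunction.mul_apply,
    Nat.sum_divisorsAntidiagonal (fun a b => (ArithmeticFunction.moebius : ArithmeticFunction ℝ) a * totientArith b),
    Nat.sum_divisors_prime_pow hp, Finset.sum_range_succ', Finset.sum_range_succ', Finset.sum_eq_zero]
  · rw [pow_zero, zero_add, pow_one, Nat.div_one, ArithmeticFunction.intCoe_apply, ArithmeticFunction.intCoe_apply,
      ArithmeticFunction.moebius_apply_prime hp, ArithmeticFunction.moebius_apply_one, pow_succ p k,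
      Nat.mul_div_cancel _ hp.pos, totientArith_apply, totientArith_apply]
    push_cast; ring
  · intro i _
    rw [ArithmeticFunction.intCoe_apply, ArithmeticFunction.moebius_apply_prime_pow hp (by omega), if_neg (by omega)]
    simp

/-- The ratio between the primitive character count and `φ(q)² / q` at odd primes exactly dividing `q`. -/
noncomputable def oddCorrection (n : ℕ) : ℝ := ∏ p ∈ n.primeFactors.erase 2, (1 - 1 / ((p - 1 : ℕ) : ℝ) ^ 2)

theorem oddCorrection_ge (n : ℕ) : 1 / 2 ≤ oddCorrection n := by
  have h := prod_one_sub_sq_ge ((n.primeFactors.erase 2).image (fun p => p - 1)) (by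
    intro m hm
    obtain ⟨p, hp, rfl⟩ := Finset.mem_image.mp hm
    obtain ⟨h1, h2⟩ := Finset.mem_erase.mp hp
    have := (Nat.prime_of_mem_primeFactors h2).two_le
    omega)
  rw [Finset.prod_image] at h
  · exact h
  · intro a ha b hb hab
    have h1 := (Nat.prime_of_mem_primeFactors (Finset.mem_of_mem_erase ha)).two_le
    have h2 := (Nat.prime_of_mem_primeFactors (Finset.mem_of_mem_erase hb)).two_le
    simp only at hab
    omega

theorem le_primCountArith (n : ℕ) (hn : n ≠ 0) (h4 : n % 4 ≠ 2) :
    (n.totient : ℝ) ^ 2 / n * oddCorrection n ≤ primCountArith n := by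
  induction n using Nat.recOnPosPrimePosCoprime with
  | zero => exact absurd rfl hn
  | one => simp [oddCorrection, isMultiplicative_primCountArith.1]
  | prime_pow p k hp hk =>
    obtain ⟨m, rfl⟩ : ∃ m, k = m + 1 := ⟨k - 1, by omega⟩
    rw [primCountArith_prime_pow hp, oddCorrection, Nat.primeFactors_prime_pow (by omega) hp]
    have hp1 : (2 : ℝ) ≤ p := by exact_mod_cast hp.two_le
    have hc : ((p - 1 : ℕ) : ℝ) = p - 1 := by rw [Nat.cast_sub hp.one_le]; simp
    rw [Nat.totient_prime_pow_succ hp]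
    push_cast
    rw [hc]
    rcases Nat.eq_zero_or_pos m with rfl | hm
    · have hp2 : p ≠ 2 := by rintro rfl; simp at h4
      have : ({p} : Finset ℕ).erase 2 = {p} := by
        rw [Finset.erase_eq_of_notMem]; simpa using hp2.symm
      rw [this, Finset.prod_singleton, hc]
      have h1 : (p : ℝ) - 1 ≠ 0 := by linarith
      have h2 : (p : ℝ) ≠ 0 := by linarith
      simp only [pow_zero, one_mul, zero_add, pow_one, Nat.totient_one, Nat.cast_one]
      apply le_of_eq
      field_simp
      ring
    · obtain ⟨j, rfl⟩ : ∃ j, m = j + 1 := ⟨m - 1, by omega⟩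
      rw [Nat.totient_prime_pow_succ hp]
      push_cast
      rw [hc]
      have h1 : ∏ r ∈ ({p} : Finset ℕ).erase 2, (1 - 1 / ((r - 1 : ℕ) : ℝ) ^ 2) ≤ 1 := by
        refine Finset.prod_le_one (fun r hr => ?_) (fun r hr => ?_)
        · obtain ⟨h5, h6⟩ := Finset.mem_erase.mp hr
          rw [Finset.mem_singleton.mp h6, hc]
          rw [Finset.mem_singleton.mp h6] at h5
          have : (3 : ℝ) ≤ p := by exact_mod_cast (by have := hp.two_le; omega : 3 ≤ p)
          have : 1 / ((p : ℝ) - 1) ^ 2 ≤ 1 := by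
            rw [div_le_one (by nlinarith)]; nlinarith
          linarith
        · have : 0 ≤ 1 / ((r - 1 : ℕ) : ℝ) ^ 2 := by positivity
          linarith
      have h2 : ((p : ℝ) ^ (j + 1) * (p - 1)) ^ 2 / p ^ (j + 1 + 1) = p ^ (j + 1) * (p - 1) - p ^ j * (p - 1) := by
        have : (p : ℝ) ≠ 0 := by linarith
        field_simp
        ring
      rw [h2]
      refine mul_le_of_le_one_right ?_ h1
      rw [← h2]; positivity
  | coprime a b ha hb hab iha ihb =>
    have ha' : a % 4 ≠ 2 := by
      intro h
      have hb2 : b % 2 = 1 := by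
        by_contra h'
        have := Nat.dvd_gcd (show 2 ∣ a by omega) (show 2 ∣ b by omega)
        rw [hab] at this; omega
      apply h4
      rw [Nat.mul_mod, h]
      have : b % 4 = 1 ∨ b % 4 = 3 := by omega
      rcases this with h' | h' <;> rw [h']
    have hb' : b % 4 ≠ 2 := by
      intro h
      have hb2 : a % 2 = 1 := by
        by_contra h'
        have := Nat.dvd_gcd (show 2 ∣ a by omega) (show 2 ∣ b by omega)
        rw [hab] at this; omega
      apply h4
      rw [Nat.mul_mod, h]
      have : a % 4 = 1 ∨ a % 4 = 3 := by omega
      rcases this with h' | h' <;> rw [h']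
    have h1 := iha (by omega) ha'
    have h2 := ihb (by omega) hb'
    have e : oddCorrection (a * b) = oddCorrection a * oddCorrection b := by
      unfold oddCorrection
      rw [hab.primeFactors_mul, Finset.erase_union_distrib, Finset.prod_union]
      exact Finset.disjoint_of_subset_left (Finset.erase_subset _ _)
        (Finset.disjoint_of_subset_right (Finset.erase_subset _ _) hab.disjoint_primeFactors)
    rw [isMultiplicative_primCountArith.map_mul_of_coprime hab, e, Nat.totient_mul hab]
    have h3 := oddCorrection_ge a
    have h5 := oddCorrection_ge b
    push_cast
    calc _ = ((a.totient : ℝ) ^ 2 / a * oddCorrection a) * ((b.totient : ℝ) ^ 2 / b * oddCorrection b) := by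
          rw [mul_pow, mul_div_mul_comm]; ring
      _ ≤ _ := mul_le_mul h1 h2 (by positivity) (le_trans (by positivity) h1)

theorem primCount_nonneg (q : ℕ) : 0 ≤ primCount q := Nat.cast_nonneg _

theorem primCount_le (q : ℕ) [NeZero q] : primCount q ≤ q.totient := by
  classical
  have h : Fintype.card (DirichletCharacter ℂ q) = q.totient := by
    rw [← Nat.card_eq_fintype_card, DirichletCharacter.card_eq_totient_of_hasEnoughRootsOfUnity]
  rw [primCount, ← h]
  exact_mod_cast Finset.card_filter_le _ _

theorem primCount_eq_zero_or_le (q : ℕ) [NeZero q] :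
    primCount q = 0 ∨ (q.totient : ℝ) ^ 2 ≤ 2 * q * primCount q := by
  have hq0 : (0 : ℝ) < q := by exact_mod_cast Nat.pos_of_ne_zero (NeZero.ne q)
  rw [primCount_eq]
  by_cases h4 : q % 4 = 2
  · left
    obtain ⟨m, rfl⟩ : ∃ m, q = 2 * m := ⟨q / 2, by omega⟩
    have hc : Nat.Coprime 2 m := by
      rw [Nat.coprime_two_left, Nat.odd_iff]; omega
    have h2 := primCountArith_prime_pow Nat.prime_two 0
    rw [isMultiplicative_primCountArith.map_mul_of_coprime hc]
    simp only [zero_add, pow_one, pow_zero, Nat.totient_one, Nat.totient_two, sub_self] at h2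
    rw [h2, zero_mul]
  · right
    have h1 := le_primCountArith q (NeZero.ne q) h4
    have h2 := oddCorrection_ge q
    have h3 : (q.totient : ℝ) ^ 2 / q * (1 / 2) ≤ primCountArith q :=
      le_trans (by gcongr) h1
    rw [div_mul_eq_mul_div, div_le_iff₀ hq0] at h3
    linarith

/-- Coprime pairs of positive integers, both coprime to `q`, with product at most `X`. -/
noncomputable def reducedPairs (q : ℕ) (X : ℝ) : Finset (ℕ × ℕ) :=
  (pairsLE X).filter fun i => i.1.Coprime i.2 ∧ i.1.Coprime q ∧ i.2.Coprime q

theorem mem_reducedPairs {q : ℕ} {X : ℝ} {i : ℕ × ℕ} : i ∈ reducedPairs q X ↔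
    (0 < i.1 ∧ 0 < i.2 ∧ ((i.1 * i.2 : ℕ) : ℝ) ≤ X) ∧ i.1.Coprime i.2 ∧ i.1.Coprime q ∧ i.2.Coprime q := by
  rw [reducedPairs, Finset.mem_filter, mem_pairsLE]

theorem le_sqrt_div_iff {X m : ℝ} {g : ℕ} (hm : 0 < m) : (g : ℝ) ≤ √(X / m) ↔ (g : ℝ) = 0 ∨ (g : ℝ) ^ 2 * m ≤ X := by
  rcases Nat.eq_zero_or_pos g with rfl | hg
  · simp
  have hg0 : (0 : ℝ) < g := by exact_mod_cast hg
  rw [Real.le_sqrt' hg0, le_div_iff₀ hm]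
  constructor
  · exact fun h => Or.inr h
  · rintro (h | h)
    · exact absurd h hg0.ne'
    · exact h

theorem mem_Icc_floor_sqrt {X m : ℝ} {g : ℕ} (hm : 0 < m) :
    g ∈ Finset.Icc 1 ⌊√(X / m)⌋₊ ↔ 0 < g ∧ (g : ℝ) ^ 2 * m ≤ X := by
  rw [Finset.mem_Icc]
  constructor
  · rintro ⟨h1, h2⟩
    have := (Nat.le_floor_iff (Real.sqrt_nonneg _)).mp h2
    refine ⟨h1, ?_⟩
    rcases (le_sqrt_div_iff hm).mp this with h | h
    · exact absurd h (by exact_mod_cast (show g ≠ 0 by omega))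
    · exact h
  · rintro ⟨h1, h2⟩
    exact ⟨h1, Nat.le_floor ((le_sqrt_div_iff hm).mpr (Or.inr h2))⟩

theorem pairPoly_pairsLE_eq {q : ℕ} [NeZero q] (χ : DirichletCharacter ℂ q) (t Y : ℝ) (F : ℕ → ℂ) :
    pairPoly (pairsLE Y) (fun i => F (i.1 * i.2)) χ t =
      pairPoly (reducedPairs q Y) (fun i => ∑ g ∈ (Finset.Icc 1 ⌊√(Y / ((i.1 : ℝ) * i.2))⌋₊).filter (fun g => g.Coprime q),
        F (g ^ 2 * (i.1 * i.2))) χ t := by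
  unfold pairPoly
  have h0 : ∀ n : ℕ, ¬ n.Coprime q → χ n = 0 := fun n hn =>
    MulChar.map_nonunit _ (fun hu => hn ((ZMod.isUnit_iff_coprime n q).mp hu))
  have h1 : ∀ n : ℕ, n.Coprime q → χ n * starRingEnd ℂ (χ n) = 1 := fun n hn => by
    have hu : ‖χ n‖ = 1 := by simpa using χ.unit_norm_eq_one (ZMod.unitOfCoprime n hn)
    rw [Complex.mul_conj, Complex.normSq_eq_norm_sq, hu]; simp
  rw [← Finset.sum_filter_of_ne (p := fun i : ℕ × ℕ => i.1.Coprime q ∧ i.2.Coprime q)]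
  · simp only [Finset.sum_mul]
    rw [Finset.sum_sigma']
    symm
    refine Finset.sum_bij' (fun x _ => (x.2 * x.1.1, x.2 * x.1.2))
      (fun i _ => ⟨(i.1 / i.1.gcd i.2, i.2 / i.1.gcd i.2), i.1.gcd i.2⟩) ?_ ?_ ?_ ?_ ?_
    · rintro ⟨i, g⟩ hx
      rw [Finset.mem_sigma, mem_reducedPairs, Finset.mem_filter] at hx
      obtain ⟨⟨⟨a1, a2, a3⟩, a4, a5, a6⟩, b1, b2⟩ := hx
      have hm : (0 : ℝ) < (i.1 : ℝ) * i.2 := by positivity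
      rw [mem_Icc_floor_sqrt hm] at b1
      rw [Finset.mem_filter, mem_pairsLE]
      refine ⟨⟨Nat.mul_pos b1.1 a1, Nat.mul_pos b1.1 a2, ?_⟩, Nat.Coprime.mul_left b2 a5, Nat.Coprime.mul_left b2 a6⟩
      push_cast
      linarith [b1.2]
    · rintro ⟨a, b⟩ hi
      rw [Finset.mem_filter, mem_pairsLE] at hi
      obtain ⟨⟨a1, a2, a3⟩, a4, a5⟩ := hi
      simp only at a1 a2 a3 a4 a5
      have hg : 0 < a.gcd b := Nat.gcd_pos_of_pos_left _ a1
      obtain ⟨m, hm⟩ := Nat.gcd_dvd_left a b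
      obtain ⟨n, hn⟩ := Nat.gcd_dvd_right a b
      have e1 : a / a.gcd b = m := Nat.div_eq_of_eq_mul_right hg hm
      have e2 : b / a.gcd b = n := Nat.div_eq_of_eq_mul_right hg hn
      have hmn := Nat.coprime_div_gcd_div_gcd hg
      rw [e1, e2] at hmn
      have hm0 : 0 < m := Nat.pos_of_mul_pos_left (hm ▸ a1)
      have hn0 : 0 < n := Nat.pos_of_mul_pos_left (hn ▸ a2)
      rw [Finset.mem_sigma, mem_reducedPairs, Finset.mem_filter]
      simp only [e1, e2]
      have hmr : (0 : ℝ) < (m : ℝ) * n := by positivity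
      rw [mem_Icc_floor_sqrt hmr]
      have key : ((a.gcd b : ℕ) : ℝ) ^ 2 * ((m : ℝ) * n) = ((a * b : ℕ) : ℝ) := by
        have h7 : (a : ℝ) = ((a.gcd b : ℕ) : ℝ) * m := by exact_mod_cast hm
        have h8 : (b : ℝ) = ((a.gcd b : ℕ) : ℝ) * n := by exact_mod_cast hn
        calc _ = (((a.gcd b : ℕ) : ℝ) * m) * (((a.gcd b : ℕ) : ℝ) * n) := by ring
          _ = (a : ℝ) * b := by rw [← h7, ← h8]
          _ = _ := by push_cast; ring
      have hg1 : (1 : ℝ) ≤ ((a.gcd b : ℕ) : ℝ) ^ 2 := one_le_pow₀ (by exact_mod_cast hg)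
      refine ⟨⟨⟨hm0, hn0, ?_⟩, hmn, ?_, ?_⟩, ⟨hg, ?_⟩, ?_⟩
      · push_cast
        rw [← key] at a3
        nlinarith
      · exact Nat.Coprime.coprime_dvd_left ⟨_, by rw [mul_comm]; exact hm⟩ a4
      · exact Nat.Coprime.coprime_dvd_left ⟨_, by rw [mul_comm]; exact hn⟩ a5
      · rw [key]; exact a3
      · exact Nat.Coprime.coprime_dvd_left (Nat.gcd_dvd_left a b) a4
    · rintro ⟨⟨a, b⟩, g⟩ hx
      rw [Finset.mem_sigma, mem_reducedPairs, Finset.mem_filter, Finset.mem_Icc] at hx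
      obtain ⟨⟨⟨a1, a2, a3⟩, a4, a5, a6⟩, b1, b2⟩ := hx
      simp only at a4 b1
      have hg : (g * a).gcd (g * b) = g := by rw [Nat.gcd_mul_left, a4, mul_one]
      simp only [hg, Nat.mul_div_cancel_left _ b1.1]
    · rintro ⟨a, b⟩ hi
      simp only [Nat.mul_div_cancel' (Nat.gcd_dvd_left a b), Nat.mul_div_cancel' (Nat.gcd_dvd_right a b)]
    · rintro ⟨⟨a, b⟩, g⟩ hx
      rw [Finset.mem_sigma, mem_reducedPairs, Finset.mem_filter, Finset.mem_Icc] at hx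
      obtain ⟨⟨⟨a1, a2, a3⟩, a4, a5, a6⟩, b1, b2⟩ := hx
      simp only at a1 a2 b1 b2 ⊢
      have hg : (g : ℝ) ≠ 0 := by exact_mod_cast (show g ≠ 0 by omega)
      have ha : (a : ℝ) ≠ 0 := by exact_mod_cast (show a ≠ 0 by omega)
      have hb : (b : ℝ) ≠ 0 := by exact_mod_cast (show b ≠ 0 by omega)
      have e1 : Real.log ((g * a : ℕ) : ℝ) - Real.log ((g * b : ℕ) : ℝ) = Real.log a - Real.log b := by
        push_cast
        rw [Real.log_mul hg ha, Real.log_mul hg hb]; ring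
      have e2 : χ ((g * a : ℕ) : ZMod q) * starRingEnd ℂ (χ ((g * b : ℕ) : ZMod q)) = χ a * starRingEnd ℂ (χ b) := by
        push_cast
        rw [map_mul, map_mul, map_mul]
        calc _ = (χ g * starRingEnd ℂ (χ g)) * (χ a * starRingEnd ℂ (χ b)) := by ring
          _ = _ := by rw [h1 g b2, one_mul]
      rw [e1, e2]
      congr 3
      ring
  · intro i _ hne
    by_contra h
    apply hne
    rw [not_and_or] at h
    rcases h with h | h
    · rw [h0 _ h]; simp
    · rw [h0 _ h]; simp

theorem mean_value_reducedPairs_le : ∃ K : ℝ, 0 < K ∧ ∀ (q : ℕ) [NeZero q] (X : ℝ) (c : ℕ × ℕ → ℂ) (x y : ℝ),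
    1 ≤ X → x ≤ y →
    ∑ χ : DirichletCharacter ℂ q, (∫ t in x..y, ‖pairPoly (reducedPairs q X) c χ t‖ ^ 2) ≤
      K * q.totient * (y - x + 1 + X / q) * ∑ i ∈ reducedPairs q X, ‖c i‖ ^ 2 := by
  obtain ⟨K, hK0, hK⟩ := mean_value_all_characters
  refine ⟨2 * K + 1, by positivity, fun q _ X c x y hX hxy => ?_⟩
  have hq : 0 < q := Nat.pos_of_ne_zero (NeZero.ne q)
  have hq0 : (0 : ℝ) < q := by exact_mod_cast hq
  have hδ : 0 < min ((q : ℝ) / (2 * X)) 1 := lt_min (by positivity) one_pos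
  have h := hK q (reducedPairs q X) c _ x y hδ hxy
    (fun i hi => (mem_reducedPairs.mp hi).2.2)
    (fun i hi j hj hij hmod => by
      obtain ⟨⟨a1, a2, a3⟩, a4, _⟩ := mem_reducedPairs.mp hi
      obtain ⟨⟨b1, b2, b3⟩, b4, _⟩ := mem_reducedPairs.mp hj
      push_cast at a3 b3
      exact (log_ratio_spacing hq a4 b4 a1 a2 b1 b2 a3 b3 hij hmod).1)
  have h1 := (abs_le.mp h).2
  set S := ∑ i ∈ reducedPairs q X, ‖c i‖ ^ 2
  have hS : 0 ≤ S := Finset.sum_nonneg fun _ _ => by positivity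
  have hφ0 : (0 : ℝ) ≤ q.totient := Nat.cast_nonneg _
  have hXq : 0 ≤ X / q := by positivity
  have h3 : 1 / min ((q : ℝ) / (2 * X)) 1 ≤ 2 * (X / q) + 1 := by
    rcases min_choice ((q : ℝ) / (2 * X)) 1 with h | h <;> rw [h]
    · rw [one_div_div, mul_div_assoc]; linarith
    · linarith
  have h5 : K * (1 / min ((q : ℝ) / (2 * X)) 1) ≤ K * (2 * (X / q) + 1) := by gcongr
  have h6 : (q.totient : ℝ) * S * (y - x + K * (1 / min ((q : ℝ) / (2 * X)) 1)) ≤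
      q.totient * S * ((2 * K + 1) * (y - x + 1 + X / q)) := by
    refine mul_le_mul_of_nonneg_left ?_ (by positivity)
    have : 0 ≤ K * (y - x) := mul_nonneg hK0.le (by linarith)
    nlinarith
  have e1 : (q.totient : ℝ) * (K / min ((q : ℝ) / (2 * X)) 1) * S = q.totient * S * (K * (1 / min ((q : ℝ) / (2 * X)) 1)) := by
    ring
  linarith

/-- The sum of `1/n` over `n ≤ √(Y/(ab))` coprime to `q`. -/
noncomputable def copSum (q : ℕ) (Y : ℝ) (i : ℕ × ℕ) : ℝ :=
  ∑ n ∈ Finset.Icc 1 ⌊√(Y / ((i.1 : ℝ) * i.2))⌋₊, copRecip q n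

/-- The coefficients of the central Dirichlet polynomial of length `Y`, written over reduced pairs. -/
noncomputable def critCoeff (q : ℕ) (Y : ℝ) (i : ℕ × ℕ) : ℂ :=
  (((√((i.1 : ℝ) * i.2))⁻¹ * copSum q Y i : ℝ) : ℂ)

theorem copSum_eq_zero {q : ℕ} {Y : ℝ} {i : ℕ × ℕ} (h : Y < (i.1 : ℝ) * i.2) : copSum q Y i = 0 := by
  rw [copSum, Finset.Icc_eq_empty, Finset.sum_empty]
  have h1 : √(Y / ((i.1 : ℝ) * i.2)) < 1 := by
    rw [Real.sqrt_lt' one_pos, one_pow]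
    rcases le_or_gt ((i.1 : ℝ) * i.2) 0 with h0 | h0
    · have : (i.1 : ℝ) * i.2 = 0 := le_antisymm h0 (by positivity)
      rw [this]; simp
    · rw [div_lt_one h0]; exact h
  have h2 : ⌊√(Y / ((i.1 : ℝ) * i.2))⌋₊ = 0 := Nat.floor_eq_zero.mpr h1
  omega

theorem norm_cpow_neg_half (n : ℕ) (s : ℂ) (hn : 0 < n) :
    ‖(n : ℂ) ^ (-(1 / 2 + s))‖ = (√(n : ℝ))⁻¹ * (n : ℝ) ^ (-s.re) := by
  rw [Complex.norm_natCast_cpow_of_pos hn, Real.sqrt_eq_rpow, ← Real.rpow_neg (Nat.cast_nonneg _),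
    ← Real.rpow_add (by exact_mod_cast hn)]
  congr 1
  simp; ring

theorem natCast_cpow_neg_half (n : ℕ) :
    (n : ℂ) ^ (-(1 / 2 + 0) : ℂ) = (((√(n : ℝ))⁻¹ : ℝ) : ℂ) := by
  rw [Real.sqrt_eq_rpow, ← Real.rpow_neg (Nat.cast_nonneg _), Complex.ofReal_cpow (Nat.cast_nonneg _)]
  push_cast
  congr 1
  ring

theorem sum_filter_coprime_eq_copSum (q : ℕ) (Y : ℝ) (i : ℕ × ℕ) :
    ∑ g ∈ (Finset.Icc 1 ⌊√(Y / ((i.1 : ℝ) * i.2))⌋₊).filter (fun g => g.Coprime q), (1 / g : ℝ) = copSum q Y i := by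
  rw [copSum, Finset.sum_filter]
  rfl

theorem pairSum_zero_eq {q : ℕ} [NeZero q] (χ : DirichletCharacter ℂ q) (t : ℝ) (Y : ℝ) :
    pairSum (pairsLE Y) χ t 0 = pairPoly (reducedPairs q Y) (critCoeff q Y) χ t := by
  rw [pairSum, pairPoly_pairsLE_eq χ t Y (fun n => (n : ℂ) ^ (-(1 / 2 + 0) : ℂ))]
  unfold pairPoly
  refine Finset.sum_congr rfl fun i hi => ?_
  obtain ⟨⟨a1, a2, _⟩, _⟩ := mem_reducedPairs.mp hi
  congr 2
  rw [critCoeff, ← sum_filter_coprime_eq_copSum, Finset.mul_sum, Complex.ofReal_sum]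
  refine Finset.sum_congr rfl fun g hg => ?_
  have hg0 : 0 < g := (Finset.mem_Icc.mp (Finset.mem_filter.mp hg).1).1
  rw [natCast_cpow_neg_half]
  congr 1
  push_cast
  rw [Real.sqrt_mul (by positivity), Real.sqrt_sq (by positivity), mul_inv, one_div, mul_comm]

theorem pairSum_zero_eq_of_le {q : ℕ} [NeZero q] (χ : DirichletCharacter ℂ q) (t : ℝ) {Y X : ℝ} (h : Y ≤ X) :
    pairSum (pairsLE Y) χ t 0 = pairPoly (reducedPairs q X) (critCoeff q Y) χ t := by
  rw [pairSum_zero_eq]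
  unfold pairPoly
  refine Finset.sum_subset ?_ fun i hi hni => ?_
  · intro i hi
    rw [mem_reducedPairs] at hi ⊢
    exact ⟨⟨hi.1.1, hi.1.2.1, hi.1.2.2.trans h⟩, hi.2⟩
  · rw [mem_reducedPairs] at hi hni
    have : Y < (i.1 : ℝ) * i.2 := by
      by_contra hc
      push Not at hc
      exact hni ⟨⟨hi.1.1, hi.1.2.1, by push_cast; exact hc⟩, hi.2⟩
    rw [critCoeff, copSum_eq_zero this]; simp

theorem pairPoly_sub {k : ℕ} (S : Finset (ℕ × ℕ)) (c d : ℕ × ℕ → ℂ) (χ : DirichletCharacter ℂ k) (t : ℝ) :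
    pairPoly S c χ t - pairPoly S d χ t = pairPoly S (fun i => c i - d i) χ t := by
  unfold pairPoly
  rw [← Finset.sum_sub_distrib]
  exact Finset.sum_congr rfl fun _ _ => by ring

theorem abs_sum_copRecip_sub_le {q : ℕ} (hq : q ≠ 0) {x : ℝ} (hx : 0 < x) :
    |∑ n ∈ Finset.Icc 1 ⌊x⌋₊, copRecip q n - (q.totient : ℝ) / q * max 0 (Real.log x)| ≤ sieveError q := by
  rw [sum_copRecip hq, totient_div_eq_prod q hq]
  exact abs_siftedHarmonic_sub_le _ (fun r hr => Nat.prime_of_mem_primeFactors hr) hx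

theorem sum_norm_critCoeff_sq (q : ℕ) (Y : ℝ) :
    ∑ i ∈ reducedPairs q Y, ‖critCoeff q Y i‖ ^ 2 =
      ∑ i ∈ (pairsLE Y).filter (fun i => i.1.Coprime i.2), copRecip q i.1 * copRecip q i.2 *
        (∑ n ∈ Finset.Icc 1 ⌊√(Y / (i.1 * i.2))⌋₊, copRecip q n) ^ 2 := by
  have hs : reducedPairs q Y ⊆ (pairsLE Y).filter (fun i => i.1.Coprime i.2) := fun i hi => by
    rw [Finset.mem_filter, mem_pairsLE]
    rw [mem_reducedPairs] at hi
    exact ⟨hi.1, hi.2.1⟩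
  rw [← Finset.sum_subset hs]
  · refine Finset.sum_congr rfl fun i hi => ?_
    rw [mem_reducedPairs] at hi
    rw [copRecip_of_coprime hi.2.2.1, copRecip_of_coprime hi.2.2.2, critCoeff, Complex.norm_real, Real.norm_eq_abs,
      sq_abs, mul_pow, inv_pow, Real.sq_sqrt (by positivity), copSum]
    congr 1
    field_simp
  · intro i hi hni
    rw [Finset.mem_filter, mem_pairsLE] at hi
    rw [mem_reducedPairs] at hni
    by_cases h1 : i.1.Coprime q
    · have h2 : ¬ i.2.Coprime q := fun h2 => hni ⟨hi.1, hi.2, h1, h2⟩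
      rw [show copRecip q i.2 = 0 from if_neg h2]; ring
    · rw [show copRecip q i.1 = 0 from if_neg h1]; ring

theorem card_primeFactors_le_shortening {q : ℕ} (U : ℝ) : (q.primeFactors.card : ℝ) ≤ shortening q U := by
  have h : 1 ≤ Real.log 4 := by
    rw [Real.le_log_iff_exp_le (by norm_num)]
    linarith [Real.exp_one_lt_d9]
  have h1 : (q.primeFactors.card : ℝ) * 1 ≤ q.primeFactors.card * Real.log 4 := by gcongr
  unfold shortening
  linarith [Real.sqrt_nonneg (Real.log (q * U))]

theorem card_primeFactors_le_log_mul {q : ℕ} (hq : 2 ≤ q) {U : ℝ} (hU : 1 ≤ U) :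
    (q.primeFactors.card : ℝ) ≤ 2 * Real.log (q * U) := by
  have h1 := Nat.card_primeFactors_mul_log_two_le (q := q) (by omega)
  have h2 : Real.log q ≤ Real.log (q * U) := by
    have : (2 : ℝ) ≤ q := by exact_mod_cast hq
    apply Real.log_le_log (by linarith)
    nlinarith
  have h3 := Real.log_two_gt_d9
  have h4 : (0 : ℝ) ≤ q.primeFactors.card := Nat.cast_nonneg _
  nlinarith

theorem one_le_card_primeFactors {q : ℕ} (hq : 2 ≤ q) : (1 : ℝ) ≤ q.primeFactors.card := by
  have : q.primeFactors.Nonempty := Nat.nonempty_primeFactors.mpr (by omega)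
  exact_mod_cast this.card_pos

theorem log_shortLength {q : ℕ} (hq : 2 ≤ q) {U : ℝ} (hU : 1 ≤ U) :
    Real.log (shortLength q U) = Real.log (q * U) - shortening q U := by
  have : (2 : ℝ) ≤ q := by exact_mod_cast hq
  rw [shortLength, Real.log_mul (by positivity) (Real.exp_ne_zero _), Real.log_exp]; ring

theorem shortLength_le {q : ℕ} (hq : 2 ≤ q) {U : ℝ} (hU : 1 ≤ U) : shortLength q U ≤ q * U := by
  have : (2 : ℝ) ≤ q := by exact_mod_cast hq
  have h : Real.exp (-shortening q U) ≤ 1 := Real.exp_le_one_iff.mpr (by linarith [shortening_pos hq hU])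
  unfold shortLength
  nlinarith [mul_nonneg (show (0 : ℝ) ≤ q by linarith) (show (0 : ℝ) ≤ U by linarith)]

theorem max_log_shortLength {q : ℕ} (hq : 2 ≤ q) {U : ℝ} (hU : 1 ≤ U) :
    0 ≤ max 0 (Real.log (shortLength q U)) ∧ max 0 (Real.log (shortLength q U)) ≤ Real.log (q * U) ∧
      Real.log (q * U) - max 0 (Real.log (shortLength q U)) ≤ shortening q U := by
  have h1 := log_shortLength hq hU
  have h2 := shortening_pos hq hU
  have h3 := log_two_le_log_mul hq hU
  have h4 := Real.log_two_gt_d9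
  refine ⟨le_max_left _ _, max_le (by linarith) (by linarith), ?_⟩
  have := le_max_right 0 (Real.log (shortLength q U))
  linarith

theorem abs_four_mul_sum_critCoeff_sub_le : ∃ C : ℝ, 0 < C ∧ ∀ (q : ℕ) (U : ℝ), 2 ≤ q → 1 ≤ U →
    |4 * ∑ i ∈ reducedPairs q (shortLength q U), ‖critCoeff q (shortLength q U) i‖ ^ 2 -
      momentConst q * Real.log (q * U) ^ 4| ≤
      C * ((q.totient : ℝ) / q) ^ 4 * shortening q U * Real.log (q * U) ^ 3 := by
  obtain ⟨K, hK0, hK⟩ := abs_coprime_pairs_main_le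
  obtain ⟨C₁, hC₁, hE⟩ := exists_arithmetic_bounds
  refine ⟨4 * K * (C₁ * (1 + 2 * C₁) ^ 3 + 1) + 4, by positivity, fun q U hq hU => ?_⟩
  have hq0 : q ≠ 0 := by omega
  set ρ := (q.totient : ℝ) / q with hρ
  set L := Real.log (q * U) with hL
  set J := shortening q U with hJ
  set w := (q.primeFactors.card : ℝ) with hw
  set E := sieveError q with hEd
  set Y := shortLength q U with hY
  set l := max 0 (Real.log Y) with hl
  have hρ0 : 0 ≤ ρ := by positivity
  have hJ0 : 0 < J := shortening_pos hq hU
  have hwJ : w ≤ J := card_primeFactors_le_shortening U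
  have hw1 : 1 ≤ w := one_le_card_primeFactors hq
  have hwL : w ≤ 2 * L := card_primeFactors_le_log_mul hq hU
  have hL0 : 0 < L := by linarith [Real.log_two_gt_d9, log_two_le_log_mul hq hU]
  have hE1 : E ≤ C₁ * ρ * w := (hE q hq).1
  have hE0 : 0 ≤ E := (abs_nonneg _).trans (abs_sum_copRecip_sub_le hq0 (x := 1) one_pos)
  obtain ⟨l0, lL, lJ⟩ := max_log_shortLength hq hU
  have hmain := hK (copRecip q) ρ E _ (fun m n => copRecip_mul q m n) (copRecip_nonneg q) (fun n => copRecip_le q n)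
    hρ0 hE0 (fun x hx => abs_sum_copRecip_sub_le hq0 hx) (hasSum_moebius_mul_copRecip_sq hq0) Y (shortLength_pos hq hU)
  rw [← sum_norm_critCoeff_sq] at hmain
  set D := ∑ i ∈ reducedPairs q Y, ‖critCoeff q Y i‖ ^ 2
  have hM := momentConst_eq q hq0
  have hMb := (momentConst_bounds q hq0).2
  have hM0 := momentConst_nonneg q
  rw [← hρ] at hM hMb
  have hMρ : momentConst q ≤ ρ ^ 4 := by
    refine hMb.trans ?_
    have : 1 / Real.pi ^ 2 ≤ 1 := by
      rw [div_le_one (by positivity)]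
      nlinarith [Real.pi_gt_three]
    calc _ ≤ 1 * ρ ^ 4 := by gcongr
      _ = _ := one_mul _
  have h1 : |4 * D - momentConst q * l ^ 4| ≤ 4 * (K * (E * (ρ * l + E) ^ 3 + ρ ^ 4 * l ^ 3)) := by
    rw [← hM]
    calc _ = |4 * (D - 6 / Real.pi ^ 2 * (∏ p ∈ q.primeFactors, (1 - 1 / (p : ℝ) ^ 2))⁻¹ * ρ ^ 4 / 48 * l ^ 4)| := by
          congr 1; ring
      _ = 4 * |D - 6 / Real.pi ^ 2 * (∏ p ∈ q.primeFactors, (1 - 1 / (p : ℝ) ^ 2))⁻¹ * ρ ^ 4 / 48 * l ^ 4| := by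
          rw [abs_mul, abs_of_pos (by norm_num : (0 : ℝ) < 4)]
      _ ≤ _ := by gcongr
  have h2 : E * (ρ * l + E) ^ 3 + ρ ^ 4 * l ^ 3 ≤ (C₁ * (1 + 2 * C₁) ^ 3 + 1) * (ρ ^ 4 * J * L ^ 3) := by
    have a1 : ρ * l + E ≤ (1 + 2 * C₁) * ρ * L := by
      have b1 : ρ * l ≤ ρ * L := by gcongr
      have b2 : C₁ * ρ * w ≤ C₁ * ρ * (2 * L) := by gcongr
      linarith
    have a2 : E ≤ C₁ * ρ * J := hE1.trans (by gcongr)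
    have a3 : ρ ^ 4 * l ^ 3 ≤ ρ ^ 4 * J * L ^ 3 := by
      have : l ^ 3 ≤ L ^ 3 := by gcongr
      have : L ^ 3 ≤ J * L ^ 3 := by nlinarith [pow_pos hL0 3]
      calc ρ ^ 4 * l ^ 3 ≤ ρ ^ 4 * (J * L ^ 3) := by gcongr; linarith
        _ = _ := by ring
    have a4 : E * (ρ * l + E) ^ 3 ≤ (C₁ * ρ * J) * ((1 + 2 * C₁) * ρ * L) ^ 3 := by gcongr
    calc _ ≤ (C₁ * ρ * J) * ((1 + 2 * C₁) * ρ * L) ^ 3 + ρ ^ 4 * J * L ^ 3 := add_le_add a4 a3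
      _ = _ := by ring
  have h3 : |momentConst q * l ^ 4 - momentConst q * L ^ 4| ≤ 4 * (ρ ^ 4 * J * L ^ 3) := by
    rw [← mul_sub, abs_mul, abs_of_nonneg hM0, abs_sub_comm, abs_of_nonneg (sub_nonneg.mpr (by gcongr))]
    have : L ^ 4 - l ^ 4 ≤ 4 * (J * L ^ 3) := by
      have e : L ^ 4 - l ^ 4 = (L - l) * (L ^ 3 + L ^ 2 * l + L * l ^ 2 + l ^ 3) := by ring
      have b1 : L ^ 2 * l ≤ L ^ 2 * L := by gcongr
      have b2 : L * l ^ 2 ≤ L * L ^ 2 := by gcongr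
      have b3 : l ^ 3 ≤ L ^ 3 := by gcongr
      have b0 : 0 ≤ L - l := by linarith
      rw [e]
      calc _ ≤ J * (4 * L ^ 3) := by
            apply mul_le_mul lJ _ (by positivity) hJ0.le
            nlinarith
        _ = _ := by ring
    have p : 0 ≤ 4 * (J * L ^ 3) := by positivity
    calc momentConst q * (L ^ 4 - l ^ 4) ≤ momentConst q * (4 * (J * L ^ 3)) := by gcongr
      _ ≤ ρ ^ 4 * (4 * (J * L ^ 3)) := by gcongr
      _ = _ := by ring
  calc _ ≤ |4 * D - momentConst q * l ^ 4| + |momentConst q * l ^ 4 - momentConst q * L ^ 4| := abs_sub_le _ _ _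
    _ ≤ 4 * (K * ((C₁ * (1 + 2 * C₁) ^ 3 + 1) * (ρ ^ 4 * J * L ^ 3))) + 4 * (ρ ^ 4 * J * L ^ 3) := by
        refine add_le_add (h1.trans ?_) h3
        gcongr
    _ = _ := by ring

theorem sum_reducedPairs_inv_le : ∃ C : ℝ, 0 < C ∧ ∀ (q : ℕ) (U : ℝ), 2 ≤ q → 1 ≤ U →
    ∑ i ∈ reducedPairs q (q * U), ((i.1 : ℝ) * i.2)⁻¹ ≤ C * ((q.totient : ℝ) / q) ^ 2 * Real.log (q * U) ^ 2 := by
  obtain ⟨C₁, hC₁, hE⟩ := exists_arithmetic_bounds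
  refine ⟨(1 + 2 * C₁) ^ 2, by positivity, fun q U hq hU => ?_⟩
  have hq0 : q ≠ 0 := by omega
  have hq2 : (2 : ℝ) ≤ q := by exact_mod_cast hq
  have hN : 0 < (q : ℝ) * U := by positivity
  have hρ0 : 0 ≤ (q.totient : ℝ) / q := by positivity
  have hwL := card_primeFactors_le_log_mul hq hU
  have hL0 : 0 < Real.log (q * U) := by linarith [Real.log_two_gt_d9, log_two_le_log_mul hq hU]
  have h1 := (abs_le.mp (abs_sum_copRecip_sub_le hq0 hN)).2
  rw [max_eq_right hL0.le] at h1
  have h2 : sieveError q ≤ C₁ * ((q.totient : ℝ) / q) * (2 * Real.log (q * U)) :=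
    (hE q hq).1.trans (by gcongr)
  have h3 : ∑ i ∈ reducedPairs q (q * U), ((i.1 : ℝ) * i.2)⁻¹ ≤ ∑ i ∈ pairsLE (q * U), copRecip q i.1 * copRecip q i.2 := by
    calc _ = ∑ i ∈ reducedPairs q (q * U), copRecip q i.1 * copRecip q i.2 := by
          refine Finset.sum_congr rfl fun i hi => ?_
          rw [mem_reducedPairs] at hi
          rw [copRecip_of_coprime hi.2.2.1, copRecip_of_coprime hi.2.2.2, mul_inv, one_div, one_div]
      _ ≤ _ := Finset.sum_le_sum_of_subset_of_nonneg (Finset.filter_subset _ _)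
          fun i _ _ => mul_nonneg (copRecip_nonneg _ _) (copRecip_nonneg _ _)
  refine h3.trans ((sum_pairsLE_mul_le (a := copRecip q) (copRecip_nonneg q)).trans ?_)
  have h4 : 0 ≤ ∑ n ∈ Finset.Icc 1 ⌊(q : ℝ) * U⌋₊, copRecip q n := Finset.sum_nonneg fun _ _ => copRecip_nonneg _ _
  calc _ ≤ ((1 + 2 * C₁) * ((q.totient : ℝ) / q) * Real.log (q * U)) ^ 2 := by
        gcongr
        nlinarith
    _ = _ := by ring

theorem sum_norm_critCoeff_sub_sq_le : ∃ C : ℝ, 0 < C ∧ ∀ (q : ℕ) (U : ℝ), 2 ≤ q → 1 ≤ U →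
    ∑ i ∈ reducedPairs q (q * U), ‖critCoeff q (q * U) i - critCoeff q (shortLength q U) i‖ ^ 2 ≤
      C * ((q.totient : ℝ) / q) ^ 4 * shortening q U ^ 2 * Real.log (q * U) ^ 2 := by
  obtain ⟨C₁, hC₁, hE⟩ := exists_arithmetic_bounds
  obtain ⟨C₂, hC₂, hS⟩ := sum_reducedPairs_inv_le
  refine ⟨(1 + 2 * C₁) ^ 2 * C₂, by positivity, fun q U hq hU => ?_⟩
  have hq0 : q ≠ 0 := by omega
  have hq2 : (2 : ℝ) ≤ q := by exact_mod_cast hq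
  have hN : 0 < (q : ℝ) * U := by positivity
  set ρ := (q.totient : ℝ) / q with hρ
  have hρ0 : 0 ≤ ρ := by positivity
  set J := shortening q U with hJ
  have hJ0 : 0 < J := shortening_pos hq hU
  have hwJ := card_primeFactors_le_shortening (q := q) U
  have hZ := shortLength_pos hq hU
  have h2 : sieveError q ≤ C₁ * ρ * J := (hE q hq).1.trans (by gcongr)
  have key : ∀ i ∈ reducedPairs q (q * U), ‖critCoeff q (q * U) i - critCoeff q (shortLength q U) i‖ ^ 2 ≤
      ((1 + 2 * C₁) * ρ * J) ^ 2 * ((i.1 : ℝ) * i.2)⁻¹ := by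
    intro i hi
    rw [mem_reducedPairs] at hi
    obtain ⟨⟨a1, a2, _⟩, _⟩ := hi
    have hm : 0 < (i.1 : ℝ) * i.2 := by positivity
    rw [critCoeff, critCoeff, ← Complex.ofReal_sub, ← mul_sub, Complex.norm_real, Real.norm_eq_abs, sq_abs, mul_pow, inv_pow,
      Real.sq_sqrt hm.le, mul_comm]
    refine mul_le_mul_of_nonneg_right ?_ (by positivity)
    rw [← sq_abs]
    have b1 := abs_sum_copRecip_sub_le hq0 (x := √((q * U) / ((i.1 : ℝ) * i.2))) (Real.sqrt_pos.mpr (by positivity))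
    have b2 := abs_sum_copRecip_sub_le hq0 (x := √(shortLength q U / ((i.1 : ℝ) * i.2))) (Real.sqrt_pos.mpr (by positivity))
    have b3 : |max 0 (Real.log √((q * U) / ((i.1 : ℝ) * i.2))) - max 0 (Real.log √(shortLength q U / ((i.1 : ℝ) * i.2)))| ≤ J := by
      have e := abs_max_log_sub_le (x := √((q * U) / ((i.1 : ℝ) * i.2))) (p := √(Real.exp J)) (Real.sqrt_pos.mpr (by positivity))
        (Real.one_le_sqrt.mpr (Real.one_le_exp hJ0.le))
      rw [← Real.sqrt_div (by positivity), Real.log_sqrt (Real.exp_pos _).le, Real.log_exp] at e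
      have e2 : (q : ℝ) * U / ((i.1 : ℝ) * i.2) / Real.exp J = shortLength q U / ((i.1 : ℝ) * i.2) := by
        rw [shortLength, ← hJ, Real.exp_neg]
        field_simp
      rw [e2] at e
      linarith
    have b4 : |copSum q (q * U) i - copSum q (shortLength q U) i| ≤ (1 + 2 * C₁) * ρ * J := by
      rw [abs_le] at b1 b2 b3
      unfold copSum
      have b5 : ρ * (max 0 (Real.log √((q * U) / ((i.1 : ℝ) * i.2))) - max 0 (Real.log √(shortLength q U / ((i.1 : ℝ) * i.2)))) ≤ ρ * J := by
        gcongr; exact b3.2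
      have b6 : ρ * (-J) ≤ ρ * (max 0 (Real.log √((q * U) / ((i.1 : ℝ) * i.2))) - max 0 (Real.log √(shortLength q U / ((i.1 : ℝ) * i.2)))) := by
        gcongr; exact b3.1
      rw [abs_le]
      constructor <;> linarith [b1.1, b1.2, b2.1, b2.2]
    gcongr
  calc _ ≤ ∑ i ∈ reducedPairs q (q * U), ((1 + 2 * C₁) * ρ * J) ^ 2 * ((i.1 : ℝ) * i.2)⁻¹ := Finset.sum_le_sum key
    _ = ((1 + 2 * C₁) * ρ * J) ^ 2 * ∑ i ∈ reducedPairs q (q * U), ((i.1 : ℝ) * i.2)⁻¹ := by rw [Finset.mul_sum]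
    _ ≤ ((1 + 2 * C₁) * ρ * J) ^ 2 * (C₂ * ρ ^ 2 * Real.log (q * U) ^ 2) := by gcongr; exact hS q U hq hU
    _ = _ := by ring

section

open MeasureTheory

theorem integral_gaussWeight_mul_sq_le {f : ℝ → ℝ} {M : ℝ} (hf : Continuous f) (hM : ∀ u, |f u| ≤ M) :
    (∫ u : ℝ, gaussWeight u * f u) ^ 2 ≤ (∫ u : ℝ, gaussWeight u) * ∫ u : ℝ, gaussWeight u * f u ^ 2 := by
  have i0 := integrable_gaussWeight
  have i1 := integrable_gaussWeight_mul hf hM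
  have i2 : Integrable fun u => gaussWeight u * f u ^ 2 :=
    integrable_gaussWeight_mul (hf.pow 2) (C := M ^ 2) fun u => by
      rw [abs_pow]; gcongr; exact hM u
  have key : ∀ m : ℝ, 0 ≤ (∫ u : ℝ, gaussWeight u * f u ^ 2) - 2 * m * (∫ u : ℝ, gaussWeight u * f u) +
      m ^ 2 * ∫ u : ℝ, gaussWeight u := by
    intro m
    have e : (∫ u : ℝ, gaussWeight u * (f u - m) ^ 2) = (∫ u : ℝ, gaussWeight u * f u ^ 2) -
        2 * m * (∫ u : ℝ, gaussWeight u * f u) + m ^ 2 * ∫ u : ℝ, gaussWeight u := by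
      have i3 : Integrable fun u => gaussWeight u * f u ^ 2 - 2 * m * (gaussWeight u * f u) := i2.sub (i1.const_mul _)
      rw [← integral_const_mul, ← integral_const_mul, ← integral_sub i2 (i1.const_mul _),
        ← integral_add i3 (i0.const_mul _)]
      refine integral_congr_ae (Filter.Eventually.of_forall fun u => ?_)
      simp only
      ring
    rw [← e]
    exact integral_nonneg fun u => mul_nonneg (gaussWeight_nonneg u) (sq_nonneg _)
  have hW : 0 ≤ ∫ u : ℝ, gaussWeight u := integral_nonneg gaussWeight_nonneg
  set W := ∫ u : ℝ, gaussWeight u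
  set P := ∫ u : ℝ, gaussWeight u * f u
  set Q := ∫ u : ℝ, gaussWeight u * f u ^ 2
  have hd := discrim_le_zero (a := W) (b := -2 * P) (c := Q) fun m => by
    have := key m
    nlinarith
  rw [discrim] at hd
  nlinarith

theorem continuous_integral_gaussWeight_mul {f : ℝ → ℝ → ℝ} {M : ℝ} (hf : Continuous (Function.uncurry f))
    (hM : ∀ t u, |f t u| ≤ M) : Continuous fun t => ∫ u : ℝ, gaussWeight u * f t u := by
  refine continuous_of_dominated (bound := fun u => gaussWeight u * M) ?_ ?_ ?_ ?_
  · intro t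
    exact (continuous_gaussWeight.mul (hf.comp (by fun_prop : Continuous fun u : ℝ => (t, u)))).aestronglyMeasurable
  · intro t
    refine Filter.Eventually.of_forall fun u => ?_
    rw [norm_mul, Real.norm_eq_abs, abs_of_nonneg (gaussWeight_nonneg u)]
    exact mul_le_mul_of_nonneg_left (hM t u) (gaussWeight_nonneg u)
  · exact integrable_gaussWeight.mul_const M
  · refine Filter.Eventually.of_forall fun u => ?_
    exact continuous_const.mul (hf.comp (by fun_prop : Continuous fun t : ℝ => (t, u)))

theorem sum_integral_sq_gaussWeight_le {ι : Type*} [Fintype ι] {f : ι → ℝ → ℝ → ℝ} {M V x y : ℝ}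
    (hf : ∀ i, Continuous (Function.uncurry (f i))) (hM : ∀ i t u, |f i t u| ≤ M) (hxy : x ≤ y)
    (hV : ∀ u, ∑ i, (∫ t in x..y, f i t u ^ 2) ≤ V) :
    ∑ i, (∫ t in x..y, (∫ u : ℝ, gaussWeight u * f i t u) ^ 2) ≤ (∫ u : ℝ, gaussWeight u) ^ 2 * V := by
  have hW : 0 ≤ ∫ u : ℝ, gaussWeight u := integral_nonneg gaussWeight_nonneg
  set W := ∫ u : ℝ, gaussWeight u with hWd
  have hM0 : ∀ i t u, f i t u ^ 2 ≤ M ^ 2 := fun i t u => by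
    rw [← sq_abs]; gcongr; exact hM i t u
  have hcont2 : ∀ i, Continuous (Function.uncurry fun t u => f i t u ^ 2) := fun i => (hf i).pow 2
  have hprod : ∀ i, Integrable (Function.uncurry fun t u => gaussWeight u * f i t u ^ 2)
      ((volume.restrict (Set.Ioc x y)).prod volume) := by
    intro i
    have h1 : Integrable (fun p : ℝ × ℝ => (M ^ 2) * gaussWeight p.2) ((volume.restrict (Set.Ioc x y)).prod volume) :=
      Integrable.mul_prod (f := fun _ : ℝ => M ^ 2) (g := gaussWeight) (integrable_const _) integrable_gaussWeight
    refine Integrable.mono' h1 ?_ (Filter.Eventually.of_forall fun p => ?_)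
    · exact ((continuous_gaussWeight.comp continuous_snd).mul (hcont2 i)).aestronglyMeasurable
    · simp only [Function.uncurry]
      rw [norm_mul, Real.norm_eq_abs, Real.norm_eq_abs, abs_of_nonneg (gaussWeight_nonneg _), abs_of_nonneg (sq_nonneg _),
        mul_comm]
      exact mul_le_mul_of_nonneg_right (hM0 i _ _) (gaussWeight_nonneg _)
  have hswap : ∀ i, (∫ t in x..y, ∫ u : ℝ, gaussWeight u * f i t u ^ 2) =
      ∫ u : ℝ, gaussWeight u * ∫ t in x..y, f i t u ^ 2 := by
    intro i
    rw [intervalIntegral.integral_of_le hxy, integral_integral_swap (hprod i)]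
    refine integral_congr_ae (Filter.Eventually.of_forall fun u => ?_)
    simp only
    rw [integral_const_mul, intervalIntegral.integral_of_le hxy]
  have hinteg : ∀ i, Integrable fun u : ℝ => gaussWeight u * ∫ t in x..y, f i t u ^ 2 := by
    intro i
    have := (hprod i).integral_prod_right
    refine this.congr (Filter.Eventually.of_forall fun u => ?_)
    simp only [Function.uncurry]
    rw [integral_const_mul, intervalIntegral.integral_of_le hxy]
  have h1 : ∀ i, (∫ t in x..y, (∫ u : ℝ, gaussWeight u * f i t u) ^ 2) ≤
      W * ∫ u : ℝ, gaussWeight u * ∫ t in x..y, f i t u ^ 2 := by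
    intro i
    rw [← hswap, ← intervalIntegral.integral_const_mul]
    refine intervalIntegral.integral_mono_on hxy ?_ ?_ fun t _ => ?_
    · exact ((continuous_integral_gaussWeight_mul (hf i) (hM i)).pow 2).intervalIntegrable _ _
    · refine (continuous_const.mul (continuous_integral_gaussWeight_mul (hcont2 i) (M := M ^ 2)
        fun t u => ?_)).intervalIntegrable _ _
      rw [abs_of_nonneg (sq_nonneg _)]; exact hM0 i t u
    · exact integral_gaussWeight_mul_sq_le ((hf i).comp (by fun_prop : Continuous fun u : ℝ => (t, u))) (hM i t)
  calc _ ≤ ∑ i, W * ∫ u : ℝ, gaussWeight u * ∫ t in x..y, f i t u ^ 2 := Finset.sum_le_sum fun i _ => h1 i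
    _ = W * ∫ u : ℝ, gaussWeight u * ∑ i, ∫ t in x..y, f i t u ^ 2 := by
        rw [← Finset.mul_sum, ← integral_finsetSum _ fun i _ => hinteg i]
        simp only [Finset.mul_sum]
    _ ≤ W * ∫ u : ℝ, gaussWeight u * V := by
        refine mul_le_mul_of_nonneg_left ?_ hW
        refine integral_mono ?_ (integrable_gaussWeight.mul_const V) fun u =>
          mul_le_mul_of_nonneg_left (hV u) (gaussWeight_nonneg u)
        simp only [Finset.mul_sum]
        exact integrable_finsetSum _ fun i _ => hinteg i
    _ = _ := by rw [integral_mul_const, ← hWd]; ring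

theorem continuous_pairSum_line {k : ℕ} {S : Finset (ℕ × ℕ)} (hS : ∀ i ∈ S, 0 < i.1 ∧ 0 < i.2)
    (χ : DirichletCharacter ℂ k) (σ : ℂ) :
    Continuous (Function.uncurry fun t u : ℝ => ‖pairSum S χ t (σ + u * Complex.I)‖) := by
  unfold pairSum pairPoly Function.uncurry
  refine continuous_norm.comp (continuous_finsetSum _ fun i hi => ?_)
  obtain ⟨h1, h2⟩ := hS i hi
  refine Continuous.mul (Continuous.mul ?_ continuous_const) (by fun_prop)
  refine Continuous.const_cpow (by fun_prop) (Or.inl ?_)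
  exact_mod_cast (Nat.mul_pos h1 h2).ne'

end

theorem sum_inv_sqrt_le (n : ℕ) : ∑ g ∈ Finset.Icc 1 n, (√(g : ℝ))⁻¹ ≤ 2 * √(n : ℝ) := by
  induction n with
  | zero => simp
  | succ n ih =>
    rw [Finset.sum_Icc_succ_top (by omega)]
    have h0 : (0 : ℝ) ≤ n := Nat.cast_nonneg n
    have hs : 0 < √((n + 1 : ℕ) : ℝ) := Real.sqrt_pos.mpr (by positivity)
    have e1 : √((n + 1 : ℕ) : ℝ) ^ 2 = n + 1 := by rw [Real.sq_sqrt (by positivity)]; push_cast; ring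
    have e2 : √(n : ℝ) ^ 2 = n := Real.sq_sqrt h0
    have h1 : (√((n + 1 : ℕ) : ℝ))⁻¹ ≤ 2 * √((n + 1 : ℕ) : ℝ) - 2 * √(n : ℝ) := by
      rw [inv_le_iff_one_le_mul₀ hs]
      nlinarith [sq_nonneg (√((n + 1 : ℕ) : ℝ) - √(n : ℝ))]
    linarith

theorem sum_integral_pairPoly_pairsLE_le : ∃ K : ℝ, 0 < K ∧ ∀ (q : ℕ) [NeZero q] (U B : ℝ) (F : ℕ → ℂ) (x y : ℝ),
    2 ≤ q → 1 ≤ U → x ≤ y → 0 ≤ B →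
    (∀ a b : ℕ, 0 < a → 0 < b →
      ‖∑ g ∈ (Finset.Icc 1 ⌊√(q * U / ((a : ℝ) * b))⌋₊).filter (fun g => g.Coprime q), F (g ^ 2 * (a * b))‖ ≤
        B * (√((a : ℝ) * b))⁻¹) →
    ∑ χ : DirichletCharacter ℂ q, (∫ t in x..y, ‖pairPoly (pairsLE (q * U)) (fun i => F (i.1 * i.2)) χ t‖ ^ 2) ≤
      K * q * (y - x + 1 + U) * (B * Real.log (q * U)) ^ 2 := by
  obtain ⟨K, hK0, hK⟩ := mean_value_reducedPairs_le
  obtain ⟨C, hC0, hC⟩ := sum_reducedPairs_inv_le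
  refine ⟨K * C, by positivity, fun q _ U B F x y hq hU hxy hB hF => ?_⟩
  have hq2 : (2 : ℝ) ≤ q := by exact_mod_cast hq
  have hφ : (q.totient : ℝ) ≤ q := by exact_mod_cast Nat.totient_le q
  have hρ : (q.totient : ℝ) / q ≤ 1 := by rw [div_le_one (by linarith)]; exact hφ
  simp only [pairPoly_pairsLE_eq]
  refine (hK q (q * U) _ x y (by nlinarith) hxy).trans ?_
  have e : (q : ℝ) * U / q = U := by field_simp
  rw [e]
  have h1 : ∑ i ∈ reducedPairs q (q * U), ‖∑ g ∈ (Finset.Icc 1 ⌊√(q * U / ((i.1 : ℝ) * i.2))⌋₊).filter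
      (fun g => g.Coprime q), F (g ^ 2 * (i.1 * i.2))‖ ^ 2 ≤ B ^ 2 * (C * 1 * Real.log (q * U) ^ 2) := by
    calc _ ≤ ∑ i ∈ reducedPairs q (q * U), B ^ 2 * ((i.1 : ℝ) * i.2)⁻¹ := by
          refine Finset.sum_le_sum fun i hi => ?_
          rw [mem_reducedPairs] at hi
          calc _ ≤ (B * (√((i.1 : ℝ) * i.2))⁻¹) ^ 2 := by gcongr; exact hF _ _ hi.1.1 hi.1.2.1
            _ = _ := by rw [mul_pow, inv_pow, Real.sq_sqrt (by positivity)]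
      _ = B ^ 2 * ∑ i ∈ reducedPairs q (q * U), ((i.1 : ℝ) * i.2)⁻¹ := by rw [Finset.mul_sum]
      _ ≤ B ^ 2 * (C * ((q.totient : ℝ) / q) ^ 2 * Real.log (q * U) ^ 2) := by gcongr; exact hC q U hq hU
      _ ≤ _ := by gcongr; exact pow_le_one₀ (by positivity) hρ
  have h2 : 0 ≤ y - x + 1 + U := by linarith
  calc _ ≤ K * q * (y - x + 1 + U) * (B ^ 2 * (C * 1 * Real.log (q * U) ^ 2)) := by gcongr
    _ = _ := by ring

theorem sum_integral_pairSum_quarter_le : ∃ K : ℝ, 0 < K ∧ ∀ (q : ℕ) [NeZero q] (U x y : ℝ) (s : ℂ),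
    2 ≤ q → 1 ≤ U → x ≤ y → s.re = -(1 / 4) →
    ∑ χ : DirichletCharacter ℂ q, (∫ t in x..y, ‖pairSum (pairsLE (q * U)) χ t s‖ ^ 2) ≤
      K * q * (y - x + 1 + U) * ((q * U) ^ (1 / 4 : ℝ) * Real.log (q * U)) ^ 2 := by
  obtain ⟨K, hK0, hK⟩ := sum_integral_pairPoly_pairsLE_le
  refine ⟨4 * K, by positivity, fun q _ U x y s hq hU hxy hs => ?_⟩
  have hq2 : (2 : ℝ) ≤ q := by exact_mod_cast hq
  have hN : 0 < (q : ℝ) * U := by positivity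
  have h := hK q U (2 * (q * U) ^ (1 / 4 : ℝ)) (fun n => (n : ℂ) ^ (-(1 / 2 + s))) x y hq hU hxy (by positivity) ?_
  · refine h.trans (le_of_eq ?_)
    ring
  intro a b ha hb
  set m : ℝ := (a : ℝ) * b with hm
  have hm0 : 0 < m := by positivity
  set G := √(q * U / m) with hG
  have hG0 : 0 ≤ G := Real.sqrt_nonneg _
  have key : ∀ g : ℕ, 0 < g → ‖((g ^ 2 * (a * b) : ℕ) : ℂ) ^ (-(1 / 2 + s))‖ =
      (√m)⁻¹ * m ^ (1 / 4 : ℝ) * (√(g : ℝ))⁻¹ := by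
    intro g hg
    have hg0 : (0 : ℝ) < g := by exact_mod_cast hg
    rw [norm_cpow_neg_half _ _ (by positivity), hs]
    have e : ((g ^ 2 * (a * b) : ℕ) : ℝ) = (g : ℝ) ^ 2 * m := by push_cast; ring
    rw [e, Real.sqrt_mul (by positivity), Real.sqrt_sq hg0.le, neg_neg, Real.mul_rpow (by positivity) hm0.le]
    have e2 : ((g : ℝ) ^ 2) ^ (1 / 4 : ℝ) = √(g : ℝ) := by
      rw [Real.sqrt_eq_rpow, ← Real.rpow_natCast, ← Real.rpow_mul hg0.le]; norm_num
    have e3 : (g : ℝ) = √(g : ℝ) * √(g : ℝ) := (Real.mul_self_sqrt hg0.le).symm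
    rw [e2]
    have hsg : √(g : ℝ) ≠ 0 := (Real.sqrt_pos.mpr hg0).ne'
    calc _ = (√m)⁻¹ * m ^ (1 / 4 : ℝ) * ((g : ℝ)⁻¹ * √(g : ℝ)) := by rw [mul_inv]; ring
      _ = _ := by
        congr 1
        conv_lhs => rw [e3, Real.sqrt_mul_self (Real.sqrt_nonneg _)]
        field_simp
  calc _ ≤ ∑ g ∈ (Finset.Icc 1 ⌊G⌋₊).filter (fun g => g.Coprime q), (√m)⁻¹ * m ^ (1 / 4 : ℝ) * (√(g : ℝ))⁻¹ := by
        refine (norm_sum_le _ _).trans (Finset.sum_le_sum fun g hg => ?_)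
        exact (key g (Finset.mem_Icc.mp (Finset.mem_filter.mp hg).1).1).le
    _ ≤ ∑ g ∈ Finset.Icc 1 ⌊G⌋₊, (√m)⁻¹ * m ^ (1 / 4 : ℝ) * (√(g : ℝ))⁻¹ :=
        Finset.sum_le_sum_of_subset_of_nonneg (Finset.filter_subset _ _) fun _ _ _ => by positivity
    _ = (√m)⁻¹ * m ^ (1 / 4 : ℝ) * ∑ g ∈ Finset.Icc 1 ⌊G⌋₊, (√(g : ℝ))⁻¹ := by rw [Finset.mul_sum]
    _ ≤ (√m)⁻¹ * m ^ (1 / 4 : ℝ) * (2 * √G) := by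
        gcongr
        exact (sum_inv_sqrt_le _).trans (by gcongr; exact Nat.floor_le hG0)
    _ = 2 * (m ^ (1 / 4 : ℝ) * √G) * (√m)⁻¹ := by ring
    _ = _ := by
        congr 2
        rw [hG, Real.sqrt_eq_rpow, Real.sqrt_eq_rpow, ← Real.rpow_mul (by positivity), Real.div_rpow hN.le hm0.le]
        have : m ^ (1 / 4 : ℝ) ≠ 0 := (Real.rpow_pos_of_pos hm0 _).ne'
        norm_num
        field_simp

theorem pairSum_sdiff_pairsLE {k : ℕ} {A Y : ℝ} (χ : DirichletCharacter ℂ k) (t : ℝ) (s : ℂ) :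
    pairSum (pairsLE Y \ pairsLE A) χ t s =
      pairPoly (pairsLE Y) (fun i => (fun n : ℕ => if A < n then (n : ℂ) ^ (-(1 / 2 + s)) else 0) (i.1 * i.2)) χ t := by
  unfold pairSum pairPoly
  refine (Finset.sum_congr rfl fun i hi => ?_).trans (Finset.sum_subset Finset.sdiff_subset fun i hi hni => ?_)
  · rw [Finset.mem_sdiff, mem_pairsLE, mem_pairsLE] at hi
    have : A < ((i.1 * i.2 : ℕ) : ℝ) := by
      by_contra hc
      push Not at hc
      exact hi.2 ⟨hi.1.1, hi.1.2.1, hc⟩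
    simp only [if_pos this]
  · rw [Finset.mem_sdiff, not_and_not_right] at hni
    have := (mem_pairsLE.mp (hni hi)).2.2
    simp only [if_neg this.not_gt, zero_mul]

theorem sum_integral_pairSum_dyadic_le : ∃ K : ℝ, 0 < K ∧ ∀ (q : ℕ) [NeZero q] (U A x y : ℝ) (s : ℂ),
    2 ≤ q → 1 ≤ U → x ≤ y → 0 < A → q * U = 2 * A → s.re = 1 →
    ∑ χ : DirichletCharacter ℂ q, (∫ t in x..y, ‖pairSum (pairsLE (q * U) \ pairsLE A) χ t s‖ ^ 2) ≤
      K * q * (y - x + 1 + U) * (A⁻¹ * Real.log (q * U)) ^ 2 := by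
  obtain ⟨K, hK0, hK⟩ := sum_integral_pairPoly_pairsLE_le
  refine ⟨4 * K, by positivity, fun q _ U A x y s hq hU hxy hA hAU hs => ?_⟩
  simp only [pairSum_sdiff_pairsLE]
  have h := hK q U (2 * A⁻¹) (fun n => if A < n then (n : ℂ) ^ (-(1 / 2 + s)) else 0) x y hq hU hxy (by positivity) ?_
  · refine h.trans (le_of_eq ?_)
    ring
  intro a b ha hb
  set m : ℝ := (a : ℝ) * b with hm
  have hm0 : 0 < m := by positivity
  set G := √(q * U / m) with hG
  have hG0 : 0 ≤ G := Real.sqrt_nonneg _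
  have key : ∀ n : ℕ, ‖(if A < n then (n : ℂ) ^ (-(1 / 2 + s)) else 0)‖ ≤ (√A)⁻¹ * A⁻¹ := by
    intro n
    split_ifs with h
    · have hn : (0 : ℝ) < n := hA.trans h
      rw [norm_cpow_neg_half _ _ (by exact_mod_cast hn), hs, Real.rpow_neg_one]
      have : 0 < √A := Real.sqrt_pos.mpr hA
      gcongr
    · rw [norm_zero]; positivity
  calc _ ≤ ∑ g ∈ (Finset.Icc 1 ⌊G⌋₊).filter (fun g => g.Coprime q), (√A)⁻¹ * A⁻¹ :=
        (norm_sum_le _ _).trans (Finset.sum_le_sum fun g _ => key _)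
    _ ≤ ∑ g ∈ Finset.Icc 1 ⌊G⌋₊, (√A)⁻¹ * A⁻¹ :=
        Finset.sum_le_sum_of_subset_of_nonneg (Finset.filter_subset _ _) fun _ _ _ => by positivity
    _ = ⌊G⌋₊ * ((√A)⁻¹ * A⁻¹) := by rw [Finset.sum_const, Nat.card_Icc, nsmul_eq_mul, Nat.add_sub_cancel]
    _ ≤ G * ((√A)⁻¹ * A⁻¹) := by gcongr; exact Nat.floor_le hG0
    _ = √2 * A⁻¹ * (√m)⁻¹ := by
        have : 0 < √A := Real.sqrt_pos.mpr hA
        rw [hG, hAU, Real.sqrt_div (by positivity), Real.sqrt_mul (by norm_num)]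
        field_simp
    _ ≤ _ := by
        have : √2 ≤ 2 := by rw [Real.sqrt_le_left (by norm_num)]; norm_num
        gcongr

theorem continuous_pairSum {k : ℕ} (S : Finset (ℕ × ℕ)) (χ : DirichletCharacter ℂ k) (s : ℂ) :
    Continuous fun t : ℝ => pairSum S χ t s := continuous_pairPoly S _ χ

theorem sq_sum_range_le_geometric (a : ℕ → ℝ) (n : ℕ) :
    (∑ i ∈ Finset.range n, a i) ^ 2 ≤ 4 * ∑ i ∈ Finset.range n, (4 / 3 : ℝ) ^ i * a i ^ 2 := by
  have h1 := Finset.sum_sq_le_sum_mul_sum_of_sq_le_mul (Finset.range n) (r := a) (f := fun i => (3 / 4 : ℝ) ^ i)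
    (g := fun i => (4 / 3 : ℝ) ^ i * a i ^ 2) (fun i _ => by positivity) (fun i _ => by positivity)
    (fun i _ => by rw [← mul_assoc, ← mul_pow]; norm_num)
  have h2 : ∑ i ∈ Finset.range n, (3 / 4 : ℝ) ^ i ≤ 4 := by
    rw [geom_sum_eq (by norm_num)]
    have : (0 : ℝ) ≤ (3 / 4) ^ n := by positivity
    rw [div_le_iff_of_neg (by norm_num)]
    linarith
  have h3 : 0 ≤ ∑ i ∈ Finset.range n, (4 / 3 : ℝ) ^ i * a i ^ 2 := Finset.sum_nonneg fun _ _ => by positivity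
  exact h1.trans (by gcongr)

theorem exists_sum_sq_mul_geometric_le : ∃ C : ℝ, 0 < C ∧ ∀ n : ℕ,
    ∑ i ∈ Finset.range n, ((i : ℝ) + 2) ^ 2 * (2 / 3 : ℝ) ^ i ≤ C := by
  have h := summable_pow_mul_geometric_of_norm_lt_one 2 (r := (2 / 3 : ℝ)) (by norm_num)
  have h2 : Summable fun i : ℕ => ((i : ℝ) + 2) ^ 2 * (2 / 3 : ℝ) ^ i := by
    have := ((summable_nat_add_iff 2).mpr h).mul_left (9 / 4)
    refine this.congr fun i => ?_
    push_cast
    rw [pow_add]; ring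
  refine ⟨∑' i : ℕ, ((i : ℝ) + 2) ^ 2 * (2 / 3 : ℝ) ^ i + 1, ?_, fun n => ?_⟩
  · have : 0 ≤ ∑' i : ℕ, ((i : ℝ) + 2) ^ 2 * (2 / 3 : ℝ) ^ i := tsum_nonneg fun i => by positivity
    linarith
  · have := h2.sum_le_tsum (Finset.range n) fun i _ => by positivity
    linarith

theorem sum_integral_pairSum_tail_le : ∃ K : ℝ, 0 < K ∧ ∀ (q : ℕ) [NeZero q] (U x y : ℝ) (s : ℂ) (n : ℕ),
    2 ≤ q → 1 ≤ U → x ≤ y → y - x + 1 ≤ U → s.re = 1 →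
    ∑ χ : DirichletCharacter ℂ q, (∫ t in x..y,
        ‖pairSum (pairsLE (2 ^ n * (q * U)) \ pairsLE (q * U)) χ t s‖ ^ 2) ≤
      K * q * U * ((q * U)⁻¹ * Real.log (q * U)) ^ 2 := by
  obtain ⟨K, hK0, hK⟩ := sum_integral_pairSum_dyadic_le
  obtain ⟨C, hC0, hC⟩ := exists_sum_sq_mul_geometric_le
  refine ⟨12 * K * C, by positivity, fun q _ U x y s n hq hU hxy hU2 hs => ?_⟩
  have hq2 : (2 : ℝ) ≤ q := by exact_mod_cast hq
  have hN : 0 < (q : ℝ) * U := by positivity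
  set N := (q : ℝ) * U with hNd
  set L := Real.log N with hL
  have hL0 : Real.log 2 ≤ L := log_two_le_log_mul hq hU
  have hl2 := Real.log_two_gt_d9
  set P : ℕ → DirichletCharacter ℂ q → ℝ → ℂ := fun i χ t => pairSum (pairsLE (2 ^ (i + 1) * N) \ pairsLE (2 ^ i * N)) χ t s
    with hP
  have hPc : ∀ i χ, Continuous (P i χ) := fun i χ => continuous_pairSum _ χ s
  have hsub : ∀ (A B : ℝ), A ≤ B → ∀ (χ : DirichletCharacter ℂ q) t,
      pairSum (pairsLE B \ pairsLE A) χ t s = pairSum (pairsLE B) χ t s - pairSum (pairsLE A) χ t s := by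
    intro A B h χ t
    rw [pairSum_sdiff (pairsLE_mono h)]; ring
  have hsum : ∀ χ t, pairSum (pairsLE (2 ^ n * N) \ pairsLE N) χ t s = ∑ i ∈ Finset.range n, P i χ t := by
    intro χ t
    have e : ∀ i, P i χ t = pairSum (pairsLE (2 ^ (i + 1) * N)) χ t s - pairSum (pairsLE (2 ^ i * N)) χ t s := by
      intro i
      refine hsub _ _ ?_ χ t
      rw [pow_succ]
      have : 0 ≤ 2 ^ i * N := by positivity
      nlinarith
    simp only [e]
    rw [Finset.sum_range_sub (fun i => pairSum (pairsLE (2 ^ i * N)) χ t s), pow_zero, one_mul]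
    refine hsub _ _ ?_ χ t
    have : (1 : ℝ) ≤ 2 ^ n := one_le_pow₀ (by norm_num)
    nlinarith
  have hPb : ∀ i, ∑ χ : DirichletCharacter ℂ q, (∫ t in x..y, ‖P i χ t‖ ^ 2) ≤
      3 * K * q * U * (N⁻¹ * L) ^ 2 * ((i + 2) ^ 2 * (1 / 2 : ℝ) ^ i) := by
    intro i
    have h2i : (1 : ℝ) ≤ 2 ^ i := one_le_pow₀ (by norm_num)
    have hA : 0 < 2 ^ i * N := by positivity
    have e1 : (q : ℝ) * (2 ^ (i + 1) * U) = 2 ^ (i + 1) * N := by rw [hNd]; ring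
    have h := hK q (2 ^ (i + 1) * U) (2 ^ i * N) x y s hq (by rw [pow_succ]; nlinarith) hxy hA (by rw [e1, pow_succ]; ring) hs
    rw [e1] at h
    refine h.trans ?_
    have hlog : Real.log (2 ^ (i + 1) * N) ≤ (i + 2) * L := by
      rw [Real.log_mul (by positivity) hN.ne', Real.log_pow]
      push_cast
      have : ((i : ℝ) + 1) * Real.log 2 ≤ (i + 1) * L := by gcongr
      linarith
    have hlog0 : 0 ≤ Real.log (2 ^ (i + 1) * N) := by
      rw [Real.log_mul (by positivity) hN.ne']
      have : 0 ≤ Real.log ((2 : ℝ) ^ (i + 1)) := Real.log_nonneg (one_le_pow₀ (by norm_num))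
      linarith
    have hUi : y - x + 1 + 2 ^ (i + 1) * U ≤ 3 * 2 ^ i * U := by rw [pow_succ]; nlinarith
    calc K * q * (y - x + 1 + 2 ^ (i + 1) * U) * ((2 ^ i * N)⁻¹ * Real.log (2 ^ (i + 1) * N)) ^ 2 ≤
        K * q * (3 * 2 ^ i * U) * ((2 ^ i * N)⁻¹ * ((i + 2) * L)) ^ 2 := by gcongr
      _ = _ := by
        rw [mul_inv, one_div, inv_pow]
        field_simp
  have hinteg : ∀ χ : DirichletCharacter ℂ q, (∫ t in x..y, ‖pairSum (pairsLE (2 ^ n * N) \ pairsLE N) χ t s‖ ^ 2) ≤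
      4 * ∑ i ∈ Finset.range n, (4 / 3 : ℝ) ^ i * ∫ t in x..y, ‖P i χ t‖ ^ 2 := by
    intro χ
    have hc : ∀ i, Continuous fun t => (4 / 3 : ℝ) ^ i * ‖P i χ t‖ ^ 2 := fun i =>
      continuous_const.mul ((hPc i χ).norm.pow 2)
    calc _ ≤ ∫ t in x..y, 4 * ∑ i ∈ Finset.range n, (4 / 3 : ℝ) ^ i * ‖P i χ t‖ ^ 2 := by
          refine intervalIntegral.integral_mono_on hxy ?_ ?_ fun t _ => ?_
          · exact ((continuous_pairSum _ χ s).norm.pow 2).intervalIntegrable _ _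
          · exact (continuous_const.mul (continuous_finsetSum _ fun i _ => hc i)).intervalIntegrable _ _
          · rw [hsum]
            refine le_trans ?_ (sq_sum_range_le_geometric (fun i => ‖P i χ t‖) n)
            gcongr
            exact norm_sum_le _ _
      _ = _ := by
          rw [intervalIntegral.integral_const_mul, intervalIntegral.integral_finsetSum
            fun i _ => (hc i).intervalIntegrable _ _]
          simp only [intervalIntegral.integral_const_mul]
  calc _ ≤ ∑ χ : DirichletCharacter ℂ q, 4 * ∑ i ∈ Finset.range n, (4 / 3 : ℝ) ^ i * ∫ t in x..y, ‖P i χ t‖ ^ 2 :=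
        Finset.sum_le_sum fun χ _ => hinteg χ
    _ = 4 * ∑ i ∈ Finset.range n, (4 / 3 : ℝ) ^ i * ∑ χ : DirichletCharacter ℂ q, ∫ t in x..y, ‖P i χ t‖ ^ 2 := by
        rw [← Finset.mul_sum, Finset.sum_comm]
        simp only [Finset.mul_sum]
    _ ≤ 4 * ∑ i ∈ Finset.range n, (4 / 3 : ℝ) ^ i * (3 * K * q * U * (N⁻¹ * L) ^ 2 * ((i + 2) ^ 2 * (1 / 2 : ℝ) ^ i)) := by
        gcongr with i _
        exact hPb i
    _ = 12 * K * q * U * (N⁻¹ * L) ^ 2 * ∑ i ∈ Finset.range n, ((i : ℝ) + 2) ^ 2 * (2 / 3 : ℝ) ^ i := by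
        rw [Finset.mul_sum, Finset.mul_sum]
        refine Finset.sum_congr rfl fun i _ => ?_
        have e : (2 / 3 : ℝ) ^ i = (4 / 3) ^ i * (1 / 2) ^ i := by rw [← mul_pow]; norm_num
        rw [e]
        ring
    _ ≤ 12 * K * q * U * (N⁻¹ * L) ^ 2 * C := by gcongr; exact hC n
    _ = _ := by ring

theorem continuous_LFunction_line {q : ℕ} [NeZero q] (hq : 2 ≤ q) {χ : DirichletCharacter ℂ q} (hχ : χ.IsPrimitive) :
    Continuous fun t : ℝ => χ.LFunction (1 / 2 + t * Complex.I) :=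
  (DirichletCharacter.differentiable_LFunction (hχ.ne_one hq)).continuous.comp (by fun_prop)

open scoped Classical in
set_option maxHeartbeats 1000000 in
theorem sum_integral_norm_sq_LFunction_sub_sq_le : ∃ C : ℝ, 0 < C ∧ ∀ (q : ℕ) [NeZero q] (x y : ℝ),
    2 ≤ q → 0 ≤ x → x ≤ y → 1 + y ≤ 4 * (1 + x) →
    ∑ χ : DirichletCharacter ℂ q, (if χ.IsPrimitive then ∫ t in x..y,
        ‖((‖χ.LFunction (1 / 2 + t * Complex.I)‖ ^ 2 : ℝ) : ℂ) - 2 * pairSum (pairsLE (q * (1 + y))) χ t 0‖ ^ 2 else 0) ≤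
      C * q * (1 + y) * Real.log (q * (1 + y)) ^ 2 := by
  obtain ⟨C, hC0, hC⟩ := DirichletCharacter.norm_sq_LFunction_sub_two_mul_pairSum_le
  obtain ⟨K₁, hK₁, hb₁⟩ := sum_integral_pairSum_quarter_le
  obtain ⟨K₂, hK₂, hb₂⟩ := sum_integral_pairSum_tail_le
  set W := ∫ u : ℝ, gaussWeight u with hW
  refine ⟨3 * C ^ 2 * (4 + W ^ 2 * K₂ + 8 * W ^ 2 * K₁), by positivity, fun q _ x y hq hx hxy hxy4 => ?_⟩
  have hq2 : (2 : ℝ) ≤ q := by exact_mod_cast hq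
  set U := 1 + y with hU
  have hU1 : 1 ≤ U := by linarith
  set N := (q : ℝ) * U with hNd
  have hN : 0 < N := by positivity
  set L := Real.log N with hL
  have hL0 : Real.log 2 ≤ L := log_two_le_log_mul hq hU1
  have hl2 := Real.log_two_gt_d9
  obtain ⟨X₀, hX₀⟩ := hC (1 / N) (by positivity)
  obtain ⟨n, hn⟩ : ∃ n : ℕ, X₀ / N ≤ 2 ^ n := by
    obtain ⟨n, hn⟩ := pow_unbounded_of_one_lt (X₀ / N) (one_lt_two)
    exact ⟨n, hn.le⟩
  rw [div_le_iff₀ hN] at hn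
  set X := 2 ^ n * N with hX
  have hNX : N ≤ X := by
    have : (1 : ℝ) ≤ 2 ^ n := one_le_pow₀ (by norm_num)
    nlinarith
  have hpos2 : ∀ i ∈ pairsLE X \ pairsLE N, 0 < i.1 ∧ 0 < i.2 := fun i hi => pairsLE_pos i (Finset.mem_sdiff.mp hi).1
  set f₁ : DirichletCharacter ℂ q → ℝ → ℝ → ℝ := fun χ t u => ‖pairSum (pairsLE N) χ t ((-(1 / 4) : ℝ) + u * Complex.I)‖ with hf₁
  set f₂ : DirichletCharacter ℂ q → ℝ → ℝ → ℝ := fun χ t u => ‖pairSum (pairsLE X \ pairsLE N) χ t ((1 : ℝ) + u * Complex.I)‖ with hf₂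
  have hc₁ : ∀ χ, Continuous (Function.uncurry (f₁ χ)) := fun χ => continuous_pairSum_line pairsLE_pos χ _
  have hc₂ : ∀ χ, Continuous (Function.uncurry (f₂ χ)) := fun χ => continuous_pairSum_line hpos2 χ _
  have hM₁ : ∀ χ t u, |f₁ χ t u| ≤ (pairsLE N).card := fun χ t u => by
    rw [abs_of_nonneg (norm_nonneg _)]
    exact norm_pairSum_le pairsLE_pos χ t (by simp; norm_num)
  have hM₂ : ∀ χ t u, |f₂ χ t u| ≤ (pairsLE X \ pairsLE N).card := fun χ t u => by
    rw [abs_of_nonneg (norm_nonneg _)]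
    exact norm_pairSum_le hpos2 χ t (by simp; norm_num)
  set g₁ : DirichletCharacter ℂ q → ℝ → ℝ := fun χ t => ∫ u : ℝ, gaussWeight u * f₁ χ t u with hg₁
  set g₂ : DirichletCharacter ℂ q → ℝ → ℝ := fun χ t => ∫ u : ℝ, gaussWeight u * f₂ χ t u with hg₂
  have hgc₁ : ∀ χ, Continuous (g₁ χ) := fun χ => continuous_integral_gaussWeight_mul (hc₁ χ) (hM₁ χ)
  have hgc₂ : ∀ χ, Continuous (g₂ χ) := fun χ => continuous_integral_gaussWeight_mul (hc₂ χ) (hM₂ χ)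
  have hg₁0 : ∀ χ t, 0 ≤ g₁ χ t := fun χ t => MeasureTheory.integral_nonneg fun u =>
    mul_nonneg (gaussWeight_nonneg u) (norm_nonneg _)
  have hg₂0 : ∀ χ t, 0 ≤ g₂ χ t := fun χ t => MeasureTheory.integral_nonneg fun u =>
    mul_nonneg (gaussWeight_nonneg u) (norm_nonneg _)
  have hs₁ : ∑ χ, (∫ t in x..y, g₁ χ t ^ 2) ≤ W ^ 2 * (K₁ * q * (y - x + 1 + U) * (N ^ (1 / 4 : ℝ) * L) ^ 2) :=
    sum_integral_sq_gaussWeight_le hc₁ hM₁ hxy fun u => hb₁ q U x y _ hq hU1 hxy (by simp)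
  have hs₂ : ∑ χ, (∫ t in x..y, g₂ χ t ^ 2) ≤ W ^ 2 * (K₂ * q * U * (N⁻¹ * L) ^ 2) :=
    sum_integral_sq_gaussWeight_le hc₂ hM₂ hxy fun u => hb₂ q U x y _ n hq hU1 hxy (by linarith) (by simp)
  have hN4 : 0 < N ^ (1 / 4 : ℝ) := Real.rpow_pos_of_pos hN _
  have hpt : ∀ χ : DirichletCharacter ℂ q, χ.IsPrimitive → ∀ t ∈ Set.Icc x y,
      ‖((‖χ.LFunction (1 / 2 + t * Complex.I)‖ ^ 2 : ℝ) : ℂ) - 2 * pairSum (pairsLE N) χ t 0‖ ^ 2 ≤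
        3 * C ^ 2 * (1 + N ^ 2 * g₂ χ t ^ 2 + 4 * (N ^ (1 / 4 : ℝ))⁻¹ ^ 2 * g₁ χ t ^ 2) := by
    intro χ hχ t ht
    have ht0 : 0 ≤ t := hx.trans ht.1
    have h := hX₀ X hn q hq χ hχ t N hNX
    rw [abs_of_nonneg ht0] at h
    set R := (q : ℝ) * (1 + t) with hR
    have hR0 : 0 < R := by positivity
    have hRN : R ≤ N := by rw [hR, hNd]; gcongr; linarith [ht.2]
    have hNR : N ≤ 4 * R := by
      rw [hR, hNd]
      have : U ≤ 4 * (1 + t) := by linarith [ht.1]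
      nlinarith
    have hR4 : R ^ (-(1 / 4) : ℝ) ≤ 2 * (N ^ (1 / 4 : ℝ))⁻¹ := by
      have e1 : N ^ (1 / 4 : ℝ) ≤ 2 * R ^ (1 / 4 : ℝ) := by
        calc N ^ (1 / 4 : ℝ) ≤ (4 * R) ^ (1 / 4 : ℝ) := by gcongr
          _ = 4 ^ (1 / 4 : ℝ) * R ^ (1 / 4 : ℝ) := Real.mul_rpow (by norm_num) hR0.le
          _ ≤ 2 * R ^ (1 / 4 : ℝ) := by
            gcongr
            calc (4 : ℝ) ^ (1 / 4 : ℝ) ≤ 4 ^ (1 / 2 : ℝ) := Real.rpow_le_rpow_of_exponent_le (by norm_num) (by norm_num)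
              _ = 2 := by rw [← Real.sqrt_eq_rpow, show (4 : ℝ) = 2 ^ 2 by norm_num, Real.sqrt_sq (by norm_num)]
      have hR4p : 0 < R ^ (1 / 4 : ℝ) := Real.rpow_pos_of_pos hR0 _
      rw [Real.rpow_neg hR0.le, ← div_eq_mul_inv, le_div_iff₀ hN4, inv_mul_le_iff₀ hR4p]
      linarith
    have hb : ‖((‖χ.LFunction (1 / 2 + t * Complex.I)‖ ^ 2 : ℝ) : ℂ) - 2 * pairSum (pairsLE N) χ t 0‖ ≤
        C * (1 + N * g₂ χ t + 2 * (N ^ (1 / 4 : ℝ))⁻¹ * g₁ χ t) := by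
      refine h.trans ?_
      have a1 : R * (1 / N + g₂ χ t) ≤ N * (1 / N + g₂ χ t) :=
        mul_le_mul_of_nonneg_right hRN (add_nonneg (by positivity) (hg₂0 χ t))
      have a2 : N * (1 / N + g₂ χ t) = 1 + N * g₂ χ t := by field_simp
      have a3 : R ^ (-(1 / 4) : ℝ) * g₁ χ t ≤ 2 * (N ^ (1 / 4 : ℝ))⁻¹ * g₁ χ t :=
        mul_le_mul_of_nonneg_right hR4 (hg₁0 χ t)
      refine mul_le_mul_of_nonneg_left ?_ hC0.le
      linarith
    calc _ ≤ (C * (1 + N * g₂ χ t + 2 * (N ^ (1 / 4 : ℝ))⁻¹ * g₁ χ t)) ^ 2 := by gcongr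
      _ = C ^ 2 * (1 + N * g₂ χ t + 2 * (N ^ (1 / 4 : ℝ))⁻¹ * g₁ χ t) ^ 2 := by ring
      _ ≤ C ^ 2 * (3 * (1 + N ^ 2 * g₂ χ t ^ 2 + 4 * (N ^ (1 / 4 : ℝ))⁻¹ ^ 2 * g₁ χ t ^ 2)) := by
          gcongr
          nlinarith [sq_nonneg (1 - N * g₂ χ t), sq_nonneg (1 - 2 * (N ^ (1 / 4 : ℝ))⁻¹ * g₁ χ t),
            sq_nonneg (N * g₂ χ t - 2 * (N ^ (1 / 4 : ℝ))⁻¹ * g₁ χ t)]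
      _ = _ := by ring
  have hχb : ∀ χ : DirichletCharacter ℂ q, (if χ.IsPrimitive then ∫ t in x..y,
        ‖((‖χ.LFunction (1 / 2 + t * Complex.I)‖ ^ 2 : ℝ) : ℂ) - 2 * pairSum (pairsLE N) χ t 0‖ ^ 2 else 0) ≤
      3 * C ^ 2 * ((y - x) + N ^ 2 * (∫ t in x..y, g₂ χ t ^ 2) + 4 * (N ^ (1 / 4 : ℝ))⁻¹ ^ 2 * ∫ t in x..y, g₁ χ t ^ 2) := by
    intro χ
    have i1 : 0 ≤ ∫ t in x..y, g₁ χ t ^ 2 := intervalIntegral.integral_nonneg hxy fun t _ => sq_nonneg _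
    have i2 : 0 ≤ ∫ t in x..y, g₂ χ t ^ 2 := intervalIntegral.integral_nonneg hxy fun t _ => sq_nonneg _
    have hyx : 0 ≤ y - x := by linarith
    split_ifs with hχ
    · have c1 : Continuous fun t => 4 * (N ^ (1 / 4 : ℝ))⁻¹ ^ 2 * g₁ χ t ^ 2 := continuous_const.mul ((hgc₁ χ).pow 2)
      have c2 : Continuous fun t => N ^ 2 * g₂ χ t ^ 2 := continuous_const.mul ((hgc₂ χ).pow 2)
      calc _ ≤ ∫ t in x..y, 3 * C ^ 2 * (1 + N ^ 2 * g₂ χ t ^ 2 + 4 * (N ^ (1 / 4 : ℝ))⁻¹ ^ 2 * g₁ χ t ^ 2) := by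
            refine intervalIntegral.integral_mono_on hxy ?_ ?_ (hpt χ hχ)
            · refine Continuous.intervalIntegrable ?_ _ _
              refine Continuous.pow (Continuous.norm (Continuous.sub ?_ ?_)) 2
              · exact Complex.continuous_ofReal.comp ((continuous_LFunction_line hq hχ).norm.pow 2)
              · exact continuous_const.mul (continuous_pairSum _ χ 0)
            · exact (continuous_const.mul ((continuous_const.add c2).add c1)).intervalIntegrable _ _
        _ = _ := by
            have c3 : Continuous fun t => 1 + N ^ 2 * g₂ χ t ^ 2 := continuous_const.add c2
            rw [intervalIntegral.integral_const_mul, intervalIntegral.integral_add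
              (c3.intervalIntegrable _ _) (c1.intervalIntegrable _ _),
              intervalIntegral.integral_add (continuous_const.intervalIntegrable _ _) (c2.intervalIntegrable _ _),
              intervalIntegral.integral_const_mul, intervalIntegral.integral_const_mul, intervalIntegral.integral_const]
            simp
    · positivity
  have hcard : ∑ _χ : DirichletCharacter ℂ q, (y - x) ≤ q * U := by
    rw [Finset.sum_const, nsmul_eq_mul, Finset.card_univ, ← Nat.card_eq_fintype_card,
      DirichletCharacter.card_eq_totient_of_hasEnoughRootsOfUnity]
    have : (q.totient : ℝ) ≤ q := by exact_mod_cast Nat.totient_le q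
    have h0 : 0 ≤ y - x := by linarith
    calc _ ≤ (q : ℝ) * (y - x) := by gcongr
      _ ≤ _ := by gcongr; linarith
  have hL2 : 1 ≤ 4 * L ^ 2 := by nlinarith
  have hs₁' : ∑ χ, (∫ t in x..y, g₁ χ t ^ 2) ≤ W ^ 2 * (K₁ * q * (U + U) * (N ^ (1 / 4 : ℝ) * L) ^ 2) := by
    refine hs₁.trans ?_
    have : y - x + 1 ≤ U := by linarith
    gcongr
  have hcard' : ∑ _χ : DirichletCharacter ℂ q, (y - x) ≤ q * U * (4 * L ^ 2) := by
    refine hcard.trans ?_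
    have : 0 ≤ (q : ℝ) * U := hN.le
    nlinarith
  have htot := add_le_add (add_le_add hcard' (mul_le_mul_of_nonneg_left hs₂ (sq_nonneg N)))
    (mul_le_mul_of_nonneg_left hs₁' (show 0 ≤ 4 * (N ^ (1 / 4 : ℝ))⁻¹ ^ 2 by positivity))
  refine (Finset.sum_le_sum fun χ _ => hχb χ).trans ?_
  rw [← Finset.mul_sum, Finset.sum_add_distrib, Finset.sum_add_distrib, ← Finset.mul_sum, ← Finset.mul_sum]
  refine (mul_le_mul_of_nonneg_left htot (show 0 ≤ 3 * C ^ 2 by positivity)).trans (le_of_eq ?_)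
  generalize N ^ (1 / 4 : ℝ) = P at *
  field_simp
  ring

open scoped Classical in
/-- Comparison of two second moments in terms of the second moment of the difference. -/
theorem abs_sum_integral_norm_sq_sub_le {ι : Type*} [Fintype ι] (P : ι → Prop)
    (u v : ι → ℝ → ℂ) (hu : ∀ i, P i → Continuous (u i)) (hv : ∀ i, P i → Continuous (v i))
    {x y l : ℝ} (hxy : x ≤ y) (hl : 0 < l) :
    |(∑ i, if P i then ∫ t in x..y, ‖u i t‖ ^ 2 else 0)
        - ∑ i, if P i then ∫ t in x..y, ‖v i t‖ ^ 2 else 0|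
      ≤ l * (∑ i, if P i then ∫ t in x..y, ‖v i t‖ ^ 2 else 0)
        + (1 / l + 1) * ∑ i, if P i then ∫ t in x..y, ‖u i t - v i t‖ ^ 2 else 0 := by
  have hpt : ∀ a b : ℂ, |‖a‖ ^ 2 - ‖b‖ ^ 2| ≤ l * ‖b‖ ^ 2 + (1 / l + 1) * ‖a - b‖ ^ 2 := by
    intro a b
    have h1 : |‖a‖ - ‖b‖| ≤ ‖a - b‖ := abs_norm_sub_norm_le a b
    have h2 : |‖a‖ ^ 2 - ‖b‖ ^ 2| = |‖a‖ - ‖b‖| * (‖a‖ + ‖b‖) := by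
      rw [show ‖a‖ ^ 2 - ‖b‖ ^ 2 = (‖a‖ - ‖b‖) * (‖a‖ + ‖b‖) by ring, abs_mul,
        abs_of_nonneg (add_nonneg (norm_nonneg a) (norm_nonneg b))]
    have h3 : ‖a‖ ≤ ‖a - b‖ + ‖b‖ := by
      have := abs_le.1 h1; linarith
    have h4 : |‖a‖ ^ 2 - ‖b‖ ^ 2| ≤ ‖a - b‖ * (‖a - b‖ + 2 * ‖b‖) := by
      rw [h2]
      exact mul_le_mul h1 (by linarith) (by positivity) (norm_nonneg _)
    have h5 : 2 * ‖a - b‖ * ‖b‖ ≤ l * ‖b‖ ^ 2 + 1 / l * ‖a - b‖ ^ 2 := by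
      have : 0 ≤ (l * ‖b‖ - ‖a - b‖) ^ 2 / l := by positivity
      have e : (l * ‖b‖ - ‖a - b‖) ^ 2 / l
          = l * ‖b‖ ^ 2 + 1 / l * ‖a - b‖ ^ 2 - 2 * ‖a - b‖ * ‖b‖ := by
        field_simp; ring
      linarith
    nlinarith
  rw [← Finset.sum_sub_distrib, Finset.mul_sum, Finset.mul_sum, ← Finset.sum_add_distrib]
  refine (Finset.abs_sum_le_sum_abs _ _).trans (Finset.sum_le_sum fun i _ => ?_)
  by_cases hi : P i
  · simp only [if_pos hi]
    have cu : Continuous fun t => ‖u i t‖ ^ 2 := ((hu i hi).norm).pow 2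
    have cv : Continuous fun t => ‖v i t‖ ^ 2 := ((hv i hi).norm).pow 2
    have cd : Continuous fun t => ‖u i t - v i t‖ ^ 2 := (((hu i hi).sub (hv i hi)).norm).pow 2
    have clv : Continuous fun t => l * ‖v i t‖ ^ 2 := continuous_const.mul cv
    have cld : Continuous fun t => (1 / l + 1) * ‖u i t - v i t‖ ^ 2 := continuous_const.mul cd
    rw [← intervalIntegral.integral_sub (cu.intervalIntegrable _ _) (cv.intervalIntegrable _ _),
      ← intervalIntegral.integral_const_mul, ← intervalIntegral.integral_const_mul,
      ← intervalIntegral.integral_add (clv.intervalIntegrable _ _)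
        (cld.intervalIntegrable _ _)]
    refine (intervalIntegral.abs_integral_le_integral_abs hxy).trans ?_
    exact intervalIntegral.integral_mono_on hxy ((cu.sub cv).abs.intervalIntegrable _ _)
      ((clv.add cld).intervalIntegrable _ _)
      fun t _ => hpt _ _
  · simp [hi]

theorem shortening_le {q : ℕ} (hq : 2 ≤ q) {U : ℝ} (hU : 1 ≤ U) :
    shortening q U ≤ 4 * Real.log (q * U) := by
  have hq0 : (0 : ℝ) < q := by positivity
  have h1 := Nat.card_primeFactors_mul_log_two_le (q := q) (by omega)
  have h2 : Real.log q ≤ Real.log (q * U) := Real.log_le_log hq0 (by nlinarith)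
  have h3 := log_two_le_log_mul hq hU
  have h4 : Real.log 4 = 2 * Real.log 2 := by
    rw [show (4 : ℝ) = 2 ^ 2 by norm_num, Real.log_pow]; norm_num
  have h5 := Real.log_two_gt_d9
  have h6 : √(Real.log (q * U)) ≤ 2 * Real.log (q * U) := by
    rw [Real.sqrt_le_left (by linarith)]
    nlinarith
  unfold shortening
  rw [h4]
  nlinarith

theorem momentConst_le (q : ℕ) (hq : q ≠ 0) : momentConst q ≤ ((q.totient : ℝ) / q) ^ 4 := by
  refine (momentConst_bounds q hq).2.trans ?_
  have : 1 / Real.pi ^ 2 ≤ 1 := by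
    rw [div_le_one (by positivity)]
    nlinarith [Real.pi_gt_three]
  exact mul_le_of_le_one_left (by positivity) this

theorem abs_sub_log_ratio_ge {q : ℕ} (hq : 2 ≤ q) {U : ℝ} (hU : 1 ≤ U) {k : ℕ} (hk : 0 < k)
    {i j : ℕ × ℕ} (hi : i ∈ reducedPairs q (shortLength q U))
    (hj : j ∈ reducedPairs q (shortLength q U)) (hij : i ≠ j)
    (hmod : i.1 * j.2 ≡ j.1 * i.2 [MOD k]) :
    shortGap q U k ≤ |(Real.log i.1 - Real.log i.2) - (Real.log j.1 - Real.log j.2)| := by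
  obtain ⟨⟨i1, i2, iX⟩, ic, -⟩ := mem_reducedPairs.mp hi
  obtain ⟨⟨j1, j2, jX⟩, jc, -⟩ := mem_reducedPairs.mp hj
  exact shortGap_le hq hU hk ic jc i1 i2 j1 j2 (by exact_mod_cast iX) (by exact_mod_cast jX) hij hmod

open scoped Classical in
/-- The second moment of the shortened Dirichlet polynomial over primitive characters. -/
theorem abs_sum_integral_shortened_sub_le : ∃ C : ℝ, 0 < C ∧ ∀ (q : ℕ) [NeZero q] (U x y : ℝ),
    2 ≤ q → 1 ≤ U → x ≤ y → y - x ≤ U →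
    |(∑ χ : DirichletCharacter ℂ q, if χ.IsPrimitive then
        ∫ t in x..y, ‖2 * pairSum (pairsLE (shortLength q U)) χ t 0‖ ^ 2 else 0)
      - primCount q * (y - x) * (momentConst q * Real.log (q * U) ^ 4)| ≤
      C * U * (primCount q * ((q.totient : ℝ) / q) ^ 4 * shortening q U * Real.log (q * U) ^ 3
        + q * ((q.totient : ℝ) / q) ^ 4 * Real.log (q * U) ^ 4 / shortening q U) := by
  obtain ⟨K, hK0, hK⟩ := mean_value_primitive
  obtain ⟨C₁, hC₁, hD⟩ := abs_four_mul_sum_critCoeff_sub_le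
  refine ⟨C₁ + 60 * K * (1 + 4 * C₁), by positivity, fun q _ U x y hq hU hxy hyU => ?_⟩
  have hq0 : (0 : ℝ) < q := by positivity
  have hJ := shortening_pos hq hU
  have hJL := shortening_le hq hU
  have hL : 0 < Real.log (q * U) := by linarith
  have hM := momentConst_le q (by omega)
  have hp := primCount_nonneg q
  have hDq := hD q U hq hU
  have hG := sum_moebius_div_shortGap_le hq hU
  have h := hK q (reducedPairs q (shortLength q U)) (critCoeff q (shortLength q U))
    (shortGap q U) x y (shortGap_pos hq hU) hxy
    (fun i hi => (mem_reducedPairs.mp hi).2.2)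
    (fun k hk i hi j hj hij hm => abs_sub_log_ratio_ge hq hU (Nat.pos_of_mem_divisors hk) hi hj hij hm)
  set ρ4 := ((q.totient : ℝ) / q) ^ 4 with hρ4
  have hρ0 : 0 ≤ ρ4 := by positivity
  set J := shortening q U with hJdef
  set L := Real.log (q * U) with hLdef
  set D := ∑ i ∈ reducedPairs q (shortLength q U), ‖critCoeff q (shortLength q U) i‖ ^ 2 with hDdef
  have hD0 : 0 ≤ D := Finset.sum_nonneg fun _ _ => by positivity
  have hD4 : 4 * D ≤ (1 + 4 * C₁) * ρ4 * L ^ 4 := by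
    have a1 := (abs_le.1 hDq).2
    have a2 : momentConst q * L ^ 4 ≤ ρ4 * L ^ 4 := by gcongr
    have a3 : C₁ * ρ4 * J * L ^ 3 ≤ C₁ * ρ4 * (4 * L) * L ^ 3 := by gcongr
    nlinarith
  have hE : (∑ χ : DirichletCharacter ℂ q, if χ.IsPrimitive then
        ∫ t in x..y, ‖2 * pairSum (pairsLE (shortLength q U)) χ t 0‖ ^ 2 else 0)
      = 4 * ∑ χ : DirichletCharacter ℂ q, if χ.IsPrimitive then
        ∫ t in x..y, ‖pairPoly (reducedPairs q (shortLength q U))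
          (critCoeff q (shortLength q U)) χ t‖ ^ 2 else 0 := by
    rw [Finset.mul_sum]
    refine Finset.sum_congr rfl fun χ _ => ?_
    split_ifs
    · rw [← intervalIntegral.integral_const_mul]
      refine intervalIntegral.integral_congr fun t _ => ?_
      simp only [pairSum_zero_eq, norm_mul, mul_pow, Complex.norm_ofNat]
      norm_num
    · simp
  rw [hE]
  set I := ∑ χ : DirichletCharacter ℂ q, if χ.IsPrimitive then
        ∫ t in x..y, ‖pairPoly (reducedPairs q (shortLength q U))
          (critCoeff q (shortLength q U)) χ t‖ ^ 2 else 0 with hI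
  have hpc : ((Finset.univ.filter fun χ : DirichletCharacter ℂ q => χ.IsPrimitive).card : ℝ)
      = primCount q := rfl
  rw [hpc] at h
  have hG' : ∑ k ∈ q.divisors, |(ArithmeticFunction.moebius (q / k) : ℝ)|
      * (k.totient * (K / shortGap q U k)) ≤ K * (60 * (q * U) / J) := by
    refine le_trans (le_of_eq ?_) (mul_le_mul_of_nonneg_left hG hK0.le)
    rw [Finset.mul_sum]
    exact Finset.sum_congr rfl fun k _ => by ring
  have h1 : |I - primCount q * (y - x) * D| ≤ K * (60 * (q * U) / J) * D :=
    h.trans (mul_le_mul_of_nonneg_right hG' hD0)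
  have e : 4 * I - primCount q * (y - x) * (momentConst q * L ^ 4)
      = 4 * (I - primCount q * (y - x) * D)
        + primCount q * (y - x) * (4 * D - momentConst q * L ^ 4) := by ring
  rw [e]
  refine (abs_add_le _ _).trans ?_
  rw [abs_mul, abs_mul (primCount q * (y - x)), abs_of_pos (by norm_num : (0 : ℝ) < 4),
    abs_of_nonneg (mul_nonneg hp (by linarith : (0 : ℝ) ≤ y - x))]
  have b1 : 4 * |I - primCount q * (y - x) * D|
      ≤ K * (60 * (q * U) / J) * ((1 + 4 * C₁) * ρ4 * L ^ 4) := by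
    have : K * (60 * (q * U) / J) * (4 * D) ≤ K * (60 * (q * U) / J) * ((1 + 4 * C₁) * ρ4 * L ^ 4) :=
      mul_le_mul_of_nonneg_left hD4 (by positivity)
    linarith
  have b2 : primCount q * (y - x) * |4 * D - momentConst q * L ^ 4|
      ≤ primCount q * U * (C₁ * ρ4 * J * L ^ 3) := by
    have := (abs_nonneg _).trans hDq
    exact mul_le_mul (mul_le_mul_of_nonneg_left hyU hp) hDq (abs_nonneg _) (by positivity)
  have e2 : K * (60 * (q * U) / J) * ((1 + 4 * C₁) * ρ4 * L ^ 4)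
      = 60 * K * (1 + 4 * C₁) * (U * (q * ρ4 * L ^ 4 / J)) := by ring
  have c1 : 0 ≤ U * (q * ρ4 * L ^ 4 / J) := by positivity
  have c2 : 0 ≤ U * (primCount q * ρ4 * J * L ^ 3) := by positivity
  have c3 : 0 ≤ C₁ * (U * (q * ρ4 * L ^ 4 / J)) := by positivity
  have c4 : 0 ≤ 60 * K * (1 + 4 * C₁) * (U * (primCount q * ρ4 * J * L ^ 3)) := by positivity
  nlinarith

open scoped Classical in
/-- The squared modulus of `L` is close in mean square to twice the shortened polynomial. -/
theorem sum_integral_norm_sq_LFunction_sub_shortened_sq_le : ∃ C : ℝ, 0 < C ∧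
    ∀ (q : ℕ) [NeZero q] (x y : ℝ), 2 ≤ q → 0 ≤ x → x ≤ y → 1 + y ≤ 4 * (1 + x) →
    (∑ χ : DirichletCharacter ℂ q, if χ.IsPrimitive then
      ∫ t in x..y, ‖((‖χ.LFunction (1 / 2 + t * Complex.I)‖ ^ 2 : ℝ) : ℂ)
        - 2 * pairSum (pairsLE (shortLength q (1 + y))) χ t 0‖ ^ 2 else 0) ≤
      C * (1 + y) * (q.totient * ((q.totient : ℝ) / q) ^ 4 * shortening q (1 + y) ^ 2
        * Real.log (q * (1 + y)) ^ 2 + q * Real.log (q * (1 + y)) ^ 2) := by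
  obtain ⟨C₁, hC₁, hF⟩ := sum_integral_norm_sq_LFunction_sub_sq_le
  obtain ⟨C₂, hC₂, hD⟩ := sum_norm_critCoeff_sub_sq_le
  obtain ⟨K, hK0, hK⟩ := mean_value_reducedPairs_le
  refine ⟨2 * C₁ + 8 * (K * 2 * C₂), by positivity, fun q _ x y hq hx hxy h4 => ?_⟩
  have hq0 : (0 : ℝ) < q := by positivity
  have hq2 : (2 : ℝ) ≤ q := by exact_mod_cast hq
  have hU : 1 ≤ 1 + y := by linarith
  have h1 := hF q x y hq hx hxy h4
  have h2 := hD q (1 + y) hq hU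
  have h3 := hK q (q * (1 + y))
    (fun i => critCoeff q (q * (1 + y)) i - critCoeff q (shortLength q (1 + y)) i) x y
    (by nlinarith) hxy
  set N := (q : ℝ) * (1 + y) with hN
  set Z := shortLength q (1 + y) with hZ
  have hZN : Z ≤ N := shortLength_le hq hU
  have h5 : (∑ χ : DirichletCharacter ℂ q, if χ.IsPrimitive then
      ∫ t in x..y, ‖((‖χ.LFunction (1 / 2 + t * Complex.I)‖ ^ 2 : ℝ) : ℂ)
        - 2 * pairSum (pairsLE Z) χ t 0‖ ^ 2 else 0) ≤
      2 * (∑ χ : DirichletCharacter ℂ q, if χ.IsPrimitive then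
      ∫ t in x..y, ‖((‖χ.LFunction (1 / 2 + t * Complex.I)‖ ^ 2 : ℝ) : ℂ)
        - 2 * pairSum (pairsLE N) χ t 0‖ ^ 2 else 0)
      + 8 * ∑ χ : DirichletCharacter ℂ q, ∫ t in x..y, ‖pairPoly (reducedPairs q N)
        (fun i => critCoeff q N i - critCoeff q Z i) χ t‖ ^ 2 := by
    rw [Finset.mul_sum, Finset.mul_sum, ← Finset.sum_add_distrib]
    refine Finset.sum_le_sum fun χ _ => ?_
    have cp : Continuous fun t : ℝ => 8 * ‖pairPoly (reducedPairs q N)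
        (fun i => critCoeff q N i - critCoeff q Z i) χ t‖ ^ 2 :=
      continuous_const.mul ((continuous_pairPoly _ _ χ).norm.pow 2)
    split_ifs with hχ
    · have cL := continuous_LFunction_line hq hχ
      have cf : Continuous fun t : ℝ => ((‖χ.LFunction (1 / 2 + t * Complex.I)‖ ^ 2 : ℝ) : ℂ) :=
        Complex.continuous_ofReal.comp (cL.norm.pow 2)
      have cs : ∀ Y : ℝ, Continuous fun t : ℝ =>
          ‖((‖χ.LFunction (1 / 2 + t * Complex.I)‖ ^ 2 : ℝ) : ℂ)
            - 2 * pairSum (pairsLE Y) χ t 0‖ ^ 2 := fun Y =>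
        ((cf.sub (continuous_const.mul (continuous_pairSum (pairsLE Y) χ 0))).norm).pow 2
      have cs2 : Continuous fun t : ℝ =>
          2 * ‖((‖χ.LFunction (1 / 2 + t * Complex.I)‖ ^ 2 : ℝ) : ℂ)
            - 2 * pairSum (pairsLE N) χ t 0‖ ^ 2 := continuous_const.mul (cs N)
      rw [← intervalIntegral.integral_const_mul, ← intervalIntegral.integral_const_mul,
        ← intervalIntegral.integral_add (cs2.intervalIntegrable _ _) (cp.intervalIntegrable _ _)]
      refine intervalIntegral.integral_mono_on hxy ((cs Z).intervalIntegrable _ _)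
        ((cs2.add cp).intervalIntegrable _ _) fun t _ => ?_
      have e : pairPoly (reducedPairs q N) (fun i => critCoeff q N i - critCoeff q Z i) χ t
          = pairSum (pairsLE N) χ t 0 - pairSum (pairsLE Z) χ t 0 := by
        rw [pairSum_zero_eq, pairSum_zero_eq_of_le χ t hZN, pairPoly_sub]
      rw [e]
      set f := ((‖χ.LFunction (1 / 2 + t * Complex.I)‖ ^ 2 : ℝ) : ℂ)
      set A := pairSum (pairsLE N) χ t 0
      set B := pairSum (pairsLE Z) χ t 0
      have n1 : ‖f - 2 * B‖ ≤ ‖f - 2 * A‖ + 2 * ‖A - B‖ := by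
        have : f - 2 * B = (f - 2 * A) + 2 * (A - B) := by ring
        rw [this]
        refine (norm_add_le _ _).trans (le_of_eq ?_)
        rw [norm_mul, Complex.norm_ofNat]
      have n2 := norm_nonneg (f - 2 * B)
      nlinarith [sq_nonneg (‖f - 2 * A‖ - 2 * ‖A - B‖)]
    · rw [mul_zero, zero_add, ← intervalIntegral.integral_const_mul]
      exact intervalIntegral.integral_nonneg hxy fun t _ => by positivity
  refine h5.trans ?_
  have hNq : N / q = 1 + y := by rw [hN]; field_simp
  rw [hNq] at h3
  have h6 : K * q.totient * (y - x + 1 + (1 + y)) ≤ K * q.totient * (2 * (1 + y)) :=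
    mul_le_mul_of_nonneg_left (by linarith) (by positivity)
  have h7 := h3.trans ((mul_le_mul_of_nonneg_right h6
    (Finset.sum_nonneg fun _ _ => by positivity)).trans (mul_le_mul_of_nonneg_left h2 (by positivity)))
  set L := Real.log N with hLdef
  set J := shortening q (1 + y)
  set ρ4 := ((q.totient : ℝ) / q) ^ 4
  have c1 : 0 ≤ C₁ * ((1 + y) * (q.totient * ρ4 * J ^ 2 * L ^ 2)) := by positivity
  have c2 : 0 ≤ (K * 2 * C₂) * ((1 + y) * (q * L ^ 2)) := by positivity
  nlinarith

set_option maxHeartbeats 600000 in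
/-- The bounds through which every error term of the local fourth moment is absorbed. -/
theorem local_error_bounds {C₀ q φ P w R lq L s J ρ g E : ℝ} (hq : 0 < q) (hφ : 0 < φ)
    (hP : 0 ≤ P) (hPφ : P ≤ φ) (hφP : φ ^ 2 ≤ 2 * q * P) (hw : 0 ≤ w) (hwR : w * R ≤ C₀ * lq)
    (hlq : 0 < lq) (hlL : lq ≤ L) (hs : 1 / 2 ≤ s) (hsL : s ^ 2 = L) (hg : 0 < g) (hg2 : g ≤ 2)
    (hJ : J = w * g + s) (hρ : ρ = φ / q) (hρ1 : ρ ≤ 1) (hR : 1 ≤ R) (hρR : ρ * R ^ 2 = 1)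
    (hE : E = w / lq * R * P * ρ ^ 4 * L ^ 4 + q * L ^ 3 * s) :
    P * ρ ^ 4 * R * J * L ^ 3 ≤ 2 * E ∧ q * ρ ^ 4 * L ^ 4 / J ≤ E ∧ q * ρ ^ 4 * R * L ^ 3 ≤ 2 * E ∧
      φ * ρ ^ 4 * J * L ^ 3 / R ≤ 4 * E ∧ q * L ^ 3 / (J * R) ≤ 4 * E ∧
      φ * ρ ^ 4 * J ^ 2 * L ^ 2 ≤ 2 * (8 * C₀ + 4) * E ∧ q * L ^ 2 ≤ 8 * E := by
  have hL : 0 < L := hlq.trans_le hlL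
  have hs0 : 0 < s := by linarith
  have hR0 : 0 < R := by linarith
  have hρ0 : 0 < ρ := by rw [hρ]; positivity
  have hJs : s ≤ J := by rw [hJ]; nlinarith [mul_nonneg hw hg.le]
  have hJ0 : 0 < J := hs0.trans_le hJs
  have hE1 : 0 ≤ w / lq * R * P * ρ ^ 4 * L ^ 4 := by positivity
  have hE2 : 0 ≤ q * L ^ 3 * s := by positivity
  have hφq : φ = ρ * q := by rw [hρ]; field_simp
  have hρR1 : ρ * R ≤ 1 := by
    calc ρ * R ≤ ρ * R * R := le_mul_of_one_le_right (by positivity) hR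
      _ = 1 := by rw [← hρR]; ring
  have hρ4R2 : ρ ^ 4 * R ^ 2 ≤ 1 := by
    calc ρ ^ 4 * R ^ 2 = ρ ^ 3 * (ρ * R ^ 2) := by ring
      _ = ρ ^ 3 := by rw [hρR, mul_one]
      _ ≤ 1 := pow_le_one₀ hρ0.le hρ1
  have hρ4R : ρ ^ 4 * R ≤ 1 := by
    refine le_trans ?_ hρ4R2
    nlinarith [mul_pos (pow_pos hρ0 4) hR0]
  have hPq : P ≤ q := by
    refine hPφ.trans ?_
    rw [hφq]; nlinarith
  have hφP' : φ ≤ 2 * P * R ^ 2 := by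
    have h1 : ρ * φ ≤ 2 * P := by
      rw [hρ, div_mul_eq_mul_div, div_le_iff₀ hq]; nlinarith
    calc φ = (ρ * φ) * R ^ 2 := by rw [mul_right_comm, hρR, one_mul]
      _ ≤ 2 * P * R ^ 2 := by gcongr
  have hwL : w * L ^ 3 ≤ w / lq * L ^ 4 := by
    rw [div_mul_eq_mul_div, le_div_iff₀ hlq]
    have : w * L ^ 3 * lq ≤ w * L ^ 3 * L := by gcongr
    nlinarith
  have i1 : P * ρ ^ 4 * R * J * L ^ 3 ≤ 2 * E := by
    have h1 : P * ρ ^ 4 * R * (w * L ^ 3) ≤ P * ρ ^ 4 * R * (w / lq * L ^ 4) := by gcongr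
    have h2 : P * (ρ ^ 4 * R) * (s * L ^ 3) ≤ q * 1 * (s * L ^ 3) := by gcongr
    have h3 : g * (P * ρ ^ 4 * R * (w * L ^ 3)) ≤ 2 * (P * ρ ^ 4 * R * (w * L ^ 3)) := by gcongr
    have e : P * ρ ^ 4 * R * (w * g + s) * L ^ 3
        = g * (P * ρ ^ 4 * R * (w * L ^ 3)) + P * (ρ ^ 4 * R) * (s * L ^ 3) := by ring
    rw [hJ, hE, e]
    linarith
  refine ⟨i1, ?_, ?_, ?_, ?_, ?_, ?_⟩
  · have h1 : q * ρ ^ 4 * L ^ 4 / J ≤ q * 1 * L ^ 4 / s := by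
      gcongr
      exact pow_le_one₀ hρ0.le hρ1
    have h2 : q * 1 * L ^ 4 / s = q * L ^ 3 * s := by
      rw [← hsL]; field_simp
    rw [hE]; linarith
  · have h1 : q * (ρ ^ 4 * R) * L ^ 3 ≤ q * 1 * L ^ 3 := by gcongr
    have h2 : q * L ^ 3 * 1 ≤ q * L ^ 3 * (2 * s) := by gcongr; linarith
    rw [hE]; linarith
  · rw [div_le_iff₀ hR0]
    have h1 : φ * (ρ ^ 4 * J * L ^ 3) ≤ 2 * P * R ^ 2 * (ρ ^ 4 * J * L ^ 3) := by gcongr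
    have h2 := mul_le_mul_of_nonneg_right i1 hR0.le
    linarith
  · have h1 : q * L ^ 3 / (J * R) ≤ q * L ^ 3 / (s * 1) := by gcongr
    have h2 : q * L ^ 3 / (s * 1) ≤ q * L ^ 3 * (4 * s) := by
      rw [mul_one, div_le_iff₀ hs0, mul_assoc (q * L ^ 3)]
      exact le_mul_of_one_le_right (by positivity) (by nlinarith)
    rw [hE]; linarith
  · have h0 : J ^ 2 ≤ 8 * w ^ 2 + 2 * L := by
      rw [hJ, ← hsL]
      have : (w * g) ^ 2 ≤ (w * 2) ^ 2 := by gcongr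
      nlinarith [sq_nonneg (w * g - s)]
    have h1 : φ * (ρ ^ 4 * J ^ 2 * L ^ 2) ≤ 2 * P * R ^ 2 * (ρ ^ 4 * (8 * w ^ 2 + 2 * L) * L ^ 2) := by
      gcongr
    have h2 : P * ρ ^ 4 * L ^ 2 * (w * R) * (w * R) ≤ P * ρ ^ 4 * L ^ 2 * (w * R) * (C₀ * lq) := by
      gcongr
    have hC : 0 ≤ C₀ := by
      by_contra hc
      have : C₀ * lq < 0 := mul_neg_of_neg_of_pos (not_le.1 hc) hlq
      have := mul_nonneg hw hR0.le
      linarith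
    have h3 : w * lq ≤ w / lq * L ^ 2 := by
      rw [div_mul_eq_mul_div, le_div_iff₀ hlq]
      have : w * (lq * lq) ≤ w * (L * L) := by gcongr
      nlinarith
    have h4 : C₀ * P * ρ ^ 4 * L ^ 2 * R * (w * lq) ≤ C₀ * P * ρ ^ 4 * L ^ 2 * R * (w / lq * L ^ 2) := by
      gcongr
    have h5 : P * (ρ ^ 4 * R ^ 2) * L ^ 3 ≤ q * 1 * L ^ 3 := by gcongr
    have h6 : q * L ^ 3 * 1 ≤ q * L ^ 3 * (2 * s) := by gcongr; linarith
    have h7 : 0 ≤ C₀ * (q * L ^ 3 * s) := by positivity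
    rw [hE]
    linarith
  · have h1 : q * L ^ 2 * 1 ≤ q * L ^ 2 * (8 * (L * s)) := by
      gcongr
      rw [← hsL]
      have : (1 / 2 : ℝ) ^ 3 ≤ s ^ 3 := by gcongr
      nlinarith
    rw [hE]; linarith

open scoped Classical in
/-- The fourth moment over an interval on which `1 + t` varies by a bounded factor. -/
theorem abs_sum_integral_norm_pow_four_local_sub_le : ∃ C : ℝ, 0 < C ∧
    ∀ (q : ℕ) [NeZero q] (x y : ℝ), 2 ≤ q → 0 ≤ x → x ≤ y → 1 + y ≤ 4 * (1 + x) →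
    |(∑ χ : DirichletCharacter ℂ q, if χ.IsPrimitive then
        ∫ t in x..y, ‖χ.LFunction (1 / 2 + t * Complex.I)‖ ^ 4 else 0)
      - primCount q * (y - x) * (momentConst q * Real.log (q * (1 + y)) ^ 4)| ≤
      C * (1 + y) * (q.primeFactors.card / Real.log q * √(q / q.totient) * primCount q
        * ((q.totient : ℝ) / q) ^ 4 * Real.log (q * (1 + y)) ^ 4
        + q * Real.log (q * (1 + y)) ^ 3 * √(Real.log (q * (1 + y)))) := by
  obtain ⟨C₁, hC₁, hA⟩ := abs_sum_integral_shortened_sub_le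
  obtain ⟨C₂, hC₂, hB⟩ := sum_integral_norm_sq_LFunction_sub_shortened_sq_le
  obtain ⟨C₀, hC₀, hO⟩ := exists_arithmetic_bounds
  refine ⟨3 * C₁ + (2 + 10 * C₁) + C₂ * (4 + 4 + 2 * (8 * C₀ + 4) + 8), by positivity,
    fun q _ x y hq hx hxy h4 => ?_⟩
  have hq0 : (0 : ℝ) < q := by positivity
  have hU : 1 ≤ 1 + y := by linarith
  have hφ0 : 0 < q.totient := Nat.totient_pos.2 (by omega)
  have hφ : (0 : ℝ) < q.totient := by exact_mod_cast hφ0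
  have hφq : (q.totient : ℝ) ≤ q := by exact_mod_cast Nat.totient_le q
  have hlq : 0 < Real.log q := Real.log_pos (by exact_mod_cast (by omega : 1 < q))
  have hlL : Real.log q ≤ Real.log (q * (1 + y)) := Real.log_le_log hq0 (by nlinarith)
  have hL2 := log_two_le_log_mul hq hU
  have hl2 := Real.log_two_gt_d9
  have hJ0 := shortening_pos hq hU
  have hA' := hA q (1 + y) x y hq hU hxy (by linarith)
  have hB' := hB q x y hq hx hxy h4
  have hM := momentConst_le q (by omega)
  have hM0 := momentConst_nonneg q
  have hp := primCount_nonneg q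
  rcases primCount_eq_zero_or_le q with h0 | hφP
  · have hne : ∀ χ : DirichletCharacter ℂ q, ¬ χ.IsPrimitive := by
      intro χ hχ
      have : (Finset.univ.filter fun χ : DirichletCharacter ℂ q => χ.IsPrimitive).card = 0 := by
        exact Nat.cast_eq_zero.1 h0
      rw [Finset.card_eq_zero, Finset.filter_eq_empty_iff] at this
      exact this (Finset.mem_univ χ) hχ
    simp only [hne, if_false, Finset.sum_const_zero, h0, zero_mul, sub_zero, abs_zero, mul_zero,
      zero_add]
    have := hlq.trans_le hlL
    positivity
  have hR1 : 1 ≤ √((q : ℝ) / q.totient) := by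
    rw [Real.one_le_sqrt, one_le_div hφ]; exact hφq
  have hR2 : ((q.totient : ℝ) / q) * √((q : ℝ) / q.totient) ^ 2 = 1 := by
    rw [Real.sq_sqrt (by positivity)]; field_simp
  have hs : 1 / 2 ≤ √(Real.log (q * (1 + y))) := by
    rw [Real.le_sqrt (by norm_num)]
    · linarith
    · linarith
  have hg : Real.log 4 ≤ 2 := by
    rw [show (4 : ℝ) = 2 ^ 2 by norm_num, Real.log_pow]
    have := Real.log_two_lt_d9
    push_cast; linarith
  have key := local_error_bounds (C₀ := C₀) hq0 hφ hp (primCount_le q) hφP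
    (Nat.cast_nonneg q.primeFactors.card) (hO q hq).2 hlq hlL hs (Real.sq_sqrt (by linarith))
    (Real.log_pos (by norm_num : (1 : ℝ) < 4)) hg (rfl : shortening q (1 + y) = _) rfl
    ((div_le_one hq0).2 hφq) hR1 hR2 rfl
  have hcomp := abs_sum_integral_norm_sq_sub_le
    (fun χ : DirichletCharacter ℂ q => χ.IsPrimitive)
    (fun χ t => ((‖χ.LFunction (1 / 2 + t * Complex.I)‖ ^ 2 : ℝ) : ℂ))
    (fun χ t => 2 * pairSum (pairsLE (shortLength q (1 + y))) χ t 0)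
    (fun χ hχ => Complex.continuous_ofReal.comp ((continuous_LFunction_line hq hχ).norm.pow 2))
    (fun χ _ => continuous_const.mul (continuous_pairSum _ χ 0)) hxy
    (l := √((q : ℝ) / q.totient) * shortening q (1 + y) / Real.log (q * (1 + y)))
    (by have : 0 < Real.log (q * (1 + y)) := hlq.trans_le hlL
        positivity)
  have hfour : ∀ (χ : DirichletCharacter ℂ q) (t : ℝ),
      ‖((‖χ.LFunction (1 / 2 + t * Complex.I)‖ ^ 2 : ℝ) : ℂ)‖ ^ 2
        = ‖χ.LFunction (1 / 2 + t * Complex.I)‖ ^ 4 := by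
    intro χ t
    rw [Complex.norm_real, Real.norm_of_nonneg (by positivity)]; ring
  simp only [hfour] at hcomp
  have hL0 : 0 < Real.log (q * (1 + y)) := hlq.trans_le hlL
  set a := ∑ χ : DirichletCharacter ℂ q, if χ.IsPrimitive then
        ∫ t in x..y, ‖2 * pairSum (pairsLE (shortLength q (1 + y))) χ t 0‖ ^ 2 else 0 with ha
  set b := ∑ χ : DirichletCharacter ℂ q, if χ.IsPrimitive then
      ∫ t in x..y, ‖((‖χ.LFunction (1 / 2 + t * Complex.I)‖ ^ 2 : ℝ) : ℂ)
        - 2 * pairSum (pairsLE (shortLength q (1 + y))) χ t 0‖ ^ 2 else 0 with hb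
  set F := ∑ χ : DirichletCharacter ℂ q, if χ.IsPrimitive then
        ∫ t in x..y, ‖χ.LFunction (1 / 2 + t * Complex.I)‖ ^ 4 else 0 with hF
  have hJL := shortening_le hq hU
  set L := Real.log (q * (1 + y)) with hL
  set J := shortening q (1 + y) with hJ
  set s := √L
  set R := √((q : ℝ) / q.totient)
  set ρ := (q.totient : ℝ) / q with hρ
  set P := primCount q
  set E := q.primeFactors.card / Real.log q * R * P * ρ ^ 4 * L ^ 4 + q * L ^ 3 * s with hE
  obtain ⟨k1, k2, k3, k4, k5, k6, k7⟩ := key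
  have hR0 : 0 < R := by linarith
  have hρ0 : 0 < ρ := by positivity
  have hyx : y - x ≤ 1 + y := by linarith
  have hyx0 : 0 ≤ y - x := by linarith
  have hE0 : 0 ≤ E := by positivity
  have t1 : P * ρ ^ 4 * J * L ^ 3 ≤ 2 * E := by
    refine le_trans ?_ k1
    have : P * ρ ^ 4 * 1 * J * L ^ 3 ≤ P * ρ ^ 4 * R * J * L ^ 3 := by gcongr
    linarith
  have u1 : |a - P * (y - x) * (momentConst q * L ^ 4)| ≤ C₁ * (1 + y) * (3 * E) :=
    hA'.trans (mul_le_mul_of_nonneg_left (by linarith) (by positivity))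
  have u2 : a ≤ P * (1 + y) * (ρ ^ 4 * L ^ 4)
      + C₁ * (1 + y) * (P * ρ ^ 4 * (4 * L) * L ^ 3 + q * ρ ^ 4 * L ^ 4 / J) := by
    have v1 := (abs_le.1 hA').2
    have v2 : P * (y - x) * (momentConst q * L ^ 4) ≤ P * (1 + y) * (ρ ^ 4 * L ^ 4) := by gcongr
    have v3 : C₁ * (1 + y) * (P * ρ ^ 4 * J * L ^ 3 + q * ρ ^ 4 * L ^ 4 / J)
        ≤ C₁ * (1 + y) * (P * ρ ^ 4 * (4 * L) * L ^ 3 + q * ρ ^ 4 * L ^ 4 / J) := by gcongr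
    linarith
  have u3 : R * J / L * a ≤ (1 + y) * (2 * E) + C₁ * (1 + y) * (10 * E) := by
    refine (mul_le_mul_of_nonneg_left u2 (by positivity)).trans ?_
    have e : R * J / L * (P * (1 + y) * (ρ ^ 4 * L ^ 4)
        + C₁ * (1 + y) * (P * ρ ^ 4 * (4 * L) * L ^ 3 + q * ρ ^ 4 * L ^ 4 / J))
        = (1 + y) * (P * ρ ^ 4 * R * J * L ^ 3)
          + C₁ * (1 + y) * (4 * (P * ρ ^ 4 * R * J * L ^ 3) + q * ρ ^ 4 * R * L ^ 3) := by
      field_simp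
    rw [e]
    exact add_le_add (mul_le_mul_of_nonneg_left k1 (by positivity))
      (mul_le_mul_of_nonneg_left (by linarith) (by positivity))
  have u4 : 1 / (R * J / L) * b ≤ C₂ * (1 + y) * (8 * E) := by
    refine (mul_le_mul_of_nonneg_left hB' (by positivity)).trans ?_
    have e : 1 / (R * J / L) * (C₂ * (1 + y) * (q.totient * ρ ^ 4 * J ^ 2 * L ^ 2 + q * L ^ 2))
        = C₂ * (1 + y) * (q.totient * ρ ^ 4 * J * L ^ 3 / R + q * L ^ 3 / (J * R)) := by
      field_simp
    rw [e]
    exact mul_le_mul_of_nonneg_left (by linarith) (by positivity)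
  have u5 : b ≤ C₂ * (1 + y) * ((2 * (8 * C₀ + 4) + 8) * E) :=
    hB'.trans (mul_le_mul_of_nonneg_left (by linarith) (by positivity))
  have e : F - P * (y - x) * (momentConst q * L ^ 4)
      = (F - a) + (a - P * (y - x) * (momentConst q * L ^ 4)) := by ring
  rw [e]
  refine (abs_add_le _ _).trans ?_
  linarith

theorem pow_four_sub_pow_four_le {a b : ℝ} (ha : 0 ≤ a) (hab : a ≤ b) (hba : b ≤ a + 1) :
    b ^ 4 - a ^ 4 ≤ 4 * b ^ 3 := by
  have hb : 0 ≤ b := ha.trans hab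
  have h1 : a ^ 3 ≤ b ^ 3 := by gcongr
  have h2 : b * a ^ 2 ≤ b * b ^ 2 := by gcongr
  have h3 : b ^ 2 * a ≤ b ^ 2 * b := by gcongr
  have h4 : b ^ 4 - a ^ 4 = (b - a) * (b ^ 3 + b ^ 2 * a + b * a ^ 2 + a ^ 3) := by ring
  have h5 : 0 ≤ b ^ 3 + b ^ 2 * a + b * a ^ 2 + a ^ 3 := by positivity
  have h6 : (b - a) * (b ^ 3 + b ^ 2 * a + b * a ^ 2 + a ^ 3)
      ≤ 1 * (b ^ 3 + b ^ 2 * a + b * a ^ 2 + a ^ 3) := by gcongr; linarith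
  rw [h4]; linarith

theorem primCount_mul_momentConst_le (q : ℕ) [NeZero q] : primCount q * momentConst q ≤ q := by
  have hq : q ≠ 0 := NeZero.ne q
  have h1 : (q.totient : ℝ) ≤ q := by exact_mod_cast Nat.totient_le q
  have h2 : momentConst q ≤ 1 := (momentConst_le q hq).trans
    (pow_le_one₀ (by positivity) (div_le_one_of_le₀ h1 (by positivity)))
  calc primCount q * momentConst q ≤ q * 1 :=
        mul_le_mul ((primCount_le q).trans h1) h2 (momentConst_nonneg q) (by positivity)
    _ = q := mul_one _

open scoped Classical in
/-- The fourth moment over `[0, T]`, with the conductor measured by `q * (1 + T)`. -/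
theorem abs_sum_integral_norm_pow_four_sub_le_aux : ∃ C : ℝ, 0 < C ∧
    ∀ (q : ℕ) [NeZero q] (T : ℝ), 2 ≤ q → 0 ≤ T →
    |(∑ χ : DirichletCharacter ℂ q, if χ.IsPrimitive then
        ∫ t in (0 : ℝ)..T, ‖χ.LFunction (1 / 2 + t * Complex.I)‖ ^ 4 else 0)
      - primCount q * T * (momentConst q * Real.log (q * (1 + T)) ^ 4)| ≤
      C * (1 + T) * (q.primeFactors.card / Real.log q * √(q / q.totient) * primCount q
        * ((q.totient : ℝ) / q) ^ 4 * Real.log (q * (1 + T)) ^ 4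
        + q * Real.log (q * (1 + T)) ^ 3 * √(Real.log (q * (1 + T)))) := by
  obtain ⟨C, hC, h⟩ := abs_sum_integral_norm_pow_four_local_sub_le
  refine ⟨2 * C + 8, by positivity, fun q _ T hq hT => ?_⟩
  have hq0 : (0 : ℝ) < q := by positivity
  have hq2 : (2 : ℝ) ≤ q := by exact_mod_cast hq
  have hlq : 0 < Real.log q := Real.log_pos (by linarith)
  have hP := primCount_nonneg q
  have hM := momentConst_nonneg q
  have hPM := primCount_mul_momentConst_le q
  set V := q.primeFactors.card / Real.log q * √(q / q.totient) * primCount q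
        * ((q.totient : ℝ) / q) ^ 4
  have hV : 0 ≤ V := by positivity
  have hEn : ∀ T : ℝ, 0 ≤ T → 0 ≤ V * Real.log (q * (1 + T)) ^ 4
      + q * Real.log (q * (1 + T)) ^ 3 * √(Real.log (q * (1 + T))) := by
    intro T hT
    have : 0 ≤ Real.log (q * (1 + T)) := Real.log_nonneg (by nlinarith)
    positivity
  obtain ⟨n, hn⟩ : ∃ n : ℕ, T ≤ 3 * 2 ^ n := by
    obtain ⟨n, hn⟩ := pow_unbounded_of_one_lt T (by norm_num : (1 : ℝ) < 2)
    exact ⟨n, by linarith [pow_pos (by norm_num : (0 : ℝ) < 2) n]⟩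
  induction n generalizing T with
  | zero =>
    have h0 := h q 0 T hq le_rfl hT (by norm_num at hn; linarith)
    rw [sub_zero] at h0
    refine h0.trans ?_
    have := hEn T hT
    gcongr
    linarith
  | succ n ih =>
    rcases le_or_gt T 3 with h3 | h3
    · have h0 := h q 0 T hq le_rfl hT (by linarith)
      rw [sub_zero] at h0
      refine h0.trans ?_
      have := hEn T hT
      gcongr
      linarith
    set y := (T - 1) / 2 with hy
    have hy0 : 0 ≤ y := by rw [hy]; linarith
    have hy1 : 1 + y = (1 + T) / 2 := by rw [hy]; ring
    have i1 := ih y hy0 (by rw [hy]; rw [pow_succ] at hn; linarith)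
    have i2 := h q y T hq hy0 (by rw [hy]; linarith) (by rw [hy]; linarith)
    have hsplit : (∑ χ : DirichletCharacter ℂ q, if χ.IsPrimitive then
          ∫ t in (0 : ℝ)..T, ‖χ.LFunction (1 / 2 + t * Complex.I)‖ ^ 4 else 0)
        = (∑ χ : DirichletCharacter ℂ q, if χ.IsPrimitive then
          ∫ t in (0 : ℝ)..y, ‖χ.LFunction (1 / 2 + t * Complex.I)‖ ^ 4 else 0)
        + ∑ χ : DirichletCharacter ℂ q, if χ.IsPrimitive then
          ∫ t in y..T, ‖χ.LFunction (1 / 2 + t * Complex.I)‖ ^ 4 else 0 := by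
      rw [← Finset.sum_add_distrib]
      refine Finset.sum_congr rfl fun χ _ => ?_
      split_ifs with hχ
      · have c := ((continuous_LFunction_line hq hχ).norm.pow 4)
        exact (intervalIntegral.integral_add_adjacent_intervals (c.intervalIntegrable _ _)
          (c.intervalIntegrable _ _)).symm
      · simp
    rw [hsplit]
    have hly : 0 < Real.log (q * (1 + y)) := Real.log_pos (by nlinarith)
    have hlt : Real.log (q * (1 + T)) = Real.log (q * (1 + y)) + Real.log 2 := by
      rw [← Real.log_mul (by positivity) (by norm_num), hy1]
      congr 1; ring
    have hl2 := Real.log_two_gt_d9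
    have hl2' := Real.log_two_lt_d9
    have hE' := hEn y hy0
    set l := Real.log (q * (1 + y))
    set L := Real.log (q * (1 + T))
    have hlL : l ≤ L := by linarith
    have hL0 : 0 < L := hly.trans_le hlL
    have hpow := pow_four_sub_pow_four_le hly.le hlL (by linarith)
    have hpow0 : l ^ 4 ≤ L ^ 4 := by gcongr
    have hmono : V * l ^ 4 + q * l ^ 3 * √l ≤ V * L ^ 4 + q * L ^ 3 * √L := by gcongr
    have hL3 : q * L ^ 3 ≤ 2 * (V * L ^ 4 + q * L ^ 3 * √L) := by
      have hs : 1 / 2 ≤ √L := by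
        rw [Real.le_sqrt (by norm_num) (by linarith)]; linarith
      have : q * L ^ 3 * 1 ≤ q * L ^ 3 * (2 * √L) := by gcongr; linarith
      have : 0 ≤ V * L ^ 4 := by positivity
      linarith
    set E := V * L ^ 4 + q * L ^ 3 * √L
    set A := ∑ χ : DirichletCharacter ℂ q, if χ.IsPrimitive then
          ∫ t in (0 : ℝ)..y, ‖χ.LFunction (1 / 2 + t * Complex.I)‖ ^ 4 else 0
    set B := ∑ χ : DirichletCharacter ℂ q, if χ.IsPrimitive then
          ∫ t in y..T, ‖χ.LFunction (1 / 2 + t * Complex.I)‖ ^ 4 else 0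
    have e : A + B - primCount q * T * (momentConst q * L ^ 4)
        = (A - primCount q * y * (momentConst q * l ^ 4))
          + ((B - primCount q * (T - y) * (momentConst q * L ^ 4))
          - primCount q * momentConst q * (y * (L ^ 4 - l ^ 4))) := by ring
    have d1 : |primCount q * momentConst q * (y * (L ^ 4 - l ^ 4))| ≤ (1 + T) / 2 * (8 * E) := by
      rw [abs_of_nonneg (mul_nonneg (by positivity) (mul_nonneg hy0 (by linarith)))]
      calc primCount q * momentConst q * (y * (L ^ 4 - l ^ 4))
          ≤ q * ((1 + T) / 2 * (4 * L ^ 3)) := by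
            refine mul_le_mul hPM (mul_le_mul (by linarith) hpow (by linarith) (by linarith))
              (mul_nonneg hy0 (by linarith)) hq0.le
        _ = (1 + T) / 2 * (4 * (q * L ^ 3)) := by ring
        _ ≤ (1 + T) / 2 * (8 * E) := by
            apply mul_le_mul_of_nonneg_left _ (by linarith)
            linarith
    have d2 : (2 * C + 8) * (1 + y) * (V * l ^ 4 + q * l ^ 3 * √l)
        ≤ (2 * C + 8) * ((1 + T) / 2) * E := by
      rw [hy1]
      exact mul_le_mul_of_nonneg_left hmono (mul_nonneg (by positivity) (by linarith))
    rw [e]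
    refine (abs_add_le _ _).trans ?_
    have d3 := abs_sub (B - primCount q * (T - y) * (momentConst q * L ^ 4))
      (primCount q * momentConst q * (y * (L ^ 4 - l ^ 4)))
    linarith

open scoped Classical in
/-- The fourth moment of primitive Dirichlet `L`-functions over `[0, T]`. -/
theorem abs_sum_integral_norm_pow_four_sub_le : ∃ C : ℝ, 0 < C ∧
    ∀ (q : ℕ) [NeZero q] (T : ℝ), 2 ≤ q → 2 ≤ T →
    |(∑ χ : DirichletCharacter ℂ q, if χ.IsPrimitive then
        ∫ t in (0 : ℝ)..T, ‖χ.LFunction (1 / 2 + t * Complex.I)‖ ^ 4 else 0)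
      - primCount q * T * momentConst q * Real.log (q * T) ^ 4| ≤
      C * (q.primeFactors.card / Real.log q * √(q / q.totient)
          * (primCount q * T * momentConst q * Real.log (q * T) ^ 4)
        + q * T * Real.log (q * T) ^ ((7 : ℝ) / 2)) := by
  obtain ⟨C, hC, h⟩ := abs_sum_integral_norm_pow_four_sub_le_aux
  refine ⟨C * 2 * (16 * (2 * Real.pi ^ 2)) + (C * 2 * 16 + 64), by positivity, fun q _ T hq hT => ?_⟩
  have hq0 : (0 : ℝ) < q := by positivity
  have hq2 : (2 : ℝ) ≤ q := by exact_mod_cast hq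
  have hlq : 0 < Real.log q := Real.log_pos (by linarith)
  have hP := primCount_nonneg q
  have hM := momentConst_nonneg q
  have hPM := primCount_mul_momentConst_le q
  have hρ : ((q.totient : ℝ) / q) ^ 4 ≤ 2 * Real.pi ^ 2 * momentConst q := by
    have := (momentConst_bounds q (by omega)).1
    rw [one_div, inv_mul_le_iff₀ (by positivity)] at this
    exact this
  have hl2 := Real.log_two_gt_d9
  have hL2 := log_two_le_log_mul hq (U := T) (by linarith)
  have h1 := h q T hq (by linarith)
  have hLl : Real.log (q * T) ≤ Real.log (q * (1 + T)) :=
    Real.log_le_log (by positivity) (by nlinarith)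
  have hlL : Real.log (q * (1 + T)) ≤ Real.log (q * T) + Real.log 2 := by
    rw [← Real.log_mul (by positivity) (by norm_num)]
    exact Real.log_le_log (by positivity) (by nlinarith)
  have hl2' := Real.log_two_lt_d9
  set L := Real.log (q * T)
  set l := Real.log (q * (1 + T))
  have hL0 : 0 < L := by linarith
  have hl0 : 0 < l := by linarith
  have hl : l ≤ 2 * L := by linarith
  have hr : L ^ ((7 : ℝ) / 2) = L ^ 3 * √L := by
    rw [show (7 : ℝ) / 2 = (3 : ℕ) + 1 / 2 by norm_num, Real.rpow_add hL0, Real.rpow_natCast,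
      Real.sqrt_eq_rpow]
  rw [hr]
  set w := q.primeFactors.card / Real.log q * √((q : ℝ) / q.totient)
  have hw : 0 ≤ w := by positivity
  have hs : 1 / 2 ≤ √L := by
    rw [Real.le_sqrt (by norm_num) (by linarith)]; linarith
  have hsl : √l ≤ 2 * √L := by
    rw [Real.sqrt_le_left (by positivity), mul_pow, Real.sq_sqrt hL0.le]
    linarith
  have a1 : w * primCount q * ((q.totient : ℝ) / q) ^ 4 * l ^ 4
      ≤ w * primCount q * (2 * Real.pi ^ 2 * momentConst q) * (2 * L) ^ 4 := by gcongr
  have a2 : q * l ^ 3 * √l ≤ q * (2 * L) ^ 3 * (2 * √L) := by gcongr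
  have hpow := pow_four_sub_pow_four_le hL0.le hLl (by linarith)
  have hpow0 : L ^ 4 ≤ l ^ 4 := by gcongr
  have hl3 : l ^ 3 ≤ (2 * L) ^ 3 := by gcongr
  set G := ∑ χ : DirichletCharacter ℂ q, if χ.IsPrimitive then
        ∫ t in (0 : ℝ)..T, ‖χ.LFunction (1 / 2 + t * Complex.I)‖ ^ 4 else 0
  have e : G - primCount q * T * momentConst q * L ^ 4
      = (G - primCount q * T * (momentConst q * l ^ 4))
        + primCount q * momentConst q * (T * (l ^ 4 - L ^ 4)) := by ring
  have hT0 : 0 < T := by linarith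
  have d1 : |primCount q * momentConst q * (T * (l ^ 4 - L ^ 4))| ≤ 64 * (q * T * (L ^ 3 * √L)) := by
    rw [abs_of_nonneg (mul_nonneg (by positivity) (mul_nonneg hT0.le (by linarith)))]
    calc primCount q * momentConst q * (T * (l ^ 4 - L ^ 4))
        ≤ q * (T * (4 * (2 * L) ^ 3)) :=
          mul_le_mul hPM (mul_le_mul_of_nonneg_left (by linarith) hT0.le)
            (mul_nonneg hT0.le (by linarith)) hq0.le
      _ = q * T * L ^ 3 * (32 * 1) := by ring
      _ ≤ q * T * L ^ 3 * (32 * (2 * √L)) := by gcongr; linarith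
      _ = 64 * (q * T * (L ^ 3 * √L)) := by ring
  have d2 : C * (1 + T) * (w * primCount q * ((q.totient : ℝ) / q) ^ 4 * l ^ 4 + q * l ^ 3 * √l)
      ≤ C * (2 * T) * (w * primCount q * (2 * Real.pi ^ 2 * momentConst q) * (2 * L) ^ 4
        + q * (2 * L) ^ 3 * (2 * √L)) :=
    mul_le_mul (mul_le_mul_of_nonneg_left (by linarith) hC.le) (add_le_add a1 a2)
      (by positivity) (by positivity)
  rw [e]
  refine (abs_add_le _ _).trans ?_
  have p1 : 0 ≤ (C * 2 * 16 + 64) * (w * (primCount q * T * momentConst q * L ^ 4)) := by positivity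
  have p2 : 0 ≤ C * 2 * (16 * (2 * Real.pi ^ 2)) * (q * T * (L ^ 3 * √L)) := by positivity
  linarith

open scoped Classical in
/-- Theorem 1: for `q, T ≥ 2`,
`∑*_{χ mod q} ∫₀ᵀ |L(1/2+it,χ)|⁴ dt`
`= (1 + O((ω(q)/log q)√(q/φ(q)))) (φ*(q) T)/(2π²) ∏_{p|q} (1−1/p)³/(1+1/p) (log qT)⁴`
`+ O(qT (log qT)^{7/2})`, with absolute implied constants.  Here the sum is over
primitive Dirichlet characters mod `q` and `φ*(q)` is their number. -/
theorem fourth_moment_dirichlet_L :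
    ∃ C : ℝ, 0 < C ∧ ∀ (q : ℕ) (hq : 2 ≤ q) (T : ℝ) (hT : 2 ≤ T),
      haveI : NeZero q := ⟨by omega⟩
      ∃ c₁ c₂ : ℝ,
        |c₁| ≤ C * (q.primeFactors.card / Real.log q) * Real.sqrt (q / q.totient) ∧
        |c₂| ≤ C * q * T * Real.log (q * T) ^ ((7 : ℝ) / 2) ∧
        (∑ χ : DirichletCharacter ℂ q,
            if χ.IsPrimitive then
              ∫ t in (0 : ℝ)..T,
                ‖DirichletCharacter.LFunction χ (1 / 2 + t * Complex.I)‖ ^ 4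
            else 0) =
          (1 + c₁) *
            (((Finset.univ.filter fun χ : DirichletCharacter ℂ q => χ.IsPrimitive).card : ℝ) *
                T / (2 * Real.pi ^ 2) *
              (∏ p ∈ q.primeFactors, (1 - 1 / (p : ℝ)) ^ 3 / (1 + 1 / (p : ℝ))) *
              Real.log (q * T) ^ 4) + c₂ := by
  obtain ⟨C, hC, h⟩ := abs_sum_integral_norm_pow_four_sub_le
  refine ⟨C, hC, fun q hq T hT => ?_⟩
  have : NeZero q := ⟨by omega⟩
  have hD := h q T hq hT
  have hq0 : (0 : ℝ) < q := by positivity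
  have hlq : 0 ≤ Real.log q := Real.log_natCast_nonneg q
  have hL : 0 < Real.log (q * T) :=
    (Real.log_pos one_lt_two).trans_le (log_two_le_log_mul hq (by linarith))
  have hX : 0 ≤ primCount q * T * momentConst q * Real.log (q * T) ^ 4 := by
    have := primCount_nonneg q
    have := momentConst_nonneg q
    positivity
  have he : 0 < q * T * Real.log (q * T) ^ ((7 : ℝ) / 2) := by positivity
  have hw : 0 ≤ q.primeFactors.card / Real.log q * √(q / q.totient) := by positivity
  have hmain : ((Finset.univ.filter fun χ : DirichletCharacter ℂ q => χ.IsPrimitive).card : ℝ) *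
      T / (2 * Real.pi ^ 2) *
      (∏ p ∈ q.primeFactors, (1 - 1 / (p : ℝ)) ^ 3 / (1 + 1 / (p : ℝ))) *
      Real.log (q * T) ^ 4 = primCount q * T * momentConst q * Real.log (q * T) ^ 4 := by
    unfold primCount momentConst
    ring
  rw [hmain]
  set X := primCount q * T * momentConst q * Real.log (q * T) ^ 4
  set e := q * T * Real.log (q * T) ^ ((7 : ℝ) / 2) with hedef
  set w := q.primeFactors.card / Real.log q * √((q : ℝ) / q.totient)
  set G := ∑ χ : DirichletCharacter ℂ q, if χ.IsPrimitive then
    ∫ t in (0 : ℝ)..T, ‖χ.LFunction (1 / 2 + t * Complex.I)‖ ^ 4 else 0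
  have hden : 0 < w * X + e := by positivity
  have hratio : |(G - X) / (w * X + e)| ≤ C := by
    rw [abs_div, abs_of_pos hden, div_le_iff₀ hden]
    exact hD
  refine ⟨(G - X) / (w * X + e) * w, (G - X) / (w * X + e) * e, ?_, ?_, ?_⟩
  · rw [abs_mul, abs_of_nonneg hw, mul_assoc C]
    exact mul_le_mul_of_nonneg_right hratio hw
  · rw [abs_mul, abs_of_pos he]
    exact (mul_le_mul_of_nonneg_right hratio he.le).trans (le_of_eq (by rw [hedef]; ring))
  · field_simp
    ring
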